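/- Let p be a prime and q = p^a a prime power with q ≥ 4. Then the asymptotic bilinear complexity of multiplication satisfies M_q := limsup_{n → ∞} μ_q(n)/n ≤ 3(1 + p/(q − 3)). -/

import Mathlib

/-- The bilinear complexity of multiplication in the `k`-algebra `K`: the least `r`
such that there exist `k`-linear forms `a₁,…,a_r, b₁,…,b_r : K → k` and elements
`c₁,…,c_r ∈ K` with `x·y = ∑ l, a_l(x) b_l(y) c_l` for all `x, y ∈ K`. -/
noncomputable def bilinearComplexity (k K : Type) [Field k] [Field K] [Algebra k K] : ℕ :=
  sInf {r : ℕ | ∃ (A B : Fin r → (K →ₗ[k] k)) (c : Fin r → K),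
    ∀ x y : K, x * y = ∑ l, (A l x * B l y) • c l}

section

/-- A `k`-algebra `R` with an increasing filtration `lt n` ("elements of degree less than `n`")
with one-dimensional graded pieces on which degrees of products add up. -/
structure DegAlg (k R : Type*) [Field k] [CommRing R] [Algebra k R] where
  lt : ℕ → Submodule k R
  lt_zero : lt 0 = ⊥
  mono : ∀ n, lt n ≤ lt (n + 1)
  exhaust : ∀ f, ∃ n, f ∈ lt n
  lead : ∀ n, ∃ l : R →ₗ[k] k, ∀ f ∈ lt (n + 1), l f = 0 → f ∈ lt n
  mul_mem : ∀ a b f g, f ∈ lt (a + 1) → g ∈ lt (b + 1) → f * g ∈ lt (a + b + 1)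
  mul_notMem : ∀ a b f g, f ∈ lt (a + 1) → f ∉ lt a → g ∈ lt (b + 1) → g ∉ lt b →
    f * g ∉ lt (a + b)

namespace DegAlg

variable {k R : Type*} [Field k] [CommRing R] [Algebra k R] (D : DegAlg k R)

lemma lt_mono : Monotone D.lt := monotone_nat_of_le_succ D.mono

/-- The set of degrees of nonzero elements of a subspace. -/
def degs (W : Submodule k R) : Set ℕ := {m | ∃ f ∈ W, f ∈ D.lt (m + 1) ∧ f ∉ D.lt m}

lemma exists_deg {f : R} (hf : f ≠ 0) : ∃ m, f ∈ D.lt (m + 1) ∧ f ∉ D.lt m := by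
  classical
  have h := D.exhaust f
  obtain ⟨m, hm⟩ : ∃ m, Nat.find h = m + 1 := by
    refine Nat.exists_eq_succ_of_ne_zero fun h0 => hf ?_
    have := Nat.find_spec h
    rw [h0, D.lt_zero] at this
    simpa using this
  exact ⟨m, hm ▸ Nat.find_spec h, Nat.find_min h (by omega)⟩

open Classical in
lemma finite_and_finrank (W : Submodule k R) (n : ℕ) :
    FiniteDimensional k ↥(W ⊓ D.lt n) ∧
      Module.finrank k ↥(W ⊓ D.lt n) = Nat.count (· ∈ D.degs W) n := by
  induction n with
  | zero =>
    rw [D.lt_zero, inf_bot_eq]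
    exact ⟨inferInstance, by simp⟩
  | succ n ih =>
    obtain ⟨l, hl⟩ := D.lead n
    obtain ⟨hfin, hrk⟩ := ih
    set U := W ⊓ D.lt (n + 1) with hU
    let l' : U →ₗ[k] k := l.comp U.subtype
    by_cases hn : n ∈ D.degs W
    · obtain ⟨f, hfW, hf1, hf2⟩ := hn
      -- refine the functional so that it kills the lower part
      have hlt : W ⊓ D.lt n ≤ U := inf_le_inf_left _ (D.mono n)
      have hspan : U = (W ⊓ D.lt n) ⊔ k ∙ f := by
        apply le_antisymm
        · rintro g ⟨hgW, hg⟩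
          have hlf : l f ≠ 0 := fun h => hf2 (hl f hf1 h)
          rw [Submodule.mem_sup]
          refine ⟨g - (l g / l f) • f, ⟨?_, ?_⟩, (l g / l f) • f,
            Submodule.smul_mem _ _ (Submodule.mem_span_singleton_self f), by abel⟩
          · exact W.sub_mem hgW (W.smul_mem _ hfW)
          · apply hl
            · exact Submodule.sub_mem _ hg (Submodule.smul_mem _ _ hf1)
            · rw [map_sub, map_smul, smul_eq_mul, div_mul_cancel₀ _ hlf, sub_self]
        · refine sup_le hlt ?_
          rw [Submodule.span_singleton_le_iff_mem]
          exact ⟨hfW, hf1⟩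
      have hdisj : (W ⊓ D.lt n) ⊓ k ∙ f = ⊥ := by
        rw [eq_bot_iff]
        rintro g ⟨⟨-, hg⟩, hg2⟩
        obtain ⟨c, rfl⟩ := Submodule.mem_span_singleton.1 hg2
        by_cases hc : c = 0
        · simp [hc]
        · exact absurd (by simpa [smul_smul, inv_mul_cancel₀ hc] using
            Submodule.smul_mem _ c⁻¹ hg) hf2
      have hf0 : f ≠ 0 := fun h => hf2 (h ▸ Submodule.zero_mem _)
      have := hfin
      have hfd : FiniteDimensional k U := by
        rw [hspan]; infer_instance
      refine ⟨hfd, ?_⟩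
      have := Submodule.finrank_sup_add_finrank_inf_eq (W ⊓ D.lt n) (k ∙ f)
      rw [hdisj, finrank_bot, finrank_span_singleton hf0, ← hspan, hrk] at this
      rw [Nat.count_succ, if_pos ⟨f, hfW, hf1, hf2⟩]
      simpa using this
    · have : U = W ⊓ D.lt n := by
        apply le_antisymm
        · rintro g ⟨hgW, hg⟩
          refine ⟨hgW, ?_⟩
          by_contra hcon
          exact hn ⟨g, hgW, hg, hcon⟩
        · exact inf_le_inf_left _ (D.mono n)
      rw [this, Nat.count_succ, if_neg hn]
      exact ⟨hfin, by simpa using hrk⟩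

instance (W : Submodule k R) (n : ℕ) : FiniteDimensional k ↥(W ⊓ D.lt n) :=
  (D.finite_and_finrank W n).1

instance (n : ℕ) : FiniteDimensional k ↥(D.lt n) := by
  have := (D.finite_and_finrank ⊤ n).1
  rwa [top_inf_eq] at this

open Classical in
lemma finrank_inf (W : Submodule k R) (n : ℕ) :
    Module.finrank k ↥(W ⊓ D.lt n) = Nat.count (· ∈ D.degs W) n :=
  (D.finite_and_finrank W n).2

open Classical in
lemma finrank_lt (n : ℕ) :
    Module.finrank k ↥(D.lt n) = Nat.count (· ∈ D.degs ⊤) n := by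
  rw [← D.finrank_inf, top_inf_eq]

lemma add_mem_degs {I : Ideal R} {a b : ℕ} (ha : a ∈ D.degs (I.restrictScalars k))
    (hb : b ∈ D.degs ⊤) : a + b ∈ D.degs (I.restrictScalars k) := by
  obtain ⟨f, hfI, hf1, hf2⟩ := ha
  obtain ⟨g, -, hg1, hg2⟩ := hb
  exact ⟨f * g, I.mul_mem_right g hfI, D.mul_mem a b f g hf1 hg1,
    D.mul_notMem a b f g hf1 hf2 hg1 hg2⟩

/-- `D` has exactly `g` gaps. -/
def HasGaps (g : ℕ) : Prop :=
  (∀ n, n ≤ Module.finrank k ↥(D.lt n) + g) ∧ ∃ n₀, ∀ n, n₀ ≤ n → n = Module.finrank k ↥(D.lt n) + g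

/-- Image of the elements of degree `< n` in a quotient of `R`. -/
noncomputable def img (I : Ideal R) (n : ℕ) : Submodule k (R ⧸ I) :=
  (D.lt n).map (Ideal.Quotient.mkₐ k I).toLinearMap

lemma finrank_img (I : Ideal R) (n : ℕ) :
    Module.finrank k ↥(D.img I n) + Module.finrank k ↥(I.restrictScalars k ⊓ D.lt n) =
      Module.finrank k ↥(D.lt n) := by
  have h := LinearMap.finrank_range_add_finrank_ker
    ((Ideal.Quotient.mkₐ k I).toLinearMap.domRestrict (D.lt n))
  rw [LinearMap.range_domRestrict] at h
  have h2 : Module.finrank k ↥(LinearMap.ker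
      ((Ideal.Quotient.mkₐ k I).toLinearMap.domRestrict (D.lt n))) =
      Module.finrank k ↥(I.restrictScalars k ⊓ D.lt n) := by
    have : (LinearMap.ker ((Ideal.Quotient.mkₐ k I).toLinearMap.domRestrict (D.lt n))).map
        (D.lt n).subtype = I.restrictScalars k ⊓ D.lt n := by
      ext x
      simp only [Submodule.mem_map, LinearMap.mem_ker, LinearMap.domRestrict_apply,
        Submodule.subtype_apply, Subtype.exists, AlgHom.toLinearMap_apply,
        Ideal.Quotient.mkₐ_eq_mk, Ideal.Quotient.eq_zero_iff_mem, Submodule.mem_inf,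
        Submodule.restrictScalars_mem]
      constructor
      · rintro ⟨a, ha, h1, rfl⟩; exact ⟨h1, ha⟩
      · rintro ⟨h1, h2⟩; exact ⟨x, h2, h1, rfl⟩
    rw [← this]
    exact (LinearEquiv.finrank_eq (Submodule.equivMapOfInjective _
      (Submodule.injective_subtype _) _))
  rw [← h2]; exact h

lemma exists_img_eq_top (I : Ideal R) [FiniteDimensional k (R ⧸ I)] :
    ∃ n₀, ∀ n, n₀ ≤ n → D.img I n = ⊤ := by
  have hmono : Monotone (D.img I) := fun a b h => Submodule.map_mono (D.lt_mono h)
  obtain ⟨n₀, hn₀⟩ := monotone_stabilizes_iff_noetherian.2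
    (inferInstance : IsNoetherian k (R ⧸ I)) ⟨D.img I, hmono⟩
  refine ⟨n₀, fun n hn => ?_⟩
  rw [eq_top_iff]
  rintro x -
  obtain ⟨f, rfl⟩ := Ideal.Quotient.mk_surjective x
  obtain ⟨m, hm⟩ := D.exhaust f
  have h1 : Ideal.Quotient.mk I f ∈ D.img I (max m n) :=
    ⟨f, D.lt_mono (le_max_left _ _) hm, rfl⟩
  have h2 : D.img I n₀ = D.img I n := hn₀ n hn
  have h3 : D.img I n₀ = D.img I (max m n) := hn₀ _ (hn.trans (le_max_right _ _))
  rwa [← h3, h2] at h1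

variable {D}

open Classical in
lemma count_add_count_le {I : Ideal R} {m : ℕ} (hmI : m ∉ D.degs (I.restrictScalars k)) :
    Nat.count (· ∈ D.degs (I.restrictScalars k)) (m + 1) +
      Nat.count (· ∈ D.degs ⊤) (m + 1) ≤ m + 1 := by
  rw [Nat.count_eq_card_filter_range, Nat.count_eq_card_filter_range]
  have hdisj : Disjoint ((Finset.range (m+1)).filter (· ∈ D.degs (I.restrictScalars k)))
      (((Finset.range (m+1)).filter (· ∈ D.degs ⊤)).image (fun e => m - e)) := by
    rw [Finset.disjoint_left]
    intro d hd hd2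
    rw [Finset.mem_image] at hd2
    obtain ⟨e, he, rfl⟩ := hd2
    rw [Finset.mem_filter, Finset.mem_range] at he hd
    have := D.add_mem_degs hd.2 he.2
    rw [Nat.sub_add_cancel (by omega)] at this
    exact hmI this
  have hcard : (((Finset.range (m+1)).filter (· ∈ D.degs ⊤)).image (fun e => m - e)).card =
      ((Finset.range (m+1)).filter (· ∈ D.degs ⊤)).card := by
    apply Finset.card_image_of_injOn
    intro x hx y hy hxy
    simp only [Finset.coe_filter, Finset.mem_range, Set.mem_ofPred_eq] at hx hy hxy
    omega
  rw [← hcard, ← Finset.card_union_of_disjoint hdisj]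
  conv_rhs => rw [← Finset.card_range (m + 1)]
  apply Finset.card_le_card
  intro x hx
  rw [Finset.mem_union, Finset.mem_filter, Finset.mem_image] at hx
  rw [Finset.mem_range]
  rcases hx with hx | ⟨e, -, rfl⟩
  · exact Finset.mem_range.1 hx.1
  · omega

open Classical in
/-- Riemann–Roch type statement: in degree at least `2g + codim I`, evaluation modulo `I`
is onto. -/
lemma img_eq_top {g : ℕ} (hg : D.HasGaps g) (I : Ideal R) [FiniteDimensional k (R ⧸ I)] {n : ℕ}
    (hn : 2 * g + Module.finrank k (R ⧸ I) ≤ n) : D.img I n = ⊤ := by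
  set c := Module.finrank k (R ⧸ I) with hc
  have hgap := hg.1
  simp only [finrank_lt] at hgap
  have hle : ∀ m, Nat.count (· ∈ D.degs ⊤) m ≤
      c + Nat.count (· ∈ D.degs (I.restrictScalars k)) m := by
    intro m
    have h1 := D.finrank_img I m
    have h2 : Module.finrank k ↥(D.img I m) ≤ c := Submodule.finrank_le _
    rw [D.finrank_lt, D.finrank_inf] at h1
    omega
  have hmem : ∀ m, 2 * g + c ≤ m → m ∈ D.degs (I.restrictScalars k) := by
    intro m hm
    by_contra hmI
    have hcount := count_add_count_le hmI
    have h1 := hle (m + 1)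
    have h2 := hgap (m + 1)
    omega
  have htop : ∀ m, 2 * g + c ≤ m → m ∈ D.degs ⊤ := fun m hm => by
    obtain ⟨f, -, h1⟩ := hmem m hm
    exact ⟨f, trivial, h1⟩
  have hconst : ∀ j, Nat.count (· ∈ D.degs ⊤) (n + j) = Nat.count (· ∈ D.degs ⊤) n + j ∧
      Nat.count (· ∈ D.degs (I.restrictScalars k)) (n + j) =
        Nat.count (· ∈ D.degs (I.restrictScalars k)) n + j := by
    intro j
    induction j with
    | zero => simp
    | succ j ih =>
      rw [← add_assoc, Nat.count_succ, Nat.count_succ, if_pos (htop _ (by omega)),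
        if_pos (hmem _ (by omega))]
      omega
  obtain ⟨n₀, hn₀⟩ := D.exists_img_eq_top I
  have e1 := D.finrank_img I n
  have e2 := D.finrank_img I (n + n₀)
  rw [hn₀ (n + n₀) (by omega), finrank_top, D.finrank_lt, D.finrank_inf, (hconst n₀).1,
    (hconst n₀).2, ← hc] at e2
  rw [D.finrank_lt, D.finrank_inf] at e1
  exact Submodule.eq_top_of_finrank_eq (by omega)

/-- The codimension of an ideal is bounded by the degree of any of its nonzero elements. -/
lemma finrank_quotient_le {g : ℕ} (hg : D.HasGaps g) (I : Ideal R)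
    [FiniteDimensional k (R ⧸ I)] {f : R} (hf : f ∈ I) (hf0 : f ≠ 0) {m : ℕ}
    (hfm : f ∈ D.lt (m + 1)) : Module.finrank k (R ⧸ I) ≤ m := by
  classical
  obtain ⟨d, hd1, hd2⟩ := D.exists_deg hf0
  have hdm : d ≤ m := by
    by_contra h
    exact hd2 (D.lt_mono (by omega) hfm)
  refine le_trans ?_ hdm
  obtain ⟨n₀, hn₀⟩ := hg.2
  set n := n₀ + 2 * g + Module.finrank k (R ⧸ I) with hn
  have e1 := D.finrank_img I (d + n)
  rw [img_eq_top hg I (by omega), finrank_top, D.finrank_inf, D.finrank_lt] at e1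
  have e2 := hn₀ (d + n) (by omega)
  have e3 := hn₀ n (by omega)
  rw [D.finrank_lt] at e2 e3
  have hdI : d ∈ D.degs (I.restrictScalars k) := ⟨f, hf, hd1, hd2⟩
  have : Nat.count (· ∈ D.degs ⊤) n ≤ Nat.count (· ∈ D.degs (I.restrictScalars k)) (d + n) := by
    rw [Nat.count_add _ d n]
    refine le_trans ?_ (Nat.le_add_left _ _)
    rw [Nat.count_eq_card_filter_range, Nat.count_eq_card_filter_range]
    apply Finset.card_le_card
    intro x hx
    rw [Finset.mem_filter] at hx ⊢
    exact ⟨hx.1, D.add_mem_degs hdI hx.2⟩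
  omega

lemma finrank_inf_ideal {g : ℕ} (hg : D.HasGaps g) (I : Ideal R)
    [FiniteDimensional k (R ⧸ I)] {n : ℕ} (hn : 2 * g + Module.finrank k (R ⧸ I) ≤ n) :
    Module.finrank k ↥(I.restrictScalars k ⊓ D.lt n) + Module.finrank k (R ⧸ I) =
      Module.finrank k ↥(D.lt n) := by
  have := D.finrank_img I n
  rw [img_eq_top hg I hn, finrank_top] at this
  omega

/-- There are no gaps from `2g` on. -/
lemma finrank_lt_add {g : ℕ} (hg : D.HasGaps g) {n : ℕ} (hn : 2 * g ≤ n) :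
    Module.finrank k ↥(D.lt n) + g = n := by
  classical
  have key : ∀ m, 2 * g ≤ m → m ∈ D.degs ⊤ := by
    intro m hm
    by_contra hmI
    have hcount := count_add_count_le (I := ⊤) hmI
    rw [Submodule.restrictScalars_top] at hcount
    have h2 := hg.1 (m + 1)
    rw [D.finrank_lt] at h2
    omega
  have hconst : ∀ j, Nat.count (· ∈ D.degs ⊤) (n + j) = Nat.count (· ∈ D.degs ⊤) n + j := by
    intro j
    induction j with
    | zero => simp
    | succ j ih =>
      rw [← add_assoc, Nat.count_succ, if_pos (key _ (by omega))]
      omega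
  obtain ⟨n₀, hn₀⟩ := hg.2
  have := hn₀ (n + n₀) (by omega)
  rw [D.finrank_lt, hconst] at this
  rw [D.finrank_lt]
  omega

end DegAlg

end

section Codim

variable {k R : Type*} [Field k] [CommRing R] [Algebra k R]

/-- The Chinese remainder isomorphism is linear. -/
noncomputable def quotientInfLinearEquiv (I J : Ideal R) (h : IsCoprime I J) :
    (R ⧸ (I ⊓ J)) ≃ₗ[k] (R ⧸ I) × (R ⧸ J) :=
  { (Ideal.quotientInfEquivQuotientProd I J h) with
    map_smul' := by
      intro c x
      obtain ⟨r, rfl⟩ := Ideal.Quotient.mk_surjective x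
      rfl }

lemma finrank_quotient_inf (I J : Ideal R) (h : I ⊔ J = ⊤) [FiniteDimensional k (R ⧸ I)]
    [FiniteDimensional k (R ⧸ J)] : FiniteDimensional k (R ⧸ (I ⊓ J)) ∧
      Module.finrank k (R ⧸ (I ⊓ J)) = Module.finrank k (R ⧸ I) + Module.finrank k (R ⧸ J) := by
  let e := quotientInfLinearEquiv (k := k) I J (Ideal.isCoprime_iff_sup_eq.2 h)
  exact ⟨Module.Finite.equiv e.symm, by rw [e.finrank_eq, Module.finrank_prod]⟩

lemma sup_finset_inf_eq_top {P : Ideal R} (hP : P.IsMaximal) {S : Finset (Ideal R)}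
    (hS : ∀ I ∈ S, I.IsMaximal) (hPS : P ∉ S) : P ⊔ S.inf id = ⊤ := by
  by_contra hcon
  have h1 : P ⊔ S.inf id = P := (hP.eq_of_le hcon le_sup_left).symm
  have h2 : S.inf id ≤ P := by rw [← h1]; exact le_sup_right
  have := hP.isPrime
  obtain ⟨I, hI, hIP⟩ := (Ideal.IsPrime.inf_le' this).1 h2
  exact hPS ((hS I hI).eq_of_le hP.ne_top hIP ▸ hI)

lemma disjoint_inf_sup_eq_top {S T : Finset (Ideal R)} (hS : ∀ I ∈ S, I.IsMaximal)
    (hT : ∀ I ∈ T, I.IsMaximal) (hST : Disjoint S T) : S.inf id ⊔ T.inf id = ⊤ := by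
  classical
  induction S using Finset.induction_on with
  | empty => simp
  | insert P S hPS ih =>
    rw [Finset.disjoint_insert_left] at hST
    have h1 := ih (fun I hI => hS I (Finset.mem_insert_of_mem hI)) hST.2
    have h2 := sup_finset_inf_eq_top (hS P (Finset.mem_insert_self _ _)) hT hST.1
    rw [Finset.inf_insert, id]
    rw [← Ideal.isCoprime_iff_sup_eq] at h1 h2 ⊢
    rw [Ideal.isCoprime_iff_codisjoint] at h1 h2 ⊢
    exact (IsCoprime.mul_left (Ideal.isCoprime_iff_codisjoint.2 h2)
      (Ideal.isCoprime_iff_codisjoint.2 h1)).codisjoint.mono_left Ideal.mul_le_inf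

lemma finrank_quotient_finset_inf (S : Finset (Ideal R)) (hS : ∀ I ∈ S, I.IsMaximal)
    (hfd : ∀ I ∈ S, FiniteDimensional k (R ⧸ I)) :
    FiniteDimensional k (R ⧸ S.inf id) ∧
      Module.finrank k (R ⧸ S.inf id) = ∑ I ∈ S, Module.finrank k (R ⧸ I) := by
  classical
  induction S using Finset.induction_on with
  | empty =>
    rw [Finset.inf_empty, Finset.sum_empty]
    have : Subsingleton (R ⧸ (⊤ : Ideal R)) := Ideal.Quotient.subsingleton_iff.2 rfl
    exact ⟨inferInstance, Module.finrank_zero_of_subsingleton⟩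
  | insert P S hPS ih =>
    have hS' : ∀ I ∈ S, I.IsMaximal := fun I hI => hS I (Finset.mem_insert_of_mem hI)
    obtain ⟨h1, h2⟩ := ih hS' (fun I hI => hfd I (Finset.mem_insert_of_mem hI))
    have := hfd P (Finset.mem_insert_self _ _)
    rw [Finset.inf_insert, id, Finset.sum_insert hPS, ← h2]
    exact finrank_quotient_inf P _ (sup_finset_inf_eq_top (hS P (Finset.mem_insert_self _ _)) hS' hPS)

end Codim

namespace DegAlg

variable {k R : Type*} [Field k] [CommRing R] [Algebra k R] {D : DegAlg k R}

lemma deg_unique {f : R} {a b : ℕ} (ha : f ∈ D.lt (a + 1)) (ha' : f ∉ D.lt a)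
    (hb : f ∈ D.lt (b + 1)) (hb' : f ∉ D.lt b) : a = b := by
  rcases lt_trichotomy a b with h | h | h
  · exact absurd (D.lt_mono (Nat.succ_le_of_lt h) ha) hb'
  · exact h
  · exact absurd (D.lt_mono (Nat.succ_le_of_lt h) hb) ha'

lemma one_deg [Nontrivial R] : (1 : R) ∈ D.lt (0 + 1) ∧ (1 : R) ∉ D.lt 0 := by
  obtain ⟨e, h1, h2⟩ := D.exists_deg (one_ne_zero (α := R))
  have h3 := D.mul_mem e e 1 1 h1 h1
  have h4 := D.mul_notMem e e 1 1 h1 h2 h1 h2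
  rw [one_mul] at h3 h4
  have := deg_unique h1 h2 h3 h4
  obtain rfl : e = 0 := by omega
  exact ⟨h1, h2⟩

lemma pow_deg [Nontrivial R] {f : R} {d : ℕ} (h1 : f ∈ D.lt (d + 1)) (h2 : f ∉ D.lt d) (n : ℕ) :
    f ^ n ∈ D.lt (n * d + 1) ∧ f ^ n ∉ D.lt (n * d) := by
  induction n with
  | zero => simpa using D.one_deg
  | succ n ih =>
    rw [pow_succ, Nat.succ_mul]
    exact ⟨D.mul_mem _ _ _ _ ih.1 h1, D.mul_notMem _ _ _ _ ih.1 ih.2 h1 h2⟩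

lemma pow_mem [Nontrivial R] {f : R} {d : ℕ} (h1 : f ∈ D.lt (d + 1)) (n : ℕ) :
    f ^ n ∈ D.lt (n * d + 1) := by
  induction n with
  | zero => simpa using D.one_deg.1
  | succ n ih =>
    rw [pow_succ, Nat.succ_mul]
    exact D.mul_mem _ _ _ _ ih h1

lemma finrank_lt_le (n : ℕ) : Module.finrank k ↥(D.lt n) ≤ n := by
  classical
  rw [D.finrank_lt]
  exact (Nat.count_eq_card_filter_range (· ∈ D.degs ⊤) n).trans_le
    ((Finset.card_filter_le _ _).trans (Finset.card_range n).le)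

/-- Zeros of a nonzero function at distinct rational points. -/
lemma card_le_of_zeros {g : ℕ} (hg : D.HasGaps g) (X : Finset (R →ₐ[k] k)) {G : R} (hG : G ≠ 0)
    (hX : ∀ χ ∈ X, χ G = 0) {m : ℕ} (hGm : G ∈ D.lt (m + 1)) : X.card ≤ m := by
  classical
  have hsurj : ∀ χ : R →ₐ[k] k, Function.Surjective χ := fun χ c =>
    ⟨algebraMap k R c, by rw [χ.commutes]; rfl⟩
  let e : ∀ χ : R →ₐ[k] k, (R ⧸ RingHom.ker (χ : R →ₐ[k] k)) ≃ₐ[k] k := fun χ =>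
    Ideal.quotientKerAlgEquivOfSurjective (hsurj χ)
  have hinj : Function.Injective (fun χ : R →ₐ[k] k => RingHom.ker χ) := by
    intro χ ψ h
    ext f
    have : f - algebraMap k R (χ f) ∈ RingHom.ker χ := by
      rw [RingHom.mem_ker, map_sub, χ.commutes]; simp
    have h2 : f - algebraMap k R (χ f) ∈ RingHom.ker ψ := by
      have h' : RingHom.ker χ = RingHom.ker ψ := h
      rwa [← h']
    rw [RingHom.mem_ker, map_sub, ψ.commutes, sub_eq_zero] at h2
    exact h2.symm
  set S := X.image (fun χ : R →ₐ[k] k => RingHom.ker χ) with hS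
  have hmax : ∀ I ∈ S, I.IsMaximal := by
    intro I hI
    obtain ⟨χ, -, rfl⟩ := Finset.mem_image.1 hI
    exact RingHom.ker_isMaximal_of_surjective χ (hsurj χ)
  have hfd : ∀ I ∈ S, FiniteDimensional k (R ⧸ I) := by
    intro I hI
    obtain ⟨χ, -, rfl⟩ := Finset.mem_image.1 hI
    exact Module.Finite.equiv (e χ).symm.toLinearEquiv
  obtain ⟨h1, h2⟩ := finrank_quotient_finset_inf (k := k) S hmax hfd
  have h3 : Module.finrank k (R ⧸ S.inf id) = X.card := by
    rw [h2, hS, Finset.sum_image (fun a _ b _ h => hinj h), Finset.card_eq_sum_ones]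
    refine Finset.sum_congr rfl fun χ _ => ?_
    rw [(e χ).toLinearEquiv.finrank_eq, Module.finrank_self]
  rw [← h3]
  refine finrank_quotient_le hg _ ?_ hG hGm
  rw [Submodule.mem_finsetInf]
  intro I hI
  obtain ⟨χ, hχ, rfl⟩ := Finset.mem_image.1 hI
  exact hX χ hχ

/-- Stepanov's bound for the number of rational points. -/
theorem card_points_le [Fintype k] [Nontrivial R] {g : ℕ} (hg : D.HasGaps g) {p u v : ℕ} [Fact p.Prime]
    [CharP R p] (hQ : Fintype.card k = p ^ u * p ^ v) (huv : u ≤ v) (hv : 2 * g + 4 ≤ p ^ v)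
    (X : Finset (R →ₐ[k] k)) : X.card ≤ p ^ v * (p ^ u + 3 * g + 1) := by
  classical
  set s := p ^ u with hs
  set s' := p ^ v with hs'
  have hss : s ≤ s' := Nat.pow_le_pow_right (Fact.out : p.Prime).pos huv
  set l := s + 3 * g with hl
  let T := (Finset.range (l + 1)).filter (· ∈ D.degs ⊤)
  have hT : ∀ d : T, ∃ f, f ∈ D.lt (d.1 + 1) ∧ f ∉ D.lt d.1 := by
    rintro ⟨d, hd⟩
    obtain ⟨f, -, h⟩ := (Finset.mem_filter.1 hd).2
    exact ⟨f, h⟩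
  choose f hf1 hf2 using hT
  have hTl : ∀ d : T, d.1 ≤ l := fun d => by
    have := Finset.mem_range.1 (Finset.mem_filter.1 d.2).1
    omega
  have hTcard : l + 1 ≤ T.card + g := by
    have := hg.1 (l + 1)
    rwa [D.finrank_lt, Nat.count_eq_card_filter_range] at this
  have hspos : 0 < s := pow_pos (Fact.out : p.Prime).pos u
  obtain ⟨w, hw⟩ : ∃ w, s' = w + 1 := ⟨s' - 1, by omega⟩
  have ham : ∀ (a : T → D.lt s') d, (a d : R) ∈ D.lt (w + 1) := fun a d => by
    rw [← hw]; exact (a d).2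
  let Φ : (T → D.lt s') →+ D.lt (s * w + l + 1) :=
    { toFun := fun a => ⟨∑ d, (a d : R) ^ s * f d, Submodule.sum_mem _ fun d _ => by
        have h1 := D.pow_mem (d := w) (ham a d) s
        have h2 := D.mul_mem _ _ _ _ h1 (hf1 d)
        exact D.lt_mono (by have := hTl d; omega) h2⟩
      map_zero' := by ext; simp [hspos.ne']
      map_add' := by
        intro a b
        ext
        simp only [Pi.add_apply, Submodule.coe_add, hs, add_pow_char_pow, add_mul,
          Finset.sum_add_distrib] }
  have hfin : Finite k := inferInstance
  have : Finite (D.lt s') := Module.finite_of_finite k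
  have : Finite (D.lt (s * w + l + 1)) := Module.finite_of_finite k
  have hcard : Nat.card (D.lt (s * w + l + 1)) < Nat.card (T → D.lt s') := by
    rw [Nat.card_fun, Module.natCard_eq_pow_finrank (K := k) (V := D.lt s'),
      Module.natCard_eq_pow_finrank (K := k) (V := D.lt (s * w + l + 1)), ← pow_mul]
    apply Nat.pow_lt_pow_right
    · rw [Nat.card_eq_fintype_card]; exact Fintype.one_lt_card
    · refine (D.finrank_lt_le _).trans_lt ?_
      have h1 : s' ≤ Module.finrank k ↥(D.lt s') + g := hg.1 s'
      rw [Nat.card_eq_fintype_card, Fintype.card_coe]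
      obtain ⟨x, hx⟩ : ∃ x, s' = g + x := ⟨s' - g, by omega⟩
      calc s * w + l + 1 < x * (l + 1 - g) := by
            have : l + 1 - g = s + 2 * g + 1 := by omega
            rw [this, hl]
            zify at hx hw hv hss ⊢
            have hx' : (x : ℤ) = w + 1 - g := by linarith
            rw [hx']
            have hw' : (w : ℤ) = s' - 1 := by linarith
            rw [hw']
            nlinarith [mul_le_mul_of_nonneg_left hss (Int.natCast_nonneg g), mul_le_mul_of_nonneg_left hv (Int.natCast_nonneg g)]
        _ ≤ _ := Nat.mul_le_mul (by omega) (by omega)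
  have hninj : ¬ Function.Injective Φ := fun h =>
    absurd (Nat.card_le_card_of_injective Φ h) (by omega)
  rw [injective_iff_map_eq_zero] at hninj
  push Not at hninj
  obtain ⟨a, ha0, ha⟩ := hninj
  have ha0' : ∑ d, (a d : R) ^ s * f d = 0 := congrArg Subtype.val ha0
  set G : R := ∑ d, (a d : R) * f d ^ s' with hG
  have hGmem : G ∈ D.lt (w + s' * l + 1) := Submodule.sum_mem _ fun d _ => by
    have h1 := (D.pow_deg (hf1 d) (hf2 d) s').1
    have h2 := D.mul_mem w _ _ _ (ham a d) h1
    exact D.lt_mono (by have := Nat.mul_le_mul_left s' (hTl d); omega) h2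
  have hG0 : G ≠ 0 := by
    obtain ⟨d₀, hd₀⟩ : ∃ d, a d ≠ 0 := Function.ne_iff.1 ha
    obtain ⟨d, hd, hmax⟩ := Finset.exists_max_image (Finset.univ.filter fun d : T => a d ≠ 0)
      (fun d => d.1) ⟨d₀, by simpa using hd₀⟩
    have hd' : (a d : R) ≠ 0 := by simpa using hd
    obtain ⟨e, he1, he2⟩ := D.exists_deg hd'
    have hp := D.pow_deg (hf1 d) (hf2 d) s'
    have hmain := D.mul_notMem e _ _ _ he1 he2 hp.1 hp.2
    intro h0
    rw [hG, ← Finset.add_sum_erase _ _ (Finset.mem_univ d)] at h0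
    have hrest : ∑ d' ∈ Finset.univ.erase d, (a d' : R) * f d' ^ s' ∈ D.lt (e + s' * d.1) := by
      refine Submodule.sum_mem _ fun d' hd' => ?_
      by_cases h : a d' = 0
      · simp [h]
      · have h1 := hmax d' (by simpa using h)
        have h2 : d'.1 ≠ d.1 := fun h => (Finset.mem_erase.1 hd').1 (Subtype.ext h)
        have h3 : d'.1 + 1 ≤ d.1 := by omega
        have h4 := D.mul_mem w _ _ _ (ham a d') (D.pow_deg (hf1 d') (hf2 d') s').1
        refine D.lt_mono ?_ h4
        have := Nat.mul_le_mul_left s' h3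
        rw [Nat.mul_add] at this
        omega
    have : (a d : R) * f d ^ s' = -∑ d' ∈ Finset.univ.erase d, (a d' : R) * f d' ^ s' :=
      eq_neg_of_add_eq_zero_left h0
    exact hmain (this ▸ Submodule.neg_mem _ hrest)
  refine (card_le_of_zeros hg X hG0 ?_ hGmem).trans ?_
  · intro χ _
    have hCk : CharP k p := (RingHom.charP_iff _ (algebraMap k R).injective p).2 inferInstance
    have h1 : χ G ^ s = 0 := by
      have h0 : χ (∑ d, (a d : R) ^ s * f d) = 0 := by rw [ha0', map_zero]
      rw [hG, map_sum, hs, sum_pow_char_pow, ← h0, map_sum]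
      refine Finset.sum_congr rfl fun d _ => ?_
      rw [map_mul, map_mul, map_pow, map_pow, mul_pow, ← pow_mul, mul_comm s', ← hQ,
        FiniteField.pow_card]
    exact pow_eq_zero_iff hspos.ne' |>.1 h1
  · rw [hl, hw]; nlinarith

end DegAlg

/-- `A` has a bilinear multiplication algorithm of length `r` over `k`. -/
def HasBil (k A : Type*) [Field k] [CommRing A] [Algebra k A] (r : ℕ) : Prop :=
  ∃ (a b : Fin r → A →ₗ[k] k) (c : Fin r → A), ∀ x y, x * y = ∑ l, (a l x * b l y) • c l

lemma HasBil.mono {k A : Type*} [Field k] [CommRing A] [Algebra k A] {r s : ℕ}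
    (h : HasBil k A r) (hrs : r ≤ s) : HasBil k A s := by
  obtain ⟨a, b, c, h⟩ := h
  obtain ⟨t, rfl⟩ := Nat.exists_eq_add_of_le hrs
  refine ⟨Fin.append a 0, Fin.append b 0, Fin.append c 0, fun x y => ?_⟩
  rw [Fin.sum_univ_add, h]
  simp

lemma HasBil.of_fintype {k A ι : Type*} [Field k] [CommRing A] [Algebra k A] [Fintype ι]
    (a b : ι → A →ₗ[k] k) (c : ι → A) (h : ∀ x y, x * y = ∑ l, (a l x * b l y) • c l) :
    HasBil k A (Fintype.card ι) := by
  let e := (Fintype.equivFin ι).symm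
  refine ⟨a ∘ e, b ∘ e, c ∘ e, fun x y => ?_⟩
  rw [h, ← e.sum_comp]
  rfl

lemma HasBil.equiv {k A B : Type*} [Field k] [CommRing A] [Algebra k A] [CommRing B] [Algebra k B]
    {r : ℕ} (h : HasBil k A r) (e : A ≃ₐ[k] B) : HasBil k B r := by
  obtain ⟨a, b, c, h⟩ := h
  refine ⟨fun l => (a l).comp e.symm.toLinearMap, fun l => (b l).comp e.symm.toLinearMap,
    fun l => e (c l), fun x y => ?_⟩
  have := congrArg e (h (e.symm x) (e.symm y))
  simpa using this

/-- Karatsuba multiplication in degree two. -/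
lemma hasBil_three {k A : Type*} [Field k] [CommRing A] [Algebra k A]
    (h : Module.finrank k A = 2) : HasBil k A 3 := by
  have : FiniteDimensional k A := Module.finite_of_finrank_pos (by omega)
  let b := Module.finBasisOfFinrankEq k A h
  refine ⟨![b.coord 0, b.coord 1, b.coord 0 + b.coord 1],
    ![b.coord 0, b.coord 1, b.coord 0 + b.coord 1],
    ![b 0 * b 0 - b 0 * b 1, b 1 * b 1 - b 0 * b 1, b 0 * b 1], fun x y => ?_⟩
  have hx := b.sum_repr x
  have hy := b.sum_repr y
  rw [Fin.sum_univ_two] at hx hy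
  conv_lhs => rw [← hx, ← hy]
  rw [Fin.sum_univ_three]
  simp only [Matrix.cons_val_zero, Matrix.cons_val_one, Matrix.cons_val, Module.Basis.coord_apply,
    LinearMap.add_apply, Algebra.smul_def, map_mul, map_add]
  ring

/-- Evaluation–interpolation: multiplication in `A` can be done through degree two quotients. -/
lemma hasBil_of_eval {k R : Type*} [Field k] [CommRing R] [Algebra k R] (Q : Ideal R)
    (W₁ W₂ W : Submodule k R) (hW : ∀ f ∈ W₁, ∀ g ∈ W₂, f * g ∈ W)
    (h₁ : ∀ x, ∃ f ∈ W₁, f - x ∈ Q) (h₂ : ∀ x, ∃ f ∈ W₂, f - x ∈ Q)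
    (S : Finset (Ideal R)) (hS : ∀ P ∈ S, Module.finrank k (R ⧸ P) = 2)
    (hinj : ∀ f ∈ W, (∀ P ∈ S, f ∈ P) → f = 0) : HasBil k (R ⧸ Q) (3 * S.card) := by
  classical
  have sec : ∀ (V : Submodule k R), (∀ x, ∃ f ∈ V, f - x ∈ Q) →
      ∃ s : (R ⧸ Q) →ₗ[k] R, ∀ x, s x ∈ V ∧ Ideal.Quotient.mk Q (s x) = x := by
    intro V hV
    let π : V →ₗ[k] (R ⧸ Q) := (Ideal.Quotient.mkₐ k Q).toLinearMap.comp V.subtype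
    have hπ : Function.Surjective π := by
      intro y
      obtain ⟨x, rfl⟩ := Ideal.Quotient.mk_surjective y
      obtain ⟨f, hf, hfx⟩ := hV x
      exact ⟨⟨f, hf⟩, (Ideal.Quotient.mk_eq_mk_iff_sub_mem f x).2 hfx⟩
    obtain ⟨s, hs⟩ := LinearMap.exists_rightInverse_of_surjective π (LinearMap.range_eq_top.2 hπ)
    exact ⟨V.subtype.comp s, fun x => ⟨(s x).2, LinearMap.congr_fun hs x⟩⟩
  obtain ⟨s₁, hs₁⟩ := sec W₁ h₁
  obtain ⟨s₂, hs₂⟩ := sec W₂ h₂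
  let ev : W →ₗ[k] (∀ P : S, R ⧸ P.1) :=
    LinearMap.pi fun P => (Ideal.Quotient.mkₐ k P.1).toLinearMap.comp W.subtype
  have hev : LinearMap.ker ev = ⊥ := by
    rw [eq_bot_iff]
    intro f hf
    have : (f : R) = 0 := hinj f f.2 fun P hP => by
      have := congrFun hf ⟨P, hP⟩
      exact Ideal.Quotient.eq_zero_iff_mem.1 this
    simpa using this
  obtain ⟨inv, hinv⟩ := LinearMap.exists_leftInverse_of_injective ev hev
  choose a b c habc using fun P : S => hasBil_three (hS P.1 P.2)
  have key := HasBil.of_fintype (k := k) (A := R ⧸ Q) (ι := S × Fin 3)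
    (fun l => (a l.1 l.2).comp ((Ideal.Quotient.mkₐ k l.1.1).toLinearMap.comp s₁))
    (fun l => (b l.1 l.2).comp ((Ideal.Quotient.mkₐ k l.1.1).toLinearMap.comp s₂))
    (fun l => Ideal.Quotient.mk Q (inv (Pi.single l.1 (c l.1 l.2)))) ?_
  · have hc : Fintype.card (S × Fin 3) = 3 * S.card := by
      rw [Fintype.card_prod, Fintype.card_coe, Fintype.card_fin, mul_comm]
    rwa [hc] at key
  · intro x y
    have hmem := hW _ (hs₁ x).1 _ (hs₂ y).1
    have e1 : x * y = Ideal.Quotient.mk Q (s₁ x * s₂ y) := by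
      rw [map_mul, (hs₁ x).2, (hs₂ y).2]
    have e2 : (inv (ev ⟨_, hmem⟩) : R) = s₁ x * s₂ y := by
      have := LinearMap.congr_fun hinv ⟨_, hmem⟩
      exact congrArg Subtype.val this
    have e3 : ev ⟨_, hmem⟩ = ∑ l : S × Fin 3,
        ((a l.1 l.2) (Ideal.Quotient.mk l.1.1 (s₁ x)) * (b l.1 l.2)
          (Ideal.Quotient.mk l.1.1 (s₂ y))) • Pi.single l.1 (c l.1 l.2) := by
      rw [Fintype.sum_prod_type]
      have : ∀ P : S, ∑ i, ((a P i) (Ideal.Quotient.mk P.1 (s₁ x)) * (b P i)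
          (Ideal.Quotient.mk P.1 (s₂ y))) • (Pi.single P (c P i) : ∀ P : S, R ⧸ P.1) =
          Pi.single P (Ideal.Quotient.mk P.1 (s₁ x) * Ideal.Quotient.mk P.1 (s₂ y)) := by
        intro P
        rw [habc P, ← LinearMap.single_apply (R := k), map_sum]
        refine Finset.sum_congr rfl fun i _ => ?_
        rw [map_smul, LinearMap.single_apply]
      rw [Finset.sum_congr rfl fun P _ => this P, Finset.univ_sum_single]
      ext P
      exact map_mul (Ideal.Quotient.mk P.1) _ _
    rw [e1, ← e2, e3]
    simp only [map_sum, map_smul, Submodule.coe_sum, Submodule.coe_smul]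
    refine Finset.sum_congr rfl fun l _ => ?_
    exact map_smul (Ideal.Quotient.mkₐ k Q) _ _

namespace DegAlg

variable {k R : Type*} [Field k] [CommRing R] [Algebra k R] {D : DegAlg k R}

/-- A finite set of maximal ideals of degree `d`. -/
def PrimesOfDeg (k : Type*) {R : Type*} [Field k] [CommRing R] [Algebra k R] (d : ℕ)
    (S : Finset (Ideal R)) : Prop :=
  0 < d ∧ ∀ I ∈ S, I.IsMaximal ∧ Module.finrank k (R ⧸ I) = d

/-- A finite set of maximal ideals of total degree `c`. -/
def TotalDeg (k : Type*) {R : Type*} [Field k] [CommRing R] [Algebra k R] (c : ℕ)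
    (S : Finset (Ideal R)) : Prop :=
  (∀ I ∈ S, I.IsMaximal ∧ FiniteDimensional k (R ⧸ I)) ∧
    ∑ I ∈ S, Module.finrank k (R ⧸ I) = c

lemma PrimesOfDeg.totalDeg {d : ℕ} {S : Finset (Ideal R)} (h : PrimesOfDeg k d S) :
    TotalDeg k (S.card * d) S := by
  refine ⟨fun I hI => ⟨(h.2 I hI).1, Module.finite_of_finrank_pos ?_⟩, ?_⟩
  · rw [(h.2 I hI).2]; exact h.1
  · rw [Finset.sum_congr rfl fun I hI => (h.2 I hI).2, Finset.sum_const, smul_eq_mul]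

lemma PrimesOfDeg.mono {d : ℕ} {S T : Finset (Ideal R)} (h : PrimesOfDeg k d S) (hT : T ⊆ S) :
    PrimesOfDeg k d T := ⟨h.1, fun I hI => h.2 I (hT hI)⟩

lemma PrimesOfDeg.disjoint {d d' : ℕ} {S T : Finset (Ideal R)} (h : PrimesOfDeg k d S)
    (h' : PrimesOfDeg k d' T) (hd : d ≠ d') : Disjoint S T := by
  rw [Finset.disjoint_left]
  intro I hI hI'
  exact hd ((h.2 I hI).2.symm.trans (h'.2 I hI').2)

lemma TotalDeg.finite {c : ℕ} {S : Finset (Ideal R)} (h : TotalDeg k c S) :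
    FiniteDimensional k (R ⧸ S.inf id) :=
  (finrank_quotient_finset_inf S (fun I hI => (h.1 I hI).1) (fun I hI => (h.1 I hI).2)).1

lemma TotalDeg.finrank {c : ℕ} {S : Finset (Ideal R)} (h : TotalDeg k c S) :
    Module.finrank k (R ⧸ S.inf id) = c :=
  (finrank_quotient_finset_inf S (fun I hI => (h.1 I hI).1)
    (fun I hI => (h.1 I hI).2)).2.trans h.2

lemma TotalDeg.union [DecidableEq (Ideal R)] {c d : ℕ} {S T : Finset (Ideal R)}
    (h : TotalDeg k c S) (h' : TotalDeg k d T) (hd : Disjoint S T) :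
    TotalDeg k (c + d) (S ∪ T) := by
  refine ⟨fun I hI => ?_, ?_⟩
  · rcases Finset.mem_union.1 hI with hI | hI
    exacts [h.1 I hI, h'.1 I hI]
  · rw [Finset.sum_union hd, h.2, h'.2]

lemma TotalDeg.le_deg {g c m : ℕ} (hg : D.HasGaps g) {S : Finset (Ideal R)}
    (h : TotalDeg k c S) {f : R} (hf : ∀ P ∈ S, f ∈ P) (hf0 : f ≠ 0) (hm : f ∈ D.lt (m + 1)) :
    c ≤ m := by
  have := h.finite
  rw [← h.finrank]
  exact finrank_quotient_le hg (S.inf id) ((Submodule.mem_finsetInf).2 hf) hf0 hm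

/-- If no two members of a large family share a nonzero element of each of two small spaces,
then some member of the family meets both spaces in small dimension. -/
lemma exists_small_inter [Fintype k] {V : Type*} [AddCommGroup V] [Module k V]
    (hk : 4 ≤ Fintype.card k) (Z : Finset (Submodule k V)) {N e : ℕ} (he : e ≤ N)
    (hZ : Fintype.card k ^ (N - e) ≤ Z.card) (W : Fin 2 → Submodule k V)
    [∀ i, FiniteDimensional k (W i)] (hW : ∀ i, Module.finrank k (W i) ≤ N)
    (hdis : ∀ i, ∀ A ∈ Z, ∀ B ∈ Z, ∀ f ∈ W i, f ∈ A → f ∈ B → f ≠ 0 → A = B) :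
    ∃ A ∈ Z, ∀ i, Module.finrank k ↥(W i ⊓ A) ≤ e := by
  classical
  by_contra hcon
  push Not at hcon
  set q := Fintype.card k with hq
  have hfin : ∀ i, Finite (W i) := fun i => Module.finite_of_finite k
  have hfd : ∀ i A, FiniteDimensional k ↥(W i ⊓ A) := fun i A =>
    Submodule.finiteDimensional_of_le inf_le_left
  have hfin' : ∀ i A, Finite ↥(W i ⊓ A) := fun i A => Module.finite_of_finite k
  let T : Fin 2 → Submodule k V → Set V := fun i A => {f | f ∈ W i ∧ f ∈ A ∧ f ≠ 0}
  have hT : ∀ i A, (T i A).ncard + 1 = q ^ Module.finrank k ↥(W i ⊓ A) := by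
    intro i A
    have h1 : insert 0 (T i A) = ((W i ⊓ A : Submodule k V) : Set V) := by
      ext f
      by_cases h0 : f = 0
      · simp [h0]
      · simp [T, h0]
    have hf : (T i A).Finite := (Set.toFinite ((W i ⊓ A : Submodule k V) : Set V)).subset
      (by rw [← h1]; exact Set.subset_insert _ _)
    rw [← Set.ncard_insert_of_notMem (a := 0) (by simp [T]) hf, h1, ← Nat.card_coe_set_eq,
      hq, ← Nat.card_eq_fintype_card]
    exact Module.natCard_eq_pow_finrank (K := k)
  have hfinT : ∀ i A, (T i A).Finite := fun i A =>
    (Set.toFinite (W i : Set V)).subset fun f hf => hf.1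
  have hsum : ∀ i, ∑ A ∈ Z, (T i A).ncard ≤ q ^ N - 1 := by
    intro i
    have h1 : (⋃ A ∈ Z, T i A).ncard = ∑ A ∈ Z, (T i A).ncard := by
      rw [← finsum_mem_coe_finset]
      refine Z.finite_toSet.ncard_biUnion ?_ ?_
      · exact fun A _ => hfinT i A
      · intro A hA B hB hAB
        rw [Function.onFun, Set.disjoint_left]
        intro f hf hf'
        exact hAB (hdis i A hA B hB f hf.1 hf.2.1 hf'.2.1 hf.2.2)
    rw [← h1]
    have h2 : (⋃ A ∈ Z, T i A) ⊆ T i ⊤ := by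
      intro f hf
      simp only [Set.mem_iUnion] at hf
      obtain ⟨A, hA, hf⟩ := hf
      exact ⟨hf.1, trivial, hf.2.2⟩
    refine (Set.ncard_le_ncard h2 (hfinT i ⊤)).trans ?_
    have h3 := hT i ⊤
    rw [inf_top_eq] at h3
    have h4 : q ^ Module.finrank k (W i) ≤ q ^ N := Nat.pow_le_pow_right (by omega) (hW i)
    omega
  have hlow : Z.card * (q ^ (e + 1) - 1) ≤ ∑ A ∈ Z, ((T 0 A).ncard + (T 1 A).ncard) := by
    rw [← smul_eq_mul, ← Finset.sum_const]
    refine Finset.sum_le_sum fun A hA => ?_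
    obtain ⟨i, hi⟩ := hcon A hA
    have h1 := hT i A
    have h2 : q ^ (e + 1) ≤ q ^ Module.finrank k ↥(W i ⊓ A) :=
      Nat.pow_le_pow_right (by omega) hi
    fin_cases i
    · simp only [Fin.zero_eta] at h1 h2; omega
    · simp only [Fin.mk_one] at h1 h2; omega
  rw [Finset.sum_add_distrib] at hlow
  have h0 := hsum 0
  have h1 := hsum 1
  have h2 := Nat.mul_le_mul_right (q ^ (e + 1) - 1) hZ
  rw [Nat.mul_sub, ← pow_add, show N - e + (e + 1) = N + 1 by omega, pow_succ, mul_one] at h2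
  have h3 : q ^ (N - e) ≤ q ^ N := Nat.pow_le_pow_right (by omega) (by omega)
  have h4 : 1 ≤ q ^ N := Nat.one_le_pow _ _ (by omega)
  have h5 : q ^ N * 4 ≤ q ^ N * q := Nat.mul_le_mul_left _ hk
  omega

lemma sup_lt_eq_top_iff (J : Ideal R) (n : ℕ) :
    J.restrictScalars k ⊔ D.lt n = ⊤ ↔ D.img J n = ⊤ := by
  constructor
  · intro h
    rw [eq_top_iff]
    rintro x -
    obtain ⟨r, rfl⟩ := Ideal.Quotient.mk_surjective x
    obtain ⟨a, ha, b, hb, rfl⟩ := Submodule.mem_sup.1 (h ▸ Submodule.mem_top : r ∈ _)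
    refine ⟨b, hb, ?_⟩
    have : Ideal.Quotient.mk J a = 0 := Ideal.Quotient.eq_zero_iff_mem.2 ha
    simp [this]
  · intro h
    rw [eq_top_iff]
    rintro r -
    obtain ⟨b, hb, hbr⟩ : Ideal.Quotient.mk J r ∈ D.img J n := h ▸ Submodule.mem_top
    have : r - b ∈ J := (Ideal.Quotient.mk_eq_mk_iff_sub_mem _ _).1 hbr.symm
    exact Submodule.mem_sup.2 ⟨r - b, this, b, hb, by ring⟩

lemma finrank_img_add_finrank_quotient (J : Ideal R) (n : ℕ) [FiniteDimensional k (R ⧸ J)] :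
    FiniteDimensional k (R ⧸ (J.restrictScalars k ⊔ D.lt n)) ∧
    Module.finrank k ↥(D.img J n) + Module.finrank k (R ⧸ (J.restrictScalars k ⊔ D.lt n)) =
      Module.finrank k (R ⧸ J) := by
  let π : R →ₗ[k] ((R ⧸ J) ⧸ D.img J n) :=
    (D.img J n).mkQ.comp (Ideal.Quotient.mkₐ k J).toLinearMap
  have hπ : Function.Surjective π :=
    (Submodule.mkQ_surjective _).comp Ideal.Quotient.mk_surjective
  have hker : LinearMap.ker π = J.restrictScalars k ⊔ D.lt n := by
    ext r
    rw [LinearMap.mem_ker, LinearMap.comp_apply, Submodule.mkQ_apply,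
      Submodule.Quotient.mk_eq_zero]
    constructor
    · rintro ⟨b, hb, hbr⟩
      have : r - b ∈ J := (Ideal.Quotient.mk_eq_mk_iff_sub_mem _ _).1 hbr.symm
      exact Submodule.mem_sup.2 ⟨r - b, this, b, hb, by ring⟩
    · intro h
      obtain ⟨a, ha, b, hb, rfl⟩ := Submodule.mem_sup.1 h
      refine ⟨b, hb, ?_⟩
      have : Ideal.Quotient.mk J a = 0 := Ideal.Quotient.eq_zero_iff_mem.2 ha
      simp [this]
  have e := π.quotKerEquivOfSurjective hπ
  rw [hker] at e
  refine ⟨Module.Finite.equiv e.symm, ?_⟩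
  rw [e.finrank_eq, add_comm]
  exact Submodule.finrank_quotient_add_finrank _

lemma exists_remove_aux [DecidableEq (Ideal R)] (I : Ideal R) {n : ℕ} (hI : D.img I n = ⊤)
    (e : ℕ) : ∀ (E : Finset (Ideal R)), (∀ P ∈ E, P.IsMaximal) →
      FiniteDimensional k (R ⧸ ((I ⊓ E.inf id).restrictScalars k ⊔ D.lt n)) →
      Module.finrank k (R ⧸ ((I ⊓ E.inf id).restrictScalars k ⊔ D.lt n)) ≤ e →
      ∃ E' ⊆ E, (E \ E').card ≤ e ∧ D.img (I ⊓ E'.inf id) n = ⊤ := by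
  induction e with
  | zero =>
    intro E _ hfd he
    refine ⟨E, subset_rfl, by simp, (sup_lt_eq_top_iff _ _).1 ?_⟩
    rw [← Submodule.Quotient.subsingleton_iff]
    exact Module.finrank_zero_iff.1 (Nat.le_zero.1 he)
  | succ e ih =>
    intro E hE hfd he
    by_cases htop : (I ⊓ E.inf id).restrictScalars k ⊔ D.lt n = ⊤
    · exact ⟨E, subset_rfl, by simp, (sup_lt_eq_top_iff _ _).1 htop⟩
    set T : Finset (Ideal R) → Submodule k R :=
      fun E => (I ⊓ E.inf id).restrictScalars k ⊔ D.lt n with hT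
    have hmono : ∀ P, T E ≤ T (E.erase P) := fun P => by
      refine sup_le_sup_right ?_ _
      have : I ⊓ E.inf id ≤ I ⊓ (E.erase P).inf id :=
        inf_le_inf_left I (Finset.inf_mono (Finset.erase_subset _ _))
      exact this
    obtain ⟨P, hP, hPT⟩ : ∃ P ∈ E, ¬ T (E.erase P) ≤ T E := by
      by_contra hcon
      push Not at hcon
      apply htop
      rw [eq_top_iff, ← (sup_lt_eq_top_iff I n).2 hI]
      refine sup_le ?_ le_sup_right
      have hsup : E.sup (fun P => (E.erase P).inf id) = ⊤ ∨ E = ∅ := by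
        by_contra! hne
        obtain ⟨M, hM, hle⟩ := Ideal.exists_le_maximal _ hne.1
        have hmem : ∀ P ∈ E, ∃ Q ∈ E.erase P, Q = M := by
          intro P hP
          have h1 : (E.erase P).inf id ≤ M :=
            (Finset.le_sup (f := fun P => (E.erase P).inf id) hP).trans hle
          obtain ⟨Q, hQ, hQM⟩ := (Ideal.IsPrime.inf_le' hM.isPrime).1 h1
          exact ⟨Q, hQ, (hE Q (Finset.mem_of_mem_erase hQ)).eq_of_le hM.ne_top hQM⟩
        obtain ⟨P, hP⟩ := hne.2
        obtain ⟨Q, hQ, hQM⟩ := hmem P hP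
        obtain ⟨Q', hQ', hQM'⟩ := hmem Q (Finset.mem_of_mem_erase hQ)
        exact absurd (hQM'.trans hQM.symm) (Finset.ne_of_mem_erase hQ')
      rcases hsup with hsup | rfl
      · intro i hi
        let 𝔞 : Ideal R :=
          { carrier := {r | ∀ i ∈ I, r * i ∈ T E}
            add_mem' := fun ha hb i hi => by
              rw [add_mul]; exact Submodule.add_mem _ (ha i hi) (hb i hi)
            zero_mem' := fun i _ => by rw [zero_mul]; exact Submodule.zero_mem _
            smul_mem' := fun c r hr i hi => by
              rw [smul_eq_mul, mul_comm c, mul_assoc]; exact hr _ (I.mul_mem_left c hi) }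
        have h1 : E.sup (fun P => (E.erase P).inf id) ≤ 𝔞 := by
          refine Finset.sup_le fun P hP r hr i hi => hcon P hP ?_
          exact Submodule.mem_sup_left ⟨I.mul_mem_left r hi, Ideal.mul_mem_right i _ hr⟩
        rw [hsup] at h1
        have h2 := h1 (Submodule.mem_top : (1 : R) ∈ _) i hi
        rwa [one_mul] at h2
      · refine le_trans ?_ le_sup_left
        simp
    have hfd' : FiniteDimensional k (R ⧸ T E) := hfd
    let φ : (R ⧸ T E) →ₗ[k] (R ⧸ T (E.erase P)) := Submodule.factor (hmono P)
    have hφ : Function.Surjective φ := Submodule.factor_surjective (hmono P)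
    have hfd2 : FiniteDimensional k (R ⧸ T (E.erase P)) := Module.Finite.of_surjective φ hφ
    have hlt : Module.finrank k (R ⧸ T (E.erase P)) < Module.finrank k (R ⧸ T E) := by
      refine lt_of_le_of_ne (LinearMap.finrank_le_finrank_of_surjective hφ) fun heq => hPT ?_
      have hinj := (LinearMap.injective_iff_surjective_of_finrank_eq_finrank heq.symm).2 hφ
      intro r hr
      have h1 : φ (Submodule.Quotient.mk r) = 0 :=
        (Submodule.Quotient.mk_eq_zero _).2 hr
      have h2 : (Submodule.Quotient.mk r : R ⧸ T E) = 0 := hinj (by rw [h1, map_zero])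
      exact (Submodule.Quotient.mk_eq_zero _).1 h2
    have he' : Module.finrank k (R ⧸ T E) ≤ e + 1 := he
    obtain ⟨E', hE', hcard, himg⟩ := ih (E.erase P)
      (fun Q hQ => hE Q (Finset.mem_of_mem_erase hQ)) hfd2 (by
        change Module.finrank k (R ⧸ T (E.erase P)) ≤ e; omega)
    refine ⟨E', hE'.trans (Finset.erase_subset _ _), ?_, himg⟩
    have : E \ E' ⊆ insert P (E.erase P \ E') := by
      intro Q hQ
      simp only [Finset.mem_sdiff, Finset.mem_insert, Finset.mem_erase] at hQ ⊢
      tauto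
    exact (Finset.card_le_card this).trans ((Finset.card_insert_le _ _).trans (by omega))

/-- Elements of `lt n` surject onto `R ⧸ I ⊓ J_E'` after removing few primes `E \ E'`. -/
lemma exists_remove [DecidableEq (Ideal R)] (I : Ideal R) {n : ℕ} (hI : D.img I n = ⊤) {e : ℕ}
    (E : Finset (Ideal R)) (hE : ∀ P ∈ E, P.IsMaximal)
    (hfd : FiniteDimensional k (R ⧸ (I ⊓ E.inf id)))
    (he : Module.finrank k (R ⧸ (I ⊓ E.inf id)) ≤
        Module.finrank k ↥(D.img (I ⊓ E.inf id) n) + e) :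
    ∃ E' ⊆ E, (E \ E').card ≤ e ∧ D.img (I ⊓ E'.inf id) n = ⊤ := by
  obtain ⟨h1, h2⟩ := finrank_img_add_finrank_quotient (D := D) (I ⊓ E.inf id) n
  exact exists_remove_aux I hI e E hE h1 (by omega)

lemma finrank_le_inf_add (V J : Submodule k R) [FiniteDimensional k V] [FiniteDimensional k (R ⧸ J)] :
    Module.finrank k V ≤ Module.finrank k ↥(V ⊓ J) + Module.finrank k (R ⧸ J) := by
  have h := LinearMap.finrank_range_add_finrank_ker (J.mkQ.domRestrict V)
  have h1 : Module.finrank k (LinearMap.range (J.mkQ.domRestrict V)) ≤ Module.finrank k (R ⧸ J) :=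
    Submodule.finrank_le _
  have h2 : (LinearMap.ker (J.mkQ.domRestrict V)).map V.subtype = V ⊓ J := by
    ext x
    simp only [Submodule.mem_map, LinearMap.mem_ker, LinearMap.domRestrict_apply,
      Submodule.mkQ_apply, Submodule.Quotient.mk_eq_zero, Submodule.subtype_apply,
      Subtype.exists, Submodule.mem_inf]
    constructor
    · rintro ⟨a, ha, h1, rfl⟩; exact ⟨ha, h1⟩
    · rintro ⟨h1, h2⟩; exact ⟨x, h1, h2, rfl⟩
  rw [← h2, ← LinearEquiv.finrank_eq (Submodule.equivMapOfInjective _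
      (Submodule.injective_subtype V) _)]
  omega

/-- A small space of functions is separated from zero by few primes. -/
lemma exists_kill [DecidableEq (Ideal R)] (B : Finset (Ideal R)) (d : ℕ) :
    ∀ (V : Submodule k R), FiniteDimensional k V → Module.finrank k V ≤ d →
      (∀ f ∈ V, f ≠ 0 → ∃ P ∈ B, f ∉ P) →
      ∃ S ⊆ B, S.card ≤ d ∧ ∀ f ∈ V, (∀ P ∈ S, f ∈ P) → f = 0 := by
  induction d with
  | zero =>
    intro V _ hd _
    refine ⟨∅, by simp, by simp, fun f hf _ => ?_⟩
    have := Submodule.finrank_eq_zero.1 (Nat.le_zero.1 hd)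
    simpa [this] using hf
  | succ d ih =>
    intro V _ hd hB
    by_cases hV : V = ⊥
    · exact ⟨∅, by simp, by simp, fun f hf _ => by simpa [hV] using hf⟩
    obtain ⟨f, hf, hf0⟩ := (Submodule.ne_bot_iff V).1 hV
    obtain ⟨P, hP, hfP⟩ := hB f hf hf0
    have hlt : V ⊓ P.restrictScalars k < V := by
      refine lt_of_le_of_ne inf_le_left fun h => hfP ?_
      have : f ∈ V ⊓ P.restrictScalars k := by rw [h]; exact hf
      exact this.2
    have h1 := Submodule.finrank_lt_finrank_of_lt hlt
    obtain ⟨S, hS, hcard, hz⟩ := ih (V ⊓ P.restrictScalars k)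
      (Submodule.finiteDimensional_of_le inf_le_left) (by omega)
      (fun f hf hf0 => hB f hf.1 hf0)
    refine ⟨insert P S, Finset.insert_subset hP hS, (Finset.card_insert_le _ _).trans (by omega),
      fun f hf h => hz f ⟨hf, h P (Finset.mem_insert_self _ _)⟩ fun P' hP' =>
        h P' (Finset.mem_insert_of_mem hP')⟩

lemma exists_onto [DecidableEq (Ideal R)] {g : ℕ} (hg : D.HasGaps g) {n r N e : ℕ}
    {Q Z : Ideal R} {E : Finset (Ideal R)} (hQ : PrimesOfDeg k n {Q}) (hZ : PrimesOfDeg k N {Z})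
    (hE : PrimesOfDeg k r E) (hrn : r ≠ n) (hrN : r ≠ N) (hnN : n ≠ N) (hEg : g ≤ E.card * r)
    (hsmall : Module.finrank k ↥(((({Q} ∪ E).inf id).restrictScalars k ⊓
      D.lt (N + n + E.card * r + g)) ⊓ Z.restrictScalars k) ≤ e) :
    ∃ E' ⊆ E, (E \ E').card ≤ e ∧ ∀ x, ∃ f ∈
      ((({Z} ∪ E').inf id).restrictScalars k ⊓ D.lt (N + n + E.card * r + g)), f - x ∈ Q := by
  set n₁ := N + n + E.card * r + g with hn₁
  have hQZ : TotalDeg k (1 * n + 1 * N) ({Q} ∪ {Z}) :=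
    hQ.totalDeg.union hZ.totalDeg (hQ.disjoint hZ hnN)
  have hQZE : TotalDeg k (1 * n + 1 * N + E.card * r) ({Q} ∪ {Z} ∪ E) := by
    refine hQZ.union hE.totalDeg ?_
    rw [Finset.disjoint_union_left]
    exact ⟨hQ.disjoint hE hrn.symm, hZ.disjoint hE hrN.symm⟩
  have e1 : ({Q} ∪ {Z} : Finset (Ideal R)).inf id = Q ⊓ Z := by
    rw [Finset.inf_union, Finset.inf_singleton, Finset.inf_singleton]; rfl
  have e2 : ({Q} ∪ {Z} ∪ E : Finset (Ideal R)).inf id = Q ⊓ Z ⊓ E.inf id := by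
    rw [Finset.inf_union, e1]
  have f1 := hQZ.finite
  have f2 := hQZE.finite
  have g1 := hQZ.finrank
  have g2 := hQZE.finrank
  rw [e1] at f1 g1
  rw [e2] at f2 g2
  have himg : D.img (Q ⊓ Z) n₁ = ⊤ := img_eq_top hg _ (by rw [g1]; omega)
  have hfr := D.finrank_img (Q ⊓ Z ⊓ E.inf id) n₁
  have hlt := finrank_lt_add hg (n := n₁) (by omega)
  have hsame : (Q ⊓ Z ⊓ E.inf id).restrictScalars k ⊓ D.lt n₁ =
      ((({Q} ∪ E).inf id).restrictScalars k ⊓ D.lt n₁) ⊓ Z.restrictScalars k := by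
    rw [Finset.inf_union, Finset.inf_singleton]
    ext x
    simp only [Submodule.mem_inf, Submodule.restrictScalars_mem, id]
    tauto
  rw [hsame] at hfr
  obtain ⟨E', hE', hcard, htop⟩ := exists_remove (D := D) (Q ⊓ Z) himg (e := e) E
    (fun P hP => (hE.2 P hP).1) f2 (by rw [g2]; omega)
  refine ⟨E', hE', hcard, fun x => ?_⟩
  have hcop : ({Q} : Finset (Ideal R)).inf id ⊔ ({Z} ∪ E').inf id = ⊤ := by
    refine disjoint_inf_sup_eq_top (fun I hI => (hQ.2 I hI).1) ?_ ?_
    · intro I hI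
      rcases Finset.mem_union.1 hI with hI | hI
      exacts [(hZ.2 I hI).1, (hE.2 I (hE' hI)).1]
    · rw [Finset.disjoint_union_right]
      exact ⟨hQ.disjoint hZ hnN, hQ.disjoint (hE.mono hE') hrn.symm⟩
  rw [Finset.inf_singleton, id] at hcop
  obtain ⟨u, hu, v, hv, huv⟩ := Submodule.mem_sup.1 (hcop ▸ Submodule.mem_top : x ∈ _)
  obtain ⟨f, hf, hfv⟩ : Ideal.Quotient.mk (Q ⊓ Z ⊓ E'.inf id) v ∈
    D.img (Q ⊓ Z ⊓ E'.inf id) n₁ := htop ▸ Submodule.mem_top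
  have hfv' : f - v ∈ Q ⊓ Z ⊓ E'.inf id := (Ideal.Quotient.mk_eq_mk_iff_sub_mem _ _).1 hfv
  refine ⟨f, ⟨?_, hf⟩, ?_⟩
  · have : f = (f - v) + v := by ring
    rw [this]
    refine Ideal.add_mem _ ?_ hv
    rw [Finset.inf_union, Finset.inf_singleton]
    exact ⟨hfv'.1.2, hfv'.2⟩
  · have : f - x = (f - v) - u := by rw [← huv]; ring
    rw [this]
    exact Ideal.sub_mem _ hfv'.1.1 hu

theorem hasBil_quotient [Fintype k] (hk : 4 ≤ Fintype.card k) {g : ℕ} (hg : D.HasGaps g)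
    {n r N e : ℕ} {Q : Ideal R} {𝒵 E₁ E₂ B : Finset (Ideal R)} (hQ : PrimesOfDeg k n {Q})
    (h𝒵 : PrimesOfDeg k N 𝒵) (hE₁ : PrimesOfDeg k r E₁) (hE₂ : PrimesOfDeg k r E₂)
    (hB : PrimesOfDeg k 2 B) (hE : Disjoint E₁ E₂) (hr : 2 < r) (hrn : r < n) (hnN : n < N)
    (he : e ≤ N) (hZcard : Fintype.card k ^ (N - e) + 1 ≤ 𝒵.card) (hEg₁ : g ≤ E₁.card * r)
    (hEg₂ : g ≤ E₂.card * r) (hN : 2 * n + E₁.card * r + E₂.card * r + 2 * g ≤ N)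
    (hBcard : n + g + e * r ≤ B.card) :
    HasBil k (R ⧸ Q) (3 * (n + g / 2 + e + 2 * (e * r))) := by
  classical
  have hinj : Function.Injective (fun I : Ideal R => I.restrictScalars k) :=
    Submodule.restrictScalars_injective k R R
  obtain ⟨S, hSB, hS⟩ := Finset.exists_subset_card_eq (show n + g / 2 ≤ B.card by omega)
  set c₁ := E₁.card * r with hc₁
  set c₂ := E₂.card * r with hc₂
  set n₁ := N + n + c₁ + g with hn₁
  set n₂ := N + n + c₂ + g with hn₂
  -- dimension of the spaces used to choose the primes of degree `N`
  have hdim : ∀ {c : ℕ} {T : Finset (Ideal R)} {m : ℕ}, TotalDeg k c T → 2 * g + c ≤ m →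
      m ≤ N + c + g → Module.finrank k ↥((T.inf id).restrictScalars k ⊓ D.lt m) ≤ N := by
    intro c T m hT h1 h2
    have := hT.finite
    have h3 := finrank_inf_ideal hg (T.inf id) (n := m) (by rw [hT.finrank]; exact h1)
    have h4 := finrank_lt_add hg (n := m) (by omega)
    rw [hT.finrank] at h3
    omega
  have hdis : ∀ {c : ℕ} {T : Finset (Ideal R)} {m : ℕ}, TotalDeg k c T → ∀ {A A' : Ideal R},
      A ∈ 𝒵 → A' ∈ 𝒵 → A ∉ T → A' ∉ T → m ≤ 2 * N + c → ∀ f ∈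
      (T.inf id).restrictScalars k ⊓ D.lt m, f ∈ A → f ∈ A' → f ≠ 0 → A = A' := by
    intro c T m hT A A' hA hA' hAT hAT' hm f hf hfA hfA' hf0
    by_contra hne
    have h1 := (h𝒵.mono (Finset.singleton_subset_iff.2 hA)).totalDeg
    have h2 := (h𝒵.mono (Finset.singleton_subset_iff.2 hA')).totalDeg
    have h3 := (h1.union h2 (by simpa using hne)).union hT (by
      rw [Finset.disjoint_union_left]; simp [hAT, hAT'])
    have h4 : m ≠ 0 := by
      rintro rfl
      have := hf.2
      rw [D.lt_zero] at this
      exact hf0 (by simpa using this)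
    have h5 := h3.le_deg hg (m := m - 1) (f := f) ?_ hf0
      (by rw [Nat.sub_add_cancel (by omega)]; exact hf.2)
    · simp only [Finset.card_singleton] at h5; omega
    · intro P hP
      simp only [Finset.mem_union, Finset.mem_singleton] at hP
      rcases hP with (rfl | rfl) | hP
      exacts [hfA, hfA', Submodule.mem_finsetInf.1 hf.1 P hP]
  have hnotin : ∀ {d : ℕ} {T : Finset (Ideal R)} {A : Ideal R}, PrimesOfDeg k d T → d ≠ N →
      A ∈ 𝒵 → A ∉ T := fun hT hd hA h => Finset.disjoint_left.1 (hT.disjoint h𝒵 hd) h hA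
  have hQE : ∀ {E : Finset (Ideal R)}, PrimesOfDeg k r E →
      TotalDeg k (n + E.card * r) ({Q} ∪ E) := fun {E} hE => by
    have := hQ.totalDeg.union hE.totalDeg (hQ.disjoint hE (by omega))
    rwa [Finset.card_singleton, one_mul] at this
  have hQEnot : ∀ {E : Finset (Ideal R)}, PrimesOfDeg k r E → ∀ {A}, A ∈ 𝒵 → A ∉ {Q} ∪ E := by
    intro E hE A hA h
    rcases Finset.mem_union.1 h with h | h
    exacts [hnotin hQ (by omega) hA h, hnotin hE (by omega) hA h]
  -- choice of the first prime
  obtain ⟨Z₁, hZ₁, hZ₁small⟩ : ∃ Z ∈ 𝒵, Module.finrank k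
      ↥(((({Q} ∪ E₁).inf id).restrictScalars k ⊓ D.lt n₁) ⊓ Z.restrictScalars k) ≤ e := by
    obtain ⟨A, hA, hsm⟩ := exists_small_inter hk (𝒵.image fun I => I.restrictScalars k) he
      (by rw [Finset.card_image_of_injective _ hinj]; omega)
      (fun _ => (({Q} ∪ E₁).inf id).restrictScalars k ⊓ D.lt n₁)
      (fun _ => hdim (hQE hE₁) (by omega) (by omega))
      (by
        intro _ A hA A' hA' f hf hfA hfA' hf0
        obtain ⟨I, hI, rfl⟩ := Finset.mem_image.1 hA
        obtain ⟨I', hI', rfl⟩ := Finset.mem_image.1 hA'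
        rw [hdis (hQE hE₁) hI hI' (hQEnot hE₁ hI) (hQEnot hE₁ hI') (by omega) f hf hfA hfA' hf0])
    obtain ⟨I, hI, rfl⟩ := Finset.mem_image.1 hA
    exact ⟨I, hI, hsm 0⟩
  have hZ₁' := h𝒵.mono (Finset.singleton_subset_iff.2 hZ₁)
  have hSP := hB.mono hSB
  have hbig : TotalDeg k (N + c₁ + c₂ + 2 * (n + g / 2)) ({Z₁} ∪ E₁ ∪ E₂ ∪ S) := by
    have := ((hZ₁'.totalDeg.union hE₁.totalDeg (hZ₁'.disjoint hE₁ (by omega))).union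
      hE₂.totalDeg (by
        rw [Finset.disjoint_union_left]; exact ⟨hZ₁'.disjoint hE₂ (by omega), hE⟩)).union
      hSP.totalDeg (by
        rw [Finset.disjoint_union_left, Finset.disjoint_union_left]
        exact ⟨⟨hZ₁'.disjoint hSP (by omega), hE₁.disjoint hSP (by omega)⟩,
          hE₂.disjoint hSP (by omega)⟩)
    rw [Finset.card_singleton, one_mul, hS, mul_comm (n + g / 2) 2] at this
    exact this
  have hbignot : ∀ {A}, A ∈ 𝒵 → A ≠ Z₁ → A ∉ {Z₁} ∪ E₁ ∪ E₂ ∪ S := by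
    intro A hA hne h
    simp only [Finset.mem_union, Finset.mem_singleton] at h
    rcases h with ((h | h) | h) | h
    exacts [hne h, hnotin hE₁ (by omega) hA h, hnotin hE₂ (by omega) hA h,
      hnotin hSP (by omega) hA h]
  -- choice of the second prime
  obtain ⟨Z₂, hZ₂, hZ₂ne, hZ₂small, hZ₂big⟩ : ∃ Z ∈ 𝒵, Z ≠ Z₁ ∧ Module.finrank k
      ↥(((({Q} ∪ E₂).inf id).restrictScalars k ⊓ D.lt n₂) ⊓ Z.restrictScalars k) ≤ e ∧
      Module.finrank k ↥(((({Z₁} ∪ E₁ ∪ E₂ ∪ S).inf id).restrictScalars k ⊓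
        D.lt (n₁ + n₂ - 1)) ⊓ Z.restrictScalars k) ≤ e := by
    have hfd : ∀ i, FiniteDimensional k (![(({Q} ∪ E₂).inf id).restrictScalars k ⊓ D.lt n₂,
        (({Z₁} ∪ E₁ ∪ E₂ ∪ S).inf id).restrictScalars k ⊓ D.lt (n₁ + n₂ - 1)] i) := by
      intro i
      fin_cases i
      · exact (D.finite_and_finrank _ _).1
      · exact (D.finite_and_finrank _ _).1
    obtain ⟨A, hA, hsm⟩ := exists_small_inter hk ((𝒵.erase Z₁).image fun I => I.restrictScalars k)
      he (by rw [Finset.card_image_of_injective _ hinj, Finset.card_erase_of_mem hZ₁]; omega)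
      ![(({Q} ∪ E₂).inf id).restrictScalars k ⊓ D.lt n₂,
        (({Z₁} ∪ E₁ ∪ E₂ ∪ S).inf id).restrictScalars k ⊓ D.lt (n₁ + n₂ - 1)] (by
          intro i; fin_cases i
          · exact hdim (hQE hE₂) (by omega) (by omega)
          · exact hdim hbig (by omega) (by omega)) (by
        intro i A hA A' hA' f hf hfA hfA' hf0
        obtain ⟨I, hI, rfl⟩ := Finset.mem_image.1 hA
        obtain ⟨I', hI', rfl⟩ := Finset.mem_image.1 hA'
        rw [Finset.mem_erase] at hI hI'
        fin_cases i
        · rw [hdis (hQE hE₂) hI.2 hI'.2 (hQEnot hE₂ hI.2) (hQEnot hE₂ hI'.2) (by omega) f hf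
            hfA hfA' hf0]
        · rw [hdis hbig hI.2 hI'.2 (hbignot hI.2 hI.1) (hbignot hI'.2 hI'.1) (by omega) f hf
            hfA hfA' hf0])
    obtain ⟨I, hI, rfl⟩ := Finset.mem_image.1 hA
    rw [Finset.mem_erase] at hI
    exact ⟨I, hI.2, hI.1, hsm 0, hsm 1⟩
  have hZ₂' := h𝒵.mono (Finset.singleton_subset_iff.2 hZ₂)
  obtain ⟨E₁', hE₁', hcard₁, honto₁⟩ := exists_onto hg hQ hZ₁' hE₁ (by omega) (by omega)
    (by omega) hEg₁ hZ₁small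
  obtain ⟨E₂', hE₂', hcard₂, honto₂⟩ := exists_onto hg hQ hZ₂' hE₂ (by omega) (by omega)
    (by omega) hEg₂ hZ₂small
  set T : Finset (Ideal R) := {Z₁} ∪ {Z₂} ∪ E₁' ∪ E₂' with hT
  set W := (T.inf id).restrictScalars k ⊓ D.lt (n₁ + n₂ - 1) with hW
  set K := (S.inf id).restrictScalars k ⊓ W with hK
  have hKfd : FiniteDimensional k K := Submodule.finiteDimensional_of_le inf_le_right
  -- the kernel is small
  set F := (E₁ \ E₁') ∪ (E₂ \ E₂') with hF
  have hFP : PrimesOfDeg k r F := ⟨hE₁.1, fun I hI => by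
    rcases Finset.mem_union.1 hI with hI | hI
    exacts [hE₁.2 I (Finset.sdiff_subset hI), hE₂.2 I (Finset.sdiff_subset hI)]⟩
  have hFcard : F.card * r ≤ 2 * (e * r) := by
    rw [← mul_assoc]
    exact Nat.mul_le_mul_right _ ((Finset.card_union_le _ _).trans (by omega))
  have hKdim : Module.finrank k K ≤ e + 2 * (e * r) := by
    have : FiniteDimensional k (R ⧸ (F.inf id).restrictScalars k) := hFP.totalDeg.finite
    have h1 := finrank_le_inf_add K ((F.inf id).restrictScalars k)
    have h2 : Module.finrank k (R ⧸ (F.inf id).restrictScalars k) = F.card * r :=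
      hFP.totalDeg.finrank
    have h3 : Module.finrank k ↥(K ⊓ (F.inf id).restrictScalars k) ≤ e := by
      refine le_trans (Submodule.finrank_mono ?_) hZ₂big
      rintro f ⟨⟨hfS, hfT, hflt⟩, hfF⟩
      have hfS' := Submodule.mem_finsetInf.1 hfS
      have hfT' := Submodule.mem_finsetInf.1 hfT
      have hfF' := Submodule.mem_finsetInf.1 hfF
      simp only [id, hT, hF, Finset.mem_union, Finset.mem_singleton, Finset.mem_sdiff] at hfS' hfT' hfF'
      refine ⟨⟨Submodule.mem_finsetInf.2 fun P hP => ?_, hflt⟩, hfT' Z₂ (by simp)⟩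
      simp only [Finset.mem_union, Finset.mem_singleton] at hP
      rcases hP with ((hP | hP) | hP) | hP
      · exact hfT' P (by tauto)
      · by_cases h : P ∈ E₁'
        · exact hfT' P (by tauto)
        · exact hfF' P (by tauto)
      · by_cases h : P ∈ E₂'
        · exact hfT' P (by tauto)
        · exact hfF' P (by tauto)
      · exact hfS' P hP
    omega
  have hsep : ∀ f ∈ K, f ≠ 0 → ∃ P ∈ B, f ∉ P := by
    intro f hf hf0
    by_contra! hcon
    have h1 := hE₁.mono hE₁'
    have h2 := hE₂.mono hE₂'
    have htot := (((hZ₁'.totalDeg.union hZ₂'.totalDeg (by simpa using hZ₂ne.symm)).union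
      h1.totalDeg (by
        rw [Finset.disjoint_union_left]
        exact ⟨hZ₁'.disjoint h1 (by omega), hZ₂'.disjoint h1 (by omega)⟩)).union
      h2.totalDeg (by
        rw [Finset.disjoint_union_left, Finset.disjoint_union_left]
        exact ⟨⟨hZ₁'.disjoint h2 (by omega), hZ₂'.disjoint h2 (by omega)⟩,
          Finset.disjoint_of_subset_left hE₁' (Finset.disjoint_of_subset_right hE₂' hE)⟩)).union
      hB.totalDeg (by
        rw [Finset.disjoint_union_left, Finset.disjoint_union_left, Finset.disjoint_union_left]
        exact ⟨⟨⟨hZ₁'.disjoint hB (by omega), hZ₂'.disjoint hB (by omega)⟩,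
          h1.disjoint hB (by omega)⟩, h2.disjoint hB (by omega)⟩)
    have hle := htot.le_deg hg (f := f) (m := n₁ + n₂ - 2) ?_ hf0 ?_
    · simp only [Finset.card_singleton] at hle
      have k1 : E₁'.card * r + (E₁ \ E₁').card * r = c₁ := by
        rw [← add_mul, add_comm, Finset.card_sdiff_add_card_eq_card hE₁']
      have k2 : E₂'.card * r + (E₂ \ E₂').card * r = c₂ := by
        rw [← add_mul, add_comm, Finset.card_sdiff_add_card_eq_card hE₂']
      have k3 := Nat.mul_le_mul_right r hcard₁
      have k4 := Nat.mul_le_mul_right r hcard₂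
      omega
    · intro P hP
      rcases Finset.mem_union.1 hP with hP | hP
      · exact Submodule.mem_finsetInf.1 hf.2.1 P hP
      · exact hcon P hP
    · have := hf.2.2
      rwa [show n₁ + n₂ - 1 = n₁ + n₂ - 2 + 1 by omega] at this
  obtain ⟨S', hS'B, hS'card, hS'⟩ := exists_kill B _ K hKfd hKdim hsep
  refine (hasBil_of_eval (k := k) Q _ _ W ?_ honto₁ honto₂ (S ∪ S') ?_ ?_).mono ?_
  · rintro f ⟨hf, hflt⟩ f' ⟨hf', hflt'⟩
    have hf := Submodule.mem_finsetInf.1 hf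
    have hf' := Submodule.mem_finsetInf.1 hf'
    refine ⟨Submodule.mem_finsetInf.2 fun P hP => ?_, ?_⟩
    · simp only [hT, Finset.mem_union, Finset.mem_singleton] at hP
      simp only [Finset.mem_union, Finset.mem_singleton, id] at hf hf'
      rcases hP with ((hP | hP) | hP) | hP
      · exact Ideal.mul_mem_right _ _ (hf P (Or.inl hP))
      · exact Ideal.mul_mem_left _ _ (hf' P (Or.inl hP))
      · exact Ideal.mul_mem_right _ _ (hf P (Or.inr hP))
      · exact Ideal.mul_mem_left _ _ (hf' P (Or.inr hP))
    · have := D.mul_mem (n₁ - 1) (n₂ - 1) f f' (by rwa [Nat.sub_add_cancel (by omega)])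
        (by rwa [Nat.sub_add_cancel (by omega)])
      rwa [show n₁ - 1 + (n₂ - 1) + 1 = n₁ + n₂ - 1 by omega] at this
  · intro P hP
    rcases Finset.mem_union.1 hP with hP | hP
    exacts [(hB.2 P (hSB hP)).2, (hB.2 P (hS'B hP)).2]
  · intro f hf h
    refine hS' f ⟨Submodule.mem_finsetInf.2 fun P hP => h P (Finset.mem_union_left _ hP), hf⟩
      fun P hP => h P (Finset.mem_union_right _ hP)
  · refine Nat.mul_le_mul_left _ ((Finset.card_union_le _ _).trans ?_)
    omega

end DegAlg

section

open Polynomial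

namespace Tower

variable {K L : Type*} [Field K] [Field L] [Algebra K L]

/-- Valuation rings over `K` at which `x` is finite. -/
def Adm (K : Type*) {L : Type*} [Field K] [Field L] [Algebra K L] (x : L)
    (V : ValuationSubring L) : Prop :=
  (∀ c : K, algebraMap K L c ∈ V) ∧ x ∈ V

/-- The elements finite at all valuation rings in a family. -/
def finiteAt (K : Type*) {L : Type*} [Field K] [Field L] [Algebra K L]
    (𝒱 : ValuationSubring L → Prop) (h : ∀ V, 𝒱 V → ∀ c : K, algebraMap K L c ∈ V) :
    Subalgebra K L where
  carrier := {f | ∀ V, 𝒱 V → f ∈ V}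
  mul_mem' ha hb V hV := V.mul_mem _ _ (ha V hV) (hb V hV)
  add_mem' ha hb V hV := V.add_mem _ _ (ha V hV) (hb V hV)
  algebraMap_mem' c V hV := h V hV c

/-- The elements that are finite wherever `x` is. -/
def hol (K : Type*) {L : Type*} [Field K] [Field L] [Algebra K L] (x : L) : Subalgebra K L :=
  finiteAt K (Adm K x) fun _ h => h.1

/-- The ring of elements of `F` finite wherever `x` is. -/
def reg (x : L) (F : IntermediateField K L) : Subalgebra K L := F.toSubalgebra ⊓ hol K x

lemma mem_reg {x f : L} {F : IntermediateField K L} :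
    f ∈ reg x F ↔ f ∈ F ∧ f ∈ hol K x := Iff.rfl

lemma self_mem_hol (x : L) : x ∈ hol K x := fun _ h => h.2

lemma reg_mono {x : L} {F F' : IntermediateField K L} (h : F ≤ F') : reg x F ≤ reg x F' :=
  fun _ hf => ⟨h hf.1, hf.2⟩

lemma val_lt_one_of_inv_notMem {V : ValuationSubring L} {w : L} (hw : w ∉ V) :
    V.valuation w⁻¹ < 1 := by
  rw [← V.mem_nonunits_iff, V.inv_mem_nonunits_iff]
  exact Or.inr hw

lemma inv_mem_of_notMem {V : ValuationSubring L} {w : L} (hw : w ∉ V) : w⁻¹ ∈ V :=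
  (V.mem_or_inv_mem w).resolve_left hw

lemma inv_mem_of_val_eq_one {V : ValuationSubring L} {w : L} (hw : V.valuation w = 1) :
    w⁻¹ ∈ V := by
  rw [← V.valuation_le_one_iff, map_inv₀, hw, inv_one]

lemma val_one_add {V : ValuationSubring L} {w : L} (hw : V.valuation w < 1) :
    V.valuation (1 + w) = 1 := by
  exact V.valuation.map_one_add_of_lt hw

lemma val_mul_lt_one {V : ValuationSubring L} {w h : L} (hw : V.valuation w < 1) (hh : h ∈ V) :
    V.valuation (w * h) < 1 := by
  rw [map_mul]
  have := (V.valuation_le_one_iff h).2 hh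
  exact mul_lt_one_of_lt_of_le hw this

lemma aeval_mem_of_mem {S : Subalgebra K L} {x : L} (hx : x ∈ S) (p : K[X]) : aeval x p ∈ S := by
  rw [aeval_eq_sum_range]
  exact S.sum_mem fun i _ => S.smul_mem (S.pow_mem hx i) _

/-- Leading term of a monic polynomial. -/
lemma aeval_eq_pow_mul (B : Subalgebra K L) {p : K[X]} (hp : p.Monic) {w : L} (hw0 : w ≠ 0)
    (hw : w⁻¹ ∈ B) : ∃ h ∈ B, aeval w p = w ^ p.natDegree * (1 + w⁻¹ * h) := by
  refine ⟨∑ i ∈ Finset.range p.natDegree, p.coeff i • (w⁻¹) ^ (p.natDegree - 1 - i),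
    B.sum_mem fun i _ => B.smul_mem (B.pow_mem hw _) _, ?_⟩
  rw [aeval_eq_sum_range, Finset.sum_range_succ, hp.coeff_natDegree, one_smul, mul_add, mul_one,
    add_comm, ← mul_assoc, Finset.mul_sum]
  congr 1
  refine Finset.sum_congr rfl fun i hi => ?_
  have hi := Finset.mem_range.1 hi
  rw [mul_smul_comm]
  congr 1
  rw [inv_pow, ← div_eq_mul_inv, ← div_eq_mul_inv, eq_div_iff (pow_ne_zero _ hw0),
    eq_div_iff hw0, ← pow_add, ← pow_succ]
  congr 1
  omega

lemma mul_pow_mem_of_aeval {V : ValuationSubring L} (hK : ∀ c : K, algebraMap K L c ∈ V)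
    {p : K[X]} (hp : p.Monic) {r w : L} (hr : r ∈ V) (h : r * aeval w p ∈ V) {j : ℕ}
    (hj : j ≤ p.natDegree) : r * w ^ j ∈ V := by
  by_cases hw : w ∈ V
  · exact V.mul_mem _ _ hr (V.toSubring.pow_mem hw j)
  have hw0 : w ≠ 0 := fun h => hw (h ▸ V.zero_mem)
  let B : Subalgebra K L := { V.toSubring with algebraMap_mem' := hK }
  have hwi := inv_mem_of_notMem hw
  obtain ⟨e, he, heq⟩ := aeval_eq_pow_mul B hp hw0 hwi
  have h1 := val_one_add (val_mul_lt_one (val_lt_one_of_inv_notMem hw) he)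
  have h2 := inv_mem_of_val_eq_one h1
  have h3 : (1 + w⁻¹ * e) ≠ 0 := fun h => by simp [h] at h1
  rw [heq] at h
  have : r * w ^ j = (r * (w ^ p.natDegree * (1 + w⁻¹ * e))) * (1 + w⁻¹ * e)⁻¹ *
      (w⁻¹) ^ (p.natDegree - j) := by
    have hp : w ^ p.natDegree = w ^ j * w ^ (p.natDegree - j) := by
      rw [← pow_add, Nat.add_sub_cancel' hj]
    rw [hp, inv_pow]
    rw [mul_assoc r, mul_assoc (w ^ j * _), mul_inv_cancel₀ h3]
    field_simp
  rw [this]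
  exact V.mul_mem _ _ (V.mul_mem _ _ h h2) (V.toSubring.pow_mem hwi _)

lemma mem_of_aeval_mem {V : ValuationSubring L} (hK : ∀ c : K, algebraMap K L c ∈ V)
    {p : K[X]} (hp : p.Monic) (hd : 0 < p.natDegree) {w : L} (h : aeval w p ∈ V) : w ∈ V := by
  have := mul_pow_mem_of_aeval hK hp V.one_mem (by rwa [one_mul]) (j := 1) hd
  simpa using this

/-- Elements integral over a subring of a valuation ring lie in it. -/
lemma mem_of_monic_root {V : ValuationSubring L} {p : L[X]} (hp : p.Monic)
    (hc : ∀ i, p.coeff i ∈ V) {f : L} (hf : p.eval f = 0) : f ∈ V := by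
  have hInt : IsIntegral V f := by
    obtain ⟨p', hp', -, hm⟩ := lifts_and_natDegree_eq_and_monic
      (f := algebraMap V L) (p := p) ((lifts_iff_coeff_lifts p).2 fun i => ⟨⟨_, hc i⟩, rfl⟩) hp
    exact ⟨p', hm, by rw [← hp', eval_map] at hf; exact hf⟩
  obtain ⟨y, hy⟩ := IsIntegrallyClosed.isIntegral_iff.1 hInt
  exact hy ▸ y.2

/-- Localization lemma. -/
lemma exists_denominator_aux {x : L} {F : IntermediateField K L} {V₀ : ValuationSubring L}
    (hV₀ : Adm K x V₀) {d : L} (hdF : d ∈ F) (hdV : d ∈ V₀) (n : ℕ) :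
    ∀ c : ℕ → L, (∀ i, c i ∈ reg x F) → ∑ i ∈ Finset.range (n + 1), c i * d ^ i = 0 →
      (∃ i ≤ n, V₀.valuation (c i) = 1) →
      ∃ a ∈ reg x F, V₀.valuation a = 1 ∧ a * d ∈ reg x F := by
  induction n with
  | zero =>
    rintro c - hsum ⟨i, hi, h1⟩
    obtain rfl := Nat.le_zero.1 hi
    simp only [zero_add, Finset.range_one, Finset.sum_singleton, pow_zero, mul_one] at hsum
    simp [hsum] at h1
  | succ n ih =>
    intro c hc hsum hex
    have hmem : c (n + 1) * d ∈ reg x F := by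
      refine ⟨F.mul_mem (hc _).1 hdF, fun V hV => ?_⟩
      by_cases hd : d ∈ V
      · exact V.mul_mem _ _ ((hc _).2 V hV) hd
      have hd0 : d ≠ 0 := fun h => hd (h ▸ V.zero_mem)
      have hdi := inv_mem_of_notMem hd
      have : c (n + 1) * d = -∑ i ∈ Finset.range (n + 1), c i * d⁻¹ ^ (n - i) := by
        rw [Finset.sum_range_succ] at hsum
        rw [eq_neg_iff_add_eq_zero]
        have h2 : d ^ n ≠ 0 := pow_ne_zero _ hd0
        apply mul_right_cancel₀ h2
        rw [zero_mul, ← hsum, add_mul, Finset.sum_mul, add_comm, mul_assoc, ← pow_succ']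
        congr 1
        refine Finset.sum_congr rfl fun i hi => ?_
        have hi := Finset.mem_range.1 hi
        rw [mul_assoc, inv_pow, show n = (n - i) + i by omega, pow_add]
        rw [show n - i + i - i = n - i by omega, ← mul_assoc (d ^ (n - i))⁻¹,
          inv_mul_cancel₀ (pow_ne_zero _ hd0), one_mul]
      rw [this]
      exact V.neg_mem _ (V.toSubring.sum_mem fun i _ =>
        V.mul_mem _ _ ((hc i).2 V hV) (V.toSubring.pow_mem hdi _))
    by_cases hunit : V₀.valuation (c (n + 1)) = 1
    · exact ⟨_, hc _, hunit, hmem⟩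
    have hlt : V₀.valuation (c (n + 1)) < 1 :=
      lt_of_le_of_ne ((V₀.valuation_le_one_iff _).2 ((hc _).2 _ hV₀)) hunit
    refine ih (fun i => if i = n then c n + c (n + 1) * d else c i) (fun i => ?_) ?_ ?_
    · split_ifs
      · exact (reg x F).add_mem (hc _) hmem
      · exact hc i
    · rw [← hsum, Finset.sum_range_succ, Finset.sum_range_succ, Finset.sum_range_succ, if_pos rfl]
      rw [add_assoc, add_mul, mul_assoc, ← pow_succ']
      congr 1
      refine Finset.sum_congr rfl fun i hi => ?_
      have hi := Finset.mem_range.1 hi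
      rw [if_neg (by omega)]
    · obtain ⟨i, hi, h1⟩ := hex
      have hne : i ≠ n + 1 := fun h => hunit (h ▸ h1)
      refine ⟨i, by omega, ?_⟩
      split_ifs with h
      · subst h
        rw [add_comm, Valuation.map_add_eq_of_lt_right]
        · exact h1
        · rw [h1]; exact val_mul_lt_one hlt hdV
      · exact h1

lemma exists_denominator {x : L} (hx : Transcendental K x) {F : IntermediateField K L}
    (hxF : x ∈ F) {V₀ : ValuationSubring L} (hV₀ : Adm K x V₀) {d : L} (hdF : d ∈ F)
    (hdV : d ∈ V₀)
    (halg : ∃ p : K[X][X], p ≠ 0 ∧ p.eval₂ (aeval x : K[X] →ₐ[K] L).toRingHom d = 0) :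
    ∃ a ∈ reg x F, V₀.valuation a = 1 ∧ a * d ∈ reg x F := by
  classical
  obtain ⟨p, hp0, hp⟩ := halg
  have hxr : ∀ a : K[X], aeval x a ∈ reg x F := fun a =>
    aeval_mem_of_mem (S := reg x F) ⟨hxF, self_mem_hol x⟩ a
  let _ : NormalizationMonoid K[X] := inferInstance
  let _ : NormalizedGCDMonoid K[X] := UniqueFactorizationMonoid.toNormalizedGCDMonoid K[X]
  have hroot : p.primPart.eval₂ (aeval x : K[X] →ₐ[K] L).toRingHom d = 0 := by
    rw [p.eq_C_content_mul_primPart, eval₂_mul, eval₂_C] at hp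
    refine (mul_eq_zero.1 hp).resolve_left fun h => ?_
    exact hp0 (content_eq_zero_iff.1 ((transcendental_iff.1 hx) _ h))
  have hprim := p.isPrimitive_primPart
  set P := p.primPart
  refine exists_denominator_aux hV₀ hdF hdV P.natDegree (fun i => aeval x (P.coeff i))
    (fun i => hxr _) ?_ ?_
  · rw [eval₂_eq_sum_range] at hroot
    exact hroot
  by_contra! hcon
  let I : Ideal K[X] :=
    { carrier := {a | V₀.valuation (aeval x a) < 1}
      add_mem' := fun {a b} ha hb => by
        simp only [Set.mem_ofPred_eq, map_add] at *
        exact Valuation.map_add_lt _ ha hb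
      zero_mem' := by simp
      smul_mem' := fun a b hb => by
        simp only [Set.mem_ofPred_eq, smul_eq_mul, map_mul] at *
        rw [← map_mul, mul_comm]
        exact val_mul_lt_one hb ((hxr a).2 _ hV₀) }
  have hmemI : ∀ a, a ∈ I ↔ V₀.valuation (aeval x a) < 1 := fun _ => Iff.rfl
  obtain ⟨π, hπ⟩ := (IsPrincipalIdealRing.principal I).principal
  have hd : C π ∣ P := by
    rw [C_dvd_iff_dvd_coeff]
    intro i
    rw [← Ideal.mem_span_singleton]
    have : P.coeff i ∈ I := by
      rw [hmemI]
      rcases le_or_gt i P.natDegree with h | h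
      · exact lt_of_le_of_ne ((V₀.valuation_le_one_iff _).2 ((hxr _).2 _ hV₀)) (hcon i h)
      · rw [coeff_eq_zero_of_natDegree_lt h]; simp
    rw [hπ] at this
    exact this
  have hu := hprim π hd
  have hπI : π ∈ I := by rw [hπ]; exact Submodule.mem_span_singleton_self π
  have h1 : (1 : K[X]) ∈ I := by
    rw [Ideal.eq_top_of_isUnit_mem I hπI hu]; trivial
  rw [hmemI] at h1
  simp at h1

end Tower

end

section

open Polynomial

namespace Tower

variable {K L : Type*} [Field K] [Field L] [Algebra K L]

lemma exists_monic_of_forall_valuationSubring (D : Subring L) {f : L}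
    (h : ∀ V : ValuationSubring L, D ≤ V.toSubring → f ∈ V) :
    ∃ p : L[X], p.Monic ∧ (∀ i, p.coeff i ∈ D) ∧ p.eval f = 0 := by
  have h1 : f ∈ (⨅ V : {V : ValuationSubring L // (D : Set L) ⊆ V.toSubring}, V.1.toSubring) := by
    rw [Subring.mem_iInf]
    exact fun V => h V.1 V.2
  rw [iInf_valuationSubring_superset] at h1
  obtain ⟨p, hp, hp0⟩ := (mem_integralClosure_iff _ _).1 (Subalgebra.mem_toSubring.1 h1)
  refine ⟨p.map (algebraMap _ L), hp.map _, fun i => ?_, ?_⟩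
  · rw [coeff_map]
    exact (Subring.closure_eq D).le (p.coeff i).2
  · rw [eval_map]; exact hp0

/-- A valuation ring containing the constants, as a subalgebra. -/
def valAlg (V : ValuationSubring L) (hV : ∀ c : K, algebraMap K L c ∈ V) : Subalgebra K L :=
  { V.toSubring with algebraMap_mem' := hV }

/-- Additive polynomials, as functions on `L`. -/
def IsAdditive (L : Type*) [Field L] [Algebra K L] (A : K[X]) : Prop :=
  ∀ u v : L, aeval (u + v) A = aeval u A + aeval v A

lemma IsAdditive.zero {A : K[X]} (hA : IsAdditive L A) : aeval (0 : L) A = 0 := by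
  have := hA 0 0
  simpa using this

lemma IsAdditive.neg {A : K[X]} (hA : IsAdditive L A) (u : L) : aeval (-u) A = -aeval u A := by
  have := hA u (-u)
  rw [add_neg_cancel, hA.zero] at this
  exact (neg_eq_of_add_eq_zero_right this.symm).symm

lemma IsAdditive.sub {A : K[X]} (hA : IsAdditive L A) (u v : L) :
    aeval (u - v) A = aeval u A - aeval v A := by
  rw [sub_eq_add_neg, hA, hA.neg, sub_eq_add_neg]

/-- Every element of `F` is algebraic over the rational functions in `x`. -/
def AlgOver (x : L) (F : IntermediateField K L) : Prop :=
  ∀ d ∈ F, ∃ p : K[X][X], p ≠ 0 ∧ p.eval₂ (aeval x : K[X] →ₐ[K] L).toRingHom d = 0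

lemma exists_common_denominator {x : L} (hx : Transcendental K x) {F : IntermediateField K L}
    (hxF : x ∈ F) (halg : AlgOver x F) {V₀ : ValuationSubring L} (hV₀ : Adm K x V₀)
    (d : ℕ → L) (hdF : ∀ i, d i ∈ F) (hdV : ∀ i, d i ∈ V₀) (n : ℕ) :
    ∃ a ∈ reg x F, V₀.valuation a = 1 ∧ ∀ i < n, a * d i ∈ reg x F := by
  induction n with
  | zero => exact ⟨1, (reg x F).one_mem, map_one _, by simp⟩
  | succ n ih =>
    obtain ⟨a, ha, ha1, had⟩ := ih
    obtain ⟨b, hb, hb1, hbd⟩ := exists_denominator hx hxF hV₀ (hdF n) (hdV n) (halg _ (hdF n))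
    refine ⟨a * b, mul_mem ha hb, by rw [map_mul, ha1, hb1, one_mul], fun i hi => ?_⟩
    rcases Nat.lt_succ_iff_lt_or_eq.1 hi with h | rfl
    · rw [mul_right_comm]; exact mul_mem (had i h) hb
    · rw [mul_assoc]; exact mul_mem ha hbd

lemma exists_leading {x y r : L} (hx : Transcendental K x) {F F' : IntermediateField K L}
    (hxF : x ∈ F) (halg : AlgOver x F) (hFF' : F ≤ F') (hy : y ∈ F')
    {A : K[X]} (hA : A.Monic) (hadd : IsAdditive L A) (hψ : aeval y A ∈ F) (hr : r ∈ reg x F)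
    (hloc : ∀ V₀, Adm K x V₀ → ∃ z ∈ F, r * (aeval y A - aeval z A) ∈ V₀)
    {j : ℕ} (hj : j ≤ A.natDegree) :
    ∃ c : ℕ → L, (∀ i, c i ∈ F) ∧
      r * y ^ j + ∑ i ∈ Finset.range j, c i * y ^ i ∈ reg x F' := by
  let R : Subring L := (reg x F).toSubring
  have hR : ∀ a, a ∈ R ↔ a ∈ reg x F := fun _ => Iff.rfl
  let J : Ideal R :=
    { carrier := {a | ∃ c : ℕ → L, (∀ i, c i ∈ F) ∧
        a.1 * r * y ^ j + ∑ i ∈ Finset.range j, c i * y ^ i ∈ reg x F'}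
      add_mem' := by
        rintro a b ⟨c, hc, h⟩ ⟨d, hd, h'⟩
        refine ⟨fun i => c i + d i, fun i => F.add_mem (hc i) (hd i), ?_⟩
        convert (reg x F').add_mem h h' using 1
        simp only [add_mul, Finset.sum_add_distrib, Subring.coe_add]
        ring
      zero_mem' := ⟨fun _ => 0, fun _ => F.zero_mem, by simp⟩
      smul_mem' := by
        rintro a b ⟨c, hc, h⟩
        refine ⟨fun i => a.1 * c i, fun i => F.mul_mem a.2.1 (hc i), ?_⟩
        convert (reg x F').mul_mem (reg_mono hFF' a.2) h using 1
        simp only [smul_eq_mul, Subring.coe_mul, mul_add, Finset.mul_sum]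
        congr 1
        · ring
        · exact Finset.sum_congr rfl fun i _ => by ring }
  have hJ : ∀ a : R, a ∈ J ↔ ∃ c : ℕ → L, (∀ i, c i ∈ F) ∧
        a.1 * r * y ^ j + ∑ i ∈ Finset.range j, c i * y ^ i ∈ reg x F' := fun _ => Iff.rfl
  by_cases htop : J = ⊤
  · have h1 : (1 : R) ∈ J := htop ▸ trivial
    simpa [hJ] using h1
  exfalso
  obtain ⟨V₀, hRV, hJV⟩ := J.image_subset_nonunits_valuationSubring htop
  have hV₀ : Adm K x V₀ := ⟨fun c => hRV ((reg x F).algebraMap_mem c),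
    hRV ((hR x).2 (mem_reg.2 ⟨hxF, self_mem_hol x⟩))⟩
  obtain ⟨z, hz, hrz⟩ := hloc V₀ hV₀
  have hAzF : aeval z A ∈ F := aeval_mem_of_mem (S := F.toSubalgebra) hz A
  obtain ⟨p, hp, hpc, hp0⟩ := exists_monic_of_forall_valuationSubring
    (V₀.toSubring ⊓ F.toSubalgebra.toSubring) (f := r * (y - z) ^ j) fun V hV => by
      refine mul_pow_mem_of_aeval (K := K) (fun c => hV ⟨hV₀.1 c, F.algebraMap_mem c⟩) hA
        (hV ⟨hr.2 _ hV₀, hr.1⟩) ?_ hj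
      rw [hadd.sub]
      exact hV ⟨hrz, F.mul_mem hr.1 (F.sub_mem hψ hAzF)⟩
  obtain ⟨a, ha, ha1, had⟩ := exists_common_denominator hx hxF halg hV₀ p.coeff
    (fun i => (hpc i).2) (fun i => (hpc i).1) p.natDegree
  have hag : a * (r * (y - z) ^ j) ∈ reg x F' := by
    refine ⟨F'.mul_mem (hFF' ha.1) (F'.mul_mem (hFF' hr.1)
      (pow_mem (F'.sub_mem hy (hFF' hz)) _)), fun V hV => ?_⟩
    refine mem_of_monic_root (p := p.scaleRoots a) ((monic_scaleRoots_iff a).2 hp) (fun i => ?_) ?_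
    · rw [coeff_scaleRoots]
      rcases lt_trichotomy i p.natDegree with h | h | h
      · obtain ⟨m, hm⟩ : ∃ m, p.natDegree - i = m + 1 := ⟨p.natDegree - i - 1, by omega⟩
        rw [hm, pow_succ', ← mul_assoc, mul_comm (p.coeff i)]
        exact V.mul_mem _ _ ((had i h).2 V hV) (V.toSubring.pow_mem (ha.2 V hV) _)
      · rw [h, hp.coeff_natDegree, Nat.sub_self, pow_zero, one_mul]; exact V.one_mem
      · rw [coeff_eq_zero_of_natDegree_lt h, zero_mul]; exact V.zero_mem
    · have := scaleRoots_eval₂_mul (p := p) (RingHom.id L) (r * (y - z) ^ j) a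
      rw [eval₂_id, eval₂_id, hp0, mul_zero] at this
      exact this
  have haJ : (⟨a, ha⟩ : R) ∈ J := by
    rw [hJ]
    refine ⟨fun i => a * r * ((-z) ^ (j - i) * (j.choose i : L)), fun i => ?_, ?_⟩
    · exact F.mul_mem (F.mul_mem ha.1 hr.1) (F.mul_mem (pow_mem (F.neg_mem hz) _)
        (natCast_mem F _))
    · convert hag using 1
      rw [sub_eq_add_neg, add_pow, Finset.sum_range_succ, add_comm, mul_add, mul_add,
        Finset.mul_sum, Finset.mul_sum]
      congr 1
      · exact Finset.sum_congr rfl fun i _ => by ring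
      · simp; ring
  have := hJV ⟨_, haJ, rfl⟩
  rw [SetLike.mem_coe, V₀.mem_nonunits_iff] at this
  exact this.ne ha1

/-- Genus bound in spanning form. -/
def GenusLE (O : ValuationSubring L) (x : L) (F : IntermediateField K L) (γ : ℕ) : Prop :=
  ∃ s : Finset L, s.card ≤ γ ∧ (∀ f ∈ s, f ∈ F) ∧
    ∀ f ∈ F, ∃ r ∈ reg x F, ∃ o ∈ O, ∃ c ∈ Submodule.span K (s : Set L), f = r + o + c

theorem GenusLE.step {O : ValuationSubring L} (hO : ∀ c : K, algebraMap K L c ∈ O)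
    {x y : L} (hx : Transcendental K x) {F F' : IntermediateField K L}
    (hxF : x ∈ F) (halg : AlgOver x F) (hFF' : F ≤ F') (hy : y ∈ F')
    {A : K[X]} (hA : A.Monic) (hadd : IsAdditive L A) (hψ : aeval y A ∈ F)
    (hspan : ∀ f ∈ F', ∃ c : ℕ → L, (∀ i, c i ∈ F) ∧
      f = ∑ i ∈ Finset.range A.natDegree, c i * y ^ i)
    {γ ρ : ℕ} (hγ : GenusLE O x F γ) (𝔯 : Submodule K L) (h𝔯 : ∀ r ∈ 𝔯, r ∈ reg x F)
    (hρ : ∃ s : Finset L, s.card ≤ ρ ∧ (∀ f ∈ s, f ∈ F) ∧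
      ∀ f ∈ reg x F, ∃ r ∈ 𝔯, ∃ c ∈ Submodule.span K (s : Set L), f = r + c)
    (hloc : ∀ V₀, Adm K x V₀ → ∃ z ∈ F, ∀ r ∈ 𝔯, r * (aeval y A - aeval z A) ∈ V₀)
    (hinf : ∀ l ∈ F, l ∈ O → ∃ c : K, ∀ j < A.natDegree, (l - algebraMap K L c) * y ^ j ∈ O) :
    GenusLE O x F' (A.natDegree * γ + (A.natDegree - 1) * ρ) := by
  classical
  obtain ⟨s, hsc, hsF, hs⟩ := hγ
  obtain ⟨t, htc, htF, ht⟩ := hρ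
  set P := A.natDegree with hP
  let s' : Finset L := s ∪ (Finset.range (P - 1)).biUnion fun j =>
    (s ∪ t).image fun f => f * y ^ (j + 1)
  rcases Nat.eq_zero_or_pos P with hP0 | hP0
  · refine ⟨∅, by simp, by simp, fun f hf => ?_⟩
    obtain ⟨c, -, rfl⟩ := hspan f hf
    exact ⟨0, zero_mem _, 0, O.zero_mem, 0, zero_mem _, by simp [hP0]⟩
  have hyj : ∀ j, y ^ j ∈ F' := fun j => pow_mem hy j
  refine ⟨s', ?_, ?_, ?_⟩
  · calc s'.card ≤ s.card + ((Finset.range (P - 1)).biUnion fun j =>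
          (s ∪ t).image fun f => f * y ^ (j + 1)).card := Finset.card_union_le _ _
      _ ≤ γ + (P - 1) * (γ + ρ) := by
          refine Nat.add_le_add hsc ?_
          refine (Finset.card_biUnion_le_card_mul _ _ (γ + ρ) fun j _ => ?_).trans (by simp)
          exact Finset.card_image_le.trans ((Finset.card_union_le _ _).trans
            (Nat.add_le_add hsc htc))
      _ = P * γ + (P - 1) * ρ := by
          obtain ⟨m, hm⟩ : ∃ m, P = m + 1 := ⟨P - 1, by omega⟩
          rw [hm, Nat.add_sub_cancel]; ring
  · intro f hf
    simp only [s', Finset.mem_union, Finset.mem_biUnion, Finset.mem_image] at hf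
    rcases hf with hf | ⟨j, -, g, hg, rfl⟩
    · exact hFF' (hsF f hf)
    · exact F'.mul_mem (hFF' (hg.elim (hsF g) (htF g))) (hyj _)
  let Tgt : Submodule K L := (Subalgebra.toSubmodule (reg x F')) ⊔
    (Subalgebra.toSubmodule (valAlg O hO)) ⊔ Submodule.span K (s' : Set L)
  suffices hT : ∀ j < P, ∀ f ∈ F, f * y ^ j ∈ Tgt by
    intro f hf
    obtain ⟨c, hc, rfl⟩ := hspan f hf
    have : ∑ i ∈ Finset.range P, c i * y ^ i ∈ Tgt :=
      Tgt.sum_mem fun i hi => hT i (Finset.mem_range.1 hi) _ (hc i)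
    obtain ⟨u, hu, v, hv, h⟩ := Submodule.mem_sup.1 this
    obtain ⟨r, hr, o, ho, h'⟩ := Submodule.mem_sup.1 hu
    exact ⟨r, hr, o, ho, v, hv, by rw [h', h]⟩
  have hreg : ∀ f ∈ reg x F', f ∈ Tgt := fun f hf =>
    Submodule.mem_sup_left (Submodule.mem_sup_left hf)
  have hOT : ∀ f ∈ O, f ∈ Tgt := fun f hf =>
    Submodule.mem_sup_left (Submodule.mem_sup_right hf)
  have hsT : ∀ c ∈ Submodule.span K (s : Set L), c ∈ Tgt := fun c hc =>
    Submodule.mem_sup_right (Submodule.span_mono (by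
      intro f hf
      exact Finset.mem_coe.2 (Finset.mem_union_left _ hf)) hc)
  have hstT : ∀ j, 0 < j → j < P → ∀ c ∈ Submodule.span K ((s ∪ t : Finset L) : Set L),
      c * y ^ j ∈ Tgt := by
    intro j hj0 hj c hc
    refine Submodule.mem_sup_right ?_
    have : c * y ^ j = LinearMap.mulRight K (y ^ j) c := rfl
    rw [this]
    have h2 := Submodule.mem_map_of_mem (f := LinearMap.mulRight K (y ^ j)) hc
    rw [Submodule.map_span] at h2
    refine Submodule.span_mono ?_ h2
    rintro _ ⟨f, hf, rfl⟩
    refine Finset.mem_coe.2 (Finset.mem_union_right _ (Finset.mem_biUnion.2 ⟨j - 1, ?_, ?_⟩))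
    · exact Finset.mem_range.2 (by omega)
    · refine Finset.mem_image.2 ⟨f, hf, ?_⟩
      rw [Nat.sub_add_cancel hj0]; rfl
  intro j
  induction j using Nat.strong_induction_on with
  | _ j ih =>
    intro hj f hf
    obtain ⟨r, hr, o, ho, c, hc, hfe⟩ := hs f hf
    have hcF : c ∈ F := by
      have : Submodule.span K (s : Set L) ≤ Subalgebra.toSubmodule F.toSubalgebra :=
        Submodule.span_le.2 fun g hg => hsF g hg
      exact this hc
    have hoF : o ∈ F := by
      have : o = f - r - c := by rw [hfe]; ring
      rw [this]
      exact F.sub_mem (F.sub_mem hf hr.1) hcF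
    rcases Nat.eq_zero_or_pos j with rfl | hj0
    · rw [pow_zero, mul_one, hfe]
      exact Tgt.add_mem (Tgt.add_mem (hreg _ (reg_mono hFF' hr)) (hOT _ ho)) (hsT _ hc)
    obtain ⟨c₀, hc₀⟩ := hinf o hoF ho
    obtain ⟨r', hr', c', hc', he'⟩ := ht (r + algebraMap K L c₀)
      ((reg x F).add_mem hr ((reg x F).algebraMap_mem _))
    have hsplit : f * y ^ j = r' * y ^ j + (c + c') * y ^ j + (o - algebraMap K L c₀) * y ^ j := by
      rw [hfe, eq_sub_of_add_eq he']; ring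
    rw [hsplit]
    refine Tgt.add_mem (Tgt.add_mem ?_ (hstT j hj0 hj _ (Submodule.add_mem _ ?_ ?_)))
      (hOT _ (hc₀ j hj))
    · obtain ⟨d, hd, hdr⟩ := exists_leading hx hxF halg hFF' hy hA hadd hψ (h𝔯 _ hr')
        (fun V₀ hV₀ => by
          obtain ⟨z, hz, h⟩ := hloc V₀ hV₀
          exact ⟨z, hz, h _ hr'⟩) hj.le
      have : r' * y ^ j = (r' * y ^ j + ∑ i ∈ Finset.range j, d i * y ^ i) -
          ∑ i ∈ Finset.range j, d i * y ^ i := by ring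
      rw [this]
      refine Tgt.sub_mem (hreg _ hdr) (Tgt.sum_mem fun i hi => ?_)
      have hi := Finset.mem_range.1 hi
      exact ih i hi (hi.trans hj) _ (hd i)
    · exact Submodule.span_mono (by simp) hc
    · exact Submodule.span_mono (by simp) hc'

end Tower

end

section

open Polynomial

namespace Tower

variable {K L : Type*} [Field K] [Field L] [Algebra K L]

/-- A nonempty family of valuation rings over `K`, with their intersection `B`. -/
structure Fam (K L : Type*) [Field K] [Field L] [Algebra K L] where
  /-- The family. -/
  mem : ValuationSubring L → Prop
  const : ∀ V, mem V → ∀ c : K, algebraMap K L c ∈ V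
  nonempty : ∃ V, mem V

namespace Fam

variable (𝒱 : Fam K L)

/-- The intersection of the family. -/
def B : Subalgebra K L := finiteAt K 𝒱.mem 𝒱.const

/-- Elements lying in all the maximal ideals. -/
def Small (τ : L) : Prop := τ ≠ 0 ∧ ∀ V, 𝒱.mem V → V.valuation τ < 1

variable {𝒱}

lemma Small.mem_B {τ : L} (h : 𝒱.Small τ) : τ ∈ 𝒱.B := fun V hV =>
  (V.valuation_le_one_iff _).1 (h.2 V hV).le

lemma Small.val {τ h : L} (hτ : 𝒱.Small τ) (hh : h ∈ 𝒱.B) {V} (hV : 𝒱.mem V) :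
    V.valuation (1 + τ * h) = 1 :=
  val_one_add (val_mul_lt_one (hτ.2 V hV) (hh V hV))

lemma Small.ne_zero {τ h : L} (hτ : 𝒱.Small τ) (hh : h ∈ 𝒱.B) : 1 + τ * h ≠ 0 := by
  obtain ⟨V, hV⟩ := 𝒱.nonempty
  intro h0
  have := hτ.val hh hV
  simp [h0] at this

lemma Small.inv_mem {τ h : L} (hτ : 𝒱.Small τ) (hh : h ∈ 𝒱.B) : (1 + τ * h)⁻¹ ∈ 𝒱.B :=
  fun _ hV => inv_mem_of_val_eq_one (hτ.val hh hV)

variable (𝒱)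

/-- Units congruent to a nonzero constant modulo `τ`. -/
def IsU (τ g : L) : Prop := ∃ c : K, c ≠ 0 ∧ ∃ h ∈ 𝒱.B, g = algebraMap K L c + τ * h

variable {𝒱} {τ : L}

lemma IsU.mem_B {g : L} (hτ : 𝒱.Small τ) (hg : 𝒱.IsU τ g) : g ∈ 𝒱.B := by
  obtain ⟨c, hc, h, hh, rfl⟩ := hg
  exact add_mem (𝒱.B.algebraMap_mem c) (mul_mem hτ.mem_B hh)

lemma isU_one : 𝒱.IsU τ 1 := ⟨1, one_ne_zero, 0, zero_mem _, by simp⟩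

lemma isU_one_add {h : L} (hh : h ∈ 𝒱.B) : 𝒱.IsU τ (1 + τ * h) :=
  ⟨1, one_ne_zero, h, hh, by simp⟩

lemma IsU.mul {g g' : L} (hτ : 𝒱.Small τ) (hg : 𝒱.IsU τ g) (hg' : 𝒱.IsU τ g') :
    𝒱.IsU τ (g * g') := by
  obtain ⟨c, hc, h, hh, rfl⟩ := hg
  obtain ⟨c', hc', h', hh', rfl⟩ := hg'
  refine ⟨c * c', mul_ne_zero hc hc',
    algebraMap K L c * h' + h * (algebraMap K L c' + τ * h'), ?_, by rw [map_mul]; ring⟩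
  exact add_mem (mul_mem (𝒱.B.algebraMap_mem c) hh')
    (mul_mem hh (add_mem (𝒱.B.algebraMap_mem c') (mul_mem hτ.mem_B hh')))

lemma IsU.ne_zero {g : L} (hτ : 𝒱.Small τ) (hg : 𝒱.IsU τ g) : g ≠ 0 := by
  obtain ⟨c, hc, h, hh, rfl⟩ := hg
  have hc' : algebraMap K L c ≠ 0 := by simpa using hc
  have : algebraMap K L c + τ * h = algebraMap K L c * (1 + τ * (algebraMap K L c⁻¹ * h)) := by
    rw [map_inv₀]; field_simp
  rw [this]
  exact mul_ne_zero hc' (hτ.ne_zero (mul_mem (𝒱.B.algebraMap_mem _) hh))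

lemma IsU.inv {g : L} (hτ : 𝒱.Small τ) (hg : 𝒱.IsU τ g) : 𝒱.IsU τ g⁻¹ := by
  have hg0 := hg.ne_zero hτ
  obtain ⟨c, hc, h, hh, rfl⟩ := hg
  have hc' : algebraMap K L c ≠ 0 := by simpa using hc
  have hk := mul_mem (𝒱.B.algebraMap_mem c⁻¹) hh
  have h1 := hτ.ne_zero hk
  refine ⟨c⁻¹, inv_ne_zero hc, -(algebraMap K L c⁻¹ * (algebraMap K L c⁻¹ * h) *
    (1 + τ * (algebraMap K L c⁻¹ * h))⁻¹),
    neg_mem (mul_mem (mul_mem (𝒱.B.algebraMap_mem _) hk) (hτ.inv_mem hk)), ?_⟩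
  rw [map_inv₀] at *
  have : algebraMap K L c + τ * h =
    algebraMap K L c * (1 + τ * ((algebraMap K L c)⁻¹ * h)) := by field_simp
  rw [this, mul_inv]
  generalize (algebraMap K L c)⁻¹ * h = k at *
  field_simp
  ring

lemma IsU.zpow {g : L} (hτ : 𝒱.Small τ) (hg : 𝒱.IsU τ g) (n : ℤ) : 𝒱.IsU τ (g ^ n) := by
  have hn : ∀ n : ℕ, 𝒱.IsU τ (g ^ n) := fun n => by
    induction n with
    | zero => simpa using isU_one
    | succ n ih => rw [pow_succ]; exact ih.mul hτ hg
  cases n with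
  | ofNat n => simpa using hn n
  | negSucc n => rw [zpow_negSucc]; exact (hn _).inv hτ

lemma IsU.of_mem {σ g h : L} (hh : h ∈ 𝒱.B) (hg : 𝒱.IsU (σ * h) g) : 𝒱.IsU σ g := by
  obtain ⟨c, hc, e, he, rfl⟩ := hg
  exact ⟨c, hc, h * e, mul_mem hh he, by ring⟩

variable (𝒱) in
/-- The element `f` is `τ ^ n` up to a unit. -/
def UE (τ : L) (n : ℤ) (f : L) : Prop := ∃ g, 𝒱.IsU τ g ∧ f = τ ^ n * g

lemma UE.mul (hτ : 𝒱.Small τ) {m n : ℤ} {f g : L} (hf : 𝒱.UE τ m f) (hg : 𝒱.UE τ n g) :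
    𝒱.UE τ (m + n) (f * g) := by
  obtain ⟨u, hu, rfl⟩ := hf
  obtain ⟨v, hv, rfl⟩ := hg
  exact ⟨u * v, hu.mul hτ hv, by rw [zpow_add₀ hτ.1]; ring⟩

lemma UE.inv (hτ : 𝒱.Small τ) {m : ℤ} {f : L} (hf : 𝒱.UE τ m f) : 𝒱.UE τ (-m) f⁻¹ := by
  obtain ⟨u, hu, rfl⟩ := hf
  exact ⟨u⁻¹, hu.inv hτ, by rw [mul_inv, zpow_neg]⟩

lemma UE.ne_zero (hτ : 𝒱.Small τ) {m : ℤ} {f : L} (hf : 𝒱.UE τ m f) : f ≠ 0 := by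
  obtain ⟨u, hu, rfl⟩ := hf
  exact mul_ne_zero (zpow_ne_zero _ hτ.1) (hu.ne_zero hτ)

lemma UE.add (hτ : 𝒱.Small τ) {m n : ℤ} {f g : L} (hf : 𝒱.UE τ m f) (hg : 𝒱.UE τ n g)
    (h : m < n) : 𝒱.UE τ m (f + g) := by
  obtain ⟨u, hu, rfl⟩ := hf
  obtain ⟨v, hv, rfl⟩ := hg
  have hv' := hv.mem_B hτ
  obtain ⟨c, hc, e, he, rfl⟩ := hu
  obtain ⟨d, rfl⟩ : ∃ d : ℕ, n = m + d + 1 := ⟨(n - m - 1).toNat, by omega⟩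
  refine ⟨_, ⟨c, hc, e + τ ^ d * v, add_mem he (mul_mem (pow_mem hτ.mem_B _) hv'), rfl⟩, ?_⟩
  rw [zpow_add₀ hτ.1, zpow_add₀ hτ.1, zpow_natCast, zpow_one]
  ring

lemma UE.of_pow {σ : L} (hσ : 𝒱.Small σ) {P : ℕ} {v : L} (hv : 𝒱.IsU σ v) (hP : 0 < P)
    (hτ : τ = σ ^ P * v) {n : ℤ} {f : L} (hf : 𝒱.UE τ n f) : 𝒱.UE σ (P * n) f := by
  obtain ⟨u, hu, rfl⟩ := hf
  refine ⟨v ^ n * u, (hv.zpow hσ n).mul hσ ?_, ?_⟩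
  · obtain ⟨m, rfl⟩ : ∃ m, P = m + 1 := ⟨P - 1, by omega⟩
    rw [pow_succ', mul_assoc] at hτ
    rw [hτ] at hu
    exact hu.of_mem (mul_mem (pow_mem hσ.mem_B _) (hv.mem_B hσ))
  · rw [hτ, mul_zpow, zpow_mul, zpow_natCast]; ring

variable (𝒱) in
/-- `τ` is a uniformizer of `F` at the family. -/
def Unif (F : IntermediateField K L) (τ : L) : Prop := ∀ f ∈ F, f ≠ 0 → ∃ n : ℤ, 𝒱.UE τ n f

lemma Unif.of_isU {F : IntermediateField K L} {σ v : L} (hσ : 𝒱.Small σ) (hv : 𝒱.IsU σ v)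
    (h : 𝒱.Unif F (σ * v)) : 𝒱.Unif F σ := by
  intro f hf hf0
  obtain ⟨n, hn⟩ := h f hf hf0
  exact ⟨_, UE.of_pow hσ hv one_pos (by rw [pow_one]) hn⟩

lemma Small.of_isU {σ v : L} (hσ : 𝒱.Small σ) (hv : 𝒱.IsU σ v) : 𝒱.Small (σ * v) :=
  ⟨mul_ne_zero hσ.1 (hv.ne_zero hσ), fun V hV =>
    val_mul_lt_one (hσ.2 V hV) (hv.mem_B hσ V hV)⟩

lemma IsU.of_mul {σ v g : L} (hσ : 𝒱.Small σ) (hv : 𝒱.IsU σ v) (hg : 𝒱.IsU σ g) :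
    𝒱.IsU (σ * v) g := by
  have hv0 := hv.ne_zero hσ
  obtain ⟨c, hc, e, he, rfl⟩ := hg
  exact ⟨c, hc, v⁻¹ * e, mul_mem ((hv.inv hσ).mem_B hσ) he, by field_simp⟩

lemma Unif.mul_isU {F : IntermediateField K L} {σ v : L} (hσ : 𝒱.Small σ) (hv : 𝒱.IsU σ v)
    (h : 𝒱.Unif F σ) : 𝒱.Unif F (σ * v) := by
  have hv0 := hv.ne_zero hσ
  refine Unif.of_isU (hσ.of_isU hv) (hv.of_mul hσ hv |>.inv (hσ.of_isU hv)) ?_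
  rwa [mul_assoc, mul_inv_cancel₀ hv0, mul_one]

/-- Poles are totally ramified in additive extensions. -/
lemma small_inv_of_aeval {A : K[X]} (hA : A.Monic) {y : L} (hτ : 𝒱.Small (aeval y A)⁻¹) :
    𝒱.Small y⁻¹ ∧ ∃ v, 𝒱.IsU y⁻¹ v ∧ (aeval y A)⁻¹ = y⁻¹ ^ A.natDegree * v := by
  have hA0 : aeval y A ≠ 0 := fun h => hτ.1 (by rw [h, inv_zero])
  have hyV : ∀ V, 𝒱.mem V → y ∉ V := fun V hV hy => by
    have h1 : aeval y A ∈ V :=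
      aeval_mem_of_mem (S := valAlg V (𝒱.const V hV)) hy A
    have h2 := hτ.2 V hV
    rw [← V.mem_nonunits_iff, V.inv_mem_nonunits_iff] at h2
    exact h2.elim hA0 fun h => h h1
  have hy0 : y ≠ 0 := fun h => by
    obtain ⟨V, hV⟩ := 𝒱.nonempty
    exact hyV V hV (h ▸ V.zero_mem)
  have hs : 𝒱.Small y⁻¹ := ⟨inv_ne_zero hy0, fun V hV => val_lt_one_of_inv_notMem (hyV V hV)⟩
  refine ⟨hs, ?_⟩
  obtain ⟨h, hh, heq⟩ := aeval_eq_pow_mul 𝒱.B hA hy0 hs.mem_B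
  exact ⟨_, (isU_one_add hh).inv hs, by rw [heq, mul_inv, inv_pow]⟩

lemma sum_eq_zero_or_UE {F : IntermediateField K L} {A : K[X]} (hA : A.Monic) {y : L}
    (hτ : 𝒱.Small (aeval y A)⁻¹) (hF : 𝒱.Unif F (aeval y A)⁻¹) (c : ℕ → L) (hc : ∀ i, c i ∈ F)
    {m : ℕ} (hm : m ≤ A.natDegree) :
    (∀ i < m, c i = 0) ∨ ∃ n : ℤ, ∃ j < m,
      𝒱.UE y⁻¹ (A.natDegree * n - j) (∑ i ∈ Finset.range m, c i * y ^ i) := by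
  induction m with
  | zero => left; simp
  | succ m ih =>
    obtain ⟨hs, v, hv, hveq⟩ := small_inv_of_aeval hA hτ
    rw [Finset.sum_range_succ]
    have hterm : c m ≠ 0 → ∃ n : ℤ, 𝒱.UE y⁻¹ (A.natDegree * n - m) (c m * y ^ m) := by
      intro h0
      obtain ⟨n, hn⟩ := hF _ (hc m) h0
      have h1 := UE.of_pow hs hv (by omega) hveq hn
      refine ⟨n, ?_⟩
      have h2 : 𝒱.UE y⁻¹ (-m) (y ^ m) := ⟨1, isU_one, by simp⟩
      exact h1.mul hs h2
    by_cases h0 : c m = 0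
    · rw [h0, zero_mul, add_zero]
      rcases ih (by omega) with h | ⟨n, j, hj, h⟩
      · left
        intro i hi
        rcases Nat.lt_succ_iff_lt_or_eq.1 hi with h' | rfl
        exacts [h i h', h0]
      · exact Or.inr ⟨n, j, by omega, h⟩
    right
    obtain ⟨n', hn'⟩ := hterm h0
    rcases ih (by omega) with h | ⟨n, j, hj, h⟩
    · refine ⟨n', m, by omega, ?_⟩
      rw [Finset.sum_eq_zero, zero_add]
      · exact hn'
      · intro i hi
        rw [h i (Finset.mem_range.1 hi), zero_mul]
    · rcases lt_trichotomy ((A.natDegree : ℤ) * n - j) (A.natDegree * n' - m) with hlt | heq | hlt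
      · exact ⟨n, j, by omega, h.add hs hn' hlt⟩
      · exfalso
        have h1 : (A.natDegree : ℤ) * (n' - n) = m - j := by linarith
        have h2 : (A.natDegree : ℤ) ∣ m - j := ⟨_, h1.symm⟩
        have := Int.le_of_dvd (by omega) h2
        omega
      · refine ⟨n', m, by omega, ?_⟩
        rw [add_comm]
        exact hn'.add hs h hlt

lemma Unif.step {F F' : IntermediateField K L} {A : K[X]} (hA : A.Monic) {y : L}
    (hτ : 𝒱.Small (aeval y A)⁻¹) (hF : 𝒱.Unif F (aeval y A)⁻¹)
    (hspan : ∀ f ∈ F', ∃ c : ℕ → L, (∀ i, c i ∈ F) ∧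
      f = ∑ i ∈ Finset.range A.natDegree, c i * y ^ i) : 𝒱.Unif F' y⁻¹ := by
  intro f hf hf0
  obtain ⟨c, hc, rfl⟩ := hspan f hf
  rcases sum_eq_zero_or_UE hA hτ hF c hc le_rfl with h | ⟨n, j, -, h⟩
  · exfalso
    apply hf0
    exact Finset.sum_eq_zero fun i hi => by rw [h i (Finset.mem_range.1 hi), zero_mul]
  · exact ⟨_, h⟩

lemma Unif.indep {F : IntermediateField K L} {A : K[X]} (hA : A.Monic) {y : L}
    (hτ : 𝒱.Small (aeval y A)⁻¹) (hF : 𝒱.Unif F (aeval y A)⁻¹)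
    (c : ℕ → L) (hc : ∀ i, c i ∈ F) (h0 : ∑ i ∈ Finset.range A.natDegree, c i * y ^ i = 0) :
    ∀ i < A.natDegree, c i = 0 := by
  rcases sum_eq_zero_or_UE hA hτ hF c hc le_rfl with h | ⟨n, j, -, h⟩
  · exact h
  · exact absurd h0 (h.ne_zero (small_inv_of_aeval hA hτ).1)

end Fam

end Tower

end

section

open Polynomial

namespace Tower

variable {K L : Type*} [Field K] [Field L] [Algebra K L]

lemma span_adjoin_simple (F : IntermediateField K L) {A : K[X]} (hA : A.Monic)
    (hpos : 0 < A.natDegree) {y : L} (hψ : aeval y A ∈ F) :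
    ∀ f ∈ F ⊔ IntermediateField.adjoin K {y}, ∃ c : ℕ → L, (∀ i, c i ∈ F) ∧
      f = ∑ i ∈ Finset.range A.natDegree, c i * y ^ i := by
  intro f hf
  rw [← IntermediateField.restrictScalars_adjoin_eq_sup, IntermediateField.mem_restrictScalars]
    at hf
  set Q : F[X] := A.map (algebraMap K F) - C ⟨_, hψ⟩ with hQ
  have hQm : Q.Monic := by
    refine (hA.map (algebraMap K F)).sub_of_left ?_
    refine lt_of_le_of_lt degree_C_le ?_
    rw [← natDegree_pos_iff_degree_pos, hA.natDegree_map]; exact hpos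
  have hQd : Q.natDegree = A.natDegree := by
    rw [hQ, natDegree_sub_C, hA.natDegree_map]
  have hQ0 : aeval y Q = 0 := by
    rw [hQ, map_sub, aeval_map_algebraMap, aeval_C, sub_eq_zero]; rfl
  have hInt : IsIntegral F y := ⟨Q, hQm, hQ0⟩
  have hf' : f ∈ (IntermediateField.adjoin F {y}).toSubalgebra := hf
  rw [IntermediateField.adjoin_simple_toSubalgebra_of_isAlgebraic hInt.isAlgebraic,
    Algebra.adjoin_singleton_eq_range_aeval] at hf'
  obtain ⟨g, rfl⟩ := hf'
  refine ⟨fun i => ((g %ₘ Q).coeff i : F), fun i => ((g %ₘ Q).coeff i).2, ?_⟩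
  have h1 : aeval y g = aeval y (g %ₘ Q) := by
    conv_lhs => rw [← modByMonic_add_div g Q]
    rw [map_add, map_mul, hQ0, zero_mul, add_zero]
  have h2 : (g %ₘ Q).natDegree < A.natDegree := by
    rw [← hQd]
    refine natDegree_modByMonic_lt g hQm fun h => ?_
    rw [h, natDegree_one] at hQd; omega
  change aeval y g = _
  rw [h1, aeval_eq_sum_range' h2]
  rfl

/-- `F'` is spanned by `n` elements over `F`. -/
def SpanLE (F F' : IntermediateField K L) (n : ℕ) : Prop :=
  ∃ e : Fin n → L, ∀ f ∈ F', ∃ c : Fin n → L, (∀ i, c i ∈ F) ∧ f = ∑ i, c i * e i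

lemma SpanLE.refl (F : IntermediateField K L) : SpanLE F F 1 :=
  ⟨fun _ => 1, fun f hf => ⟨fun _ => f, fun _ => hf, by simp⟩⟩

lemma SpanLE.trans {F F' F'' : IntermediateField K L} {m n : ℕ} (h : SpanLE F F' m)
    (h' : SpanLE F' F'' n) : SpanLE F F'' (m * n) := by
  obtain ⟨e, he⟩ := h
  obtain ⟨e', he'⟩ := h'
  refine ⟨fun i => e (finProdFinEquiv.symm i).1 * e' (finProdFinEquiv.symm i).2, fun f hf => ?_⟩
  obtain ⟨c, hc, rfl⟩ := he' f hf
  choose d hd hdc using fun i => he (c i) (hc i)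
  refine ⟨fun i => d (finProdFinEquiv.symm i).2 (finProdFinEquiv.symm i).1, fun i => hd _ _, ?_⟩
  rw [← finProdFinEquiv.sum_comp, Fintype.sum_prod_type_right]
  refine Finset.sum_congr rfl fun j _ => ?_
  rw [hdc j, Finset.sum_mul]
  exact Finset.sum_congr rfl fun i _ => by simp; ring

lemma spanLE_adjoin_simple (F : IntermediateField K L) {A : K[X]} (hA : A.Monic)
    (hpos : 0 < A.natDegree) {y : L} (hψ : aeval y A ∈ F) : SpanLE F (F ⊔ IntermediateField.adjoin K {y}) A.natDegree := by
  refine ⟨fun i => y ^ (i : ℕ), fun f hf => ?_⟩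
  obtain ⟨c, hc, rfl⟩ := span_adjoin_simple F hA hpos hψ f hf
  exact ⟨fun i => c i, fun i => hc i, Finset.sum_range _⟩

lemma SpanLE.exists_relation {F F' : IntermediateField K L} {n : ℕ} (h : SpanLE F F' n)
    (r : Fin (n + 1) → L) (hr : ∀ j, r j ∈ F') :
    ∃ g : Fin (n + 1) → L, (∀ j, g j ∈ F) ∧ (∃ j, g j ≠ 0) ∧ ∑ j, g j * r j = 0 := by
  obtain ⟨e, he⟩ := h
  choose d hd hdr using fun j => he (r j) (hr j)
  have hdep : ¬ LinearIndependent F fun j => (fun i => (⟨d j i, hd j i⟩ : F)) := fun h => by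
    have := h.fintype_card_le_finrank
    simp at this
  obtain ⟨g, hg, j, hj⟩ := Fintype.not_linearIndependent_iff.1 hdep
  refine ⟨fun j => g j, fun j => (g j).2, ⟨j, by simpa using hj⟩, ?_⟩
  have hg' : ∀ i, ∑ j, (g j : L) * d j i = 0 := fun i => by
    have := congrArg (fun f => ((f i : F) : L)) hg
    simpa using this
  calc ∑ j, (g j : L) * r j = ∑ j, ∑ i, (g j : L) * d j i * e i := by
        refine Finset.sum_congr rfl fun j _ => ?_
        rw [hdr j, Finset.mul_sum]
        exact Finset.sum_congr rfl fun i _ => by ring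
    _ = ∑ i, (∑ j, (g j : L) * d j i) * e i := by
        rw [Finset.sum_comm]
        exact Finset.sum_congr rfl fun i _ => by rw [Finset.sum_mul]
    _ = 0 := by simp [hg']

lemma mem_submoduleOf {R W : Submodule K L} {f : R} : f ∈ W.submoduleOf R ↔ (f : L) ∈ W := Iff.rfl

/-- The codimension of `W ∩ R` in `R` is at most `ρ`. -/
def CodimLE (R W : Submodule K L) (ρ : ℕ) : Prop :=
  Module.rank K (R ⧸ W.submoduleOf R) ≤ ρ

lemma CodimLE.of_forall {R W : Submodule K L} {n : ℕ}
    (h : ∀ r : Fin (n + 1) → L, (∀ j, r j ∈ R) → ∃ c : Fin (n + 1) → K, (∃ j, c j ≠ 0) ∧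
      ∑ j, c j • r j ∈ W) : CodimLE R W n := by
  refine rank_le fun s hs => ?_
  by_contra! hcard
  obtain ⟨t, hts, htc⟩ := Finset.exists_subset_card_eq (show n + 1 ≤ s.card by omega)
  let e := t.equivFinOfCardEq htc
  have hli : LinearIndependent K fun j : Fin (n + 1) => ((e.symm j : _) : R ⧸ W.submoduleOf R) := by
    have h1 := hs.comp (fun j : Fin (n + 1) => (⟨e.symm j, hts (e.symm j).2⟩ : s)) (by
      intro i j hij
      simpa [Subtype.ext_iff] using hij)
    exact h1
  choose r hr using fun j : Fin (n + 1) =>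
    Submodule.Quotient.mk_surjective _ ((e.symm j : _) : R ⧸ W.submoduleOf R)
  obtain ⟨c, ⟨j, hj⟩, hc⟩ := h (fun j => r j) fun j => (r j).2
  refine hj (Fintype.linearIndependent_iff.1 hli c ?_ j)
  simp_rw [← hr]
  have : ∑ j, c j • (Submodule.Quotient.mk (r j) : R ⧸ W.submoduleOf R) =
      Submodule.Quotient.mk (∑ j, c j • r j) := by
    simp only [← Submodule.mkQ_apply, map_sum, map_smul]
  rw [this, Submodule.Quotient.mk_eq_zero]
  rw [mem_submoduleOf]
  simpa using hc

lemma CodimLE.inf {R W W' : Submodule K L} {m n : ℕ} (h : CodimLE R W m) (h' : CodimLE R W' n) :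
    CodimLE R (W ⊓ W') (m + n) := by
  unfold CodimLE at *
  let θ : R →ₗ[K] (R ⧸ W.submoduleOf R) × (R ⧸ W'.submoduleOf R) :=
    (Submodule.mkQ _).prod (Submodule.mkQ _)
  have hker : LinearMap.ker θ = (W ⊓ W').submoduleOf R := by
    ext f
    simp [θ, mem_submoduleOf]
  have h1 : Module.rank K (R ⧸ (W ⊓ W').submoduleOf R) ≤
      Module.rank K ((R ⧸ W.submoduleOf R) × (R ⧸ W'.submoduleOf R)) := by
    rw [← hker]
    exact (LinearEquiv.rank_eq θ.quotKerEquivRange).le.trans (Submodule.rank_le _)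
  rw [rank_prod'] at h1
  push_cast
  exact h1.trans (add_le_add h h')

lemma CodimLE.mono {R W W' : Submodule K L} {m n : ℕ} (h : CodimLE R W m) (hW : W ≤ W')
    (hmn : m ≤ n) : CodimLE R W' n := by
  unfold CodimLE at *
  have h1 : W.submoduleOf R ≤ W'.submoduleOf R := fun f hf => hW hf
  have := LinearMap.rank_le_of_surjective (Submodule.factor h1) (Submodule.factor_surjective h1)
  exact this.trans (h.trans (by exact_mod_cast hmn))

lemma CodimLE.top (R : Submodule K L) {W : Submodule K L} (h : R ≤ W) : CodimLE R W 0 :=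
  CodimLE.of_forall fun _ hr => ⟨fun _ => 1, ⟨0, one_ne_zero⟩, W.sum_mem fun j _ =>
    W.smul_mem _ (h (hr j))⟩

lemma CodimLE.biInf {R : Submodule K L} {ι : Type*} (s : Finset ι) (W : ι → Submodule K L)
    (n : ι → ℕ) (h : ∀ i ∈ s, CodimLE R (W i) (n i)) :
    CodimLE R (⨅ i ∈ s, W i) (∑ i ∈ s, n i) := by
  classical
  induction s using Finset.induction_on with
  | empty => exact CodimLE.top R (by simp)
  | insert i s hi ih =>
    rw [Finset.iInf_insert, Finset.sum_insert hi]
    exact (h i (Finset.mem_insert_self _ _)).inf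
      (ih fun j hj => h j (Finset.mem_insert_of_mem hj))

lemma CodimLE.exists_span {R W : Submodule K L} {n : ℕ} (h : CodimLE R W n) :
    ∃ s : Finset L, s.card ≤ n ∧ (∀ f ∈ s, f ∈ R) ∧
      ∀ f ∈ R, ∃ r ∈ R ⊓ W, ∃ c ∈ Submodule.span K (s : Set L), f = r + c := by
  classical
  unfold CodimLE at h
  have hfin : Module.Finite K (R ⧸ W.submoduleOf R) :=
    Module.rank_lt_aleph0_iff.1 (h.trans_lt (Cardinal.natCast_lt_aleph0))
  have hfr : Module.finrank K (R ⧸ W.submoduleOf R) ≤ n := Module.finrank_le_of_rank_le h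
  let b := Module.finBasis K (R ⧸ W.submoduleOf R)
  choose r hr using fun j => Submodule.Quotient.mk_surjective _ (b j)
  refine ⟨Finset.univ.image fun j => (r j : L), ?_, ?_, fun f hf => ?_⟩
  · exact Finset.card_image_le.trans (by simpa using hfr)
  · intro f hf
    obtain ⟨j, -, rfl⟩ := Finset.mem_image.1 hf
    exact (r j).2
  · set a := fun j => b.repr (Submodule.Quotient.mk ⟨f, hf⟩) j
    have hsum : (∑ j, a j • r j) - ⟨f, hf⟩ ∈ W.submoduleOf R := by
      rw [← Submodule.Quotient.mk_eq_zero, Submodule.Quotient.mk_sub, sub_eq_zero]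
      have : Submodule.Quotient.mk (p := W.submoduleOf R) (∑ j, a j • r j) = ∑ j, a j • b j := by
        simp only [← hr, ← Submodule.mkQ_apply, map_sum, map_smul]
      rw [this]
      exact b.sum_repr _
    have hsum' : ∑ j, a j • (r j : L) - f ∈ W := by
      rw [mem_submoduleOf] at hsum
      simpa using hsum
    refine ⟨f - ∑ j, a j • (r j : L), ⟨R.sub_mem hf (R.sum_mem fun j _ => R.smul_mem _ (r j).2),
      by rw [← neg_sub]; exact W.neg_mem hsum'⟩, ∑ j, a j • (r j : L),
      Submodule.sum_mem _ fun j _ => Submodule.smul_mem _ _ (Submodule.subset_span (by simp)),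
      by ring⟩

namespace Fam

/-- The elements `r` such that `r / τ` is finite at the family. -/
def bound (𝒱 : Fam K L) (τ : L) : Submodule K L :=
  (Subalgebra.toSubmodule 𝒱.B).comap (LinearMap.mulRight K τ⁻¹)

lemma codimLE_bound {𝒱 : Fam K L} {τ : L} (hτ : 𝒱.Small τ) {F F' : IntermediateField K L}
    (hF : 𝒱.Unif F τ) {n : ℕ} (hs : SpanLE F F' n) {R : Submodule K L} (hRF : ∀ r ∈ R, r ∈ F')
    (hRB : ∀ r ∈ R, r ∈ 𝒱.B) : CodimLE R (𝒱.bound τ) n := by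
  classical
  refine CodimLE.of_forall fun r hr => ?_
  obtain ⟨g, hgF, ⟨j₀, hj₀⟩, hsum⟩ := hs.exists_relation r fun j => hRF _ (hr j)
  have hex : ∀ j, ∃ m : ℤ, g j ≠ 0 → 𝒱.UE τ m (g j) := fun j => by
    by_cases h : g j = 0
    · exact ⟨0, fun h' => absurd h h'⟩
    · obtain ⟨m, hm⟩ := hF _ (hgF j) h
      exact ⟨m, fun _ => hm⟩
  choose m hm using hex
  obtain ⟨j₁, hj₁, hmin⟩ := Finset.exists_min_image (Finset.univ.filter fun j => g j ≠ 0) m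
    ⟨j₀, by simpa using hj₀⟩
  have hj₁ : g j₁ ≠ 0 := by simpa using hj₁
  have hmin : ∀ j, g j ≠ 0 → m j₁ ≤ m j := fun j hj => hmin j (by simpa using hj)
  have hform : ∀ j, ∃ c : K, ∃ h ∈ 𝒱.B, (j = j₁ → c ≠ 0) ∧
      g j = τ ^ m j₁ * (algebraMap K L c + τ * h) := fun j => by
    by_cases h0 : g j = 0
    · exact ⟨0, 0, zero_mem _, fun h => absurd (h ▸ h0) hj₁, by simp [h0]⟩
    obtain ⟨u, hu, hgu⟩ := hm j h0
    rcases (hmin j h0).eq_or_lt with heq | hlt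
    · obtain ⟨c, hc, h, hh, rfl⟩ := hu
      exact ⟨c, h, hh, fun _ => hc, by rw [hgu, heq]⟩
    · refine ⟨0, τ ^ (m j - m j₁ - 1).toNat * u, mul_mem (pow_mem hτ.mem_B _) (hu.mem_B hτ),
        fun h => absurd hlt (by rw [h]; exact lt_irrefl _), ?_⟩
      rw [hgu, map_zero, zero_add, ← mul_assoc, ← mul_assoc]
      congr 1
      rw [← zpow_natCast, ← zpow_add_one₀ hτ.1, ← zpow_add₀ hτ.1]
      congr 1
      omega
  choose c h hh hc hgc using hform
  refine ⟨c, ⟨j₁, hc j₁ rfl⟩, ?_⟩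
  have h1 : ∑ j, (algebraMap K L (c j) + τ * h j) * r j = 0 := by
    have h2 : τ ^ m j₁ * ∑ j, (algebraMap K L (c j) + τ * h j) * r j = 0 := by
      rw [← hsum, Finset.mul_sum]
      exact Finset.sum_congr rfl fun j _ => by rw [hgc j, mul_assoc]
    exact (mul_eq_zero.1 h2).resolve_left (zpow_ne_zero _ hτ.1)
  have h3 : ∑ j, c j • r j = -(τ * ∑ j, h j * r j) := by
    rw [eq_neg_iff_add_eq_zero, ← h1, Finset.mul_sum, ← Finset.sum_add_distrib]
    exact Finset.sum_congr rfl fun j _ => by rw [Algebra.smul_def]; ring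
  change (∑ j, c j • r j) * τ⁻¹ ∈ 𝒱.B
  have h4 : (∑ j, c j • r j) * τ⁻¹ = -∑ j, h j * r j := by
    rw [h3]
    have := hτ.1
    field_simp
  rw [h4]
  exact neg_mem (sum_mem fun j _ => mul_mem (hh j) (hRB _ (hr j)))

end Fam

end Tower

end

section

open Polynomial

namespace Tower

variable {K L : Type*} [Field K] [Field L] [Algebra K L]

/-- The function `z ^ q + z`. -/
def T {L : Type*} [Field L] (q : ℕ) (z : L) : L := z ^ q + z

/-- The function `z ^ q / (z ^ (q - 1) + 1)`. -/
def phi {L : Type*} [Field L] (q : ℕ) (z : L) : L := (T q z⁻¹)⁻¹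

/-- The polynomial `X ^ q + X`. -/
noncomputable def TP (K : Type*) [Field K] (q : ℕ) : K[X] := X ^ q + X

lemma aeval_TP (q : ℕ) (z : L) : aeval z (TP K q) = T q z := by simp [TP, T]

lemma TP_monic {q : ℕ} (hq : 2 ≤ q) : (TP K q).Monic := by
  refine monic_X_pow_add ?_
  rw [degree_X]; exact_mod_cast hq

lemma TP_natDegree {q : ℕ} (hq : 2 ≤ q) : (TP K q).natDegree = q := by
  unfold TP
  rw [natDegree_add_eq_left_of_natDegree_lt] <;> simp; omega

lemma T_zero {q : ℕ} (hq : 2 ≤ q) : T q (0 : L) = 0 := by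
  simp [T]; omega

lemma T_eq_mul {q : ℕ} (hq : 2 ≤ q) (z : L) : T q z = z * (z ^ (q - 1) + 1) := by
  rw [T, mul_add, mul_one, ← pow_succ', Nat.sub_add_cancel (by omega)]

lemma phi_mul {q : ℕ} (hq : 2 ≤ q) {z : L} (hz : T q z ≠ 0) :
    phi q z * (z ^ (q - 1) + 1) = z ^ q := by
  rw [T_eq_mul hq] at hz
  have h0 := left_ne_zero_of_mul hz
  have h1 := right_ne_zero_of_mul hz
  rw [phi, T_eq_mul hq]
  have h2 : z⁻¹ * (z⁻¹ ^ (q - 1) + 1) = (z ^ (q - 1) + 1) / z ^ q := by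
    obtain ⟨m, rfl⟩ : ∃ m, q = m + 1 := ⟨q - 1, by omega⟩
    rw [Nat.add_sub_cancel, inv_pow]
    field_simp
    ring
  rw [h2, inv_div, div_mul_cancel₀ _ h1]

section Local

variable {V : ValuationSubring L} {q : ℕ}

lemma mem_of_T_mem (hq : 2 ≤ q) (hK : ∀ c : K, algebraMap K L c ∈ V) {z : L} (h : T q z ∈ V) :
    z ∈ V := by
  refine mem_of_aeval_mem hK (TP_monic hq) (by rw [TP_natDegree hq]; omega) ?_
  rwa [aeval_TP]

lemma val_mul_lt_one' {w h : L} (hw : V.valuation w < 1) (hh : h ∈ V) :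
    V.valuation (h * w) < 1 := by
  rw [mul_comm]; exact val_mul_lt_one hw hh

lemma mem_of_val_lt_one {w : L} (hw : V.valuation w < 1) : w ∈ V :=
  (V.valuation_le_one_iff _).1 hw.le

lemma val_pow_add_one (hq : 2 ≤ q) {w : L} (hw : V.valuation w < 1) :
    V.valuation (w ^ (q - 1) + 1) = 1 := by
  rw [add_comm]
  refine val_one_add ?_
  obtain ⟨m, rfl⟩ : ∃ m, q = m + 2 := ⟨q - 2, by omega⟩
  rw [show m + 2 - 1 = m + 1 by omega, pow_succ]
  exact val_mul_lt_one' hw (V.toSubring.pow_mem (mem_of_val_lt_one hw) _)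

lemma T_inv_sub_mem (hq : 2 ≤ q) {w : L} (hw : V.valuation w < 1) : (T q w)⁻¹ - w⁻¹ ∈ V := by
  by_cases h0 : w = 0
  · subst h0; simp [T_zero hq, V.zero_mem]
  have h1 := val_pow_add_one hq hw
  have h2 : w ^ (q - 1) + 1 ≠ 0 := fun h => by simp [h] at h1
  have : (T q w)⁻¹ - w⁻¹ = -(w ^ (q - 2) * (w ^ (q - 1) + 1)⁻¹) := by
    rw [T_eq_mul hq]
    obtain ⟨m, rfl⟩ : ∃ m, q = m + 2 := ⟨q - 2, by omega⟩
    rw [show m + 2 - 1 = m + 1 by omega, Nat.add_sub_cancel] at *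
    field_simp
    ring
  rw [this]
  exact V.neg_mem _ (V.mul_mem _ _ (V.toSubring.pow_mem (mem_of_val_lt_one hw) _)
    (inv_mem_of_val_eq_one h1))

lemma phi_sub_mem (hq : 2 ≤ q) {z : L} (hz : z ∉ V) : phi q z - z ∈ V := by
  have := T_inv_sub_mem hq (val_lt_one_of_inv_notMem hz)
  rwa [inv_inv] at this

lemma phi_add_mem (hq : 2 ≤ q) (hadd : ∀ u v : L, (u + v) ^ q = u ^ q + v ^ q) {z ω : L}
    (hω : T q ω = 0) (hωV : ω ∈ V) (hz : V.valuation (z - ω) < 1) (hT : T q z ≠ 0) :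
    phi q z + ω ^ 2 * (T q z)⁻¹ ∈ V := by
  have hz0 : z ≠ 0 := by rintro rfl; exact hT (T_zero hq)
  have h0 := hT
  rw [T_eq_mul hq] at h0
  have hu := right_ne_zero_of_mul h0
  have hzV : z ∈ V := by
    have := V.add_mem _ _ (mem_of_val_lt_one hz) hωV
    rwa [sub_add_cancel] at this
  have h1 := val_pow_add_one hq hz
  have h2 : (z - ω) ^ (q - 1) + 1 ≠ 0 := fun h => by simp [h] at h1
  have hTz : T q z = (z - ω) * ((z - ω) ^ (q - 1) + 1) := by
    rw [← T_eq_mul hq]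
    have : z = (z - ω) + ω := by ring
    conv_lhs => rw [this, T, hadd]
    have hω' : ω ^ q = -ω := eq_neg_of_add_eq_zero_left hω
    rw [hω', T]; ring
  have hd : z - ω ≠ 0 := fun h => hT (by rw [hTz, h, zero_mul])
  have key : phi q z + ω ^ 2 * (T q z)⁻¹ = z - (z + ω) * ((z - ω) ^ (q - 1) + 1)⁻¹ := by
    have h3 : phi q z = z - z ^ 2 * (T q z)⁻¹ := by
      have := phi_mul hq hT
      have h4 : phi q z = z ^ q / (z ^ (q - 1) + 1) := by rw [eq_div_iff hu, this]
      rw [h4, T_eq_mul hq]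
      obtain ⟨m, rfl⟩ : ∃ m, q = m + 1 := ⟨q - 1, by omega⟩
      rw [Nat.add_sub_cancel] at *
      field_simp
      ring
    rw [h3, hTz]
    field_simp
    ring
  rw [key]
  exact V.sub_mem hzV (V.mul_mem _ _ (V.add_mem _ _ hzV hωV) (inv_mem_of_val_eq_one h1))

lemma phi_mem (hq : 2 ≤ q) {z : L} (hz : z ∈ V) (hu : V.valuation (z ^ (q - 1) + 1) = 1) :
    phi q z ∈ V := by
  by_cases hT : T q z = 0
  · have h1 : z ^ (q - 1) + 1 ≠ 0 := fun h => by simp [h] at hu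
    have hz0 : z = 0 := by
      rw [T_eq_mul hq] at hT
      exact (mul_eq_zero.1 hT).resolve_right h1
    rw [hz0, phi, inv_zero, T_zero hq, inv_zero]; exact V.zero_mem
  have h1 : z ^ (q - 1) + 1 ≠ 0 := fun h => by simp [h] at hu
  have : phi q z = z ^ q * (z ^ (q - 1) + 1)⁻¹ := by
    rw [eq_mul_inv_iff_mul_eq₀ h1, phi_mul hq hT]
  rw [this]
  exact V.mul_mem _ _ (V.toSubring.pow_mem hz _) (inv_mem_of_val_eq_one hu)

lemma val_lt_one_of_phi (hq : 2 ≤ q) {z : L} (hT : T q z ≠ 0) (h : V.valuation (phi q z) < 1) :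
    V.valuation z < 1 := by
  have hz : z ∈ V := by
    by_contra hz
    have := V.sub_mem (mem_of_val_lt_one h) (phi_sub_mem hq hz)
    rw [sub_sub_cancel] at this
    exact hz this
  have h1 : V.valuation (z ^ q) < 1 := by
    rw [← phi_mul hq hT]
    exact val_mul_lt_one h (V.add_mem _ _ (V.toSubring.pow_mem hz _) V.one_mem)
  refine lt_of_le_of_ne ((V.valuation_le_one_iff _).2 hz) fun he => ?_
  rw [map_pow, he, one_pow] at h1
  exact lt_irrefl _ h1

end Local

/-- A finite piece of the tower. -/
structure Tow (K : Type*) {L : Type*} [Field K] [Field L] [Algebra K L] (q i : ℕ) (x : ℕ → L)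
    (Ω : Finset K) : Prop where
  two_le : 2 ≤ q
  add_pow : ∀ u v : L, (u + v) ^ q = u ^ q + v ^ q
  card : Ω.card = q
  zero_mem : 0 ∈ Ω
  prod : ∀ z : L, T q z = ∏ ω ∈ Ω, (z - algebraMap K L ω)
  step : ∀ l, 1 ≤ l → l < i → T q (x (l + 1)) = phi q (x l)
  trans : Transcendental K (x 1)

namespace Tow

variable {q i : ℕ} {x : ℕ → L} {Ω : Finset K}

lemma mono (h : Tow K q i x Ω) {j : ℕ} (hj : j ≤ i) : Tow K q j x Ω :=
  { h with step := fun l h1 h2 => h.step l h1 (h2.trans_le hj) }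

lemma T_root (h : Tow K q i x Ω) {ω : K} (hω : ω ∈ Ω) : T q (algebraMap K L ω) = 0 := by
  rw [h.prod]
  exact Finset.prod_eq_zero hω (sub_self _)

lemma isAlgebraic_of_T (h : Tow K q i x Ω) {z : L} (hz : IsAlgebraic K (T q z)) :
    IsAlgebraic K z := by
  have hm := TP_monic (K := K) h.two_le
  have := h.two_le
  refine IsAlgebraic.of_aeval (TP K q) (by rw [TP_natDegree h.two_le]; omega) ?_
    (by rwa [aeval_TP])
  rw [hm.leadingCoeff]; exact one_mem _

lemma isAlgebraic_of_phi (h : Tow K q i x Ω) {z : L} (hz : IsAlgebraic K (phi q z)) :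
    IsAlgebraic K z := by
  rw [phi, IsAlgebraic.inv_iff] at hz
  exact IsAlgebraic.inv_iff.1 (h.isAlgebraic_of_T hz)

lemma trans_x (h : Tow K q i x Ω) {l : ℕ} (hl : 1 ≤ l) (hli : l ≤ i) :
    Transcendental K (x l) := by
  induction l, hl using Nat.le_induction with
  | base => exact h.trans
  | succ l hl ih =>
    intro halg
    refine ih (by omega) (h.isAlgebraic_of_phi ?_)
    rw [← h.step l hl (by omega), ← aeval_TP (K := K)]
    exact isAlgebraic_iff_isIntegral.2
      (aeval_mem_of_mem (S := integralClosure K L) (isAlgebraic_iff_isIntegral.1 halg) _)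

lemma T_ne_zero (h : Tow K q i x Ω) {l : ℕ} (hl : 1 ≤ l) (hli : l ≤ i) : T q (x l) ≠ 0 :=
  fun h0 => h.trans_x hl hli (h.isAlgebraic_of_T (by rw [h0]; exact isAlgebraic_zero))

lemma x_ne_zero (h : Tow K q i x Ω) {l : ℕ} (hl : 1 ≤ l) (hli : l ≤ i) : x l ≠ 0 :=
  fun h0 => h.T_ne_zero hl hli (by rw [h0, T_zero h.two_le])

lemma phi_ne_zero (h : Tow K q i x Ω) {l : ℕ} (hl : 1 ≤ l) (hli : l ≤ i) : phi q (x l) ≠ 0 :=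
  fun h0 => h.trans_x hl hli (h.isAlgebraic_of_phi (by rw [h0]; exact isAlgebraic_zero))

variable {V : ValuationSubring L}

/-- Either everything is finite, or some `x t` reduces to a nonzero root of `z ^ q + z`. -/
lemma finite_or_root (h : Tow K q i x Ω) (hV : Adm K (x 1) V) :
    (∀ l, 1 ≤ l → l ≤ i → phi q (x l) ∈ V) ∨
      ∃ t, 1 ≤ t ∧ t ≤ i ∧ ∃ ω ∈ Ω, ω ≠ 0 ∧ V.valuation (x t - algebraMap K L ω) < 1 := by
  by_contra! hcon
  obtain ⟨⟨l₀, hl₀, hl₀i, hphi⟩, hno⟩ := hcon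
  have key' : ∀ l, 1 ≤ l → l ≤ i → x l ∈ V → phi q (x l) ∈ V := by
    intro l hl hi hx
    refine phi_mem h.two_le hx ?_
    have hu : x l ^ (q - 1) + 1 ∈ V := V.add_mem _ _ (V.toSubring.pow_mem hx _) V.one_mem
    by_contra hne
    have hlt := lt_of_le_of_ne ((V.valuation_le_one_iff _).2 hu) hne
    have hT : V.valuation (T q (x l)) < 1 := by
      rw [T_eq_mul h.two_le]; exact val_mul_lt_one' hlt hx
    rw [h.prod, map_prod] at hT
    obtain ⟨ω, hω, hωV⟩ : ∃ ω ∈ Ω, V.valuation (x l - algebraMap K L ω) < 1 := by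
      by_contra! hge
      refine absurd hT (not_lt.2 ?_)
      refine Finset.prod_induction _ (fun g => 1 ≤ g) (fun a b ha hb => ?_) le_rfl hge
      calc (1 : V.ValueGroup) = 1 * 1 := (one_mul 1).symm
        _ ≤ a * b := mul_le_mul' ha hb
    have h0 : ω = 0 := by
      by_contra h0
      exact absurd hωV (not_lt.2 (hno l hl hi ω hω h0))
    rw [h0, map_zero, sub_zero] at hωV
    exact hne (val_pow_add_one h.two_le hωV)
  have key : ∀ l, 1 ≤ l → l ≤ i → x l ∈ V ∧ phi q (x l) ∈ V := by
    intro l hl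
    induction l, hl using Nat.le_induction with
    | base => exact fun hi => ⟨hV.2, key' _ le_rfl hi hV.2⟩
    | succ l hl ih =>
      intro hi
      have hx : x (l + 1) ∈ V := by
        refine mem_of_T_mem h.two_le hV.1 ?_
        rw [h.step l hl (by omega)]
        exact (ih (by omega)).2
      exact ⟨hx, key' _ (by omega) hi hx⟩
  exact hphi (key l₀ hl₀ hl₀i).2

lemma val_T_lt_one (h : Tow K q i x Ω) {ω : K} (hω : ω ∈ Ω) {z : L}
    (hz : V.valuation (z - algebraMap K L ω) < 1) : V.valuation (T q z) < 1 := by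
  have h1 : T q z = T q (z - algebraMap K L ω) := by
    conv_lhs => rw [show z = (z - algebraMap K L ω) + algebraMap K L ω by ring, T, h.add_pow]
    have := h.T_root hω
    rw [T] at this
    rw [T, ← add_zero ((z - algebraMap K L ω) ^ q + (z - algebraMap K L ω)), ← this]
    ring
  rw [h1, T_eq_mul h.two_le]
  exact val_mul_lt_one hz
    (V.add_mem _ _ (V.toSubring.pow_mem (mem_of_val_lt_one hz) _) V.one_mem)

lemma val_lt_one (h : Tow K q i x Ω) {t : ℕ} (hti : t ≤ i) {ω : K} (hω : ω ∈ Ω)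
    (hz : V.valuation (x t - algebraMap K L ω) < 1) {l : ℕ} (hl : 1 ≤ l) (hlt : l < t) :
    V.valuation (x l) < 1 := by
  have key : ∀ d, ∀ l, 1 ≤ l → l + d + 1 = t → V.valuation (x l) < 1 := by
    intro d
    induction d with
    | zero =>
      intro l hl hlt
      refine val_lt_one_of_phi h.two_le (h.T_ne_zero hl (by omega)) ?_
      rw [← h.step l hl (by omega), show l + 1 = t by omega]
      exact h.val_T_lt_one hω hz
    | succ d ih =>
      intro l hl hlt
      have h1 := ih (l + 1) (by omega) (by omega)
      refine val_lt_one_of_phi h.two_le (h.T_ne_zero hl (by omega)) ?_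
      rw [← h.step l hl (by omega)]
      refine h.val_T_lt_one h.zero_mem ?_
      rwa [map_zero, sub_zero]
  exact key (t - l - 1) l hl (by omega)

lemma T_add (h : Tow K q i x Ω) (u v : L) : T q (u + v) = T q u + T q v := by
  rw [T, T, T, h.add_pow]; ring

lemma T_sub (h : Tow K q i x Ω) (u v : L) : T q (u - v) = T q u - T q v := by
  rw [eq_sub_iff_add_eq, ← h.T_add, sub_add_cancel]

lemma T_mul (κ : L) (hκ : κ ^ q = κ) (z : L) : T q (κ * z) = κ * T q z := by
  rw [T, T, mul_pow, hκ]; ring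

/-- Reflection of the tower around the place where it is ramified. -/
lemma phi_sub_mem_of_root (h : Tow K q i x Ω) (hV : Adm K (x 1) V) {t : ℕ} {ω : K} (hω : ω ∈ Ω)
    (hω0 : ω ≠ 0) (hz : V.valuation (x t - algebraMap K L ω) < 1) {m : ℕ} :
    m + 2 ≤ t → t + m ≤ i →
      phi q (x (t + m)) - T q (-algebraMap K L ω ^ 2 * (x (t - m - 1))⁻¹) ∈ V := by
  have hq := h.two_le
  have hωq : algebraMap K L ω ^ q = -algebraMap K L ω :=
    eq_neg_of_add_eq_zero_left (h.T_root hω)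
  have hκ : (-algebraMap K L ω ^ 2) ^ q = -algebraMap K L ω ^ 2 := by
    have h1 : ∀ z : L, (-z) ^ q = -z ^ q := fun z => by
      have := h.add_pow (-z) z
      rw [neg_add_cancel, zero_pow (by omega)] at this
      exact eq_neg_of_add_eq_zero_left this.symm
    rw [h1, ← pow_mul, mul_comm 2 q, pow_mul, hωq]
    ring
  have hκV : -algebraMap K L ω ^ 2 ∈ V := V.neg_mem _ (V.toSubring.pow_mem (hV.1 _) 2)
  induction m with
  | zero =>
    intro ht hti
    have h1 := phi_add_mem hq h.add_pow (h.T_root hω) (hV.1 ω) hz (h.T_ne_zero (by omega) hti)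
    have h2 := h.step (t - 1) (by omega) (by omega)
    rw [Nat.sub_add_cancel (by omega)] at h2
    have h3 : (phi q (x (t - 1)))⁻¹ = T q (x (t - 1))⁻¹ := inv_inv _
    rw [h2, h3] at h1
    rw [T_mul _ hκ, add_zero, Nat.sub_zero, neg_mul, sub_neg_eq_add]
    exact h1
  | succ m ih =>
    intro ht hti
    have h1 := ih (by omega) (by omega)
    have hl := h.val_lt_one (by omega) hω hz (l := t - m - 1) (by omega) (by omega)
    have hx0 := h.x_ne_zero (l := t - m - 1) (by omega) (by omega)
    have h2 : x (t + m + 1) - -algebraMap K L ω ^ 2 * (x (t - m - 1))⁻¹ ∈ V := by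
      refine mem_of_T_mem hq hV.1 ?_
      rw [h.T_sub, h.step (t + m) (by omega) (by omega)]
      exact h1
    have h3 : x (t + m + 1) ∉ V := fun h3 => by
      have h4 := V.sub_mem h3 h2
      rw [sub_sub_cancel] at h4
      have h5 : (x (t - m - 1))⁻¹ ∈ V := by
        have h6 : (-algebraMap K L ω ^ 2)⁻¹ ∈ V := by
          rw [inv_neg, ← inv_pow, ← map_inv₀]
          exact V.neg_mem _ (V.toSubring.pow_mem (hV.1 _) 2)
        have h7 : (-algebraMap K L ω ^ 2) ≠ 0 := by simpa using hω0
        have := V.mul_mem _ _ h6 h4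
        rwa [inv_mul_cancel_left₀ h7] at this
      have h8 := val_mul_lt_one hl h5
      rw [mul_inv_cancel₀ hx0, map_one] at h8
      exact lt_irrefl _ h8
    have h4 := phi_sub_mem hq h3
    have h5 := T_inv_sub_mem hq hl
    have h6 := h.step (t - m - 2) (by omega) (by omega)
    rw [show t - m - 2 + 1 = t - m - 1 by omega] at h6
    rw [h6, phi, inv_inv] at h5
    rw [T_mul _ hκ, show t - (m + 1) - 1 = t - m - 2 by omega, ← add_assoc]
    have h7 := V.sub_mem (V.add_mem _ _ h4 h2) (V.mul_mem _ _ hκV h5)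
    rw [ValuationSubring.mem_toSubring] at h7
    convert h7 using 1
    ring

end Tow

end Tower

end

section

open Polynomial

namespace Tower

variable {K L : Type*} [Field K] [Field L] [Algebra K L]

namespace Fam

variable {𝒱 : Fam K L} {τ : L}

lemma UE.aeval (hτ : 𝒱.Small τ) {p : K[X]} (hp : p ≠ 0) : ∃ n : ℤ, 𝒱.UE τ n (aeval τ p) := by
  obtain ⟨p', hp', hnd⟩ := Polynomial.exists_eq_pow_rootMultiplicity_mul_and_not_dvd p hp 0
  rw [map_zero, sub_zero] at hp' hnd
  refine ⟨(p.rootMultiplicity 0 : ℕ), Polynomial.aeval τ p',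
    ⟨p'.coeff 0, fun h => hnd (X_dvd_iff.2 h), Polynomial.aeval τ p'.divX,
      aeval_mem_of_mem hτ.mem_B _, ?_⟩, ?_⟩
  · conv_lhs => rw [← p'.divX_mul_X_add]
    rw [map_add, map_mul, aeval_X, aeval_C]; ring
  · conv_lhs => rw [hp']
    rw [map_mul, map_pow, aeval_X, zpow_natCast]

lemma Unif.base (hτ : 𝒱.Small τ) : 𝒱.Unif (IntermediateField.adjoin K {τ}) τ := by
  intro f hf hf0
  obtain ⟨r, s, rfl⟩ := (IntermediateField.mem_adjoin_simple_iff K _).1 hf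
  have hr : r ≠ 0 := by rintro rfl; simp at hf0
  have hs : s ≠ 0 := by rintro rfl; simp at hf0
  obtain ⟨m, hm⟩ := UE.aeval hτ hr
  obtain ⟨n, hn⟩ := UE.aeval hτ hs
  exact ⟨_, by rw [div_eq_mul_inv]; exact hm.mul hτ (hn.inv hτ)⟩

lemma Unif.mono {F F' : IntermediateField K L} (h : 𝒱.Unif F' τ) (hF : F ≤ F') : 𝒱.Unif F τ :=
  fun f hf => h f (hF hf)

lemma isU_pow_add_one {q : ℕ} (hq : 2 ≤ q) (hτ : 𝒱.Small τ) : 𝒱.IsU τ (τ ^ (q - 1) + 1) := by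
  obtain ⟨m, rfl⟩ : ∃ m, q = m + 2 := ⟨q - 2, by omega⟩
  rw [show m + 2 - 1 = m + 1 by omega, add_comm, pow_succ']
  exact isU_one_add (pow_mem hτ.mem_B _)

lemma Small.T {q : ℕ} (hq : 2 ≤ q) (hτ : 𝒱.Small τ) : 𝒱.Small (T q τ) := by
  rw [T_eq_mul hq]; exact hτ.of_isU (isU_pow_add_one hq hτ)

lemma Unif.T {q : ℕ} (hq : 2 ≤ q) (hτ : 𝒱.Small τ) {F : IntermediateField K L}
    (h : 𝒱.Unif F τ) : 𝒱.Unif F (T q τ) := by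
  rw [T_eq_mul hq]; exact h.mul_isU hτ (isU_pow_add_one hq hτ)

lemma inv_add_const {w : L} (hw : w ≠ 0) (b : K) (h : w + algebraMap K L b ≠ 0) :
    (w + algebraMap K L b)⁻¹ = w⁻¹ * (1 + w⁻¹ * algebraMap K L b)⁻¹ := by
  have : 1 + w⁻¹ * algebraMap K L b ≠ 0 := fun h0 => h (by field_simp at h0; simpa using h0)
  field_simp

lemma Small.inv_add_const {w : L} (hw : 𝒱.Small w⁻¹) (b : K) :
    𝒱.Small (w + algebraMap K L b)⁻¹ := by
  have hw0 : w ≠ 0 := fun h => hw.1 (by rw [h, inv_zero])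
  have hB := 𝒱.B.algebraMap_mem b
  have h1 := hw.ne_zero hB
  rw [Fam.inv_add_const hw0 b fun h0 => h1 (by field_simp; rw [h0, mul_zero])]
  exact hw.of_isU ((isU_one_add hB).inv hw)

lemma Unif.inv_add_const {F : IntermediateField K L} {w : L} (hw : 𝒱.Small w⁻¹)
    (h : 𝒱.Unif F w⁻¹) (b : K) : 𝒱.Unif F (w + algebraMap K L b)⁻¹ := by
  have hw0 : w ≠ 0 := fun h => hw.1 (by rw [h, inv_zero])
  have hB := 𝒱.B.algebraMap_mem b
  have h1 := hw.ne_zero hB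
  rw [Fam.inv_add_const hw0 b fun h0 => h1 (by field_simp; rw [h0, mul_zero])]
  exact h.mul_isU hw ((isU_one_add hB).inv hw)

/-- Elements of `F` finite at a place with uniformizer `τ` are constant modulo `τ`. -/
lemma Unif.exists_const {F : IntermediateField K L} (hτ : 𝒱.Small τ) (h : 𝒱.Unif F τ) {f : L}
    (hf : f ∈ F) (hfB : f ∈ 𝒱.B) : ∃ c : K, ∃ e ∈ 𝒱.B, f = algebraMap K L c + τ * e := by
  by_cases hf0 : f = 0
  · exact ⟨0, 0, zero_mem _, by simp [hf0]⟩
  obtain ⟨n, g, hg, hfg⟩ := h f hf hf0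
  rcases lt_trichotomy n 0 with hn | rfl | hn
  · exfalso
    obtain ⟨m, hm⟩ : ∃ m : ℕ, n = -(m + 1 : ℕ) := ⟨(-n - 1).toNat, by omega⟩
    have hg' : g = τ * (τ ^ m * f) := by
      rw [hfg, hm, zpow_neg, zpow_natCast, pow_succ]
      have := hτ.1
      field_simp
    obtain ⟨V, hV⟩ := 𝒱.nonempty
    have h1 := hτ.2 V hV
    have h2 : V.valuation (g * g⁻¹) < 1 := by
      nth_rw 1 [hg']
      rw [mul_assoc]
      exact val_mul_lt_one h1 (mul_mem (mul_mem (pow_mem hτ.mem_B m) hfB)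
        ((hg.inv hτ).mem_B hτ) V hV)
    rw [mul_inv_cancel₀ (hg.ne_zero hτ), map_one] at h2
    exact lt_irrefl _ h2
  · obtain ⟨c, -, e, he, rfl⟩ := hg
    exact ⟨c, e, he, by rw [hfg, zpow_zero, one_mul]⟩
  · obtain ⟨m, rfl⟩ : ∃ m : ℕ, n = (m + 1 : ℕ) := ⟨(n - 1).toNat, by omega⟩
    exact ⟨0, τ ^ m * g, mul_mem (pow_mem hτ.mem_B _) (hg.mem_B hτ), by
      rw [hfg, map_zero, zero_add, zpow_natCast, pow_succ']; ring⟩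

end Fam

/-- The field generated by the members of the tower with indices in `[t, i]`. -/
def fld (K : Type*) {L : Type*} [Field K] [Field L] [Algebra K L] (x : ℕ → L) (t i : ℕ) :
    IntermediateField K L :=
  IntermediateField.adjoin K (x '' Set.Icc t i)

lemma mem_fld {x : ℕ → L} {t i l : ℕ} (h : t ≤ l) (h' : l ≤ i) : x l ∈ fld K x t i :=
  IntermediateField.subset_adjoin K _ ⟨l, ⟨h, h'⟩, rfl⟩

lemma fld_self (x : ℕ → L) (t : ℕ) : fld K x t t = IntermediateField.adjoin K {x t} := by
  rw [fld, Set.Icc_self, Set.image_singleton]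

lemma fld_succ (x : ℕ → L) {t i : ℕ} (h : t ≤ i + 1) :
    fld K x t (i + 1) = fld K x t i ⊔ IntermediateField.adjoin K {x (i + 1)} := by
  rw [fld, fld, ← IntermediateField.adjoin_union, ← Set.image_singleton, ← Set.image_union]
  congr 2
  ext j
  simp only [Set.mem_Icc, Set.mem_union, Set.mem_singleton_iff]
  omega

lemma fld_succ_left (x : ℕ → L) {t i : ℕ} (h : t ≤ i) :
    fld K x t i = fld K x (t + 1) i ⊔ IntermediateField.adjoin K {(x t)⁻¹} := by
  have h1 : IntermediateField.adjoin K {(x t)⁻¹} = IntermediateField.adjoin K {x t} := by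
    refine le_antisymm ?_ ?_ <;> rw [IntermediateField.adjoin_simple_le_iff]
    · exact inv_mem (IntermediateField.mem_adjoin_simple_self K _)
    · simpa using inv_mem (IntermediateField.mem_adjoin_simple_self K (x t)⁻¹)
  rw [h1, fld, fld, ← IntermediateField.adjoin_union, ← Set.image_singleton, ← Set.image_union]
  congr 2
  ext j
  simp only [Set.mem_Icc, Set.mem_union, Set.mem_singleton_iff]
  omega

namespace Tow

variable {q i : ℕ} {x : ℕ → L} {Ω : Finset K}

lemma T_mem_fld {F : IntermediateField K L} {z : L} (hz : z ∈ F) : T q z ∈ F :=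
  F.add_mem (pow_mem hz q) hz

lemma phi_mem_fld {F : IntermediateField K L} {z : L} (hz : z ∈ F) : phi q z ∈ F :=
  F.inv_mem (T_mem_fld (F.inv_mem hz))

/-- Uniformizers propagate up the tower at the poles. -/
lemma unif (h : Tow K q i x Ω) {𝒱 : Fam K L} {t : ℕ} (ht : 1 ≤ t)
    (hs : 𝒱.Small (phi q (x t))⁻¹)
    (hu : 𝒱.Unif (IntermediateField.adjoin K {x t}) (phi q (x t))⁻¹) {l : ℕ} (htl : t ≤ l)
    (hl : l ≤ i) : 𝒱.Small (phi q (x l))⁻¹ ∧ 𝒱.Unif (fld K x t l) (phi q (x l))⁻¹ := by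
  have hq := h.two_le
  have hm := TP_monic (K := K) hq
  have hd := TP_natDegree (K := K) hq
  induction l, htl using Nat.le_induction with
  | base => exact ⟨hs, by rwa [fld_self]⟩
  | succ l htl ih =>
    obtain ⟨ih1, ih2⟩ := ih (by omega)
    have hst := h.step l (by omega) (by omega)
    have h1 : aeval (x (l + 1)) (TP K q) = phi q (x l) := by rw [aeval_TP, hst]
    rw [← h1] at ih1 ih2
    have h2 := (Fam.small_inv_of_aeval hm ih1).1
    have h3 : 𝒱.Unif (fld K x t (l + 1)) (x (l + 1))⁻¹ := by
      refine Fam.Unif.step hm ih1 ih2 ?_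
      rw [fld_succ x (by omega)]
      refine span_adjoin_simple _ hm (by omega) ?_
      rw [h1]
      exact phi_mem_fld (mem_fld htl le_rfl)
    rw [phi, inv_inv]
    exact ⟨h2.T hq, h3.T hq h2⟩

/-- The family of a single valuation ring. -/
def famInf (O : ValuationSubring L) (hO : ∀ c : K, algebraMap K L c ∈ O) : Fam K L where
  mem V := V = O
  const := by rintro V rfl; exact hO
  nonempty := ⟨O, rfl⟩

lemma unif_inf (h : Tow K q i x Ω) {𝒱 : Fam K L} (hx : 𝒱.Small (x 1)⁻¹) {l : ℕ}
    (hl1 : 1 ≤ l) (hl : l ≤ i) :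
    𝒱.Small (phi q (x l))⁻¹ ∧ 𝒱.Unif (fld K x 1 l) (phi q (x l))⁻¹ := by
  refine h.unif le_rfl ?_ ?_ hl1 hl <;> rw [phi, inv_inv]
  · exact hx.T h.two_le
  · refine Fam.Unif.T h.two_le hx ((Fam.Unif.base hx).mono ?_)
    rw [IntermediateField.adjoin_simple_le_iff]
    simpa using inv_mem (IntermediateField.mem_adjoin_simple_self K (x 1)⁻¹)

lemma spanLE (h : Tow K q i x Ω) {t : ℕ} (ht : 1 ≤ t) (hti : t ≤ i) :
    SpanLE (fld K x t i) (fld K x 1 i) (q ^ (t - 1)) := by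
  have hq := h.two_le
  induction t, ht using Nat.le_induction with
  | base => simpa using SpanLE.refl _
  | succ t ht ih =>
    have h1 : SpanLE (fld K x (t + 1) i) (fld K x t i) q := by
      have := spanLE_adjoin_simple (fld K x (t + 1) i) (TP_monic (K := K) hq)
        (by rw [TP_natDegree hq]; omega) (y := (x t)⁻¹) (by
          rw [aeval_TP]
          have h2 : T q (x t)⁻¹ = (T q (x (t + 1)))⁻¹ := by
            rw [h.step t ht (by omega), phi, inv_inv]
          rw [h2]
          exact IntermediateField.inv_mem _ (T_mem_fld (mem_fld le_rfl hti)))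
      rwa [TP_natDegree hq, ← fld_succ_left x (by omega)] at this
    have := h1.trans (ih (by omega))
    rwa [← pow_succ', show t - 1 + 1 = t + 1 - 1 by omega] at this

end Tow

end Tower

end

section

open Polynomial

namespace Tower

variable {K L : Type*} [Field K] [Field L] [Algebra K L]

namespace Tow

variable {q i : ℕ} {x : ℕ → L} {Ω : Finset K}

lemma ramified (h : Tow K q i x Ω) {𝒱 : Fam K L} {t : ℕ} (ht : 1 ≤ t) (hti : t ≤ i) {ω : K}
    (hω : ω ∈ Ω) (hω0 : ω ≠ 0) (hδ : 𝒱.Small (x t - algebraMap K L ω)) :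
    𝒱.Small (phi q (x t))⁻¹ ∧
      𝒱.Unif (IntermediateField.adjoin K {x t}) (phi q (x t))⁻¹ := by
  have hq := h.two_le
  set δ := x t - algebraMap K L ω with hδd
  have hz : 𝒱.IsU δ (x t) := ⟨ω, hω0, 1, one_mem _, by rw [hδd]; ring⟩
  have hT : T q (x t) = δ * (δ ^ (q - 1) + 1) := by
    rw [← T_eq_mul hq, hδd, h.T_sub, h.T_root hω, sub_zero]
  have hphi : (phi q (x t))⁻¹ = δ * ((δ ^ (q - 1) + 1) * (x t ^ ((q : ℤ) + 1))⁻¹) := by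
    have h1 := phi_mul hq (h.T_ne_zero ht hti)
    have h2 := h.phi_ne_zero ht hti
    have h3 := h.x_ne_zero ht hti
    rw [← mul_assoc, ← hT, T_eq_mul hq, zpow_add_one₀ h3, zpow_natCast, ← h1]
    have h4 : x t ^ (q - 1) + 1 ≠ 0 := fun h0 =>
      h.T_ne_zero ht hti (by rw [T_eq_mul hq, h0, mul_zero])
    field_simp
  have hu : 𝒱.IsU δ ((δ ^ (q - 1) + 1) * (x t ^ ((q : ℤ) + 1))⁻¹) :=
    (Fam.isU_pow_add_one hq hδ).mul hδ ((hz.zpow hδ _).inv hδ)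
  rw [hphi]
  refine ⟨hδ.of_isU hu, Fam.Unif.mul_isU hδ hu ((Fam.Unif.base hδ).mono ?_)⟩
  rw [IntermediateField.adjoin_simple_le_iff]
  have h1 := IntermediateField.add_mem _ (IntermediateField.mem_adjoin_simple_self K δ)
    ((IntermediateField.adjoin K {δ}).algebraMap_mem ω)
  rwa [hδd, sub_add_cancel] at h1

lemma codim_ramified (h : Tow K q i x Ω) {t : ℕ} (ht : 1 ≤ t) (hti : t ≤ i) {ω : K}
    (hω : ω ∈ Ω) (hω0 : ω ≠ 0) : ∃ W : Submodule K L,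
      CodimLE (Subalgebra.toSubmodule (reg (x 1) (fld K x 1 i))) W (q ^ (t - 1)) ∧
      ∀ V, Adm K (x 1) V → V.valuation (x t - algebraMap K L ω) < 1 →
        ∀ r ∈ W, r * phi q (x i) ∈ V := by
  by_cases hne : ∃ V : ValuationSubring L, (∀ c : K, algebraMap K L c ∈ V) ∧
      V.valuation (x t - algebraMap K L ω) < 1
  · let 𝒱 : Fam K L := ⟨_, fun V hV => hV.1, hne⟩
    have hδ : 𝒱.Small (x t - algebraMap K L ω) :=
      ⟨fun h0 => h.T_ne_zero ht hti (by rw [sub_eq_zero.1 h0, h.T_root hω]), fun V hV => hV.2⟩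
    obtain ⟨h1, h2⟩ := h.ramified ht hti hω hω0 hδ
    obtain ⟨h3, h4⟩ := h.unif ht h1 h2 hti le_rfl
    refine ⟨𝒱.bound (phi q (x i))⁻¹, Fam.codimLE_bound h3 h4 (h.spanLE ht hti)
      (fun r hr => hr.1) fun r hr V hV => hr.2 V ⟨hV.1, ?_⟩, fun V hV hV' r hr => ?_⟩
    · rcases ht.eq_or_lt with rfl | ht
      · have := V.add_mem _ _ (mem_of_val_lt_one hV.2) (hV.1 ω)
        rwa [sub_add_cancel] at this
      · exact mem_of_val_lt_one (h.val_lt_one hti hω hV.2 le_rfl ht)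
    · have := hr V ⟨hV.1, hV'⟩
      rwa [inv_inv] at this
  · refine ⟨⊤, (CodimLE.top _ le_top).mono le_rfl (Nat.zero_le _), fun V hV hV' => ?_⟩
    exact absurd ⟨V, hV.1, hV'⟩ hne

lemma exists_conductor (h : Tow K q i x Ω) : ∃ 𝔯 : Submodule K L,
    (∀ r ∈ 𝔯, r ∈ reg (x 1) (fld K x 1 i)) ∧
    (∃ s : Finset L, s.card ≤ q ^ ((i + 1) / 2) - 1 ∧ (∀ f ∈ s, f ∈ fld K x 1 i) ∧
      ∀ f ∈ reg (x 1) (fld K x 1 i), ∃ r ∈ 𝔯, ∃ c ∈ Submodule.span K (s : Set L), f = r + c) ∧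
    ∀ V, Adm K (x 1) V → ∀ t, 1 ≤ t → 2 * t ≤ i + 1 → ∀ ω ∈ Ω, ω ≠ 0 →
      V.valuation (x t - algebraMap K L ω) < 1 → ∀ r ∈ 𝔯, r * phi q (x i) ∈ V := by
  classical
  set R := Subalgebra.toSubmodule (reg (x 1) (fld K x 1 i)) with hR
  have hex : ∀ a : ℕ × K, ∃ W : Submodule K L, (1 ≤ a.1 → 2 * a.1 ≤ i + 1 → a.2 ∈ Ω → a.2 ≠ 0 →
      CodimLE R W (q ^ (a.1 - 1)) ∧
      ∀ V, Adm K (x 1) V → V.valuation (x a.1 - algebraMap K L a.2) < 1 →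
        ∀ r ∈ W, r * phi q (x i) ∈ V) := fun a => by
    by_cases ha : 1 ≤ a.1 ∧ 2 * a.1 ≤ i + 1 ∧ a.2 ∈ Ω ∧ a.2 ≠ 0
    · obtain ⟨W, hW⟩ := h.codim_ramified ha.1 (by omega) ha.2.2.1 ha.2.2.2
      exact ⟨W, fun _ _ _ _ => hW⟩
    · exact ⟨⊤, fun h1 h2 h3 h4 => absurd ⟨h1, h2, h3, h4⟩ ha⟩
  choose W hW using hex
  set S := Finset.Icc 1 ((i + 1) / 2) ×ˢ (Ω.erase 0) with hS
  have hmem : ∀ a ∈ S, 1 ≤ a.1 ∧ 2 * a.1 ≤ i + 1 ∧ a.2 ∈ Ω ∧ a.2 ≠ 0 := fun a ha => by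
    simp only [hS, Finset.mem_product, Finset.mem_Icc, Finset.mem_erase] at ha
    refine ⟨ha.1.1, by omega, ha.2.2, ha.2.1⟩
  have hcod := CodimLE.biInf S W (fun a => q ^ (a.1 - 1)) fun a ha =>
    (hW a (hmem a ha).1 (hmem a ha).2.1 (hmem a ha).2.2.1 (hmem a ha).2.2.2).1
  have hsum : ∑ a ∈ S, q ^ (a.1 - 1) = q ^ ((i + 1) / 2) - 1 := by
    rw [hS, Finset.sum_product]
    simp only [Finset.sum_const, smul_eq_mul]
    rw [← Finset.mul_sum, Finset.card_erase_of_mem h.zero_mem, h.card]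
    have : ∑ t ∈ Finset.Icc 1 ((i + 1) / 2), q ^ (t - 1) =
        ∑ t ∈ Finset.range ((i + 1) / 2), q ^ t := by
      rw [Finset.range_eq_Ico, Finset.sum_Ico_eq_sum_range, ← Finset.Ico_add_one_right_eq_Icc,
        Finset.sum_Ico_eq_sum_range]
      simp
    have hq := h.two_le
    rw [this]
    have h2 := Nat.geomSum_eq hq ((i + 1) / 2)
    rw [h2, Nat.mul_div_cancel']
    simpa using Nat.sub_dvd_pow_sub_pow q 1 ((i + 1) / 2)
  rw [hsum] at hcod
  obtain ⟨s, hs, hsR, hs'⟩ := hcod.exists_span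
  refine ⟨R ⊓ ⨅ a ∈ S, W a, fun r hr => hr.1, ⟨s, hs, fun f hf => (hsR f hf).1, fun f hf => ?_⟩, ?_⟩
  · obtain ⟨r, hr, c, hc, rfl⟩ := hs' f hf
    exact ⟨r, hr, c, hc, rfl⟩
  · intro V hV t ht1 ht2 ω hω hω0 hval r hr
    have ha : ((t, ω) : ℕ × K) ∈ S := by
      simp only [hS, Finset.mem_product, Finset.mem_Icc, Finset.mem_erase]
      exact ⟨⟨ht1, by omega⟩, hω0, hω⟩
    refine (hW (t, ω) ht1 ht2 hω hω0).2 V hV hval r ?_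
    have : r ∈ ⨅ a ∈ S, W a := hr.2
    simp only [Submodule.mem_iInf] at this
    exact this _ ha

/-- One step of the tower, possibly by a factor of `T`. -/
theorem genusLE_step (h : Tow K q i x Ω) (hi : 1 ≤ i) {O : ValuationSubring L}
    (hO : ∀ c : K, algebraMap K L c ∈ O) (hxO : x 1 ∉ O)
    (halg : AlgOver (x 1) (fld K x 1 i)) {γ : ℕ} (hγ : GenusLE O (x 1) (fld K x 1 i) γ)
    {A B : K[X]} (hA : A.Monic) (hpos : 0 < A.natDegree) (hadd : IsAdditive L A)
    (hAB : ∀ u : L, aeval (aeval u B) A = T q u) {y : L} {b : K}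
    (hy : aeval y A = phi q (x i) + algebraMap K L b) :
    GenusLE O (x 1) (fld K x 1 i ⊔ IntermediateField.adjoin K {y})
      (A.natDegree * γ + (A.natDegree - 1) * (q ^ ((i + 1) / 2) - 1)) := by
  obtain ⟨𝔯, h𝔯, hρ, hloc⟩ := h.exists_conductor
  set F := fld K x 1 i with hF
  have hphiF : phi q (x i) ∈ F := phi_mem_fld (mem_fld hi le_rfl)
  have hψ : aeval y A ∈ F := by rw [hy]; exact F.add_mem hphiF (F.algebraMap_mem b)
  have hA0 : aeval (0 : L) A = 0 := hadd.zero
  refine GenusLE.step hO h.trans (mem_fld le_rfl hi) halg le_sup_left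
    ((le_sup_right : _ ≤ F ⊔ _) (IntermediateField.mem_adjoin_simple_self K y)) hA hadd hψ
    (span_adjoin_simple F hA hpos hψ) hγ 𝔯 h𝔯 hρ ?_ ?_
  · intro V hV
    have hb : ∀ r ∈ 𝔯, r * algebraMap K L b ∈ V := fun r hr =>
      V.mul_mem _ _ ((h𝔯 r hr).2 V hV) (hV.1 b)
    rcases h.finite_or_root hV with hfin | ⟨t, ht, hti, ω, hω, hω0, hval⟩
    · refine ⟨0, F.zero_mem, fun r hr => ?_⟩
      rw [hA0, sub_zero, hy, mul_add]
      exact V.add_mem _ _ (V.mul_mem _ _ ((h𝔯 r hr).2 V hV) (hfin i hi le_rfl)) (hb r hr)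
    · by_cases h2 : 2 * t ≤ i + 1
      · refine ⟨0, F.zero_mem, fun r hr => ?_⟩
        rw [hA0, sub_zero, hy, mul_add]
        exact V.add_mem _ _ (hloc V hV t ht h2 ω hω hω0 hval r hr) (hb r hr)
      · have h3 := h.phi_sub_mem_of_root hV hω hω0 hval (m := i - t) (by omega) (by omega)
        rw [show t + (i - t) = i by omega] at h3
        refine ⟨aeval (-algebraMap K L ω ^ 2 * (x (t - (i - t) - 1))⁻¹) B, ?_, fun r hr => ?_⟩
        · refine aeval_mem_of_mem (S := F.toSubalgebra) ?_ B
          exact F.mul_mem (F.neg_mem (pow_mem (F.algebraMap_mem ω) 2))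
            (F.inv_mem (mem_fld (by omega) (by omega)))
        · rw [hAB, hy, add_sub_right_comm, mul_add]
          exact V.add_mem _ _ (V.mul_mem _ _ ((h𝔯 r hr).2 V hV) h3) (hb r hr)
  · intro l hlF hlO
    have hsm : (famInf O hO).Small (x 1)⁻¹ :=
      ⟨inv_ne_zero fun h0 => hxO (h0 ▸ O.zero_mem), by
        intro V hV; rw [show V = O from hV]; exact val_lt_one_of_inv_notMem hxO⟩
    obtain ⟨h1, h2⟩ := h.unif_inf hsm hi le_rfl
    have h3 := h1.inv_add_const b
    have h4 := h2.inv_add_const h1 b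
    rw [← hy] at h3 h4
    obtain ⟨c, e, he, hl⟩ := h4.exists_const h3 hlF (fun V hV => by rw [show V = O from hV]; exact hlO)
    refine ⟨c, fun j hj => ?_⟩
    have heO : e ∈ O := he O rfl
    rw [hl, add_sub_cancel_left, mul_comm _ e, mul_assoc]
    refine O.mul_mem _ _ heO (mul_pow_mem_of_aeval hO hA ?_ ?_ hj.le)
    · exact h3.mem_B O rfl
    · rw [inv_mul_cancel₀ (fun h0 => h3.1 (by rw [h0, inv_zero]))]; exact O.one_mem

end Tow

end Tower

end

section

open Polynomial

namespace Tower

variable {K L : Type*} [Field K] [Field L] [Algebra K L]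

lemma GenusLE.mono {O : ValuationSubring L} {x : L} {F : IntermediateField K L} {γ γ' : ℕ}
    (h : GenusLE O x F γ) (hγ : γ ≤ γ') : GenusLE O x F γ' := by
  obtain ⟨s, hs, h⟩ := h
  exact ⟨s, hs.trans hγ, h⟩

lemma algOver_iff {x : L} {F : IntermediateField K L} :
    AlgOver x F ↔ ∀ d ∈ F, (let := (aeval x : K[X] →ₐ[K] L).toRingHom.toAlgebra;
      IsAlgebraic K[X] d) := Iff.rfl

lemma AlgOver.adjoin {x : L} {s : Set L} (h : ∀ d ∈ s,
    (let := (aeval x : K[X] →ₐ[K] L).toRingHom.toAlgebra; IsAlgebraic K[X] d)) :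
    AlgOver x (IntermediateField.adjoin K s) := by
  let := (aeval x : K[X] →ₐ[K] L).toRingHom.toAlgebra
  rw [algOver_iff]
  intro d hd
  induction hd using IntermediateField.adjoin_induction with
  | mem d hd => exact h d hd
  | algebraMap c =>
    have : algebraMap K L c = algebraMap K[X] L (C c) := (aeval_C x c).symm
    rw [this]; exact isAlgebraic_algebraMap _
  | add u v _ _ hu hv => exact hu.add hv
  | inv u _ hu => exact hu.inv
  | mul u v _ _ hu hv => exact hu.mul hv

lemma AlgOver.base (x : L) : AlgOver x (IntermediateField.adjoin K {x}) := by
  refine AlgOver.adjoin ?_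
  intro d hd
  let := (aeval x : K[X] →ₐ[K] L).toRingHom.toAlgebra
  have : d = algebraMap K[X] L X := (Set.mem_singleton_iff.1 hd).trans (aeval_X x).symm
  rw [this]
  exact isAlgebraic_algebraMap (R := K[X]) (A := L) X

lemma AlgOver.step {x : L} {F : IntermediateField K L} (h : AlgOver x F) {A : K[X]}
    (hA : A.Monic) (hpos : 0 < A.natDegree) {y : L} (hy : aeval y A ∈ F) :
    AlgOver x (F ⊔ IntermediateField.adjoin K {y}) := by
  have h1 : F ⊔ IntermediateField.adjoin K {y} = IntermediateField.adjoin K ((F : Set L) ∪ {y}) := by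
    rw [IntermediateField.adjoin_union, IntermediateField.adjoin_self]
  rw [h1]
  refine AlgOver.adjoin ?_
  rintro d (hd | rfl)
  · exact h d hd
  · let := (aeval x : K[X] →ₐ[K] L).toRingHom.toAlgebra
    have h2 : IsAlgebraic K[X] (aeval d A) := h _ hy
    have h3 : aeval d A = aeval d (A.map (C : K →+* K[X])) := by
      rw [aeval_def, aeval_def, eval₂_map]
      congr 1
      ext c
      exact (aeval_C x c).symm
    rw [h3] at h2
    refine IsAlgebraic.of_aeval _ ?_ ?_ h2
    · rw [hA.natDegree_map]; omega
    · rw [(hA.map _).leadingCoeff]; exact one_mem _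

lemma GenusLE.base {O : ValuationSubring L} (hO : ∀ c : K, algebraMap K L c ∈ O) {x : L}
    (hxO : x ∉ O) : GenusLE O x (IntermediateField.adjoin K {x}) 0 := by
  refine ⟨∅, by simp, by simp, fun f hf => ?_⟩
  obtain ⟨p, s, rfl⟩ := (IntermediateField.mem_adjoin_simple_iff K _).1 hf
  have hx0 : x ≠ 0 := fun h => hxO (h ▸ O.zero_mem)
  have hxi := inv_mem_of_notMem hxO
  have hreg : ∀ p : K[X], aeval x p ∈ reg x (IntermediateField.adjoin K {x}) := fun p =>
    ⟨aeval_mem_of_mem (S := (IntermediateField.adjoin K {x}).toSubalgebra)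
      (IntermediateField.mem_adjoin_simple_self K x) p, aeval_mem_of_mem (self_mem_hol x) p⟩
  by_cases hs : s = 0
  · exact ⟨0, zero_mem _, 0, O.zero_mem, 0, zero_mem _, by simp [hs]⟩
  set l := s.leadingCoeff with hl
  have hl0 : l ≠ 0 := leadingCoeff_ne_zero.2 hs
  set m := s * C l⁻¹ with hm
  have hmon : m.Monic := monic_mul_leadingCoeff_inv hs
  obtain ⟨h, hh, hmx⟩ := aeval_eq_pow_mul (valAlg O hO) hmon hx0 hxi
  have hval : O.valuation (1 + x⁻¹ * h) = 1 :=
    val_one_add (val_mul_lt_one (val_lt_one_of_inv_notMem hxO) hh)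
  have hne : (1 + x⁻¹ * h) ≠ 0 := fun h0 => by simp [h0] at hval
  have hmx0 : aeval x m ≠ 0 := by rw [hmx]; exact mul_ne_zero (pow_ne_zero _ hx0) hne
  have hsm : aeval x s = algebraMap K L l * aeval x m := by
    rw [hm, map_mul, aeval_C, map_inv₀]
    have : algebraMap K L l ≠ 0 := by simpa using hl0
    field_simp
  clear_value m
  set p' := p * C l⁻¹ with hp'
  have hpp : aeval x p / aeval x s = aeval x p' / aeval x m := by
    rw [hsm, hp', map_mul, aeval_C, map_inv₀]
    have : algebraMap K L l ≠ 0 := by simpa using hl0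
    field_simp
  refine ⟨_, hreg (p' /ₘ m), aeval x (p' %ₘ m) / aeval x m, ?_, 0, zero_mem _, ?_⟩
  · have h1 : aeval x (p' %ₘ m) * (x⁻¹) ^ m.natDegree ∈ O := by
      rw [aeval_eq_sum_range, Finset.sum_mul]
      refine O.toSubring.sum_mem fun i hi => ?_
      have him : i ≤ m.natDegree := by
        have h2 := natDegree_modByMonic_le p' hmon
        have := Finset.mem_range.1 hi
        omega
      rw [Algebra.smul_def, mul_assoc]
      refine O.mul_mem _ _ (hO _) ?_
      obtain ⟨d, hd⟩ := Nat.exists_eq_add_of_le him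
      rw [hd, pow_add, ← mul_assoc, inv_pow, mul_inv_cancel₀ (pow_ne_zero _ hx0), one_mul]
      exact O.toSubring.pow_mem hxi d
    have h2 : aeval x (p' %ₘ m) / aeval x m =
        aeval x (p' %ₘ m) * (x⁻¹) ^ m.natDegree * (1 + x⁻¹ * h)⁻¹ := by
      rw [hmx, inv_pow, div_eq_mul_inv, mul_inv, mul_assoc]
    rw [h2]
    exact O.mul_mem _ _ h1 (inv_mem_of_val_eq_one hval)
  · rw [hpp, add_zero, eq_comm, ← mul_right_inj' hmx0, mul_add, mul_div_cancel₀ _ hmx0,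
      mul_div_cancel₀ _ hmx0, ← map_mul, ← map_add, add_comm, modByMonic_add_div]

namespace Tow

variable {q i : ℕ} {x : ℕ → L} {Ω : Finset K}

lemma isAdditive_TP (h : Tow K q i x Ω) : IsAdditive L (TP K q) := fun u v => by
  simp only [aeval_TP, h.T_add]

lemma algOver (h : Tow K q i x Ω) {l : ℕ} (hl : 1 ≤ l) (hli : l ≤ i) :
    AlgOver (x 1) (fld K x 1 l) := by
  induction l, hl using Nat.le_induction with
  | base => rw [fld_self]; exact AlgOver.base _
  | succ l hl ih =>
    rw [fld_succ x (by omega)]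
    refine (ih (by omega)).step (TP_monic h.two_le)
      (by rw [TP_natDegree h.two_le]; have := h.two_le; omega) ?_
    rw [aeval_TP, h.step l hl (by omega)]
    exact phi_mem_fld (mem_fld hl le_rfl)

lemma genusLE (h : Tow K q i x Ω) {O : ValuationSubring L}
    (hO : ∀ c : K, algebraMap K L c ∈ O) (hxO : x 1 ∉ O) {l : ℕ} (hl : 1 ≤ l) (hli : l ≤ i) :
    ∃ γ, GenusLE O (x 1) (fld K x 1 l) γ ∧ γ + q ^ ((l + 1) / 2) + q ^ (l / 2) = q ^ l + 1 := by
  have hq := h.two_le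
  induction l, hl using Nat.le_induction with
  | base => exact ⟨0, by rw [fld_self]; exact GenusLE.base hO hxO, by simp⟩
  | succ l hl ih =>
    obtain ⟨γ, hγ, heq⟩ := ih (by omega)
    have h1 := (h.mono (show l ≤ i by omega)).genusLE_step hl hO hxO (h.algOver hl (by omega)) hγ
      (A := TP K q) (B := X) (TP_monic hq) (by rw [TP_natDegree hq]; omega) h.isAdditive_TP
      (fun u => by rw [aeval_X, aeval_TP]) (y := x (l + 1)) (b := 0)
      (by rw [aeval_TP, h.step l hl (by omega), map_zero, add_zero])
    rw [← fld_succ x (by omega), TP_natDegree hq] at h1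
    refine ⟨_, h1, ?_⟩
    have h2 : 1 ≤ q ^ ((l + 1) / 2) := Nat.one_le_pow _ _ (by omega)
    obtain ⟨d, hd⟩ := Nat.exists_eq_add_of_le h2
    obtain ⟨e, rfl⟩ : ∃ e, q = e + 1 := ⟨q - 1, by omega⟩
    have h3 : (l + 1 + 1) / 2 = l / 2 + 1 := by omega
    rw [h3, pow_succ, pow_succ _ l]
    rw [hd] at heq ⊢
    rw [Nat.add_sub_cancel_left, Nat.add_sub_cancel]
    have h4 : (e + 1) ^ l = γ + d + (e + 1) ^ (l / 2) := by omega
    rw [h4]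
    ring

/-- Genus bound for the final curve. -/
theorem genusLE_final (h : Tow K q i x Ω) (hi : 1 ≤ i) {O : ValuationSubring L}
    (hO : ∀ c : K, algebraMap K L c ∈ O) (hxO : x 1 ∉ O)
    {A B : K[X]} (hA : A.Monic) (hpos : 0 < A.natDegree) (hadd : IsAdditive L A)
    (hAB : ∀ u : L, aeval (aeval u B) A = T q u) {y : L} {b : K}
    (hy : aeval y A = phi q (x i) + algebraMap K L b) :
    GenusLE O (x 1) (fld K x 1 i ⊔ IntermediateField.adjoin K {y}) (A.natDegree * q ^ i) := by
  obtain ⟨γ, hγ, heq⟩ := h.genusLE hO hxO hi le_rfl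
  refine (h.genusLE_step hi hO hxO (h.algOver hi le_rfl) hγ hA hpos hadd hAB hy).mono ?_
  have hq := h.two_le
  have h1 : 1 ≤ q ^ ((i + 1) / 2) := Nat.one_le_pow _ _ (by omega)
  have h2 : 1 ≤ q ^ (i / 2) := Nat.one_le_pow _ _ (by omega)
  obtain ⟨e, he⟩ : ∃ e, A.natDegree = e + 1 := ⟨A.natDegree - 1, by omega⟩
  rw [he, Nat.add_sub_cancel]
  have h3 : γ + (q ^ ((i + 1) / 2) - 1) ≤ q ^ i := by omega
  calc (e + 1) * γ + e * (q ^ ((i + 1) / 2) - 1)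
      = γ + e * (γ + (q ^ ((i + 1) / 2) - 1)) := by ring
    _ ≤ q ^ i + e * q ^ i := Nat.add_le_add (by omega) (Nat.mul_le_mul_left _ h3)
    _ = (e + 1) * q ^ i := by ring

end Tow

end Tower

end

section

open Polynomial

namespace Tower

section PowerSeriesRoot

open PowerSeries

variable {E : Type*} [Field E] {p : ℕ} [Fact p.Prime] [CharP E p]

lemma powerSeries_add_pow (a : ℕ) (u v : E⟦X⟧) : (u + v) ^ p ^ a = u ^ p ^ a + v ^ p ^ a := by
  have : CharP E⟦X⟧ p := charP_of_injective_ringHom (PowerSeries.C_injective (R := E)) p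
  exact add_pow_char_pow u v p a

/-- Successive approximations to a solution of `w ^ q + w = ε`. -/
noncomputable def rootApprox (q : ℕ) (ε : E⟦X⟧) : ℕ → E⟦X⟧
  | 0 => 0
  | n + 1 => ε - rootApprox q ε n ^ q

lemma rootApprox_sub (a : ℕ) (ha : 0 < a) {ε : E⟦X⟧} (hε : PowerSeries.X ∣ ε) (n : ℕ) :
    PowerSeries.X ^ (n + 1) ∣ rootApprox (p ^ a) ε (n + 1) - rootApprox (p ^ a) ε n := by
  have hp : 2 ≤ p := (Fact.out : p.Prime).two_le
  have hq : 2 ≤ p ^ a := hp.trans (Nat.le_self_pow ha.ne' p)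
  induction n with
  | zero => simpa [rootApprox, show p ≠ 0 by omega, ha.ne'] using hε
  | succ n ih =>
    have h1 : rootApprox (p ^ a) ε (n + 2) - rootApprox (p ^ a) ε (n + 1) =
        (-(rootApprox (p ^ a) ε (n + 1) - rootApprox (p ^ a) ε n)) ^ p ^ a := by
      have h := powerSeries_add_pow (p := p) a (rootApprox (p ^ a) ε (n + 1))
        (-(rootApprox (p ^ a) ε (n + 1) - rootApprox (p ^ a) ε n))
      rw [show rootApprox (p ^ a) ε (n + 1) +
        -(rootApprox (p ^ a) ε (n + 1) - rootApprox (p ^ a) ε n) = rootApprox (p ^ a) ε n by ring] at h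
      rw [eq_sub_of_add_eq' h.symm]
      simp only [rootApprox]; ring
    rw [h1]
    refine (pow_dvd_pow _ (show n + 1 + 1 ≤ (n + 1) * p ^ a by nlinarith)).trans ?_
    rw [pow_mul]
    exact pow_dvd_pow_of_dvd ((dvd_neg).2 ih) _

lemma rootApprox_sub_of_le (a : ℕ) (ha : 0 < a) {ε : E⟦X⟧} (hε : PowerSeries.X ∣ ε) {n m : ℕ}
    (h : n ≤ m) :
    PowerSeries.X ^ (n + 1) ∣ rootApprox (p ^ a) ε m - rootApprox (p ^ a) ε n := by
  induction m, h using Nat.le_induction with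
  | base => simp
  | succ m h ih =>
    rw [← sub_add_sub_cancel]
    exact dvd_add ((pow_dvd_pow _ (by omega)).trans (rootApprox_sub a ha hε m)) ih

lemma powerSeries_eq_zero_of_dvd {f : E⟦X⟧} (h : ∀ n, PowerSeries.X ^ n ∣ f) : f = 0 := by
  ext n
  exact (PowerSeries.X_pow_dvd_iff.1 (h (n + 1))) n (by omega)

lemma exists_powerSeries_root (a : ℕ) (ha : 0 < a) {ε : E⟦X⟧} (hε : PowerSeries.X ∣ ε) :
    ∃ w : E⟦X⟧, PowerSeries.X ∣ w ∧ w ^ p ^ a + w = ε := by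
  have hp : 2 ≤ p := (Fact.out : p.Prime).two_le
  have hq : 2 ≤ p ^ a := hp.trans (Nat.le_self_pow ha.ne' p)
  set S := rootApprox (p ^ a) ε with hS
  let w : E⟦X⟧ := PowerSeries.mk fun n => PowerSeries.coeff n (S n)
  have hw : ∀ n, PowerSeries.X ^ (n + 1) ∣ w - S n := by
    intro n
    rw [PowerSeries.X_pow_dvd_iff]
    intro m hm
    have h := PowerSeries.X_pow_dvd_iff.1
      (rootApprox_sub_of_le (p := p) a ha hε (show m ≤ n by omega)) m (by omega)
    rw [map_sub] at h ⊢
    rw [PowerSeries.coeff_mk, ← sub_eq_zero.1 h, sub_self]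
  refine ⟨w, ?_, ?_⟩
  · have := hw 0
    simpa [hS, rootApprox] using this
  · rw [← sub_eq_zero]
    refine powerSeries_eq_zero_of_dvd fun n => ?_
    have h1 := powerSeries_add_pow (p := p) a (w - S n) (S n)
    rw [sub_add_cancel] at h1
    have h2 : w ^ p ^ a + w - ε = (w - S n) ^ p ^ a + (w - S n) - (S (n + 1) - S n) := by
      rw [h1, hS]; simp only [rootApprox]; ring
    rw [h2]
    refine (pow_dvd_pow _ (Nat.le_succ n)).trans ?_
    exact dvd_sub (dvd_add ((hw n).trans (dvd_pow_self _ (by omega))) (hw n))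
      (rootApprox_sub (p := p) a ha hε n)

lemma powerSeries_root_unique (a : ℕ) (ha : 0 < a) {w w' : E⟦X⟧} (hw : PowerSeries.X ∣ w)
    (hw' : PowerSeries.X ∣ w') (h : w ^ p ^ a + w = w' ^ p ^ a + w') : w = w' := by
  have hp : 2 ≤ p := (Fact.out : p.Prime).two_le
  have hq : 2 ≤ p ^ a := hp.trans (Nat.le_self_pow ha.ne' p)
  have h1 := powerSeries_add_pow (p := p) a (w - w') w'
  rw [sub_add_cancel] at h1
  have h2 : (w - w') * ((w - w') ^ (p ^ a - 1) + 1) = 0 := by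
    rw [mul_add, mul_one, ← pow_succ', Nat.sub_add_cancel (by omega)]
    linear_combination h - h1
  rcases mul_eq_zero.1 h2 with h3 | h3
  · exact sub_eq_zero.1 h3
  · have h4 := congrArg (PowerSeries.constantCoeff (R := E)) h3
    have h5 : PowerSeries.constantCoeff (R := E) (w - w') = 0 :=
      PowerSeries.X_dvd_iff.1 (dvd_sub hw hw')
    rw [map_add, map_pow, h5, zero_pow (by omega), map_one, map_zero, zero_add] at h4
    exact absurd h4 one_ne_zero

end PowerSeriesRoot

section Laurent

variable {E : Type*} [Field E]

/-- The embedding of power series in Laurent series. -/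
noncomputable def ofPow (E : Type*) [Field E] : PowerSeries E →+* LaurentSeries E :=
  HahnSeries.ofPowerSeries ℤ E

/-- The ring of power series as a valuation ring of the field of Laurent series. -/
noncomputable def powerRing (E : Type*) [Field E] : ValuationSubring (LaurentSeries E) :=
  (ValuationRing.valuation (PowerSeries E) (LaurentSeries E)).valuationSubring

lemma mem_powerRing {f : LaurentSeries E} : f ∈ powerRing E ↔ ∃ g, ofPow E g = f :=
  ValuationRing.mem_integer_iff _ _ f

lemma ofPow_injective : Function.Injective (ofPow E) := HahnSeries.ofPowerSeries_injective

lemma algebraMap_eq_ofPow (c : E) :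
    algebraMap E (LaurentSeries E) c = ofPow E (PowerSeries.C c) := by
  rw [LaurentSeries.algebraMap_apply, ofPow, HahnSeries.ofPowerSeries_C]

lemma const_mem_powerRing (c : E) : algebraMap E (LaurentSeries E) c ∈ powerRing E :=
  mem_powerRing.2 ⟨_, (algebraMap_eq_ofPow c).symm⟩

lemma val_lt_one_iff {f : LaurentSeries E} :
    (powerRing E).valuation f < 1 ↔ ∃ g, PowerSeries.X ∣ g ∧ ofPow E g = f := by
  constructor
  · intro h
    obtain ⟨g, rfl⟩ := mem_powerRing.1 (mem_of_val_lt_one h)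
    refine ⟨g, ?_, rfl⟩
    by_contra hX
    rw [PowerSeries.X_dvd_iff] at hX
    have h1 : ofPow E g⁻¹ * ofPow E g = 1 := by
      rw [← map_mul, PowerSeries.inv_mul_cancel _ hX, map_one]
    have h2 := congrArg (powerRing E).valuation h1
    rw [map_mul, map_one] at h2
    have h3 : (powerRing E).valuation (ofPow E g⁻¹) ≤ 1 :=
      ((powerRing E).valuation_le_one_iff _).2 (mem_powerRing.2 ⟨_, rfl⟩)
    exact absurd h2 ((mul_comm _ _).trans_lt (mul_lt_one_of_lt_of_le h h3)).ne
  · rintro ⟨g, hg, rfl⟩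
    have hm : ofPow E g ∈ powerRing E := mem_powerRing.2 ⟨g, rfl⟩
    refine lt_of_le_of_ne (((powerRing E).valuation_le_one_iff _).2 hm) fun h => ?_
    obtain ⟨g', hg'⟩ := mem_powerRing.1 (inv_mem_of_val_eq_one h)
    have h0 : ofPow E g ≠ 0 := fun h' => by simp [h'] at h
    have h1 : ofPow E (g' * g) = ofPow E 1 := by
      rw [map_mul, hg', inv_mul_cancel₀ h0, map_one]
    have h2 := congrArg (PowerSeries.constantCoeff (R := E)) (ofPow_injective h1)
    rw [map_mul, PowerSeries.X_dvd_iff.1 hg, mul_zero, map_one] at h2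
    exact zero_ne_one h2

lemma laurent_add_pow {p : ℕ} [Fact p.Prime] [CharP E p] (a : ℕ) (u v : LaurentSeries E) :
    (u + v) ^ p ^ a = u ^ p ^ a + v ^ p ^ a := by
  have : CharP (LaurentSeries E) p := charP_of_injective_ringHom (algebraMap E (LaurentSeries E)).injective p
  exact add_pow_char_pow u v p a

/-- `z ^ q + z = ε` is uniquely solvable in the maximal ideal. -/
lemma exists_root {p : ℕ} [Fact p.Prime] [CharP E p] {a : ℕ} (ha : 0 < a) {ε : LaurentSeries E}
    (hε : (powerRing E).valuation ε < 1) :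
    ∃ w, (powerRing E).valuation w < 1 ∧ T (p ^ a) w = ε := by
  obtain ⟨e, he, rfl⟩ := val_lt_one_iff.1 hε
  obtain ⟨w, hw, h⟩ := exists_powerSeries_root a ha he
  exact ⟨ofPow E w, val_lt_one_iff.2 ⟨w, hw, rfl⟩, by rw [T, ← h, map_add, map_pow]⟩

lemma root_unique {p : ℕ} [Fact p.Prime] [CharP E p] {a : ℕ} (ha : 0 < a)
    {w w' : LaurentSeries E} (hw : (powerRing E).valuation w < 1)
    (hw' : (powerRing E).valuation w' < 1) (h : T (p ^ a) w = T (p ^ a) w') : w = w' := by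
  obtain ⟨e, he, rfl⟩ := val_lt_one_iff.1 hw
  obtain ⟨e', he', rfl⟩ := val_lt_one_iff.1 hw'
  rw [T, T, ← map_pow, ← map_pow, ← map_add, ← map_add] at h
  rw [powerSeries_root_unique a ha he he' (ofPow_injective h)]

/-- The coefficientwise extension of an endomorphism of `E` to Laurent series. -/
noncomputable def cmap (σ : E →+* E) : LaurentSeries E →+* LaurentSeries E where
  toFun f := HahnSeries.map f σ
  map_zero' := by ext; simp
  map_one' := by
    ext n
    rw [HahnSeries.map_coeff, HahnSeries.coeff_one, apply_ite σ, map_one, map_zero]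
  map_add' f g := by ext; simp
  map_mul' f g := by
    exact HahnSeries.map_mul (σ : E →ₙ+* E)

@[simp] lemma cmap_coeff (σ : E →+* E) (f : LaurentSeries E) (n : ℤ) :
    (cmap σ f).coeff n = σ (f.coeff n) := rfl

lemma cmap_ofPow (σ : E →+* E) (g : PowerSeries E) :
    cmap σ (ofPow E g) = ofPow E (PowerSeries.map σ g) := by
  ext n
  rw [cmap_coeff, ofPow, PowerSeries.coeff_coe, PowerSeries.coeff_coe]
  split_ifs <;> simp

lemma cmap_algebraMap (σ : E →+* E) (c : E) :
    cmap σ (algebraMap E _ c) = algebraMap E _ (σ c) := by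
  rw [algebraMap_eq_ofPow, cmap_ofPow, PowerSeries.map_C, algebraMap_eq_ofPow]

lemma cmap_val_lt_one (σ : E →+* E) {f : LaurentSeries E}
    (h : (powerRing E).valuation f < 1) : (powerRing E).valuation (cmap σ f) < 1 := by
  obtain ⟨g, hg, rfl⟩ := val_lt_one_iff.1 h
  refine val_lt_one_iff.2 ⟨PowerSeries.map σ g, ?_, (cmap_ofPow σ g).symm⟩
  rw [PowerSeries.X_dvd_iff] at hg ⊢
  rw [← PowerSeries.coeff_zero_eq_constantCoeff_apply] at hg ⊢
  rw [PowerSeries.coeff_map, hg, map_zero]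

end Laurent

end Tower

end

section

open Polynomial

namespace Tower

variable {E : Type*} [Field E]

/-- The inverse of the variable of the field of Laurent series. -/
noncomputable def yy (E : Type*) [Field E] : LaurentSeries E := (ofPow E PowerSeries.X)⁻¹

lemma yy_notMem : yy E ∉ powerRing E := by
  intro h
  have h1 : (powerRing E).valuation (ofPow E PowerSeries.X) < 1 :=
    val_lt_one_iff.2 ⟨_, dvd_rfl, rfl⟩
  have h2 := ((powerRing E).valuation_le_one_iff _).2 h
  have h0 : ofPow E PowerSeries.X ≠ 0 := by
    rw [Ne, map_eq_zero_iff _ ofPow_injective]; exact PowerSeries.X_ne_zero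
  have h3 : yy E * ofPow E PowerSeries.X = 1 := inv_mul_cancel₀ h0
  have h4 := congrArg (powerRing E).valuation h3
  rw [map_mul, map_one] at h4
  exact absurd h4 ((mul_comm _ _).trans_lt (mul_lt_one_of_lt_of_le h1 h2)).ne

lemma cmap_yy (σ : E →+* E) : cmap σ (yy E) = yy E := by
  rw [yy, map_inv₀, cmap_ofPow, PowerSeries.map_X]

lemma cmap_aeval (σ : E →+* E) {A : E[X]} (hA : A.map σ = A) (z : LaurentSeries E) :
    cmap σ (aeval z A) = aeval (cmap σ z) A := by
  conv_rhs => rw [← hA]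
  rw [aeval_def, aeval_def, hom_eval₂, eval₂_map]
  congr 1
  ext1 c
  exact cmap_algebraMap σ c

section Hom

variable {L M : Type*} [Field L] [Field M]

lemma map_T (f : L →+* M) (q : ℕ) (z : L) : f (T q z) = T q (f z) := by simp [T]

lemma map_phi (f : L →+* M) (q : ℕ) (z : L) : f (phi q z) = phi q (f z) := by
  simp [phi, map_T]

end Hom

variable {p : ℕ} [Fact p.Prime] [CharP E p] {a : ℕ}

lemma two_le_pow (p : ℕ) [Fact p.Prime] {a : ℕ} (ha : 0 < a) : 2 ≤ p ^ a :=
  (Fact.out : p.Prime).two_le.trans (Nat.le_self_pow ha.ne' p)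

lemma exists_chain (ha : 0 < a) {i : ℕ} (hi : 1 ≤ i) : ∀ {v : LaurentSeries E},
    (powerRing E).valuation v < 1 → v ≠ 0 → ∃ x : ℕ → LaurentSeries E,
      (∀ l, 1 ≤ l → l ≤ i → x l ∉ powerRing E) ∧ phi (p ^ a) (x i) = v⁻¹ ∧
      (∀ l, 1 ≤ l → l < i → T (p ^ a) (x (l + 1)) = phi (p ^ a) (x l)) ∧
      ∀ σ : E →+* E, cmap σ v = v → ∀ l, 1 ≤ l → l ≤ i → cmap σ (x l) = x l := by
  have hq := two_le_pow p ha
  induction i, hi using Nat.le_induction with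
  | base =>
    intro v hv hv0
    obtain ⟨w, hw, hwv⟩ := exists_root (p := p) ha hv
    have hw0 : w ≠ 0 := by rintro rfl; exact hv0 (hwv ▸ T_zero hq)
    refine ⟨fun _ => w⁻¹, ?_, ?_, ?_, ?_⟩
    · intro l _ _ h
      have h2 := ((powerRing E).valuation_le_one_iff _).2 h
      rw [map_inv₀] at h2
      exact absurd h2 (not_le.2 ((one_lt_inv₀ (zero_lt_iff.2 ((_root_.map_ne_zero _).2 hw0))).2 hw))
    · rw [phi, inv_inv, hwv]
    · intro l h1 h2; omega
    · intro σ hσ l _ _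
      rw [map_inv₀, root_unique (p := p) ha (cmap_val_lt_one σ hw) hw]
      rw [← map_T, hwv, hσ]
  | succ i hi ih =>
    intro v hv hv0
    obtain ⟨w, hw, hwv⟩ := exists_root (p := p) ha hv
    have hw0 : w ≠ 0 := by rintro rfl; exact hv0 (hwv ▸ T_zero hq)
    have hwO : w⁻¹ ∉ powerRing E := by
      intro h
      have h2 := ((powerRing E).valuation_le_one_iff _).2 h
      rw [map_inv₀] at h2
      exact absurd h2 (not_le.2 ((one_lt_inv₀ (zero_lt_iff.2 ((_root_.map_ne_zero _).2 hw0))).2 hw))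
    have hT : T (p ^ a) w⁻¹ ∉ powerRing E := fun h =>
      hwO (mem_of_T_mem hq (fun c => const_mem_powerRing c) h)
    have hT0 : T (p ^ a) w⁻¹ ≠ 0 := fun h => hT (h ▸ (powerRing E).zero_mem)
    obtain ⟨x, h1, h2, h3, h4⟩ := ih (val_lt_one_of_inv_notMem hT) (inv_ne_zero hT0)
    have hσw : ∀ σ : E →+* E, cmap σ v = v → cmap σ w = w := fun σ hσ =>
      root_unique (p := p) ha (cmap_val_lt_one σ hw) hw (by rw [← map_T, hwv, hσ])
    refine ⟨Function.update x (i + 1) w⁻¹, ?_, ?_, ?_, ?_⟩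
    · intro l hl hli
      rcases eq_or_ne l (i + 1) with rfl | hne
      · rwa [Function.update_self]
      · rw [Function.update_of_ne hne]; exact h1 l hl (by omega)
    · rw [Function.update_self, phi, inv_inv, hwv]
    · intro l hl hli
      rw [Function.update_of_ne (show l ≠ i + 1 by omega)]
      rcases eq_or_ne (l + 1) (i + 1) with he | hne
      · obtain rfl : l = i := by omega
        rw [Function.update_self, h2, inv_inv]
      · rw [Function.update_of_ne hne]; exact h3 l hl (by omega)
    · intro σ hσ l hl hli
      rcases eq_or_ne l (i + 1) with rfl | hne
      · rw [Function.update_self, map_inv₀, hσw σ hσ]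
      · rw [Function.update_of_ne hne]
        exact h4 σ (by rw [map_inv₀, map_T, map_inv₀, hσw σ hσ]) l hl (by omega)

/-- A tower of Laurent series with the equation `A y = φ (x_i) + b` on top. -/
structure Curve (q i : ℕ) (x : ℕ → LaurentSeries E) (Ω : Finset E) (A : E[X]) (b : E) : Prop
    extends Tow E q i x Ω where
  one_le : 1 ≤ i
  notMem : ∀ l, 1 ≤ l → l ≤ i → x l ∉ powerRing E
  monic : A.Monic
  pos : 0 < A.natDegree
  eqn : aeval (yy E) A = phi q (x i) + algebraMap E _ b
  fix : ∀ σ : E →+* E, A.map σ = A → σ b = b → ∀ l, 1 ≤ l → l ≤ i → cmap σ (x l) = x l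

/-- The zeros of `z ^ q + z`. -/
noncomputable def zeros (E : Type*) [Field E] [DecidableEq E] (q : ℕ) : Finset E :=
  (TP E q).roots.toFinset

lemma mem_zeros [DecidableEq E] {q : ℕ} (hq : 2 ≤ q) {z : E} : z ∈ zeros E q ↔ T q z = 0 := by
  rw [zeros, Multiset.mem_toFinset, mem_roots (TP_monic hq).ne_zero, IsRoot, ← aeval_TP (K := E),
    coe_aeval_eq_eval]

lemma roots_TP_nodup (p : ℕ) [Fact p.Prime] [CharP E p] (ha : 0 < a) :
    (TP E (p ^ a)).roots.Nodup := by
  refine nodup_roots ?_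
  rw [separable_def, TP]
  have : derivative (X ^ p ^ a + X : E[X]) = 1 := by
    have : (p : E) = 0 := CharP.cast_eq_zero E p
    rw [derivative_add, derivative_X, derivative_X_pow, Nat.cast_pow, this, zero_pow ha.ne', C_0,
      zero_mul, zero_add]
  rw [this]
  exact isCoprime_one_right

lemma exists_curve [IsAlgClosed E] [DecidableEq E] (ha : 0 < a) {i : ℕ} (hi : 1 ≤ i) {A : E[X]}
    (hA : A.Monic) (hpos : 0 < A.natDegree) (b : E) :
    ∃ x, Curve (p ^ a) i x (zeros E (p ^ a)) A b := by
  have hq := two_le_pow p ha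
  have h1 : aeval (yy E) A - algebraMap E _ b ∉ powerRing E := by
    intro h
    have h2 := (powerRing E).add_mem _ _ h (const_mem_powerRing b)
    rw [sub_add_cancel] at h2
    exact yy_notMem (mem_of_aeval_mem (fun c => const_mem_powerRing c) hA hpos h2)
  have h0 : aeval (yy E) A - algebraMap E _ b ≠ 0 := fun h => h1 (h ▸ (powerRing E).zero_mem)
  obtain ⟨x, hx, hphi, hstep, hfix⟩ := exists_chain (p := p) ha hi (val_lt_one_of_inv_notMem h1)
    (inv_ne_zero h0)
  have hs : (TP E (p ^ a)).Splits := IsAlgClosed.splits _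
  refine ⟨x, ⟨hq, laurent_add_pow a, ?_, ?_, ?_, hstep, ?_⟩, hi, hx, hA, hpos, ?_, ?_⟩
  · rw [zeros, Multiset.toFinset_card_of_nodup (roots_TP_nodup p ha),
      ← hs.natDegree_eq_card_roots, TP_natDegree hq]
  · rw [mem_zeros hq, T_zero hq]
  · intro z
    have h2 := hs.eq_prod_roots_of_monic (TP_monic hq)
    rw [← aeval_TP (K := E)]
    conv_lhs => rw [h2]
    rw [map_multiset_prod, Multiset.map_map, zeros, Finset.prod_eq_multiset_prod,
      Multiset.toFinset_val, (roots_TP_nodup p ha).dedup]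
    simp
  · intro halg
    refine hx 1 le_rfl hi (mem_of_aeval_mem (fun c => const_mem_powerRing c)
      (minpoly.monic halg.isIntegral) (minpoly.natDegree_pos halg.isIntegral) ?_)
    rw [minpoly.aeval]
    exact (powerRing E).zero_mem
  · rw [hphi, inv_inv, sub_add_cancel]
  · intro σ hσA hσb
    refine hfix σ ?_
    rw [map_inv₀, map_sub, cmap_aeval σ hσA, cmap_yy, cmap_algebraMap, hσb]

end Tower

end

section

open Polynomial

namespace Tower

section Extension

variable {K L M : Type*} [Field K] [Field L] [Field M] [Algebra K L] [Algebra K M]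

/-- Extending a homomorphism to a simple extension given by a linearly independent power basis. -/
lemma exists_extension {F : IntermediateField K L} (θ : F →ₐ[K] M) {A : K[X]} (hA : A.Monic)
    (hpos : 0 < A.natDegree) {y : L} (hy : aeval y A ∈ F)
    (hind : ∀ c : ℕ → L, (∀ i, c i ∈ F) → ∑ i ∈ Finset.range A.natDegree, c i * y ^ i = 0 →
      ∀ i < A.natDegree, c i = 0) {z : M} (hz : aeval z A = θ ⟨_, hy⟩) :
    ∃ θ' : ↥(F ⊔ IntermediateField.adjoin K {y}) →ₐ[K] M,
      (∀ f (hf : f ∈ F), θ' ⟨f, (le_sup_left : F ≤ _) hf⟩ = θ ⟨f, hf⟩) ∧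
      θ' ⟨y, (le_sup_right : _ ≤ F ⊔ _) (IntermediateField.mem_adjoin_simple_self K y)⟩ = z := by
  set P : F[X] := A.map (algebraMap K F) - C ⟨_, hy⟩ with hP
  have hdeg : (C (⟨_, hy⟩ : F)).degree < (A.map (algebraMap K F)).degree := by
    rw [degree_map]
    refine degree_C_le.trans_lt ?_
    exact natDegree_pos_iff_degree_pos.1 hpos
  have hPm : P.Monic := (hA.map _).sub_of_left hdeg
  have hPd : P.natDegree = A.natDegree := by
    rw [hP, natDegree_sub_eq_left_of_natDegree_lt, natDegree_map]
    rw [natDegree_map, natDegree_C]; exact hpos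
  have hPy : aeval y P = 0 := by
    rw [hP, map_sub, aeval_map_algebraMap, aeval_C]
    exact sub_self _
  have hmin : P = minpoly F y := by
    refine minpoly.unique F y hPm hPy fun Q hQ hQy => ?_
    by_contra hlt
    rw [not_le] at hlt
    have hlt' : Q.natDegree < A.natDegree := by
      rw [← hPd]; exact natDegree_lt_natDegree hQ.ne_zero hlt
    have := hind (fun i => ((Q.coeff i : F) : L)) (fun i => (Q.coeff i).2) (by
      rw [aeval_eq_sum_range' hlt'] at hQy
      exact hQy) _ hlt'
    rw [hQ.coeff_natDegree] at this
    exact one_ne_zero (α := F) (Subtype.ext this)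
  have hInt : IsIntegral F y := ⟨P, hPm, by rw [← aeval_def]; exact hPy⟩
  let := θ.toRingHom.toAlgebra
  have hsc : IsScalarTower K F M := IsScalarTower.of_algebraMap_eq fun c => (θ.commutes c).symm
  have hz' : aeval z (minpoly F y) = 0 := by
    rw [← hmin, hP, map_sub, aeval_map_algebraMap, aeval_C, hz]
    exact sub_self _
  obtain ⟨ψ, hψ⟩ : ∃ ψ : IntermediateField.adjoin F {y} →ₐ[F] M,
      ψ ⟨y, IntermediateField.mem_adjoin_simple_self F y⟩ = z := by
    have hmem : z ∈ (minpoly F y).aroots M := by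
      rw [mem_aroots]
      exact ⟨minpoly.ne_zero hInt, hz'⟩
    refine ⟨(IntermediateField.algHomAdjoinIntegralEquiv F hInt).symm ⟨z, hmem⟩, ?_⟩
    exact IntermediateField.algHomAdjoinIntegralEquiv_symm_apply_gen F hInt _
  have heq : F ⊔ IntermediateField.adjoin K {y} =
      (IntermediateField.adjoin F {y}).restrictScalars K :=
    (IntermediateField.restrictScalars_adjoin_eq_sup K F {y}).symm
  refine ⟨(ψ.restrictScalars K).comp (IntermediateField.inclusion heq.le), fun f hf => ?_, hψ⟩
  exact ψ.commutes ⟨f, hf⟩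

end Extension

variable {E : Type*} [Field E]

/-- The field generated by a tower of Laurent series. -/
noncomputable def topF (x : ℕ → LaurentSeries E) (i : ℕ) : IntermediateField E (LaurentSeries E) :=
  fld E x 1 i ⊔ IntermediateField.adjoin E {yy E}

/-- The valuation rings at which `x` has a pole. -/
noncomputable def famPole {x : LaurentSeries E} (hx : x ∉ powerRing E) : Fam E (LaurentSeries E) where
  mem V := (∀ c : E, algebraMap E _ c ∈ V) ∧ x ∉ V
  const _ h := h.1
  nonempty := ⟨powerRing E, fun c => const_mem_powerRing c, hx⟩

lemma famPole_small {x : LaurentSeries E} (hx : x ∉ powerRing E) : (famPole hx).Small x⁻¹ :=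
  ⟨inv_ne_zero fun h => hx (h ▸ (powerRing E).zero_mem), fun _ h =>
    val_lt_one_of_inv_notMem h.2⟩

namespace Curve

variable {q i : ℕ} {x : ℕ → LaurentSeries E} {Ω : Finset E} {A : E[X]} {b : E}

lemma x_notMem (h : Curve q i x Ω A b) : x 1 ∉ powerRing E := h.notMem 1 le_rfl h.one_le

lemma small_top (h : Curve q i x Ω A b) : (famPole h.x_notMem).Small (aeval (yy E) A)⁻¹ := by
  rw [h.eqn]
  exact (h.toTow.unif_inf (famPole_small h.x_notMem) h.one_le le_rfl).1.inv_add_const b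

lemma unif_top (h : Curve q i x Ω A b) :
    (famPole h.x_notMem).Unif (fld E x 1 i) (aeval (yy E) A)⁻¹ := by
  rw [h.eqn]
  have := h.toTow.unif_inf (famPole_small h.x_notMem) h.one_le le_rfl
  exact this.2.inv_add_const this.1 b

lemma phi_mem_fld {l : ℕ} (h1 : 1 ≤ l) :
    phi q (x l) ∈ fld E x 1 l := Tow.phi_mem_fld (mem_fld h1 le_rfl)

lemma aeval_mem_fld (h : Curve q i x Ω A b) : aeval (yy E) A ∈ fld E x 1 i := by
  rw [h.eqn]
  exact add_mem (phi_mem_fld h.one_le) (IntermediateField.algebraMap_mem _ _)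

lemma indep_top (h : Curve q i x Ω A b) (c : ℕ → LaurentSeries E) (hc : ∀ j, c j ∈ fld E x 1 i)
    (h0 : ∑ j ∈ Finset.range A.natDegree, c j * yy E ^ j = 0) : ∀ j < A.natDegree, c j = 0 :=
  Fam.Unif.indep h.monic h.small_top h.unif_top c hc h0

lemma indep_succ (h : Curve q i x Ω A b) {l : ℕ} (hl1 : 1 ≤ l) (hl : l < i)
    (c : ℕ → LaurentSeries E) (hc : ∀ j, c j ∈ fld E x 1 l)
    (h0 : ∑ j ∈ Finset.range (TP E q).natDegree, c j * x (l + 1) ^ j = 0) :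
    ∀ j < (TP E q).natDegree, c j = 0 := by
  have := h.toTow.unif_inf (famPole_small h.x_notMem) hl1 hl.le
  rw [← h.step l hl1 hl, ← aeval_TP (K := E) (L := LaurentSeries E)] at this
  exact Fam.Unif.indep (TP_monic h.two_le) this.1 this.2 c hc h0

lemma unif_topF (h : Curve q i x Ω A b) : (famPole h.x_notMem).Small (yy E)⁻¹ ∧
    (famPole h.x_notMem).Unif (topF x i) (yy E)⁻¹ :=
  ⟨(Fam.small_inv_of_aeval h.monic h.small_top).1, Fam.Unif.step h.monic h.small_top h.unif_top
    (span_adjoin_simple _ h.monic h.pos h.aeval_mem_fld)⟩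

/-- There are no nonconstant functions without poles. -/
lemma eq_zero_of_val_lt_one [IsAlgClosed E] (h : Curve q i x Ω A b) {f : LaurentSeries E}
    (hf : f ∈ reg (x 1) (topF x i)) (hv : (powerRing E).valuation f < 1) : f = 0 := by
  by_contra hf0
  obtain ⟨hs, hu⟩ := h.unif_topF
  obtain ⟨n, g, hg, hfg⟩ := hu f hf.1 hf0
  have hP : (famPole h.x_notMem).mem (powerRing E) :=
    ⟨fun c => const_mem_powerRing c, h.x_notMem⟩
  have hn : 0 ≤ n := by
    by_contra hn
    obtain ⟨m, rfl⟩ : ∃ m : ℕ, n = -m := ⟨(-n).toNat, by omega⟩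
    have h1 : f⁻¹ = ((yy E)⁻¹) ^ m * g⁻¹ := by
      rw [hfg, mul_inv, zpow_neg, inv_inv, zpow_natCast]
    have h2 : f⁻¹ ∈ (famPole h.x_notMem).B := by
      rw [h1]; exact mul_mem (_root_.pow_mem hs.mem_B m) ((hg.inv hs).mem_B hs)
    have h3 := val_mul_lt_one hv (h2 _ hP)
    rw [mul_inv_cancel₀ hf0, map_one] at h3
    exact lt_irrefl _ h3
  obtain ⟨m, rfl⟩ : ∃ m : ℕ, n = m := ⟨n.toNat, by omega⟩
  have hB : f ∈ (famPole h.x_notMem).B := by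
    rw [hfg, zpow_natCast]
    exact mul_mem (_root_.pow_mem hs.mem_B m) (hg.mem_B hs)
  obtain ⟨P, hPm, hPc, hP0⟩ := exists_monic_of_forall_valuationSubring
    (algebraMap E (LaurentSeries E)).range (f := f) fun V hV => by
      have hc : ∀ c : E, algebraMap E _ c ∈ V := fun c => hV ⟨c, rfl⟩
      by_cases hxV : x 1 ∈ V
      · exact hf.2 V ⟨hc, hxV⟩
      · exact hB V ⟨hc, hxV⟩
  have hInt : IsIntegral E f := by
    obtain ⟨P', hP', -, hm⟩ := lifts_and_natDegree_eq_and_monic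
      (f := algebraMap E (LaurentSeries E)) (p := P) ((lifts_iff_coeff_lifts P).2 fun i => hPc i) hPm
    exact ⟨P', hm, by rw [← hP', eval_map] at hP0; exact hP0⟩
  have hd : (minpoly E f).natDegree = 1 :=
    natDegree_eq_of_degree_eq_some
      (IsAlgClosed.degree_eq_one_of_irreducible E (minpoly.irreducible hInt))
  obtain ⟨c, hc⟩ := (minpoly.natDegree_eq_one_iff).1 hd
  subst hc
  have hc0 : c ≠ 0 := fun h0 => hf0 (by rw [h0, map_zero])
  have h3 := val_mul_lt_one hv (const_mem_powerRing c⁻¹)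
  rw [← map_mul, mul_inv_cancel₀ hc0, map_one, map_one] at h3
  exact lt_irrefl _ h3

end Curve

end Tower

end

section

open Polynomial

namespace Tower

variable {E : Type*} [Field E]

/-- The Laurent series `z` is a power series with constant term `c`. -/
def Res (z : LaurentSeries E) (c : E) : Prop :=
  (powerRing E).valuation (z - algebraMap E _ c) < 1

namespace Res

variable {z z' : LaurentSeries E} {c c' : E}

lemma const (c : E) : Res (algebraMap E _ c) c := by
  rw [Res, sub_self, map_zero]; exact zero_lt_one

lemma mem (h : Res z c) : z ∈ powerRing E := by
  have := (powerRing E).add_mem _ _ (mem_of_val_lt_one h) (const_mem_powerRing c)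
  rwa [sub_add_cancel] at this

lemma exists_of_mem (h : z ∈ powerRing E) : ∃ c, Res z c := by
  obtain ⟨g, rfl⟩ := mem_powerRing.1 h
  refine ⟨PowerSeries.constantCoeff g, val_lt_one_iff.2 ⟨g - PowerSeries.C
    (PowerSeries.constantCoeff g), ?_, ?_⟩⟩
  · rw [PowerSeries.X_dvd_iff]; simp
  · rw [map_sub, algebraMap_eq_ofPow]

lemma val_lt_one_zero : Res z 0 ↔ (powerRing E).valuation z < 1 := by
  rw [Res, map_zero, sub_zero]

lemma of_eq_add {w : LaurentSeries E} (hw : (powerRing E).valuation w < 1) (c : E) :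
    Res (algebraMap E _ c + w) c := by
  rwa [Res, add_sub_cancel_left]

lemma add (h : Res z c) (h' : Res z' c') : Res (z + z') (c + c') := by
  have := (powerRing E).valuation.map_add_lt h h'
  rw [Res]; convert this using 2; rw [map_add]; ring

lemma neg (h : Res z c) : Res (-z) (-c) := by
  rw [Res, map_neg, ← neg_sub_neg, neg_neg, neg_neg, Valuation.map_sub_swap]
  rw [Valuation.map_sub_swap]; rwa [Valuation.map_sub_swap]

lemma sub (h : Res z c) (h' : Res z' c') : Res (z - z') (c - c') := by
  rw [sub_eq_add_neg, sub_eq_add_neg]; exact h.add h'.neg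

lemma mul (h : Res z c) (h' : Res z' c') : Res (z * z') (c * c') := by
  have := (powerRing E).valuation.map_add_lt (val_mul_lt_one h h'.mem)
    (val_mul_lt_one h' (const_mem_powerRing c))
  rw [Res]; convert this using 2; rw [map_mul]; ring

lemma pow (h : Res z c) (n : ℕ) : Res (z ^ n) (c ^ n) := by
  induction n with
  | zero => rw [pow_zero, pow_zero]; simpa using const (1 : E)
  | succ n ih => rw [pow_succ, pow_succ]; exact ih.mul h

lemma unique (h : Res z c) (h' : Res z c') : c = c' := by
  have h1 := h.sub h'
  rw [sub_self, Res, zero_sub, Valuation.map_neg] at h1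
  by_contra hne
  have h2 := val_mul_lt_one h1 (const_mem_powerRing (c - c')⁻¹)
  rw [← map_mul, mul_inv_cancel₀ (sub_ne_zero.2 hne), map_one, map_one] at h2
  exact lt_irrefl _ h2

lemma ne_zero (h : Res z c) (hc : c ≠ 0) : z ≠ 0 := by
  rintro rfl
  exact hc (h.unique (by simpa using const (0 : E)))

lemma inv (h : Res z c) (hc : c ≠ 0) : Res z⁻¹ c⁻¹ := by
  have hz := h.ne_zero hc
  have hm : z⁻¹ ∈ powerRing E := by
    by_contra hz'
    have h1 := val_lt_one_of_inv_notMem hz'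
    rw [inv_inv] at h1
    exact hc (h.unique (val_lt_one_zero.2 h1))
  obtain ⟨d, hd⟩ := exists_of_mem hm
  have h1 := h.mul hd
  rw [mul_inv_cancel₀ hz] at h1
  have h2 : c * d = 1 := h1.unique (by simpa using const (1 : E))
  rwa [← eq_inv_of_mul_eq_one_right h2]

lemma aeval (h : Res z c) (P : E[X]) : Res (Polynomial.aeval z P) (P.eval c) := by
  induction P using Polynomial.induction_on' with
  | add P Q hP hQ => rw [map_add, eval_add]; exact hP.add hQ
  | monomial n r => rw [aeval_monomial, eval_monomial]; exact (const r).mul (h.pow n)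

lemma T (h : Res z c) (q : ℕ) : Res (T q z) (Tower.T q c) := (h.pow q).add h

lemma phi (h : Res z c) {q : ℕ} (hc : c ≠ 0) (hT : Tower.T q c⁻¹ ≠ 0) :
    Res (phi q z) (Tower.phi q c) := ((h.inv hc).T q).inv hT

end Res

/-- A solution in the field of constants of the equations defining a tower. -/
structure Chain (q i : ℕ) (A : E[X]) (b : E) (α : ℕ → E) (β : E) : Prop where
  ne_zero : T q (α 1) ≠ 0
  step : ∀ l, 1 ≤ l → l < i → T q (α (l + 1)) = phi q (α l)
  top : A.eval β = phi q (α i) + b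

lemma T_inv_ne_zero {q : ℕ} (hq : 2 ≤ q) {c : E} (hc : T q c ≠ 0) : c ≠ 0 ∧ T q c⁻¹ ≠ 0 := by
  have h0 : c ≠ 0 := by rintro rfl; exact hc (T_zero hq)
  refine ⟨h0, fun h => hc ?_⟩
  have h1 : T q c = c ^ (q + 1) * T q c⁻¹ := by
    rw [T, T, inv_pow]; field_simp; ring
  rw [h1, h, mul_zero]

lemma phi_ne_zero {q : ℕ} (hq : 2 ≤ q) {c : E} (hc : T q c ≠ 0) : phi q c ≠ 0 :=
  inv_ne_zero (T_inv_ne_zero hq hc).2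

namespace Chain

variable {q i : ℕ} {A : E[X]} {b : E} {α : ℕ → E} {β : E}

lemma T_ne_zero (h : Chain q i A b α β) (hq : 2 ≤ q) {l : ℕ} (h1 : 1 ≤ l) (hl : l ≤ i) :
    T q (α l) ≠ 0 := by
  induction l, h1 using Nat.le_induction with
  | base => exact h.ne_zero
  | succ l h1 ih =>
    rw [h.step l h1 (by omega)]
    exact phi_ne_zero hq (ih (by omega))

end Chain

variable {p : ℕ} [Fact p.Prime] [CharP E p] {a : ℕ}

lemma exists_res_T (ha : 0 < a) {ψ : LaurentSeries E} {c : E} (hψ : Res ψ (T (p ^ a) c)) :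
    ∃ z, Res z c ∧ T (p ^ a) z = ψ ∧ ∀ σ : E →+* E, σ c = c → cmap σ ψ = ψ → cmap σ z = z := by
  have hTc : ∀ w, T (p ^ a) (algebraMap E (LaurentSeries E) c + w) =
      algebraMap E _ (T (p ^ a) c) + T (p ^ a) w := by
    intro w
    rw [T, laurent_add_pow, T, T, map_add, map_pow]; ring
  obtain ⟨w, hw, hwT⟩ := exists_root (p := p) ha hψ
  refine ⟨algebraMap E _ c + w, .of_eq_add hw c, ?_, fun σ hσ hσψ => ?_⟩
  · rw [hTc, hwT, add_sub_cancel]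
  · rw [map_add, cmap_algebraMap, hσ,
      root_unique (p := p) ha (cmap_val_lt_one σ hw) hw]
    rw [← map_T, hwT, map_sub, hσψ, cmap_algebraMap, T, map_add, map_pow, hσ]

lemma exists_res_aeval (ha : 0 < a) {A B : E[X]} (hadd : IsAdditive (LaurentSeries E) A)
    (hAB : ∀ u : LaurentSeries E, aeval (aeval u B) A = T (p ^ a) u) (hB : B.coeff 0 = 0)
    {ψ : LaurentSeries E} {c : E} (hψ : Res ψ (A.eval c)) :
    ∃ z, Res z c ∧ aeval z A = ψ ∧ ∀ σ : E →+* E, A.map σ = A → B.map σ = B →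
      σ c = c → cmap σ ψ = ψ → cmap σ z = z := by
  obtain ⟨w, hw, hwT⟩ := exists_root (p := p) ha hψ
  have hBw : Res (aeval w B) 0 := by
    have := (Res.val_lt_one_zero.2 hw).aeval B
    rwa [← coeff_zero_eq_eval_zero, hB] at this
  refine ⟨algebraMap E _ c + aeval w B, .of_eq_add (Res.val_lt_one_zero.1 hBw) c, ?_,
    fun σ hσA hσB hσ hσψ => ?_⟩
  · rw [hadd, hAB, hwT, aeval_def, eval₂_at_apply, add_sub_cancel]
  · rw [map_add, cmap_algebraMap, hσ, cmap_aeval σ hσB,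
      root_unique (p := p) ha (cmap_val_lt_one σ hw) hw]
    have h1 : σ (A.eval c) = A.eval c := by rw [← eval_map_apply, hσA, hσ]
    rw [← map_T, hwT, map_sub, hσψ, cmap_algebraMap, h1]

section Generic

variable {K L M : Type*} [Field K] [Field L] [Field M] [Algebra K L] [Algebra K M]

lemma map_phi_eq {F : IntermediateField K L} (θ : F →ₐ[K] M) (q : ℕ) {z u : L} (hz : z ∈ F)
    (hu : u ∈ F) (h : u = phi q z) : θ ⟨u, hu⟩ = phi q (θ ⟨z, hz⟩) := by
  have h1 : (⟨u, hu⟩ : F) = phi q ⟨z, hz⟩ :=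
    Subtype.ext (h.trans (map_phi F.val.toRingHom q ⟨z, hz⟩).symm)
  rw [h1]
  exact map_phi θ.toRingHom _ _

lemma map_phi_add_eq {F : IntermediateField K L} (θ : F →ₐ[K] M) (q : ℕ) {z u : L} {b : K}
    (hz : z ∈ F) (hu : u ∈ F) (h : u = phi q z + algebraMap K L b) :
    θ ⟨u, hu⟩ = phi q (θ ⟨z, hz⟩) + algebraMap K M b := by
  have hp : phi q z ∈ F := Tow.phi_mem_fld hz
  have h1 : (⟨u, hu⟩ : F) = ⟨phi q z, hp⟩ + algebraMap K F b := Subtype.ext h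
  rw [h1, map_add, AlgHom.commutes, map_phi_eq θ q hz hp rfl]

end Generic

lemma exists_hom_base {x : LaurentSeries E} (hx : Transcendental E x) {z : LaurentSeries E}
    (hz : Transcendental E z) : ∃ θ : IntermediateField.adjoin E {x} →ₐ[E] LaurentSeries E,
      θ ⟨x, IntermediateField.mem_adjoin_simple_self E x⟩ = z := by
  let e := RatFunc.algEquivOfTranscendental x hx
  let e' := RatFunc.algEquivOfTranscendental z hz
  have h1 : e RatFunc.X = ⟨x, IntermediateField.mem_adjoin_simple_self E x⟩ :=
    Subtype.ext (RatFunc.algEquivOfTranscendental_X x hx)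
  refine ⟨(IntermediateField.val _).comp (e'.toAlgHom.comp e.symm.toAlgHom), ?_⟩
  rw [← h1]
  have h2 : e.symm (e RatFunc.X) = RatFunc.X := e.symm_apply_apply _
  have h3 : (e' RatFunc.X : LaurentSeries E) = z := RatFunc.algEquivOfTranscendental_X z hz
  exact (congrArg (fun u => (e' u : LaurentSeries E)) h2).trans h3

lemma transcendental_const_add (c : E) :
    Transcendental E (algebraMap E (LaurentSeries E) c + ofPow E PowerSeries.X) := by
  have h0 : Transcendental E (yy E) := fun halg => by
    refine yy_notMem (mem_of_aeval_mem (fun c => const_mem_powerRing c)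
      (minpoly.monic halg.isIntegral) (minpoly.natDegree_pos halg.isIntegral) ?_)
    rw [minpoly.aeval]
    exact (powerRing E).zero_mem
  intro h
  refine h0 (IsAlgebraic.inv_iff.1 ?_)
  rw [yy, inv_inv]
  have := h.add (isAlgebraic_algebraMap (A := LaurentSeries E) (-c))
  rwa [map_neg, add_neg_cancel_comm] at this

namespace Curve

variable {i : ℕ} {x : ℕ → LaurentSeries E} {Ω : Finset E} {A B : E[X]} {b : E} {α : ℕ → E}
  {β : E}

lemma exists_hom_fld (ha : 0 < a) (h : Curve (p ^ a) i x Ω A b) (hc : Chain (p ^ a) i A b α β)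
    {l : ℕ} (h1 : 1 ≤ l) (hl : l ≤ i) : ∃ θ : fld E x 1 l →ₐ[E] LaurentSeries E,
      ∀ j (h1 : 1 ≤ j) (hj : j ≤ l), Res (θ ⟨x j, mem_fld h1 hj⟩) (α j) ∧
        ∀ σ : E →+* E, (∀ m, 1 ≤ m → m ≤ i → σ (α m) = α m) →
          cmap σ (θ ⟨x j, mem_fld h1 hj⟩) = θ ⟨x j, mem_fld h1 hj⟩ := by
  have hq := h.two_le
  induction l, h1 using Nat.le_induction with
  | base =>
    obtain ⟨θ, hθ⟩ := exists_hom_base h.trans (transcendental_const_add (α 1))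
    refine ⟨θ.comp (IntermediateField.inclusion (fld_self x 1).le), fun j h1 hj => ?_⟩
    obtain rfl : j = 1 := by omega
    have h2 : (θ.comp (IntermediateField.inclusion (fld_self x 1).le)) ⟨x 1, mem_fld h1 hj⟩ =
      algebraMap E _ (α 1) + ofPow E PowerSeries.X := hθ
    rw [h2]
    refine ⟨.of_eq_add (val_lt_one_iff.2 ⟨_, dvd_rfl, rfl⟩) _, fun σ hσ => ?_⟩
    rw [map_add, cmap_algebraMap, hσ 1 le_rfl hl, cmap_ofPow, PowerSeries.map_X]
  | succ l h1 ih =>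
    obtain ⟨θ, hθ⟩ := ih (by omega)
    have hy : aeval (x (l + 1)) (TP E (p ^ a)) ∈ fld E x 1 l := by
      rw [aeval_TP, h.step l h1 (by omega)]; exact phi_mem_fld h1
    have hT := hc.T_ne_zero hq h1 (show l ≤ i by omega)
    obtain ⟨hα0, hTα⟩ := T_inv_ne_zero hq hT
    have hres := (hθ l h1 le_rfl).1.phi hα0 hTα
    rw [← hc.step l h1 (by omega)] at hres
    obtain ⟨z, hz, hzT, hzσ⟩ := exists_res_T ha hres
    obtain ⟨θ', hθ', hθy⟩ := exists_extension θ (TP_monic hq)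
      (by rw [TP_natDegree hq]; omega) hy (h.indep_succ h1 (by omega)) (z := z) (by
        rw [aeval_TP, hzT]
        exact (map_phi_eq θ _ (mem_fld h1 le_rfl) hy
          (by rw [aeval_TP, h.step l h1 (by omega)])).symm)
    refine ⟨θ'.comp (IntermediateField.inclusion (fld_succ x (by omega)).le), fun j h1' hj => ?_⟩
    rcases eq_or_ne j (l + 1) with rfl | hne
    · have h2 : (θ'.comp (IntermediateField.inclusion (fld_succ x (by omega)).le))
        ⟨x (l + 1), mem_fld h1' hj⟩ = z := hθy
      rw [h2]
      refine ⟨hz, fun σ hσ => hzσ σ (hσ _ h1' hl) ?_⟩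
      rw [map_phi, (hθ l h1 le_rfl).2 σ hσ]
    · have hj' : j ≤ l := by omega
      have h2 : (θ'.comp (IntermediateField.inclusion (fld_succ x (by omega)).le))
        ⟨x j, mem_fld h1' hj⟩ = θ ⟨x j, mem_fld h1' hj'⟩ := hθ' _ _
      rw [h2]
      exact hθ j h1' hj'

lemma x_mem_topF {l : ℕ} (h1 : 1 ≤ l) (hl : l ≤ i) : x l ∈ topF x i :=
  (le_sup_left : _ ≤ topF x i) (mem_fld h1 hl)

lemma yy_mem_topF : yy E ∈ topF x i :=
  (le_sup_right : _ ≤ topF x i) (IntermediateField.mem_adjoin_simple_self E _)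

lemma exists_hom_topF (ha : 0 < a) (h : Curve (p ^ a) i x Ω A b)
    (hadd : IsAdditive (LaurentSeries E) A)
    (hAB : ∀ u : LaurentSeries E, aeval (aeval u B) A = T (p ^ a) u) (hB : B.coeff 0 = 0)
    (hc : Chain (p ^ a) i A b α β) : ∃ θ : topF x i →ₐ[E] LaurentSeries E,
      (∀ j (h1 : 1 ≤ j) (hj : j ≤ i), Res (θ ⟨x j, x_mem_topF h1 hj⟩) (α j)) ∧
      Res (θ ⟨yy E, yy_mem_topF⟩) β ∧
      ∀ σ : E →+* E, A.map σ = A → B.map σ = B → σ b = b →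
        (∀ m, 1 ≤ m → m ≤ i → σ (α m) = α m) → σ β = β →
        (∀ j (h1 : 1 ≤ j) (hj : j ≤ i),
          cmap σ (θ ⟨x j, x_mem_topF h1 hj⟩) = θ ⟨x j, x_mem_topF h1 hj⟩) ∧
        cmap σ (θ ⟨yy E, yy_mem_topF⟩) = θ ⟨yy E, yy_mem_topF⟩ := by
  have hq := h.two_le
  have h1 := h.one_le
  obtain ⟨θ, hθ⟩ := h.exists_hom_fld ha hc h1 le_rfl
  have hT := hc.T_ne_zero hq h1 le_rfl
  obtain ⟨hα0, hTα⟩ := T_inv_ne_zero hq hT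
  have hres := ((hθ i h1 le_rfl).1.phi hα0 hTα).add (.const b)
  rw [← hc.top] at hres
  obtain ⟨z, hz, hzA, hzσ⟩ := exists_res_aeval ha hadd hAB hB hres
  obtain ⟨θ', hθ', hθy⟩ := exists_extension θ h.monic h.pos h.aeval_mem_fld h.indep_top
    (z := z) (by
      rw [hzA]
      exact (map_phi_add_eq θ _ (mem_fld h1 le_rfl) h.aeval_mem_fld h.eqn).symm)
  have hx : ∀ j (h1 : 1 ≤ j) (hj : j ≤ i), θ' ⟨x j, x_mem_topF h1 hj⟩ =
    θ ⟨x j, mem_fld h1 hj⟩ := fun j h1 hj => hθ' _ _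
  refine ⟨θ', fun j h1 hj => ?_, ?_, fun σ hσA hσB hσb hσ hσβ => ⟨fun j h1 hj => ?_, ?_⟩⟩
  · exact (congrArg (Res · (α j)) (hx j h1 hj)).mpr (hθ j h1 hj).1
  · exact (congrArg (Res · β) hθy).mpr hz
  · exact (congrArg (fun u => cmap σ u = u) (hx j h1 hj)).mpr ((hθ j h1 hj).2 σ hσ)
  · refine (congrArg (fun u => cmap σ u = u) hθy).mpr (hzσ σ hσA hσB hσβ ?_)
    rw [map_add, map_phi, (hθ i h1 le_rfl).2 σ hσ, cmap_algebraMap, hσb]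

end Curve

end Tower

end

section

open Polynomial

namespace Tower

section Loc

variable {K L : Type*} [Field K] [Field L] [Algebra K L]

/-- Fractions with denominator a power of `t`. -/
def loc (S : Subalgebra K L) {t : L} (ht : t ∈ S) : Subalgebra K L where
  carrier := {f | ∃ M : ℕ, t ^ M * f ∈ S}
  mul_mem' := by
    rintro f g ⟨M, hM⟩ ⟨N, hN⟩
    refine ⟨M + N, ?_⟩
    have := S.mul_mem hM hN
    convert this using 1; ring
  add_mem' := by
    rintro f g ⟨M, hM⟩ ⟨N, hN⟩
    refine ⟨M + N, ?_⟩
    have := S.add_mem (S.mul_mem (_root_.pow_mem ht N) hM) (S.mul_mem (_root_.pow_mem ht M) hN)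
    convert this using 1; ring
  algebraMap_mem' c := ⟨0, by rw [pow_zero, one_mul]; exact S.algebraMap_mem c⟩

lemma T_mem_subalgebra {S : Subalgebra K L} {z : L} (hz : z ∈ S) (q : ℕ) : T q z ∈ S :=
  S.add_mem (S.pow_mem hz q) hz

lemma mem_loc_hol_of_aeval {x t w : L} {ht : t ∈ hol K x} {A : K[X]} (hA : A.Monic)
    (hpos : 0 < A.natDegree) (h : aeval w A ∈ loc (hol K x) ht) : w ∈ loc (hol K x) ht := by
  obtain ⟨M, hM⟩ := h
  refine ⟨M, fun V hV => ?_⟩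
  have := mul_pow_mem_of_aeval hV.1 hA ((hol K x).pow_mem ht M V hV) (hM V hV)
    (show 1 ≤ A.natDegree from hpos)
  rwa [pow_one] at this

lemma phi_mem_loc {S : Subalgebra K L} {q : ℕ} (hq : 2 ≤ q) {z : L} (hz : z ∈ S)
    (hT : T q z ≠ 0) (hTi : (T q z)⁻¹ ∈ S) : phi q z ∈ S ∧ (phi q z)⁻¹ ∈ S := by
  have h0 : z ≠ 0 := by rintro rfl; exact hT (T_zero hq)
  have h1 : z ^ (q - 1) + 1 ≠ 0 := fun h => hT (by rw [T_eq_mul hq, h, mul_zero])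
  constructor
  · have : phi q z = z ^ q * z * (T q z)⁻¹ := by
      rw [← phi_mul hq hT, T_eq_mul hq]; field_simp
    rw [this]
    exact S.mul_mem (S.mul_mem (S.pow_mem hz q) hz) hTi
  · rw [phi, inv_inv]
    refine T_mem_subalgebra ?_ q
    have : z⁻¹ = (z ^ (q - 1) + 1) * (T q z)⁻¹ := by
      rw [T_eq_mul hq]; field_simp
    rw [this]
    exact S.mul_mem (S.add_mem (S.pow_mem hz _) S.one_mem) hTi

lemma Tow.mem_loc {q i : ℕ} {x : ℕ → L} {Ω : Finset K} (h : Tow K q i x Ω)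
    (ht : T q (x 1) ∈ hol K (x 1)) {l : ℕ} (h1 : 1 ≤ l) (hl : l ≤ i) :
    x l ∈ loc (hol K (x 1)) ht ∧ (T q (x l))⁻¹ ∈ loc (hol K (x 1)) ht := by
  have hq := h.two_le
  induction l, h1 using Nat.le_induction with
  | base =>
    refine ⟨⟨0, by rw [pow_zero, one_mul]; exact self_mem_hol _⟩, 1, ?_⟩
    rw [pow_one, mul_inv_cancel₀ (h.T_ne_zero le_rfl hl)]
    exact one_mem _
  | succ l h1 ih =>
    obtain ⟨hx, hT⟩ := ih (by omega)
    have h2 := phi_mem_loc hq hx (h.T_ne_zero h1 (by omega)) hT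
    rw [← h.step l h1 (by omega)] at h2
    refine ⟨mem_loc_hol_of_aeval (TP_monic hq) (by rw [TP_natDegree hq]; omega) ?_, h2.2⟩
    rw [aeval_TP]; exact h2.1

end Loc

section Generic

variable {K L M : Type*} [Field K] [Field L] [Field M] [Algebra K L] [Algebra K M]

lemma semilinear_comm {F : IntermediateField K L} (θ : F →ₐ[K] M)
    {S : Set L} (hF : F = IntermediateField.adjoin K S) {σ : K →+* K} {f₁ : L →+* L} {f₂ : M →+* M}
    (h₁ : ∀ c, f₁ (algebraMap K L c) = algebraMap K L (σ c))
    (h₂ : ∀ c, f₂ (algebraMap K M c) = algebraMap K M (σ c))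
    (hS : ∀ s ∈ S, f₁ s = s)
    (hθ : ∀ s (hs : s ∈ F), s ∈ S → f₂ (θ ⟨s, hs⟩) = θ ⟨s, hs⟩) {f : L}
    (hf : f ∈ F) : ∃ h : f₁ f ∈ F, f₂ (θ ⟨f, hf⟩) = θ ⟨f₁ f, h⟩ := by
  have hf' := hF ▸ hf
  have key : ∃ (h : f ∈ F) (h' : f₁ f ∈ F), f₂ (θ ⟨f, h⟩) = θ ⟨f₁ f, h'⟩ := by
    clear hf
    induction hf' using IntermediateField.adjoin_induction with
    | mem s hs =>
      have hsF : s ∈ F := hF ▸ IntermediateField.subset_adjoin K S hs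
      refine ⟨hsF, (hS s hs).symm ▸ hsF, ?_⟩
      rw [hθ s hsF hs]
      congr 2
      exact (hS s hs).symm
    | algebraMap c =>
      have h1 : f₁ (algebraMap K L c) ∈ F := by rw [h₁]; exact F.algebraMap_mem _
      refine ⟨F.algebraMap_mem c, h1, ?_⟩
      have h3 : (⟨algebraMap K L c, F.algebraMap_mem c⟩ : F) = algebraMap K F c := rfl
      have h4 : (⟨_, h1⟩ : F) = algebraMap K F (σ c) := Subtype.ext (h₁ c)
      rw [h3, h4, AlgHom.commutes, AlgHom.commutes, h₂]
    | add u v hu hv ihu ihv =>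
      obtain ⟨a, a', ha⟩ := ihu
      obtain ⟨b, b', hb⟩ := ihv
      have h1 : f₁ (u + v) ∈ F := by rw [map_add]; exact F.add_mem a' b'
      refine ⟨F.add_mem a b, h1, ?_⟩
      have h2 : (⟨u + v, F.add_mem a b⟩ : F) = ⟨u, a⟩ + ⟨v, b⟩ := rfl
      have h3 : (⟨f₁ (u + v), h1⟩ : F) = ⟨f₁ u, a'⟩ + ⟨f₁ v, b'⟩ :=
        Subtype.ext (map_add _ _ _)
      rw [h2, h3, map_add, map_add, map_add, ha, hb]
    | mul u v hu hv ihu ihv =>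
      obtain ⟨a, a', ha⟩ := ihu
      obtain ⟨b, b', hb⟩ := ihv
      have h1 : f₁ (u * v) ∈ F := by rw [map_mul]; exact F.mul_mem a' b'
      refine ⟨F.mul_mem a b, h1, ?_⟩
      have h2 : (⟨u * v, F.mul_mem a b⟩ : F) = ⟨u, a⟩ * ⟨v, b⟩ := rfl
      have h3 : (⟨f₁ (u * v), h1⟩ : F) = ⟨f₁ u, a'⟩ * ⟨f₁ v, b'⟩ :=
        Subtype.ext (map_mul _ _ _)
      rw [h2, h3, map_mul, map_mul, map_mul, ha, hb]
    | inv u hu ihu =>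
      obtain ⟨a, a', ha⟩ := ihu
      have h1 : f₁ u⁻¹ ∈ F := by rw [map_inv₀]; exact F.inv_mem a'
      refine ⟨F.inv_mem a, h1, ?_⟩
      have h2 : (⟨u⁻¹, F.inv_mem a⟩ : F) = ⟨u, a⟩⁻¹ := rfl
      have h3 : (⟨f₁ u⁻¹, h1⟩ : F) = ⟨f₁ u, a'⟩⁻¹ :=
        Subtype.ext (map_inv₀ _ _)
      rw [h2, h3, map_inv₀, map_inv₀, map_inv₀, ha]
  obtain ⟨_, h', h⟩ := key
  exact ⟨h', h⟩

lemma hom_T_pow_mul {F : IntermediateField K L} (θ : F →ₐ[K] M) {u z : L} (hu : u ∈ F)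
    (hz : z ∈ F) {q N : ℕ} (hm : T q u ^ N * z ∈ F) :
    θ ⟨T q u ^ N * z, hm⟩ = T q (θ ⟨u, hu⟩) ^ N * θ ⟨z, hz⟩ := by
  have h1 : (⟨T q u ^ N * z, hm⟩ : F) = ((⟨u, hu⟩ : F) ^ q + ⟨u, hu⟩) ^ N * ⟨z, hz⟩ := rfl
  rw [h1, map_mul, map_pow, map_add, map_pow]
  rfl

lemma mem_of_mem_reg {F : IntermediateField K L} (θ : F →ₐ[K] M) {V : ValuationSubring M}
    (hV : ∀ c : K, algebraMap K M c ∈ V) {x : L} (hx : x ∈ F) (hθ : θ ⟨x, hx⟩ ∈ V) {f : L}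
    (hf : f ∈ reg x F) : θ ⟨f, hf.1⟩ ∈ V := by
  obtain ⟨P, hPm, hPc, hP0⟩ := exists_monic_of_forall_valuationSubring
    (Algebra.adjoin K {x}).toSubring (f := f) fun V hV =>
      hf.2 V ⟨fun c => hV ((Algebra.adjoin K {x}).algebraMap_mem c),
        hV (Algebra.self_mem_adjoin_singleton K x)⟩
  have hle : Algebra.adjoin K {x} ≤ F.toSubalgebra :=
    Algebra.adjoin_le (Set.singleton_subset_iff.2 hx)
  have hval : ∀ g (hg : g ∈ Algebra.adjoin K {x}), θ ⟨g, hle hg⟩ ∈ V := by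
    intro g hg
    obtain ⟨Q, hQ⟩ : ∃ Q : K[X], aeval x Q = g := by
      rw [Algebra.adjoin_singleton_eq_range_aeval] at hg
      exact hg
    have h1 : (⟨_, hle hg⟩ : F) = aeval ⟨x, hx⟩ Q :=
      Subtype.ext (hQ.symm.trans (aeval_algHom_apply F.val (⟨x, hx⟩ : F) Q))
    rw [h1, ← aeval_algHom_apply]
    exact aeval_mem_of_mem (S := valAlg V hV) hθ Q
  obtain ⟨P', hP', -, hm⟩ := lifts_and_natDegree_eq_and_monic
    (f := algebraMap F L) (p := P)
    ((lifts_iff_coeff_lifts P).2 fun i => ⟨⟨_, hle (hPc i)⟩, rfl⟩) hPm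
  refine mem_of_monic_root (hm.map θ.toRingHom) (fun i => ?_) ?_ (f := θ ⟨f, hf.1⟩)
  · rw [coeff_map]
    have h2 := congrArg (fun P => P.coeff i) hP'
    simp only [coeff_map] at h2
    have h1 : P'.coeff i = ⟨P.coeff i, hle (hPc i)⟩ := Subtype.ext h2
    rw [h1]
    exact hval _ (hPc i)
  · have h1 : P'.eval ⟨f, hf.1⟩ = 0 := by
      apply Subtype.ext
      rw [← hP'] at hP0
      exact (eval_map_apply (algebraMap F L) ⟨f, hf.1⟩).symm.trans hP0
    exact (eval_map_apply θ.toRingHom _).trans (by rw [h1, map_zero])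

end Generic

variable {E : Type*} [Field E]

lemma topF_eq (x : ℕ → LaurentSeries E) (i : ℕ) :
    topF x i = IntermediateField.adjoin E (x '' Set.Icc 1 i ∪ {yy E}) := by
  rw [topF, fld, IntermediateField.adjoin_union]

namespace Curve

variable {p : ℕ} [Fact p.Prime] [CharP E p] {a : ℕ} {q i : ℕ} {x : ℕ → LaurentSeries E}
  {Ω : Finset E} {A B : E[X]} {b : E} {α : ℕ → E} {β : E}

/-- The coordinate ring of the affine part of the tower. -/
noncomputable def ring (x : ℕ → LaurentSeries E) (i : ℕ) : Subalgebra E (LaurentSeries E) :=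
  reg (x 1) (topF x i)

lemma T_mem_ring (h : Curve q i x Ω A b) : T q (x 1) ∈ ring x i :=
  T_mem_subalgebra (S := ring x i) ⟨x_mem_topF le_rfl h.one_le, self_mem_hol _⟩ q

lemma exists_mul_x_mem_ring (h : Curve q i x Ω A b) {l : ℕ} (h1 : 1 ≤ l) (hl : l ≤ i) :
    ∃ M : ℕ, T q (x 1) ^ M * x l ∈ ring x i := by
  obtain ⟨M, hM⟩ := (h.toTow.mem_loc h.T_mem_ring.2 h1 hl).1
  exact ⟨M, (topF x i).mul_mem ((topF x i).toSubalgebra.pow_mem h.T_mem_ring.1 M)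
    (x_mem_topF h1 hl), hM⟩

lemma exists_mul_yy_mem_ring (h : Curve q i x Ω A b) :
    ∃ M : ℕ, T q (x 1) ^ M * yy E ∈ ring x i := by
  have h1 := h.toTow.mem_loc h.T_mem_ring.2 h.one_le le_rfl
  have h2 : yy E ∈ loc (hol E (x 1)) h.T_mem_ring.2 := by
    refine mem_loc_hol_of_aeval h.monic h.pos ?_
    rw [h.eqn]
    exact add_mem (phi_mem_loc h.two_le h1.1 (h.T_ne_zero h.one_le le_rfl) h1.2).1
      (Subalgebra.algebraMap_mem _ b)
  obtain ⟨M, hM⟩ := h2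
  exact ⟨M, (topF x i).mul_mem ((topF x i).toSubalgebra.pow_mem h.T_mem_ring.1 M)
    yy_mem_topF, hM⟩

/-- The point of the tower above a solution of the equations. -/
lemma exists_point (ha : 0 < a) (h : Curve (p ^ a) i x Ω A b)
    (hadd : IsAdditive (LaurentSeries E) A)
    (hAB : ∀ u : LaurentSeries E, aeval (aeval u B) A = T (p ^ a) u) (hB : B.coeff 0 = 0)
    (hc : Chain (p ^ a) i A b α β) : ∃ χ : ring x i →ₐ[E] E,
      (∀ (M : ℕ) (hm), χ ⟨T (p ^ a) (x 1) ^ M, hm⟩ = T (p ^ a) (α 1) ^ M) ∧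
      (∀ l, 1 ≤ l → l ≤ i → ∀ (M : ℕ) (hm), χ ⟨T (p ^ a) (x 1) ^ M * x l, hm⟩ =
        T (p ^ a) (α 1) ^ M * α l) ∧
      (∀ (M : ℕ) (hm), χ ⟨T (p ^ a) (x 1) ^ M * yy E, hm⟩ = T (p ^ a) (α 1) ^ M * β) ∧
      ∀ σ : E →+* E, A.map σ = A → B.map σ = B → σ b = b →
        (∀ m, 1 ≤ m → m ≤ i → σ (α m) = α m) → σ β = β →
        ∀ f : ring x i, cmap σ f = f → σ (χ f) = χ f := by
  obtain ⟨θ, hx, hy, hσ⟩ := h.exists_hom_topF ha hadd hAB hB hc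
  have hmem : ∀ f : ring x i, ∃ c, Res (θ ⟨f, f.2.1⟩) c := fun f =>
    Res.exists_of_mem (mem_of_mem_reg θ (fun c => const_mem_powerRing c)
      (x_mem_topF le_rfl h.one_le) (hx 1 le_rfl h.one_le).mem f.2)
  choose χ₀ hχ₀ using hmem
  let θ₀ : ring x i →ₐ[E] LaurentSeries E := θ.comp (Subalgebra.inclusion
    (inf_le_left : ring x i ≤ (topF x i).toSubalgebra))
  have hχ : ∀ f, Res (θ₀ f) (χ₀ f) := hχ₀
  let χ : ring x i →ₐ[E] E := {
    toFun := χ₀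
    map_one' := (hχ 1).unique (by rw [map_one]; simpa using Res.const (1 : E))
    map_zero' := (hχ 0).unique (by rw [map_zero]; simpa using Res.const (0 : E))
    map_mul' := fun f g => (hχ (f * g)).unique (by rw [map_mul]; exact (hχ f).mul (hχ g))
    map_add' := fun f g => (hχ (f + g)).unique (by rw [map_add]; exact (hχ f).add (hχ g))
    commutes' := fun c => (hχ _).unique (by rw [AlgHom.commutes]; exact Res.const c) }
  have hχθ : ∀ f, Res (θ₀ f) (χ f) := hχ
  have hT : ∀ (z : LaurentSeries E) (c : E) (hz : z ∈ topF x i), Res (θ ⟨z, hz⟩) c →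
      ∀ (M : ℕ) (hm : T (p ^ a) (x 1) ^ M * z ∈ ring x i),
        χ ⟨T (p ^ a) (x 1) ^ M * z, hm⟩ = T (p ^ a) (α 1) ^ M * c := by
    intro z c hz hc M hm
    refine (hχθ _).unique ?_
    have h1 : θ₀ ⟨T (p ^ a) (x 1) ^ M * z, hm⟩ =
        T (p ^ a) (θ ⟨x 1, x_mem_topF le_rfl h.one_le⟩) ^ M * θ ⟨z, hz⟩ :=
      hom_T_pow_mul θ _ hz hm.1
    rw [h1]
    exact (((hx 1 le_rfl h.one_le).T _).pow M).mul hc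
  refine ⟨χ, fun M hm => ?_, fun l h1 hl M hm => hT _ _ (x_mem_topF h1 hl) (hx l h1 hl) M hm,
    fun M hm => hT _ _ yy_mem_topF hy M hm, fun σ hσA hσB hσb hσα hσβ f hf => ?_⟩
  · have h1 := hT 1 1 (topF x i).one_mem (by
      have h1 : θ ⟨1, (topF x i).one_mem⟩ = 1 := θ.map_one
      have h2 := Res.const (1 : E)
      rw [map_one] at h2
      rw [h1]; exact h2) M (by rwa [mul_one])
    have h2 : (⟨T (p ^ a) (x 1) ^ M, hm⟩ : ring x i) =
      ⟨T (p ^ a) (x 1) ^ M * 1, by rwa [mul_one]⟩ := Subtype.ext (mul_one _).symm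
    rw [h2]
    exact h1.trans (mul_one _)
  · obtain ⟨hσx, hσy⟩ := hσ σ hσA hσB hσb hσα hσβ
    have hS : ∀ s ∈ x '' Set.Icc 1 i ∪ {yy E}, cmap σ s = s := by
      rintro s (⟨l, ⟨h1, hl⟩, rfl⟩ | rfl)
      · exact h.fix σ hσA hσb l h1 hl
      · exact cmap_yy σ
    obtain ⟨h1, h2⟩ := semilinear_comm θ (topF_eq x i) (cmap_algebraMap σ) (cmap_algebraMap σ) hS
      (fun s hs hs' => by
        rcases hs' with ⟨l, ⟨h1, hl⟩, rfl⟩ | rfl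
        · exact hσx l h1 hl
        · exact hσy) f.2.1
    have h3 : (⟨cmap σ f, h1⟩ : topF x i) = ⟨f, f.2.1⟩ := Subtype.ext hf
    rw [h3] at h2
    have h4 := hχθ f
    have h5 : Res (cmap σ (θ₀ f)) (σ (χ f)) := by
      have := cmap_val_lt_one σ h4
      rwa [map_sub, cmap_algebraMap] at this
    refine Res.unique (z := θ₀ f) ?_ h4
    rwa [show cmap σ (θ₀ f) = θ₀ f from h2] at h5

end Curve

end Tower

end

section

open Polynomial

namespace DegAlg

variable {k R : Type*} [Field k] [CommRing R] [Algebra k R] (D : DegAlg k R)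

lemma exists_hasGaps {γ : ℕ} (h : ∀ s : Finset ℕ, (∀ m ∈ s, m ∉ D.degs ⊤) → s.card ≤ γ) :
    ∃ g ≤ γ, D.HasGaps g := by
  classical
  have hfin : {m | m ∉ D.degs ⊤}.Finite := by
    by_contra hinf
    obtain ⟨s, hs, hc⟩ := Set.Infinite.exists_subset_card_eq hinf (γ + 1)
    have := h s fun m hm => hs hm
    omega
  have hcount : ∀ n, n = Module.finrank k ↥(D.lt n) +
      ((Finset.range n).filter (· ∉ D.degs ⊤)).card := by
    intro n
    rw [D.finrank_lt, Nat.count_eq_card_filter_range, Finset.card_filter_add_card_filter_not,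
      Finset.card_range]
  refine ⟨hfin.toFinset.card, h _ fun m hm => hfin.mem_toFinset.1 hm, fun n => ?_, ?_⟩
  · have h1 := hcount n
    have h2 : ((Finset.range n).filter (· ∉ D.degs ⊤)).card ≤ hfin.toFinset.card :=
      Finset.card_le_card fun m hm => hfin.mem_toFinset.2 (Finset.mem_filter.1 hm).2
    omega
  · refine ⟨hfin.toFinset.sup id + 1, fun n hn => ?_⟩
    have h1 := hcount n
    have h2 : (Finset.range n).filter (· ∉ D.degs ⊤) = hfin.toFinset := by
      ext m
      rw [Finset.mem_filter, Finset.mem_range, hfin.mem_toFinset]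
      refine ⟨fun h => h.2, fun h => ⟨?_, h⟩⟩
      have : id m ≤ hfin.toFinset.sup id := Finset.le_sup (hfin.mem_toFinset.2 h)
      simp only [id] at this
      omega
    rw [h2] at h1
    exact h1

end DegAlg

namespace Tower

section Filtration

variable {E : Type*} [Field E] {k : Type*} [Field k] [Algebra k E]

lemma laurent_algebraMap (c : k) : algebraMap k (LaurentSeries E) c =
    algebraMap E (LaurentSeries E) (algebraMap k E c) := by
  rw [algebraMap_eq_ofPow, HahnSeries.algebraMap_apply', PowerSeries.algebraMap_apply, ofPow]

lemma coeff_algebraMap_mul (c : E) (f : LaurentSeries E) (j : ℤ) :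
    (algebraMap E (LaurentSeries E) c * f).coeff j = c * f.coeff j := by
  rw [LaurentSeries.algebraMap_apply, HahnSeries.C_apply, HahnSeries.coeff_single_zero_mul]

lemma coeff_subalgebra_smul {S : Subalgebra k (LaurentSeries E)} (c : k) (f : S) (j : ℤ) :
    ((c • f : S) : LaurentSeries E).coeff j = c • (f : LaurentSeries E).coeff j := by
  rw [Algebra.smul_def, Subalgebra.coe_mul, Algebra.smul_def, ← coeff_algebraMap_mul,
    ← laurent_algebraMap]
  rfl

lemma coeff_mul_eq_zero {f g : LaurentSeries E} {a b : ℤ} (hf : ∀ j < a, f.coeff j = 0)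
    (hg : ∀ j < b, g.coeff j = 0) {j : ℤ} (hj : j < a + b) : (f * g).coeff j = 0 := by
  rw [HahnSeries.coeff_mul]
  refine Finset.sum_eq_zero fun ij hij => ?_
  rw [Finset.mem_antidiagonal] at hij
  by_cases h : ij.1 < a
  · rw [hf _ h, zero_mul]
  · rw [hg _ (by omega), mul_zero]

lemma coeff_mul_eq_mul {f g : LaurentSeries E} {a b : ℤ} (hf : ∀ j < a, f.coeff j = 0)
    (hg : ∀ j < b, g.coeff j = 0) : (f * g).coeff (a + b) = f.coeff a * g.coeff b := by
  rw [HahnSeries.coeff_mul]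
  rw [Finset.sum_eq_single (a, b)]
  · intro ij hij hne
    rw [Finset.mem_antidiagonal] at hij
    rcases lt_trichotomy ij.1 a with h | h | h
    · rw [hf _ h, zero_mul]
    · exact absurd (Prod.ext h (by simp only; omega)) hne
    · rw [hg _ (by omega), mul_zero]
  · intro h
    rw [Finset.mem_antidiagonal] at h
    by_contra hne
    exact h ⟨fun h0 => hne (by simp [h0]), fun h0 => hne (by simp [h0]), rfl⟩

lemma mem_powerRing_of_coeff {f : LaurentSeries E} (hf : ∀ j < 0, f.coeff j = 0) :
    f = ofPow E (PowerSeries.mk fun n => f.coeff n) := by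
  ext n
  rw [ofPow, PowerSeries.coeff_coe]
  split_ifs with h
  · exact hf n h
  · rw [PowerSeries.coeff_mk, Int.natAbs_of_nonneg (by omega)]

lemma coeff_eq_zero_of_mem {f : LaurentSeries E} (hf : f ∈ powerRing E) {j : ℤ} (hj : j < 0) :
    f.coeff j = 0 := by
  obtain ⟨g, rfl⟩ := mem_powerRing.1 hf
  rw [ofPow, PowerSeries.coeff_coe, if_pos hj]

lemma val_lt_one_of_coeff {f : LaurentSeries E} (hf : ∀ j ≤ 0, f.coeff j = 0) :
    (powerRing E).valuation f < 1 := by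
  refine val_lt_one_iff.2 ⟨_, ?_, (mem_powerRing_of_coeff fun j hj => hf j hj.le).symm⟩
  rw [PowerSeries.X_dvd_iff, ← PowerSeries.coeff_zero_eq_constantCoeff_apply, PowerSeries.coeff_mk]
  exact hf _ le_rfl

/-- The filtration of a subalgebra of Laurent series by pole order. -/
noncomputable def laurentDeg (S : Subalgebra k (LaurentSeries E))
    (h0 : ∀ f ∈ S, (∀ j ≤ 0, f.coeff j = 0) → f = 0)
    (hk : ∀ f ∈ S, ∀ j, ∃ c : k, algebraMap k E c = f.coeff j) : DegAlg k S where
  lt n := {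
    carrier := {f | ∀ j : ℤ, j < 1 - n → (f : LaurentSeries E).coeff j = 0}
    add_mem' := fun {f g} hf hg j hj => by
      rw [Subalgebra.coe_add, HahnSeries.coeff_add, hf j hj, hg j hj, add_zero]
    zero_mem' := fun j _ => by rw [Subalgebra.coe_zero, HahnSeries.coeff_zero]
    smul_mem' := fun c f hf j hj => by
      rw [coeff_subalgebra_smul, hf j hj, smul_zero] }
  lt_zero := by
    rw [eq_bot_iff]
    intro f hf
    exact (Submodule.mem_bot k).2 (Subtype.ext (h0 f f.2 fun j hj => hf j (by push_cast; omega)))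
  mono n f hf j hj := hf j (by push_cast at hj; omega)
  exhaust f := ⟨(1 - (f : LaurentSeries E).order).toNat, fun j hj =>
    HahnSeries.coeff_eq_zero_of_lt_order (by omega)⟩
  lead n := by
    obtain ⟨ψ, hψ⟩ := (Algebra.linearMap k E).exists_leftInverse_of_injective
      (LinearMap.ker_eq_bot.2 (algebraMap k E).injective)
    refine ⟨{ toFun := fun f => ψ ((f : LaurentSeries E).coeff (-n))
              map_add' := fun f g => by
                rw [Subalgebra.coe_add, HahnSeries.coeff_add, map_add]
              map_smul' := fun c f => by
                rw [coeff_subalgebra_smul, map_smul]; rfl },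
      fun f hf hl j hj => ?_⟩
    by_cases h : j < -n
    · exact hf j (by push_cast; omega)
    · obtain rfl : j = -n := by omega
      obtain ⟨c, hc⟩ := hk f f.2 (-n)
      have h1 : ψ ((f : LaurentSeries E).coeff (-n)) = 0 := hl
      rw [← hc] at h1 ⊢
      have h2 := LinearMap.congr_fun hψ c
      rw [LinearMap.comp_apply, Algebra.linearMap_apply, h1] at h2
      rw [show c = 0 from h2.symm, map_zero]
  mul_mem a b f g hf hg j hj := by
    rw [Subalgebra.coe_mul]
    exact coeff_mul_eq_zero hf hg (by push_cast at hj ⊢; omega)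
  mul_notMem a b f g hf hf' hg hg' h := by
    have key : ∀ (m : ℕ) (f : LaurentSeries E), (∀ j : ℤ, j < 1 - (m + 1 : ℕ) → f.coeff j = 0) →
        (¬ ∀ j : ℤ, j < 1 - m → f.coeff j = 0) → f.coeff (1 - (m + 1 : ℕ)) ≠ 0 := by
      intro m f h1 h2 h3
      refine h2 fun j hj => ?_
      by_cases h4 : j < 1 - (m + 1 : ℕ)
      · exact h1 j h4
      · rwa [show j = 1 - (m + 1 : ℕ) by push_cast at h4 ⊢; omega]
    refine mul_ne_zero (key a f hf hf') (key b g hg hg') ?_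
    rw [← coeff_mul_eq_mul hf hg, ← Subalgebra.coe_mul]
    exact h _ (by push_cast; omega)

lemma mem_degs_laurentDeg {S : Subalgebra k (LaurentSeries E)}
    {h0 : ∀ f ∈ S, (∀ j ≤ 0, f.coeff j = 0) → f = 0}
    {hk : ∀ f ∈ S, ∀ j, ∃ c : k, algebraMap k E c = f.coeff j} {m : ℕ} :
    m ∈ (laurentDeg S h0 hk).degs ⊤ ↔
      ∃ f ∈ S, (∀ j : ℤ, j < -m → f.coeff j = 0) ∧ f.coeff (-m) ≠ 0 := by
  constructor
  · rintro ⟨f, -, h1, h2⟩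
    have h1' : ∀ j : ℤ, j < -m → (f : LaurentSeries E).coeff j = 0 :=
      fun j hj => h1 j (by push_cast; omega)
    refine ⟨f, f.2, h1', fun h3 => h2 fun j hj => ?_⟩
    by_cases h4 : j < -m
    · exact h1' j h4
    · rwa [show j = -m by omega]
  · rintro ⟨f, hf, h1, h2⟩
    exact ⟨⟨f, hf⟩, trivial, fun j hj => h1 j (by push_cast at hj; omega),
      fun h => h2 (h _ (by omega))⟩

lemma coeff_yy_pow (m : ℕ) (j : ℤ) : (yy E ^ m).coeff j = if j = -m then 1 else 0 := by
  have h1 : yy E = HahnSeries.single (-1) 1 := by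
    rw [yy]
    rw [ofPow, HahnSeries.ofPowerSeries_X]
    refine inv_eq_of_mul_eq_one_left ?_
    rw [HahnSeries.single_mul_single]
    simp
  rw [h1, HahnSeries.single_pow, HahnSeries.coeff_single, one_pow]
  simp

end Filtration

end Tower

end

section

open Polynomial Function

namespace Tower

section Frobenius

variable (k E : Type*) [Field k] [Fintype k] [Field E] [Algebra k E]

/-- The Frobenius endomorphism over the finite field `k`. -/
noncomputable def frob : E →+* E := (FiniteField.frobeniusAlgHom k E : E →+* E)

variable {k E}

lemma frob_apply (c : E) : frob k E c = c ^ Fintype.card k := rfl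

lemma frob_algebraMap (c : k) : frob k E (algebraMap k E c) = algebraMap k E c := by
  rw [frob_apply, ← map_pow, FiniteField.pow_card]

lemma frob_iterate (N : ℕ) (c : E) : (frob k E)^[N] c = c ^ Fintype.card k ^ N := by
  have : ⇑(frob k E) = (· ^ Fintype.card k) := rfl
  rw [this, pow_iterate]

lemma frob_eq_self_iff {c : E} : frob k E c = c ↔ ∃ a : k, algebraMap k E a = c := by
  classical
  refine ⟨fun h => ?_, fun ⟨a, ha⟩ => ha ▸ frob_algebraMap a⟩
  have hQ : 1 < Fintype.card k := Fintype.one_lt_card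
  have h0 : (X ^ Fintype.card k - X : E[X]) ≠ 0 := FiniteField.X_pow_card_sub_X_ne_zero E hQ
  have hmem : ∀ c : E, c ∈ (X ^ Fintype.card k - X : E[X]).roots.toFinset ↔
      c ^ Fintype.card k = c := by
    intro c
    rw [Multiset.mem_toFinset, mem_roots h0, IsRoot, eval_sub, eval_pow, eval_X, sub_eq_zero]
  have hsub : Finset.univ.image (algebraMap k E) ⊆
      (X ^ Fintype.card k - X : E[X]).roots.toFinset := by
    intro c hc
    obtain ⟨a, -, rfl⟩ := Finset.mem_image.1 hc
    exact (hmem _).2 (frob_algebraMap a)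
  have heq := Finset.eq_of_subset_of_card_le hsub (by
    rw [Finset.card_image_of_injective _ (algebraMap k E).injective, Finset.card_univ]
    refine (Multiset.toFinset_card_le _).trans ((card_roots' _).trans_eq ?_)
    exact FiniteField.X_pow_card_sub_X_natDegree_eq E hQ)
  have := heq.symm ▸ (hmem c).2 h
  obtain ⟨a, -, ha⟩ := Finset.mem_image.1 this
  exact ⟨a, ha⟩

lemma frob_periodic [Algebra.IsAlgebraic k E] (c : E) : c ∈ periodicPts (frob k E) := by
  have hc : IsIntegral k c := Algebra.IsIntegral.isIntegral c
  have := IntermediateField.adjoin.finiteDimensional hc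
  have : Finite (IntermediateField.adjoin k {c}) := Module.finite_of_finite k
  let := Fintype.ofFinite (IntermediateField.adjoin k {c})
  refine mk_mem_periodicPts (Module.finrank_pos (R := k) (M := IntermediateField.adjoin k {c})) ?_
  have h1 := FiniteField.pow_card (⟨c, IntermediateField.mem_adjoin_simple_self k c⟩ :
    IntermediateField.adjoin k {c})
  rw [Module.card_eq_pow_finrank (K := k)] at h1
  exact (frob_iterate _ c).trans (congrArg Subtype.val h1)

lemma exists_trace_ne_zero [IsAlgClosed E] {N : ℕ} (hN : 0 < N) :
    ∃ u : E, IsPeriodicPt (frob k E) N u ∧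
      ∑ j ∈ Finset.range N, (frob k E)^[j] u ≠ 0 := by
  classical
  set Q := Fintype.card k with hQdef
  have hQ : 1 < Q := Fintype.one_lt_card
  obtain ⟨p, hp⟩ := CharP.exists k
  have : CharP E p := charP_of_injective_ringHom (algebraMap k E).injective p
  obtain ⟨n, hprime, hn⟩ := FiniteField.card k p
  have hsep : (X ^ Q ^ N - X : E[X]).Separable :=
    galois_poly_separable p (Q ^ N) (by
      rw [hQdef, hn]; exact (dvd_pow_self p n.ne_zero).trans (dvd_pow_self _ hN.ne'))
  have hdeg := FiniteField.X_pow_card_pow_sub_X_natDegree_eq E hN.ne' hQ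
  have h0 := FiniteField.X_pow_card_pow_sub_X_ne_zero E hN.ne' hQ
  have hcard : (X ^ Q ^ N - X : E[X]).roots.toFinset.card = Q ^ N := by
    rw [Multiset.toFinset_card_of_nodup (nodup_roots hsep)]
    exact (splits_iff_card_roots.1 (IsAlgClosed.splits _)).trans hdeg
  by_contra! hcon
  set P : E[X] := ∑ j ∈ Finset.range N, X ^ Q ^ j with hP
  have hPdeg : P.natDegree ≤ Q ^ (N - 1) := by
    refine natDegree_sum_le_of_forall_le _ _ fun j hj => ?_
    rw [natDegree_X_pow]
    exact Nat.pow_le_pow_right (by omega) (by have := Finset.mem_range.1 hj; omega)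
  have hP0 : P ≠ 0 := by
    intro h
    have h1 : P.coeff 1 = 1 := by
      rw [hP, finsetSum_coeff, Finset.sum_eq_single 0]
      · simp
      · intro j _ hj
        rw [coeff_X_pow, if_neg (Nat.one_lt_pow hj hQ).ne]
      · intro h; exact absurd (Finset.mem_range.2 hN) h
    rw [h, coeff_zero] at h1
    exact zero_ne_one h1
  have hsub : (X ^ Q ^ N - X : E[X]).roots.toFinset ⊆ P.roots.toFinset := by
    intro c hc
    rw [Multiset.mem_toFinset, mem_roots h0, IsRoot, eval_sub, eval_pow, eval_X,
      sub_eq_zero] at hc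
    rw [Multiset.mem_toFinset, mem_roots hP0, IsRoot, hP, eval_finsetSum]
    rw [← hcon c ((frob_iterate N c).trans hc)]
    exact Finset.sum_congr rfl fun j _ => by rw [eval_pow, eval_X, frob_iterate]
  have h1 := (Finset.card_le_card hsub).trans
    ((Multiset.toFinset_card_le _).trans ((card_roots' _).trans hPdeg))
  rw [hcard] at h1
  exact absurd h1 (not_le.2 (Nat.pow_lt_pow_right hQ (by omega)))

end Frobenius

section Period

variable {K L : Type*} [Field K] [Field L] [Algebra K L]

lemma map_mem_hol {σ : K →+* K} {f₁ : L →+* L}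
    (h₁ : ∀ c, f₁ (algebraMap K L c) = algebraMap K L (σ c)) {x : L} (hx : f₁ x = x) {f : L}
    (hf : f ∈ hol K x) : f₁ f ∈ hol K x := by
  intro V hV
  refine hf (V.comap f₁) ⟨fun c => ?_, ?_⟩
  · rw [ValuationSubring.mem_comap, h₁]; exact hV.1 _
  · rw [ValuationSubring.mem_comap, hx]; exact hV.2

lemma mem_periodicPts_of_mem_adjoin {S : Set L} {f₁ : L →+* L}
    (h₁ : ∀ c : K, algebraMap K L c ∈ periodicPts f₁) (hS : ∀ s ∈ S, f₁ s = s) {f : L}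
    (hf : f ∈ IntermediateField.adjoin K S) : f ∈ periodicPts f₁ := by
  have hit : ∀ n, f₁^[n] = ⇑(f₁ ^ n) := fun n => (RingHom.coe_pow f₁ n).symm
  induction hf using IntermediateField.adjoin_induction with
  | mem s hs => exact mk_mem_periodicPts one_pos (IsFixedPt.isPeriodicPt (hS s hs) 1)
  | algebraMap c => exact h₁ c
  | add u v _ _ ihu ihv =>
    obtain ⟨m, hm, hu⟩ := ihu
    obtain ⟨n, hn, hv⟩ := ihv
    refine mk_mem_periodicPts (Nat.mul_pos hm hn) ?_
    have h1 := hu.mul_const n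
    have h2 := hv.const_mul m
    rw [IsPeriodicPt, IsFixedPt, hit] at *
    rw [map_add, h1, h2]
  | mul u v _ _ ihu ihv =>
    obtain ⟨m, hm, hu⟩ := ihu
    obtain ⟨n, hn, hv⟩ := ihv
    refine mk_mem_periodicPts (Nat.mul_pos hm hn) ?_
    have h1 := hu.mul_const n
    have h2 := hv.const_mul m
    rw [IsPeriodicPt, IsFixedPt, hit] at *
    rw [map_mul, h1, h2]
  | inv u _ ihu =>
    obtain ⟨m, hm, hu⟩ := ihu
    refine mk_mem_periodicPts hm ?_
    rw [IsPeriodicPt, IsFixedPt, hit] at *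
    rw [map_inv₀, hu]

end Period

section Relation

variable {K L : Type*} [Field K] [Field L] [Algebra K L]

lemma GenusLE.exists_relation {O : ValuationSubring L} {x y : L} {F : IntermediateField K L}
    {γ : ℕ} (h : GenusLE O x F γ) (hy : y ∈ F) (hO : ∀ c : K, algebraMap K L c ∈ O)
    {s : Finset ℕ} (hs : γ < s.card) :
    ∃ g : s → K, ∃ m₁, g m₁ ≠ 0 ∧ ∃ r ∈ reg x F, ∃ o ∈ O,
      ∑ m : s, algebraMap K L (g m) * y ^ (m : ℕ) = r + o := by
  obtain ⟨w, hw, -, hdec⟩ := h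
  have hdec' : ∀ m : ℕ, ∃ r ∈ reg x F, ∃ o ∈ O,
      ∃ c ∈ Submodule.span K (w : Set L), y ^ m = r + o + c :=
    fun m => hdec _ (pow_mem hy m)
  choose r hr o ho c hc hdec' using hdec'
  have hnot : ¬ LinearIndependent K (fun m : s =>
      (⟨c m, hc m⟩ : Submodule.span K (w : Set L))) := by
    intro hli
    have h1 := hli.fintype_card_le_finrank
    rw [Fintype.card_coe] at h1
    have h2 : Module.finrank K (Submodule.span K (w : Set L)) ≤ w.card :=
      finrank_span_finset_le_card (R := K) w
    omega
  rw [Fintype.not_linearIndependent_iff] at hnot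
  obtain ⟨g, hg0, m₁, hgm₁⟩ := hnot
  have hzero : ∑ m, algebraMap K L (g m) * c m = 0 := by
    have h1 := congrArg Subtype.val hg0
    rw [Submodule.coe_sum] at h1
    simpa [Algebra.smul_def] using h1
  refine ⟨g, m₁, hgm₁, ∑ m, algebraMap K L (g m) * r m,
    sum_mem fun m _ => mul_mem ((reg x F).algebraMap_mem _) (hr m),
    ∑ m, algebraMap K L (g m) * o m, sum_mem fun m _ => mul_mem (hO _) (ho m), ?_⟩
  rw [← add_zero (_ + _), ← hzero, ← Finset.sum_add_distrib, ← Finset.sum_add_distrib]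
  exact Finset.sum_congr rfl fun m _ => by rw [hdec']; ring

end Relation

namespace Curve

variable {k E : Type*} [Field k] [Fintype k] [Field E] [Algebra k E]
  {q i : ℕ} {x : ℕ → LaurentSeries E} {Ω : Finset E} {A : E[X]} {b : E}

/-- The coordinate ring of the tower over the finite field `k`. -/
noncomputable def rat (k : Type*) [Field k] [Fintype k] [Algebra k E] (x : ℕ → LaurentSeries E)
    (i : ℕ) : Subalgebra k (LaurentSeries E) where
  carrier := {f | f ∈ ring x i ∧ cmap (frob k E) f = f}
  mul_mem' hf hg := ⟨mul_mem hf.1 hg.1, by rw [map_mul, hf.2, hg.2]⟩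
  add_mem' hf hg := ⟨add_mem hf.1 hg.1, by rw [map_add, hf.2, hg.2]⟩
  algebraMap_mem' c := by
    rw [laurent_algebraMap]
    exact ⟨(ring x i).algebraMap_mem _, by rw [cmap_algebraMap, frob_algebraMap]⟩

/-- The pole order filtration of the coordinate ring. -/
noncomputable def ratDeg (k : Type*) [Field k] [Fintype k] [Algebra k E] [IsAlgClosed E]
    (h : Curve q i x Ω A b) : DegAlg k (rat k x i) :=
  laurentDeg (rat k x i) (fun _ hf h0 => h.eq_zero_of_val_lt_one hf.1 (val_lt_one_of_coeff h0))
    (fun f hf j => frob_eq_self_iff.1 (by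
      conv_rhs => rw [← hf.2]
      rfl))

/-- The pole order filtration over the algebraic closure. -/
noncomputable def ringDeg [IsAlgClosed E] (h : Curve q i x Ω A b) : DegAlg E (ring x i) :=
  laurentDeg (ring x i) (fun _ hf h0 => h.eq_zero_of_val_lt_one hf (val_lt_one_of_coeff h0))
    (fun _ _ _ => ⟨_, rfl⟩)

lemma card_gaps_ring_le [IsAlgClosed E] (h : Curve q i x Ω A b)
    (hadd : IsAdditive (LaurentSeries E) A) {B : E[X]}
    (hAB : ∀ u : LaurentSeries E, aeval (aeval u B) A = T q u) (s : Finset ℕ)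
    (hs : ∀ m ∈ s, m ∉ h.ringDeg.degs ⊤) : s.card ≤ A.natDegree * q ^ i := by
  classical
  have hgen := h.toTow.genusLE_final h.one_le (fun c => const_mem_powerRing c)
    h.x_notMem h.monic h.pos hadd hAB h.eqn
  by_contra! hcon
  obtain ⟨g, m₁, hgm₁, f, hfmem, o, ho, hsum⟩ := hgen.exists_relation
    (yy_mem_topF (x := x) (i := i)) (fun c => const_mem_powerRing c) hcon
  set t : Finset s := Finset.univ.filter fun m => g m ≠ 0 with ht
  have htne : t.Nonempty := ⟨m₁, Finset.mem_filter.2 ⟨Finset.mem_univ _, hgm₁⟩⟩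
  obtain ⟨M, hMt, hMmax⟩ := Finset.exists_max_image t (fun m => (m : ℕ)) htne
  have hgM : g M ≠ 0 := (Finset.mem_filter.1 hMt).2
  have hbig : ∀ m, g m ≠ 0 → (m : ℕ) ≤ M := fun m hm =>
    hMmax m (Finset.mem_filter.2 ⟨Finset.mem_univ _, hm⟩)
  have hcoef : ∀ j < (0 : ℤ), f.coeff j = ∑ m : s, g m * (if j = -(m : ℕ) then 1 else 0) := by
    intro j hj
    rw [eq_sub_of_add_eq hsum.symm, HahnSeries.coeff_sub, HahnSeries.coeff_sum,
      coeff_eq_zero_of_mem ho hj, sub_zero]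
    exact Finset.sum_congr rfl fun m _ => by rw [coeff_algebraMap_mul, coeff_yy_pow]
  have hM0 : 0 < (M : ℕ) := by
    by_contra hM
    refine hs M M.2 (mem_degs_laurentDeg.2 ⟨1, one_mem _, fun j hj => ?_, ?_⟩)
    · rw [HahnSeries.coeff_one, if_neg (by omega)]
    · rw [HahnSeries.coeff_one, if_pos (by omega)]; exact one_ne_zero
  refine hs M M.2 (mem_degs_laurentDeg.2 ⟨f, hfmem, fun j hj => ?_, ?_⟩)
  · rw [hcoef j (by omega)]
    refine Finset.sum_eq_zero fun m _ => ?_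
    by_cases hm : g m = 0
    · rw [hm, zero_mul]
    · have := hbig m hm
      rw [if_neg (by omega), mul_zero]
  · rw [hcoef _ (by omega), Finset.sum_eq_single M]
    · simpa using hgM
    · intro m _ hm
      rw [if_neg, mul_zero]
      intro h1
      exact hm (Subtype.ext (by omega))
    · intro h1; exact absurd (Finset.mem_univ _) h1

lemma cmap_mem_ring (h : Curve q i x Ω A b) {σ : E →+* E} (hσA : A.map σ = A) (hσb : σ b = b)
    {f : LaurentSeries E} (hf : f ∈ ring x i) : cmap σ f ∈ ring x i := by
  have hS : ∀ s ∈ x '' Set.Icc 1 i ∪ {yy E}, cmap σ s = s := by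
    rintro s (⟨l, ⟨h1, hl⟩, rfl⟩ | rfl)
    · exact h.fix σ hσA hσb l h1 hl
    · exact cmap_yy σ
  obtain ⟨h1, -⟩ := semilinear_comm (topF x i).val (topF_eq x i) (cmap_algebraMap σ)
    (cmap_algebraMap σ) hS (fun s _ hs => hS s hs) hf.1
  exact ⟨h1, map_mem_hol (cmap_algebraMap σ) (h.fix σ hσA hσb 1 le_rfl h.one_le) hf.2⟩

lemma mem_degs_rat [IsAlgClosed E] [Algebra.IsAlgebraic k E] (h : Curve q i x Ω A b)
    (hσA : A.map (frob k E) = A) (hσb : frob k E b = b) {m : ℕ}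
    (hm : m ∈ h.ringDeg.degs ⊤) : m ∈ (h.ratDeg k).degs ⊤ := by
  set σ := frob k E with hσ
  obtain ⟨f, hf, hlow, hlead⟩ := mem_degs_laurentDeg.1 hm
  obtain ⟨N, hN, hper⟩ : f ∈ periodicPts (cmap σ) := by
    refine mem_periodicPts_of_mem_adjoin (K := E) (S := x '' Set.Icc 1 i ∪ {yy E}) (fun c => ?_) ?_
      (topF_eq x i ▸ hf.1)
    · obtain ⟨n, hn, hc⟩ := frob_periodic (k := k) c
      exact mk_mem_periodicPts hn (hc.map fun c => (cmap_algebraMap σ c).symm)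
    · rintro s (⟨l, ⟨h1, hl⟩, rfl⟩ | rfl)
      · exact h.fix σ hσA hσb l h1 hl
      · exact cmap_yy σ
  have hcoeff : ∀ n j (g : LaurentSeries E), ((cmap σ)^[n] g).coeff j = σ^[n] (g.coeff j) := by
    intro n j g
    exact (Semiconj.iterate_right (f := fun g : LaurentSeries E => g.coeff j)
      (ga := cmap σ) (gb := σ) (fun g => cmap_coeff σ g j) n) g
  obtain ⟨u, hu, hu0⟩ := exists_trace_ne_zero (k := k) (E := E) hN
  set l := f.coeff (-m) with hl
  have hlper : IsPeriodicPt σ N l := by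
    rw [IsPeriodicPt, IsFixedPt, hl, ← hcoeff, hper]
  have hc : IsPeriodicPt σ N (u / l) := by
    rw [IsPeriodicPt, IsFixedPt, frob_iterate, div_pow]
    rw [IsPeriodicPt, IsFixedPt, frob_iterate] at hu hlper
    rw [hu, hlper]
  set g := algebraMap E (LaurentSeries E) (u / l) * f with hg
  have hgmem : g ∈ ring x i := mul_mem ((ring x i).algebraMap_mem _) hf
  have hgper : (cmap σ)^[N] g = g := by
    have hit : ∀ n, (cmap σ)^[n] = ⇑((cmap σ) ^ n) := fun n => (RingHom.coe_pow _ n).symm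
    have h1 : (cmap σ)^[N] (algebraMap E (LaurentSeries E) (u / l)) = algebraMap E _ (u / l) :=
      hc.map fun c => (cmap_algebraMap σ c).symm
    have h2 : (cmap σ)^[N] f = f := hper
    rw [hit] at h1 h2 ⊢
    rw [hg, map_mul, h1, h2]
  have hmem : ∀ n, (cmap σ)^[n] g ∈ ring x i := by
    intro n
    induction n with
    | zero => exact hgmem
    | succ n ih =>
      rw [iterate_succ_apply']
      exact h.cmap_mem_ring hσA hσb ih
  have hco : ∀ j, (∑ n ∈ Finset.range N, (cmap σ)^[n] g).coeff j =
      ∑ n ∈ Finset.range N, σ^[n] (u / l * f.coeff j) := by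
    intro j
    rw [HahnSeries.coeff_sum]
    exact Finset.sum_congr rfl fun n _ => by rw [hcoeff, hg, coeff_algebraMap_mul]
  refine mem_degs_laurentDeg.2 ⟨∑ n ∈ Finset.range N, (cmap σ)^[n] g,
    ⟨sum_mem fun n _ => hmem n, ?_⟩, fun j hj => ?_, ?_⟩
  · rw [map_sum]
    have h1 : ∀ n ∈ Finset.range N, cmap σ ((cmap σ)^[n] g) = (cmap σ)^[n + 1] g :=
      fun n _ => (iterate_succ_apply' _ _ _).symm
    rw [Finset.sum_congr rfl h1]
    have h2 := Finset.sum_range_succ (fun n => (cmap σ)^[n] g) N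
    rw [Finset.sum_range_succ', hgper, iterate_zero_apply] at h2
    exact add_right_cancel h2
  · rw [hco, hlow j hj, mul_zero]
    refine Finset.sum_eq_zero fun n _ => ?_
    rw [← RingHom.coe_pow, map_zero]
  · rw [hco, ← hl, div_mul_cancel₀ _ hlead]
    exact hu0

lemma exists_hasGaps_rat [IsAlgClosed E] [Algebra.IsAlgebraic k E] (h : Curve q i x Ω A b)
    (hadd : IsAdditive (LaurentSeries E) A) {B : E[X]}
    (hAB : ∀ u : LaurentSeries E, aeval (aeval u B) A = T q u)
    (hσA : A.map (frob k E) = A) (hσb : frob k E b = b) :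
    ∃ g ≤ A.natDegree * q ^ i, (h.ratDeg k).HasGaps g :=
  DegAlg.exists_hasGaps _ fun s hs => h.card_gaps_ring_le hadd hAB s fun m hm hd =>
    hs m hm (h.mem_degs_rat hσA hσb hd)

end Curve

end Tower

end

section

open Polynomial Function

namespace Tower

/-- A factorization `A ∘ B` of `X ^ q + X` with `A` additive. -/
structure Splitting {E : Type*} [Field E] (q : ℕ) (A B : E[X]) : Prop where
  monic : A.Monic
  pos : 0 < A.natDegree
  add : IsAdditive (LaurentSeries E) A
  comp : A.comp B = TP E q
  coeff_zero : B.coeff 0 = 0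

lemma Splitting.aeval {E L : Type*} [Field E] [Field L] [Algebra E L] {q : ℕ} {A B : E[X]}
    (h : Splitting q A B) (u : L) : aeval (Polynomial.aeval u B) A = T q u := by
  rw [← aeval_comp, h.comp, aeval_TP]

namespace Curve

variable {k E : Type*} [Field k] [Fintype k] [Field E] [Algebra k E]
  {p : ℕ} [Fact p.Prime] [CharP E p] {a i : ℕ} {x : ℕ → LaurentSeries E} {Ω : Finset E}
  {A B : E[X]} {b : E} {α α' : ℕ → E} {β β' : E}

/-- The homomorphism `χ` takes the coordinate functions to `α` and `β`. -/
structure Evals (q i : ℕ) (x : ℕ → LaurentSeries E) (χ : rat k x i →ₐ[k] E) (α : ℕ → E) (β : E) :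
    Prop where
  powT : ∀ (M : ℕ) (hm), χ ⟨T q (x 1) ^ M, hm⟩ = T q (α 1) ^ M
  mul : ∀ l, 1 ≤ l → l ≤ i → ∀ (M : ℕ) (hm), χ ⟨T q (x 1) ^ M * x l, hm⟩ =
    T q (α 1) ^ M * α l
  mul_yy : ∀ (M : ℕ) (hm), χ ⟨T q (x 1) ^ M * yy E, hm⟩ = T q (α 1) ^ M * β

lemma cmap_pow_of_fix {σ : E →+* E} {f : LaurentSeries E} (h : cmap σ f = f) (n : ℕ) :
    cmap (σ ^ n) f = f := by
  have hc : ∀ j, σ (f.coeff j) = f.coeff j := fun j => by rw [← cmap_coeff, h]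
  refine HahnSeries.ext (funext fun j => ?_)
  rw [cmap_coeff, RingHom.coe_pow]
  exact iterate_fixed (hc j) n

lemma map_pow_of_fix {σ : E →+* E} {A : E[X]} (h : A.map σ = A) (n : ℕ) : A.map (σ ^ n) = A := by
  have hc : ∀ j, σ (A.coeff j) = A.coeff j := fun j => by rw [← coeff_map, h]
  ext j
  rw [coeff_map, RingHom.coe_pow]
  exact iterate_fixed (hc j) n

lemma exists_evals (ha : 0 < a) (h : Curve (p ^ a) i x Ω A b) (hs : Splitting (p ^ a) A B)
    (hA : A.map (frob k E) = A) (hB : B.map (frob k E) = B) (hb : frob k E b = b)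
    (hc : Chain (p ^ a) i A b α β) : ∃ χ : rat k x i →ₐ[k] E, Evals (p ^ a) i x χ α β ∧
      ∀ n, (∀ m, 1 ≤ m → m ≤ i → (frob k E)^[n] (α m) = α m) → (frob k E)^[n] β = β →
        ∀ f, (frob k E)^[n] (χ f) = χ f := by
  obtain ⟨χ, h1, h2, h3, h4⟩ := h.exists_point ha hs.add hs.aeval hs.coeff_zero hc
  let j : rat k x i →+* ring x i := {
    toFun := fun f => ⟨f, f.2.1⟩
    map_one' := rfl
    map_zero' := rfl
    map_mul' := fun _ _ => rfl
    map_add' := fun _ _ => rfl }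
  let χ' : rat k x i →ₐ[k] E := {
    (χ : ring x i →+* E).comp j with
    commutes' := fun c => by
      have h5 : j (algebraMap k _ c) = algebraMap E (ring x i) (algebraMap k E c) :=
        Subtype.ext (laurent_algebraMap c)
      change χ (j (algebraMap k _ c)) = _
      rw [h5, AlgHom.commutes]
      rfl }
  refine ⟨χ', ⟨fun M hm => h1 M hm.1, fun l hl hl' M hm => h2 l hl hl' M hm.1,
    fun M hm => h3 M hm.1⟩, fun n hα hβ f => ?_⟩
  have h6 := h4 (frob k E ^ n) (map_pow_of_fix hA n) (map_pow_of_fix hB n)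
    (by rw [RingHom.coe_pow]; exact iterate_fixed hb n)
    (fun m hm hm' => by rw [RingHom.coe_pow]; exact hα m hm hm')
    (by rw [RingHom.coe_pow]; exact hβ) (j f) (cmap_pow_of_fix f.2.2 n)
  rw [RingHom.coe_pow] at h6
  exact h6

lemma map_T_eq {σ : LaurentSeries E →+* LaurentSeries E} {z : LaurentSeries E} (hz : σ z = z)
    (q : ℕ) : σ (T q z) = T q z := by
  rw [map_T, hz]

section Rational

variable {q : ℕ} (h : Curve q i x Ω A b) (hA : A.map (frob k E) = A) (hb : frob k E b = b)

include h hA hb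

lemma cmap_powT (M : ℕ) : cmap (frob k E) (T q (x 1) ^ M) = T q (x 1) ^ M := by
  rw [map_pow, map_T_eq (h.fix _ hA hb 1 le_rfl h.one_le)]

lemma powT_mem_rat : T q (x 1) ^ 1 ∈ rat k x i :=
  ⟨_root_.pow_mem h.T_mem_ring 1, h.cmap_powT hA hb 1⟩

lemma exists_mul_mem_rat {l : ℕ} (h1 : 1 ≤ l) (hl : l ≤ i) :
    ∃ M : ℕ, T q (x 1) ^ M * x l ∈ rat k x i := by
  obtain ⟨M, hM⟩ := h.exists_mul_x_mem_ring h1 hl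
  exact ⟨M, hM, by rw [map_mul, h.cmap_powT hA hb, h.fix _ hA hb l h1 hl]⟩

lemma exists_mul_yy_mem_rat : ∃ M : ℕ, T q (x 1) ^ M * yy E ∈ rat k x i := by
  obtain ⟨M, hM⟩ := h.exists_mul_yy_mem_ring
  exact ⟨M, hM, by rw [map_mul, h.cmap_powT hA hb, cmap_yy]⟩

lemma Evals.inj {χ : rat k x i →ₐ[k] E} (he : Evals q i x χ α β) (he' : Evals q i x χ α' β')
    (h0 : T q (α 1) ≠ 0) : (∀ l, 1 ≤ l → l ≤ i → α l = α' l) ∧ β = β' := by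
  have hT : T q (α 1) = T q (α' 1) := by
    have h1 := he.powT 1 (h.powT_mem_rat hA hb)
    rw [he'.powT 1] at h1
    simpa using h1.symm
  refine ⟨fun l h1 hl => ?_, ?_⟩
  · obtain ⟨M, hM⟩ := h.exists_mul_mem_rat (k := k) hA hb h1 hl
    have h2 := he.mul l h1 hl M hM
    rw [he'.mul l h1 hl M hM, ← hT] at h2
    exact (mul_left_cancel₀ (pow_ne_zero M h0) h2).symm
  · obtain ⟨M, hM⟩ := h.exists_mul_yy_mem_rat (k := k) hA hb
    have h2 := he.mul_yy M hM
    rw [he'.mul_yy M hM, ← hT] at h2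
    exact (mul_left_cancel₀ (pow_ne_zero M h0) h2).symm

lemma Evals.fix_of_forall {χ : rat k x i →ₐ[k] E} (he : Evals q i x χ α β)
    (h0 : T q (α 1) ≠ 0) {n : ℕ} (hn : ∀ f, (frob k E)^[n] (χ f) = χ f) :
    (∀ l, 1 ≤ l → l ≤ i → (frob k E)^[n] (α l) = α l) ∧ (frob k E)^[n] β = β := by
  simp only [← RingHom.coe_pow] at hn ⊢
  have hT : (frob k E ^ n) (T q (α 1)) = T q (α 1) := by
    have h1 := hn ⟨_, h.powT_mem_rat hA hb⟩
    rwa [he.powT 1, pow_one] at h1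
  refine ⟨fun l h1 hl => ?_, ?_⟩
  · obtain ⟨M, hM⟩ := h.exists_mul_mem_rat (k := k) hA hb h1 hl
    have h2 := hn ⟨_, hM⟩
    rw [he.mul l h1 hl M hM, map_mul, map_pow, hT] at h2
    exact mul_left_cancel₀ (pow_ne_zero M h0) h2
  · obtain ⟨M, hM⟩ := h.exists_mul_yy_mem_rat (k := k) hA hb
    have h2 := hn ⟨_, hM⟩
    rw [he.mul_yy M hM, map_mul, map_pow, hT] at h2
    exact mul_left_cancel₀ (pow_ne_zero M h0) h2

end Rational

end Curve

end Tower

end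

section

open Polynomial Function

namespace Tower

section FixedField

variable (k E : Type*) [Field k] [Fintype k] [Field E] [Algebra k E]

/-- The subfield of elements of degree dividing `j` over the finite field `k`. -/
noncomputable def fixedBy (j : ℕ) : IntermediateField k E where
  carrier := {c | (frob k E)^[j] c = c}
  mul_mem' {u v} hu hv := by
    simp only [Set.mem_ofPred_eq, ← RingHom.coe_pow] at *
    rw [map_mul, hu, hv]
  add_mem' {u v} hu hv := by
    simp only [Set.mem_ofPred_eq, ← RingHom.coe_pow] at *
    rw [map_add, hu, hv]
  algebraMap_mem' c := iterate_fixed (frob_algebraMap c) j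
  inv_mem' u hu := by
    simp only [Set.mem_ofPred_eq, ← RingHom.coe_pow] at *
    rw [map_inv₀, hu]

variable {k E}

lemma mem_fixedBy {j : ℕ} {c : E} : c ∈ fixedBy k E j ↔ (frob k E)^[j] c = c := Iff.rfl

lemma mem_fixedBy_iff_pow {j : ℕ} {c : E} :
    c ∈ fixedBy k E j ↔ c ^ Fintype.card k ^ j = c := by
  rw [mem_fixedBy, frob_iterate]

variable (k E) in
lemma card_roots_fixed [IsAlgClosed E] [DecidableEq E] {N : ℕ} (hN : 0 < N) :
    (X ^ Fintype.card k ^ N - X : E[X]).roots.toFinset.card = Fintype.card k ^ N := by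
  set Q := Fintype.card k with hQdef
  have hQ : 1 < Q := Fintype.one_lt_card
  obtain ⟨p, hp⟩ := CharP.exists k
  have : CharP E p := charP_of_injective_ringHom (algebraMap k E).injective p
  obtain ⟨n, hprime, hn⟩ := FiniteField.card k p
  have hsep : (X ^ Q ^ N - X : E[X]).Separable :=
    galois_poly_separable p (Q ^ N) (by
      rw [hQdef, hn]; exact (dvd_pow_self p n.ne_zero).trans (dvd_pow_self _ hN.ne'))
  have hdeg := FiniteField.X_pow_card_pow_sub_X_natDegree_eq E hN.ne' hQ
  rw [Multiset.toFinset_card_of_nodup (nodup_roots hsep)]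
  exact (splits_iff_card_roots.1 (IsAlgClosed.splits _)).trans hdeg

variable (k E) in
lemma exists_finset_fixedBy [IsAlgClosed E] {N : ℕ} (hN : 0 < N) :
    ∃ U : Finset E, (∀ c, c ∈ U ↔ c ∈ fixedBy k E N) ∧ U.card = Fintype.card k ^ N := by
  classical
  refine ⟨_, fun c => ?_, card_roots_fixed k E hN⟩
  rw [Multiset.mem_toFinset,
    mem_roots (FiniteField.X_pow_card_pow_sub_X_ne_zero E hN.ne' Fintype.one_lt_card), IsRoot,
    eval_sub, eval_pow, eval_X, sub_eq_zero, mem_fixedBy_iff_pow]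

variable (k E) in
lemma finite_fixedBy [IsAlgClosed E] {N : ℕ} (hN : 0 < N) :
    Finite (fixedBy k E N) ∧ Nat.card (fixedBy k E N) = Fintype.card k ^ N := by
  obtain ⟨U, hU, hcard⟩ := exists_finset_fixedBy k E hN
  let e : fixedBy k E N ≃ U := Equiv.subtypeEquivRight fun c => (hU c).symm
  exact ⟨Finite.of_equiv _ e.symm, by
    rw [Nat.card_congr e, Nat.card_eq_fintype_card, Fintype.card_coe, hcard]⟩

variable (k E) in
lemma finrank_fixedBy [IsAlgClosed E] {N : ℕ} (hN : 0 < N) :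
    FiniteDimensional k (fixedBy k E N) ∧ Module.finrank k (fixedBy k E N) = N := by
  obtain ⟨hfin, hcard⟩ := finite_fixedBy k E hN
  have : FiniteDimensional k (fixedBy k E N) := Module.Finite.of_finite
  refine ⟨this, ?_⟩
  rw [Module.natCard_eq_pow_finrank (K := k), Nat.card_eq_fintype_card] at hcard
  exact Nat.pow_right_injective (Fintype.one_lt_card (α := k)) hcard

end FixedField

section Quotient

variable {k : Type*} [Field k] {R : Type*} [CommRing R] [Algebra k R]

variable (k) in
lemma isMaximal_of_finite [Finite k] (I : Ideal R) [I.IsPrime] [FiniteDimensional k (R ⧸ I)] :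
    I.IsMaximal := by
  have : Finite (R ⧸ I) := Module.finite_of_finite k
  exact Ideal.Quotient.maximal_of_isField _ (Finite.isDomain_to_isField _)

lemma card_algHom_quotient_le (E : Type*) [Field E] [Algebra k E] (I : Ideal R)
    [FiniteDimensional k (R ⧸ I)] :
    Nat.card ((R ⧸ I) →ₐ[k] E) ≤ Module.finrank k (R ⧸ I) :=
  card_algHom_le_finrank k _ E

end Quotient

/-- A point of the tower over the extension of degree `j` of `k`. -/
structure FPoint (k : Type*) {E : Type*} [Field k] [Fintype k] [Field E] [Algebra k E]
    (j q i : ℕ) (A : E[X]) (b : E) (z : (ℕ → E) × E) : Prop where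
  chain : Chain q i A b z.1 z.2
  supp : ∀ l, ¬ (1 ≤ l ∧ l ≤ i) → z.1 l = 0
  mem_fst : ∀ l, z.1 l ∈ fixedBy k E j
  mem_snd : z.2 ∈ fixedBy k E j

namespace Curve

variable {k E : Type*} [Field k] [Fintype k] [Field E] [Algebra k E]
  {p : ℕ} [Fact p.Prime] [CharP E p] {a i : ℕ} {x : ℕ → LaurentSeries E} {Ω : Finset E}
  {A B : E[X]} {b : E}

lemma eq_of_evals {q : ℕ} (h : Curve q i x Ω A b)
    (hA : A.map (frob k E) = A) (hb : frob k E b = b) {j j' : ℕ} {z z' : (ℕ → E) × E}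
    (hz : FPoint k j q i A b z) (hz' : FPoint k j' q i A b z') {χ : rat k x i →ₐ[k] E}
    (he : Evals q i x χ z.1 z.2) (he' : Evals q i x χ z'.1 z'.2) : z = z' := by
  obtain ⟨h1, h2⟩ := Evals.inj h hA hb he he' hz.chain.ne_zero
  refine Prod.ext (funext fun l => ?_) h2
  by_cases hl : 1 ≤ l ∧ l ≤ i
  · exact h1 l hl.1 hl.2
  · rw [hz.supp l hl, hz'.supp l hl]

lemma exists_evals_fpoint (ha : 0 < a) (h : Curve (p ^ a) i x Ω A b) (hs : Splitting (p ^ a) A B)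
    (hA : A.map (frob k E) = A) (hB : B.map (frob k E) = B) (hb : frob k E b = b) {j : ℕ}
    {z : (ℕ → E) × E} (hz : FPoint k j (p ^ a) i A b z) :
    ∃ χ : rat k x i →ₐ[k] E, Evals (p ^ a) i x χ z.1 z.2 ∧ ∀ f, χ f ∈ fixedBy k E j := by
  obtain ⟨χ, h1, h2⟩ := h.exists_evals ha hs hA hB hb hz.chain
  exact ⟨χ, h1, h2 j (fun m _ _ => hz.mem_fst m) hz.mem_snd⟩

/-- The number of rational points is bounded by Stepanov's method. -/
lemma card_rational_le [IsAlgClosed E] [Algebra.IsAlgebraic k E] (ha : 0 < a)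
    (h : Curve (p ^ a) i x Ω A b) (hs : Splitting (p ^ a) A B)
    (hA : A.map (frob k E) = A) (hB : B.map (frob k E) = B) (hb : frob k E b = b)
    {X : Finset ((ℕ → E) × E)} (hX : ∀ z ∈ X, FPoint k 1 (p ^ a) i A b z) {u v : ℕ}
    (hk : Fintype.card k = p ^ u * p ^ v) (huv : u ≤ v)
    (hv : 2 * (A.natDegree * (p ^ a) ^ i) + 4 ≤ p ^ v) :
    X.card ≤ p ^ v * (p ^ u + 3 * (A.natDegree * (p ^ a) ^ i) + 1) := by
  classical
  obtain ⟨g, hg, hgaps⟩ := h.exists_hasGaps_rat (k := k) hs.add hs.aeval hA hb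
  have : CharP k p := (RingHom.charP_iff (algebraMap k E) (algebraMap k E).injective p).2 ‹_›
  have : CharP (rat k x i) p := charP_of_injective_ringHom (algebraMap k (rat k x i)).injective p
  have hex : ∀ z : X, ∃ ψ : rat k x i →ₐ[k] k,
      Evals (p ^ a) i x ((Algebra.ofId k E).comp ψ) z.1.1 z.1.2 := by
    intro z
    obtain ⟨χ, h1, h2⟩ := h.exists_evals_fpoint ha hs hA hB hb (hX z z.2)
    have h3 : ∀ f, χ f ∈ (⊥ : Subalgebra k E) := fun f => by
      obtain ⟨c, hc⟩ := frob_eq_self_iff.1 (h2 f)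
      exact Algebra.mem_bot.2 ⟨c, hc⟩
    let e := Algebra.botEquivOfInjective (algebraMap k E).injective
    refine ⟨e.toAlgHom.comp (χ.codRestrict ⊥ h3), ?_⟩
    convert h1 using 1
    ext f
    have h4 : ∀ y : (⊥ : Subalgebra k E), algebraMap k E (e y) = y := by
      intro y
      obtain ⟨c, rfl⟩ := e.symm.surjective y
      rw [AlgEquiv.apply_symm_apply]
      exact (congrArg Subtype.val (e.symm.commutes c)).symm
    exact h4 _
  choose ψ hψ using hex
  have hinj : Function.Injective ψ := by
    intro z z' hzz
    have h1 := hψ z'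
    rw [← hzz] at h1
    exact Subtype.ext (h.eq_of_evals hA hb (hX z z.2) (hX z' z'.2) (hψ z) h1)
  have hle := DegAlg.card_points_le hgaps hk huv (by omega) (Finset.univ.image ψ)
  rw [Finset.card_image_of_injective _ hinj, Finset.card_univ, Fintype.card_coe] at hle
  refine hle.trans (Nat.mul_le_mul_left _ ?_)
  omega

/-- Points of exact degree `j` give primes of degree `j`. -/
lemma exists_primes [IsAlgClosed E] (ha : 0 < a)
    (h : Curve (p ^ a) i x Ω A b) (hs : Splitting (p ^ a) A B)
    (hA : A.map (frob k E) = A) (hB : B.map (frob k E) = B) (hb : frob k E b = b)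
    {j : ℕ} (hj : 0 < j) {X : Finset ((ℕ → E) × E)}
    (hX : ∀ z ∈ X, FPoint k j (p ^ a) i A b z)
    (hX' : ∀ z ∈ X, ∀ d, 0 < d → 2 * d ≤ j → ¬ FPoint k d (p ^ a) i A b z) :
    ∃ S : Finset (Ideal (rat k x i)), DegAlg.PrimesOfDeg k j S ∧ X.card ≤ j * S.card := by
  classical
  obtain ⟨hfd, hrank⟩ := finrank_fixedBy k E hj
  have hex : ∀ z : X, ∃ χ : rat k x i →ₐ[k] E, Evals (p ^ a) i x χ z.1.1 z.1.2 ∧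
      ∀ f, χ f ∈ fixedBy k E j :=
    fun z => h.exists_evals_fpoint ha hs hA hB hb (hX z z.2)
  choose χ hχ hχj using hex
  set I : X → Ideal (rat k x i) := fun z => RingHom.ker (χ z) with hI
  have hinjχ : Function.Injective χ := by
    intro z z' hzz
    have h1 := hχ z'
    rw [← hzz] at h1
    exact Subtype.ext (h.eq_of_evals hA hb (hX z z.2) (hX z' z'.2) (hχ z) h1)
  have key : ∀ z, (I z).IsMaximal ∧ FiniteDimensional k (rat k x i ⧸ I z) ∧
      Module.finrank k (rat k x i ⧸ I z) = j := by
    intro z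
    let ψ : (rat k x i ⧸ I z) →ₐ[k] fixedBy k E j :=
      Ideal.Quotient.liftₐ (I z) ((χ z).codRestrict (fixedBy k E j).toSubalgebra (hχj z))
        fun f hf => Subtype.ext hf
    have hψ : Function.Injective ψ := by
      rw [injective_iff_map_eq_zero]
      intro f hf
      obtain ⟨f, rfl⟩ := Ideal.Quotient.mk_surjective f
      exact Ideal.Quotient.eq_zero_iff_mem.2 (congrArg Subtype.val hf)
    have hfin : FiniteDimensional k (rat k x i ⧸ I z) :=
      FiniteDimensional.of_injective ψ.toLinearMap hψ
    have hle : Module.finrank k (rat k x i ⧸ I z) ≤ j :=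
      (LinearMap.finrank_le_finrank_of_injective (f := ψ.toLinearMap) hψ).trans_eq hrank
    have hprime : (I z).IsPrime := RingHom.ker_isPrime _
    have hmax : (I z).IsMaximal := isMaximal_of_finite k (I z)
    refine ⟨hmax, hfin, le_antisymm hle ?_⟩
    let := Ideal.Quotient.field (I z)
    have : Finite (rat k x i ⧸ I z) := Module.finite_of_finite k
    let := Fintype.ofFinite (rat k x i ⧸ I z)
    set d := Module.finrank k (rat k x i ⧸ I z) with hd
    have hd0 : 0 < d := Module.finrank_pos
    have hcard : Fintype.card (rat k x i ⧸ I z) = Fintype.card k ^ d :=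
      Module.card_eq_pow_finrank
    have hfix : ∀ f, (frob k E)^[d] (χ z f) = χ z f := by
      intro f
      have h1 := FiniteField.pow_card (Ideal.Quotient.mk (I z) f)
      rw [hcard, ← map_pow, Ideal.Quotient.mk_eq_mk_iff_sub_mem] at h1
      have h2 : χ z (f ^ Fintype.card k ^ d - f) = 0 := h1
      rw [map_sub, map_pow, sub_eq_zero] at h2
      rw [frob_iterate, h2]
    obtain ⟨h3, h4⟩ := Evals.fix_of_forall h hA hb (hχ z) (hX z z.2).chain.ne_zero hfix
    have hzero : ∀ n, (frob k E)^[n] 0 = 0 := fun n => by rw [← RingHom.coe_pow, map_zero]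
    have hgcd : FPoint k (d.gcd j) (p ^ a) i A b z := by
      refine ⟨(hX z z.2).chain, (hX z z.2).supp, fun l => ?_,
        IsPeriodicPt.gcd h4 (hX z z.2).mem_snd⟩
      by_cases hl : 1 ≤ l ∧ l ≤ i
      · exact IsPeriodicPt.gcd (h3 l hl.1 hl.2) ((hX z z.2).mem_fst l)
      · rw [(hX z z.2).supp l hl]; exact hzero _
    by_contra! hlt
    have hg0 : 0 < d.gcd j := Nat.gcd_pos_of_pos_left _ hd0
    refine hX' z z.2 _ hg0 ?_ hgcd
    obtain ⟨c, hc⟩ := Nat.gcd_dvd_right d j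
    have hgd := Nat.gcd_le_left j hd0
    rcases Nat.lt_or_ge c 2 with h5 | h5
    · have : c = 0 ∨ c = 1 := by omega
      rcases this with rfl | rfl
      · omega
      · omega
    · nlinarith
  refine ⟨Finset.univ.image I, ⟨hj, fun J hJ => ?_⟩, ?_⟩
  · obtain ⟨z, -, rfl⟩ := Finset.mem_image.1 hJ
    exact ⟨(key z).1, (key z).2.2⟩
  · rw [← Fintype.card_coe X, ← Finset.card_univ]
    refine Finset.card_le_mul_card_image _ _ fun J hJ => ?_
    obtain ⟨z₀, -, rfl⟩ := Finset.mem_image.1 hJ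
    obtain ⟨hmax, hfin, hd⟩ := key z₀
    let := Ideal.Quotient.field (I z₀)
    let φ : {z : X // I z = I z₀} → ((rat k x i ⧸ I z₀) →ₐ[k] E) := fun z =>
      Ideal.Quotient.liftₐ (I z₀) (χ z.1) fun f hf => by
        rw [← z.2] at hf; exact hf
    have hφ : Function.Injective φ := by
      intro z z' hzz
      refine Subtype.ext (hinjχ (AlgHom.ext fun f => ?_))
      exact DFunLike.congr_fun hzz (Ideal.Quotient.mk (I z₀) f)
    have h1 : Fintype.card {z : X // I z = I z₀} ≤ j := by
      rw [← hd]
      rw [← Nat.card_eq_fintype_card]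
      exact (Nat.card_le_card_of_injective φ hφ).trans (card_algHom_quotient_le E (I z₀))
    rwa [Fintype.card_subtype] at h1

end Curve

end Tower

end

section

open Polynomial Function

namespace Tower

section Chains

variable (k E : Type*) [Field k] [Fintype k] [Field E] [Algebra k E]

open Classical in
/-- The elements of the extension of degree `j` of `k`. -/
noncomputable def elems (j : ℕ) : Finset E := (X ^ Fintype.card k ^ j - X : E[X]).roots.toFinset

variable {k E} {j q l : ℕ} {A B : E[X]} {b : E}

lemma mem_elems (hj : 0 < j) {c : E} : c ∈ elems k E j ↔ c ∈ fixedBy k E j := by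
  classical
  rw [elems, Multiset.mem_toFinset,
    mem_roots (FiniteField.X_pow_card_pow_sub_X_ne_zero E hj.ne' Fintype.one_lt_card), IsRoot,
    eval_sub, eval_pow, eval_X, sub_eq_zero, mem_fixedBy_iff_pow]

lemma card_elems [IsAlgClosed E] (hj : 0 < j) : (elems k E j).card = Fintype.card k ^ j := by
  classical
  rw [← card_roots_fixed k E hj, elems]

/-- A solution of the equations of the tower without the last step. -/
structure PChain (k : Type*) {E : Type*} [Field k] [Fintype k] [Field E] [Algebra k E]
    (j q l : ℕ) (α : ℕ → E) : Prop where
  ne_zero : T q (α 1) ≠ 0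
  step : ∀ m, 1 ≤ m → m < l → T q (α (m + 1)) = phi q (α m)
  supp : ∀ m, ¬ (1 ≤ m ∧ m ≤ l) → α m = 0
  mem : ∀ m, α m ∈ elems k E j

lemma PChain.T_ne_zero {α : ℕ → E} (h : PChain k j q l α) (hq : 2 ≤ q) {m : ℕ} (h1 : 1 ≤ m)
    (hm : m ≤ l) : T q (α m) ≠ 0 := by
  induction m, h1 using Nat.le_induction with
  | base => exact h.ne_zero
  | succ m h1 ih =>
    rw [h.step m h1 (by omega)]
    exact phi_ne_zero hq (ih (by omega))

variable (k) in
lemma finite_chains (j q l : ℕ) : {α : ℕ → E | PChain k j q l α}.Finite := by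
  have : Finite ({α : ℕ → E | PChain k j q l α} : Set (ℕ → E)) := by
    refine Finite.of_injective (β := Fin (l + 1) → elems k E j)
      (fun α m => ⟨α.1 m, α.2.mem m⟩) fun α α' h => Subtype.ext (funext fun m => ?_)
    by_cases hm : 1 ≤ m ∧ m ≤ l
    · exact congrArg Subtype.val (congrFun h ⟨m, by omega⟩)
    · rw [α.2.supp m hm, α'.2.supp m hm]
  exact Set.toFinite _

variable (k E) in
/-- The solutions of the equations of the tower without the last step. -/
noncomputable def chains (j q l : ℕ) : Finset (ℕ → E) := (finite_chains (E := E) k j q l).toFinset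

lemma mem_chains {α : ℕ → E} : α ∈ chains k E j q l ↔ PChain k j q l α := by
  rw [chains, Set.Finite.mem_toFinset]; rfl

open Classical in
variable (k) in
/-- The solutions of all equations of the tower. -/
noncomputable def points (j q l : ℕ) (A : E[X]) (b : E) : Finset ((ℕ → E) × E) :=
  (chains k E j q l ×ˢ elems k E j).filter fun z => A.eval z.2 = phi q (z.1 l) + b

lemma mem_points {z : (ℕ → E) × E} : z ∈ points k j q l A b ↔
    PChain k j q l z.1 ∧ z.2 ∈ elems k E j ∧ A.eval z.2 = phi q (z.1 l) + b := by
  classical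
  rw [points, Finset.mem_filter, Finset.mem_product, mem_chains, and_assoc]

lemma fpoint_iff (hj : 0 < j) {z : (ℕ → E) × E} :
    FPoint k j q l A b z ↔ z ∈ points k j q l A b := by
  rw [mem_points]
  constructor
  · intro h
    exact ⟨⟨h.chain.ne_zero, h.chain.step, h.supp, fun m => (mem_elems hj).2 (h.mem_fst m)⟩,
      (mem_elems hj).2 h.mem_snd, h.chain.top⟩
  · rintro ⟨h1, h2, h3⟩
    exact ⟨⟨h1.ne_zero, h1.step, h3⟩, h1.supp, fun m => (mem_elems hj).1 (h1.mem m),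
      (mem_elems hj).1 h2⟩

open Classical in
lemma card_points : (points k j q l A b).card =
    ∑ α ∈ chains k E j q l, ((elems k E j).filter fun c => A.eval c = phi q (α l) + b).card := by
  rw [points, Finset.card_filter, Finset.sum_product]
  exact Finset.sum_congr rfl fun α _ => (Finset.card_filter _ _).symm

lemma eval_TP (q : ℕ) (z : E) : (TP E q).eval z = T q z := by simp [TP, T]

lemma card_chains_succ (hj : 0 < j) (hl : 1 ≤ l) :
    (chains k E j q (l + 1)).card = (points k j q l (TP E q) 0).card := by
  classical
  refine Finset.card_bij' (fun α _ => (update α (l + 1) 0, α (l + 1)))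
    (fun z _ => update z.1 (l + 1) z.2) (fun α hα => ?_) (fun z hz => ?_) (fun α hα => ?_)
    fun z hz => ?_
  · have h := mem_chains.1 hα
    have hne : ∀ m, m ≤ l → update α (l + 1) 0 m = α m := fun m hm =>
      update_of_ne (by omega) _ _
    refine mem_points.2 ⟨⟨?_, fun m h1 hm => ?_, fun m hm => ?_, fun m => ?_⟩, h.mem _, ?_⟩
    · change T q (update α (l + 1) 0 1) ≠ 0
      rw [hne 1 hl]; exact h.ne_zero
    · change T q (update α (l + 1) 0 (m + 1)) = phi q (update α (l + 1) 0 m)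
      rw [hne _ (by omega), hne _ (by omega)]; exact h.step m h1 (by omega)
    · by_cases hm' : m = l + 1
      · subst hm'; exact update_self _ _ _
      · exact (update_of_ne hm' _ _).trans (h.supp m (by omega))
    · by_cases hm' : m = l + 1
      · subst hm'
        change update α (l + 1) 0 (l + 1) ∈ _
        rw [update_self, mem_elems hj]; exact zero_mem _
      · change update α (l + 1) 0 m ∈ _
        rw [update_of_ne hm']; exact h.mem m
    · change (TP E q).eval (α (l + 1)) = phi q (update α (l + 1) 0 l) + 0
      rw [eval_TP, add_zero, hne l le_rfl]; exact h.step l hl (by omega)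
  · obtain ⟨h, h2, h3⟩ := mem_points.1 hz
    have hne : ∀ m, m ≤ l → update z.1 (l + 1) z.2 m = z.1 m := fun m hm =>
      update_of_ne (by omega) _ _
    refine mem_chains.2 ⟨?_, fun m h1 hm => ?_, fun m hm => ?_, fun m => ?_⟩
    · rw [hne 1 hl]; exact h.ne_zero
    · rw [hne m (by omega)]
      by_cases hm' : m = l
      · subst hm'
        rw [update_self, ← eval_TP, h3, add_zero]
      · rw [hne _ (by omega)]; exact h.step m h1 (by omega)
    · rw [update_of_ne (by omega)]; exact h.supp m (by omega)
    · by_cases hm' : m = l + 1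
      · subst hm'; rw [update_self]; exact h2
      · rw [update_of_ne hm']; exact h.mem m
  · change update (update α (l + 1) 0) (l + 1) (α (l + 1)) = α
    rw [update_idem, update_eq_self]
  · have h := (mem_points.1 hz).1.supp (l + 1) (by omega)
    refine Prod.ext ?_ (update_self _ _ _)
    change update (update z.1 (l + 1) z.2) (l + 1) 0 = z.1
    rw [update_idem, ← h, update_eq_self]

open Classical in
lemma card_chains_one (hj : 0 < j) (q : ℕ) :
    (chains k E j q 1).card = ((elems k E j).filter fun c => T q c ≠ 0).card := by
  refine Finset.card_bij' (fun α _ => α 1) (fun c _ => update 0 1 c) (fun α hα => ?_)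
    (fun c hc => ?_) (fun α hα => ?_) fun z hz => ?_
  · have h := mem_chains.1 hα
    exact Finset.mem_filter.2 ⟨h.mem 1, h.ne_zero⟩
  · obtain ⟨h1, h2⟩ := Finset.mem_filter.1 hc
    refine mem_chains.2 ⟨by rwa [update_self], fun m _ _ => by omega, fun m hm => ?_, fun m => ?_⟩
    · rw [update_of_ne (by omega)]; rfl
    · by_cases hm : m = 1
      · subst hm; rwa [update_self]
      · rw [update_of_ne hm, mem_elems hj]; exact zero_mem _
  · have h := mem_chains.1 hα
    refine funext fun m => ?_
    by_cases hm : m = 1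
    · subst hm; exact update_self _ _ _
    · exact (update_of_ne hm _ _).trans (h.supp m (by omega)).symm
  · exact update_self _ _ _

open Classical in
lemma card_eval_eq_le (s : Finset E) (hA : 0 < A.natDegree) (c : E) :
    (s.filter fun z => A.eval z = c).card ≤ A.natDegree := by
  have h0 : A - C c ≠ 0 := by
    intro h
    rw [sub_eq_zero] at h
    rw [h, natDegree_C] at hA
    exact hA.false
  have h1 : (s.filter fun z => A.eval z = c) ⊆ (A - C c).roots.toFinset := by
    intro z hz
    rw [Multiset.mem_toFinset, mem_roots h0, IsRoot, eval_sub, eval_C, (Finset.mem_filter.1 hz).2,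
      sub_self]
  refine (Finset.card_le_card h1).trans ((Multiset.toFinset_card_le _).trans
    ((card_roots' _).trans_eq ?_))
  rw [natDegree_sub_C]

open Classical in
lemma card_T_eq_le (s : Finset E) (hq : 2 ≤ q) (c : E) :
    (s.filter fun z => T q z = c).card ≤ q := by
  have h := card_eval_eq_le (A := TP E q) s (by rw [TP_natDegree hq]; omega) c
  simpa only [eval_TP, TP_natDegree hq] using h

lemma card_points_le_mul (hA : 0 < A.natDegree) :
    (points k j q l A b).card ≤ (chains k E j q l).card * A.natDegree := by
  classical
  rw [card_points]
  refine Finset.sum_le_card_nsmul _ _ _ fun α _ => ?_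
  exact card_eval_eq_le _ hA _

lemma card_chains_le [IsAlgClosed E] (hq : 2 ≤ q) (hj : 0 < j) (hl : 1 ≤ l) :
    (chains k E j q l).card ≤ Fintype.card k ^ j * q ^ (l - 1) := by
  classical
  induction l, hl using Nat.le_induction with
  | base =>
    rw [card_chains_one hj, ← card_elems (E := E) hj]
    simpa using Finset.card_filter_le _ _
  | succ l hl ih =>
    rw [card_chains_succ hj hl]
    refine (card_points_le_mul (by rw [TP_natDegree hq]; omega)).trans ?_
    rw [TP_natDegree hq]
    calc _ ≤ Fintype.card k ^ j * q ^ (l - 1) * q := Nat.mul_le_mul_right _ ih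
      _ = Fintype.card k ^ j * q ^ (l + 1 - 1) := by
        rw [mul_assoc, ← pow_succ]; congr 2; omega

lemma card_points_le_crude [IsAlgClosed E] (hq : 2 ≤ q) (hj : 0 < j) (hl : 1 ≤ l)
    (hA : 0 < A.natDegree) :
    (points k j q l A b).card ≤ Fintype.card k ^ j * (A.natDegree * q ^ l) := by
  refine (card_points_le_mul hA).trans ?_
  have h1 := card_chains_le (k := k) (E := E) hq hj hl
  have h2 : q ^ (l - 1) ≤ q ^ l := Nat.pow_le_pow_right (by omega) (by omega)
  calc _ ≤ Fintype.card k ^ j * q ^ (l - 1) * A.natDegree := Nat.mul_le_mul_right _ h1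
    _ = Fintype.card k ^ j * (A.natDegree * q ^ (l - 1)) := by ring
    _ ≤ _ := by gcongr

lemma card_chains_one_ge [IsAlgClosed E] (hq : 2 ≤ q) (hj : 0 < j) :
    Fintype.card k ^ j ≤ (chains k E j q 1).card + q := by
  classical
  rw [card_chains_one hj, ← card_elems (E := E) hj]
  have h := Finset.card_filter_add_card_filter_not (s := elems k E j) (fun c => T q c = 0)
  have h1 := card_T_eq_le (elems k E j) hq (0 : E)
  simp only [ne_eq]
  omega

end Chains

end Tower

end

section

open Polynomial Function

namespace Tower

section Twist

variable {k E : Type*} [Field k] [Fintype k] [Field E] [Algebra k E] [IsAlgClosed E]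
  {p : ℕ} [Fact p.Prime] [CharP E p] {a j l : ℕ} {A B : E[X]} {b : E}

omit [IsAlgClosed E] in
lemma T_add (p : ℕ) [Fact p.Prime] [CharP E p] (a : ℕ) (u v : E) :
    T (p ^ a) (u + v) = T (p ^ a) u + T (p ^ a) v := by
  rw [T, add_pow_char_pow u v p a, T, T]; ring

omit [IsAlgClosed E] in
lemma T_sub (p : ℕ) [Fact p.Prime] [CharP E p] (a : ℕ) (u v : E) :
    T (p ^ a) (u - v) = T (p ^ a) u - T (p ^ a) v := by
  rw [eq_sub_iff_add_eq, ← T_add, sub_add_cancel]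

omit [Fintype k] [IsAlgClosed E] in
lemma T_mem_subfield {F : IntermediateField k E} {u : E} (hu : u ∈ F) (q : ℕ) : T q u ∈ F :=
  add_mem (_root_.pow_mem hu q) hu

omit [Fintype k] [IsAlgClosed E] in
lemma phi_mem_subfield {F : IntermediateField k E} {u : E} (hu : u ∈ F) (q : ℕ) : phi q u ∈ F :=
  inv_mem (T_mem_subfield (inv_mem hu) q)

lemma card_chains_succ_ge (ha : 0 < a) (hj : 0 < j) (hl : 1 ≤ l) {X err : ℕ}
    (hX : Fintype.card k ^ j ≤ (chains k E j (p ^ a) l).card + X)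
    (herr : ∀ b ∈ elems k E j,
      (points k j (p ^ a) l (TP E (p ^ a)) b).card ≤ Fintype.card k ^ j + err) :
    Fintype.card k ^ j ≤ (chains k E j (p ^ a) (l + 1)).card + p ^ a * (X + err) := by
  classical
  set q := p ^ a with hq
  have hq2 : 2 ≤ q := two_le_pow p ha
  set Q := Fintype.card k ^ j with hQ
  have hQpos : 0 < Q := pow_pos Fintype.card_pos j
  set U := elems k E j with hU
  have hUcard : U.card = Q := card_elems hj
  set I := U.image (T q) with hI
  have hIU : I ⊆ U := by
    intro c hc
    obtain ⟨u, hu, rfl⟩ := Finset.mem_image.1 hc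
    rw [mem_elems hj] at hu ⊢
    exact T_mem_subfield hu q
  set m := I.card with hm
  have hQm : Q ≤ q * m := by
    rw [← hUcard]
    exact Finset.card_le_mul_card_image _ _ fun c _ => card_T_eq_le U hq2 c
  have hmQ : m ≤ Q := hUcard ▸ Finset.card_le_card hIU
  set N := (chains k E j q (l + 1)).card with hN
  have hN0 : N = (points k j q l (TP E q) 0).card := card_chains_succ hj hl
  have hphi : ∀ α ∈ chains k E j q l, phi q (α l) ∈ U := fun α hα => by
    have := (mem_chains.1 hα).mem l
    rw [mem_elems hj] at this ⊢
    exact phi_mem_subfield this q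
  have htwist : ∀ c ∈ I, (points k j q l (TP E q) c).card = N := by
    intro c hc
    obtain ⟨u, hu, rfl⟩ := Finset.mem_image.1 hc
    rw [mem_elems hj] at hu
    rw [hN0, card_points, card_points]
    refine Finset.sum_congr rfl fun α hα => ?_
    refine Finset.card_bij' (fun z _ => z - u) (fun z _ => z + u) (fun z hz => ?_)
      (fun z hz => ?_) (fun z _ => sub_add_cancel z u) (fun z _ => add_sub_cancel_right z u)
    · obtain ⟨h1, h2⟩ := Finset.mem_filter.1 hz
      rw [mem_elems hj] at h1
      refine Finset.mem_filter.2 ⟨(mem_elems hj).2 (sub_mem h1 hu), ?_⟩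
      rw [eval_TP] at h2 ⊢
      rw [T_sub, h2]; ring
    · obtain ⟨h1, h2⟩ := Finset.mem_filter.1 hz
      rw [mem_elems hj] at h1
      refine Finset.mem_filter.2 ⟨(mem_elems hj).2 (add_mem h1 hu), ?_⟩
      rw [eval_TP] at h2 ⊢
      rw [T_add, h2]; ring
  have hsum : ∑ c ∈ U, (points k j q l (TP E q) c).card = (chains k E j q l).card * Q := by
    simp_rw [card_points]
    rw [Finset.sum_comm, ← smul_eq_mul, ← Finset.sum_const]
    refine Finset.sum_congr rfl fun α hα => ?_
    rw [← hUcard]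
    have h1 : ∀ z ∈ U, T q z - phi q (α l) ∈ U := fun z hz => by
      have h2 := hphi α hα
      rw [mem_elems hj] at hz h2 ⊢
      exact sub_mem (T_mem_subfield hz q) h2
    rw [Finset.card_eq_sum_card_fiberwise h1]
    refine Finset.sum_congr rfl fun c _ => congrArg Finset.card ?_
    refine Finset.filter_congr fun z _ => ?_
    rw [eval_TP, sub_eq_iff_eq_add, add_comm c]
  have hle : (chains k E j q l).card * Q ≤ m * N + (Q - m) * (Q + err) := by
    rw [← hsum, ← Finset.sum_sdiff hIU, add_comm (m * N)]
    refine add_le_add ?_ ?_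
    · have h1 := Finset.sum_le_card_nsmul (U \ I) (fun c => (points k j q l (TP E q) c).card)
        (Q + err) fun c hc => herr c (Finset.mem_sdiff.1 hc).1
      rwa [Finset.card_sdiff_of_subset hIU, hUcard, smul_eq_mul] at h1
    · rw [Finset.sum_congr rfl htwist, Finset.sum_const, smul_eq_mul]
  have hm0 : 0 < m := by
    by_contra h
    have : m = 0 := by omega
    rw [this] at hQm
    omega
  obtain ⟨d, hd⟩ := Nat.exists_eq_add_of_le hmQ
  rw [hd, Nat.add_sub_cancel_left, ← hd] at hle
  have h1 : Q * Q ≤ m * N + d * (Q + err) + X * Q := by nlinarith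
  have h2 : m * Q ≤ m * N + d * err + X * Q := by nlinarith
  have h3 : d * err + X * Q ≤ q * m * (X + err) := by nlinarith
  refine Nat.le_of_mul_le_mul_left (c := m) ?_ hm0
  nlinarith

end Twist

section Rational

variable {k E : Type*} [Field k] [Fintype k] [Field E] [Algebra k E] [IsAlgClosed E]
  [Algebra.IsAlgebraic k E] {p : ℕ} [Fact p.Prime] [CharP E p] {a j l : ℕ}

omit [IsAlgClosed E] in
lemma splitting_TP (ha : 0 < a) : Splitting (p ^ a) (TP E (p ^ a)) X where
  monic := TP_monic (two_le_pow p ha)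
  pos := by rw [TP_natDegree (two_le_pow p ha)]; have := two_le_pow p ha; omega
  add u v := by
    rw [aeval_TP, aeval_TP, aeval_TP, T, laurent_add_pow, T, T]; ring
  comp := comp_X
  coeff_zero := coeff_X_zero

omit [IsAlgClosed E] in
lemma TP_map (σ : E →+* E) (q : ℕ) : (TP E q).map σ = TP E q := by simp [TP]

lemma card_points_TP_le (ha : 0 < a) (hj : 0 < j) (hl : 1 ≤ l) {u v : ℕ}
    (hk : Fintype.card k ^ j = p ^ u * p ^ v) (huv : u ≤ v)
    (hv : 2 * (p ^ a) ^ (l + 1) + 4 ≤ p ^ v) {b : E} (hb : b ∈ elems k E j) :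
    (points k j (p ^ a) l (TP E (p ^ a)) b).card ≤
      Fintype.card k ^ j + p ^ v * (3 * (p ^ a) ^ (l + 1) + 1) := by
  classical
  have hq := two_le_pow p ha
  rw [mem_elems hj] at hb
  obtain ⟨hfin, hcard⟩ := finite_fixedBy k E hj
  let := Fintype.ofFinite (fixedBy k E j)
  rw [Nat.card_eq_fintype_card] at hcard
  have halg : Algebra.IsAlgebraic (fixedBy k E j) E := Algebra.IsAlgebraic.tower_top (K := k) _
  have hs := splitting_TP (E := E) (p := p) ha
  obtain ⟨x, h⟩ := exists_curve (p := p) ha hl hs.monic hs.pos b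
  have hfix : ∀ c : E, c ∈ fixedBy k E j → frob (fixedBy k E j) E c = c := fun c hc =>
    frob_algebraMap (⟨c, hc⟩ : fixedBy k E j)
  have hmul : (TP E (p ^ a)).natDegree * (p ^ a) ^ l = (p ^ a) ^ (l + 1) := by
    rw [TP_natDegree hq, pow_succ']
  have h1 := h.card_rational_le (k := fixedBy k E j) ha hs (TP_map _ _) (Polynomial.map_X _)
    (hfix b hb) (X := points k j (p ^ a) l (TP E (p ^ a)) b) (u := u) (v := v) (fun z hz => ?_)
    (hcard.trans hk) huv (by rwa [hmul])
  · rw [hmul] at h1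
    refine h1.trans (le_of_eq ?_)
    rw [hk]; ring
  · have h2 := (fpoint_iff hj).2 hz
    exact ⟨h2.chain, h2.supp, fun m => hfix _ (h2.mem_fst m), hfix _ h2.mem_snd⟩

lemma card_chains_ge (ha : 0 < a) (hj : 0 < j) {i : ℕ} {u v : ℕ}
    (hk : Fintype.card k ^ j = p ^ u * p ^ v) (huv : u ≤ v)
    (hv : 2 * (p ^ a) ^ (i + 1) + 4 ≤ p ^ v) {l : ℕ} (hl : 1 ≤ l) (hli : l ≤ i + 1) :
    Fintype.card k ^ j + 2 * (p ^ v * (3 * (p ^ a) ^ (i + 1) + 1)) ≤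
      (chains k E j (p ^ a) l).card +
        (p ^ a) ^ l * (1 + 2 * (p ^ v * (3 * (p ^ a) ^ (i + 1) + 1))) := by
  have hq := two_le_pow p ha
  set err := p ^ v * (3 * (p ^ a) ^ (i + 1) + 1) with herr
  induction l, hl using Nat.le_induction with
  | base =>
    have := card_chains_one_ge (k := k) (E := E) hq hj
    nlinarith
  | succ l hl ih =>
    have h1 := ih (by omega)
    set Y := (p ^ a) ^ l * (1 + 2 * err) with hY
    have hpow : (p ^ a) ^ (l + 1) ≤ (p ^ a) ^ (i + 1) := Nat.pow_le_pow_right (by omega) (by omega)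
    have hYerr : 2 * err ≤ Y := by
      have : 1 ≤ (p ^ a) ^ l := Nat.one_le_pow _ _ (by omega)
      nlinarith
    have h2 := card_chains_succ_ge (k := k) (E := E) (p := p) ha hj hl (X := Y - 2 * err)
      (err := err) (by omega) fun b hb =>
        (card_points_TP_le ha hj hl hk huv (by omega) hb).trans (by
          rw [herr]; gcongr)
    obtain ⟨Z, hZ⟩ := Nat.exists_eq_add_of_le hYerr
    rw [hZ, Nat.add_sub_cancel_left] at h2
    have h3 : (p ^ a) ^ (l + 1) * (1 + 2 * err) = p ^ a * Y := by rw [hY]; ring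
    rw [h3, hZ]
    nlinarith

end Rational

end Tower

end

section

open Polynomial Function

namespace Tower

section Descend

variable {k E : Type*} [Field k] [Fintype k] [Field E] [Algebra k E]
  {j q i l : ℕ} {A B : E[X]} {b : E}

lemma eval_mem_fixedBy (hB : B.map (frob k E) = B) {z : E} (hz : z ∈ fixedBy k E j) :
    B.eval z ∈ fixedBy k E j := by
  have h := Curve.map_pow_of_fix hB j
  rw [mem_fixedBy, ← RingHom.coe_pow] at hz ⊢
  have h1 := Polynomial.hom_eval₂ B (RingHom.id E) (frob k E ^ j) z
  rw [RingHom.comp_id, hz, ← eval_map (frob k E ^ j), h] at h1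
  exact h1

lemma Splitting.natDegree_mul (hs : Splitting q A B) (hq : 2 ≤ q) :
    A.natDegree * B.natDegree = q := by
  rw [← natDegree_comp, hs.comp, TP_natDegree hq]

lemma Splitting.natDegree_right_pos (hs : Splitting q A B) (hq : 2 ≤ q) : 0 < B.natDegree := by
  have := hs.natDegree_mul hq
  by_contra h
  have h0 : B.natDegree = 0 := by omega
  rw [h0] at this
  omega

lemma Splitting.eval (hs : Splitting q A B) (z : E) : A.eval (B.eval z) = T q z := by
  rw [← eval_comp, hs.comp, eval_TP]

lemma card_points_TP_le_mul (hs : Splitting q A B) (hq : 2 ≤ q) (hB : B.map (frob k E) = B)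
    (hj : 0 < j) :
    (points k j q l (TP E q) b).card ≤ B.natDegree * (points k j q l A b).card := by
  classical
  have hmap : (points k j q l (TP E q) b).image (fun z => (z.1, B.eval z.2)) ⊆
      points k j q l A b := by
    intro w hw
    obtain ⟨z, hz, rfl⟩ := Finset.mem_image.1 hw
    obtain ⟨h1, h2, h3⟩ := mem_points.1 hz
    rw [mem_elems hj] at h2
    refine mem_points.2 ⟨h1, (mem_elems hj).2 (eval_mem_fixedBy hB h2), ?_⟩
    rw [hs.eval, ← eval_TP]
    exact h3
  refine (Finset.card_le_mul_card_image (f := fun z => (z.1, B.eval z.2)) _ B.natDegree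
    fun w _ => ?_).trans (Nat.mul_le_mul_left _ (Finset.card_le_card hmap))
  refine le_trans (Finset.card_le_card_of_injOn (fun z => z.2) (fun z hz => ?_)
    fun z hz z' hz' h => ?_) (card_eval_eq_le (elems k E j) (hs.natDegree_right_pos hq) w.2)
  · obtain ⟨h1, h2⟩ := Finset.mem_filter.1 hz
    exact Finset.mem_coe.2 (Finset.mem_filter.2
      ⟨(mem_points.1 h1).2.1, congrArg Prod.snd h2⟩)
  · have h1 := congrArg Prod.fst (Finset.mem_filter.1 hz).2
    have h2 := congrArg Prod.fst (Finset.mem_filter.1 hz').2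
    exact Prod.ext (h1.trans h2.symm) h

end Descend

section Quadratic

variable {k E : Type*} [Field k] [Fintype k] [Field E] [Algebra k E] [IsAlgClosed E]
  {p : ℕ} [Fact p.Prime] [CharP E p] {a i l : ℕ} {A B : E[X]}

omit [IsAlgClosed E] [Fact (Nat.Prime p)] [CharP E p] in
lemma frob_T_of_mem (hk : Fintype.card k = p ^ a) {z : E} (hz : z ∈ fixedBy k E 2) :
    frob k E (T (p ^ a) z) = T (p ^ a) z := by
  have h1 : frob k E z = z ^ p ^ a := by rw [frob_apply, hk]
  have h2 : frob k E (frob k E z) = z := hz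
  rw [T, map_add, map_pow, ← map_pow, ← h1, h2, add_comm]

omit [IsAlgClosed E] [Fact (Nat.Prime p)] [CharP E p] in
lemma frob_phi_of_mem (hk : Fintype.card k = p ^ a) {z : E} (hz : z ∈ fixedBy k E 2) :
    frob k E (phi (p ^ a) z) = phi (p ^ a) z := by
  rw [phi, map_inv₀, frob_T_of_mem hk (inv_mem hz)]

open Classical in
lemma card_T_eq (ha : 0 < a) (hk : Fintype.card k = p ^ a) {c : E} (hc : frob k E c = c) :
    ((elems k E 2).filter fun z => T (p ^ a) z = c).card = p ^ a := by
  have hq := two_le_pow p ha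
  have hdeg : (TP E (p ^ a) - C c).natDegree = p ^ a := by rw [natDegree_sub_C, TP_natDegree hq]
  have h0 : TP E (p ^ a) - C c ≠ 0 := by
    intro h
    rw [h, natDegree_zero] at hdeg
    omega
  have hder : derivative (TP E (p ^ a) - C c) = 1 := by
    have : (p : E) = 0 := CharP.cast_eq_zero E p
    rw [TP, derivative_sub, derivative_C, derivative_add, derivative_X, derivative_X_pow,
      Nat.cast_pow, this, zero_pow ha.ne', C_0, zero_mul, zero_add, sub_zero]
  have hsep : (TP E (p ^ a) - C c).Separable := by
    rw [separable_def, hder]; exact isCoprime_one_right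
  have heq : ((elems k E 2).filter fun z => T (p ^ a) z = c) =
      (TP E (p ^ a) - C c).roots.toFinset := by
    ext z
    rw [Finset.mem_filter, Multiset.mem_toFinset, mem_roots h0, IsRoot, eval_sub, eval_C, eval_TP,
      sub_eq_zero, mem_elems two_pos]
    refine ⟨fun h => h.2, fun h => ⟨?_, h⟩⟩
    have h1 : frob k E z = c - z := by rw [frob_apply, hk, ← h, T, add_sub_cancel_right]
    change frob k E (frob k E z) = z
    rw [h1, map_sub, hc, h1, sub_sub_cancel]
  rw [heq, Multiset.toFinset_card_of_nodup (nodup_roots hsep)]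
  exact (splits_iff_card_roots.1 (IsAlgClosed.splits _)).trans hdeg

lemma card_points_two_TP (ha : 0 < a) (hk : Fintype.card k = p ^ a) :
    (points k 2 (p ^ a) l (TP E (p ^ a)) 0).card = (chains k E 2 (p ^ a) l).card * p ^ a := by
  classical
  rw [card_points, ← smul_eq_mul, ← Finset.sum_const]
  refine Finset.sum_congr rfl fun α hα => ?_
  have h1 := (mem_chains.1 hα).mem l
  rw [mem_elems two_pos] at h1
  refine (congrArg Finset.card ?_).trans (card_T_eq ha hk (frob_phi_of_mem hk h1))
  simp only [eval_TP, add_zero]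

lemma card_chains_two_ge (ha : 0 < a) (hk : Fintype.card k = p ^ a) (hl : 1 ≤ l) :
    (p ^ a - 1) * (p ^ a) ^ l ≤ (chains k E 2 (p ^ a) l).card := by
  have hq := two_le_pow p ha
  induction l, hl using Nat.le_induction with
  | base =>
    have h := card_chains_one_ge (k := k) (E := E) hq two_pos
    rw [hk] at h
    obtain ⟨c, hc⟩ := Nat.exists_eq_add_of_le hq
    rw [hc] at h ⊢
    have : 2 + c - 1 = 1 + c := by omega
    rw [this]
    nlinarith
  | succ l hl ih =>
    rw [card_chains_succ two_pos hl, card_points_two_TP ha hk, pow_succ, ← mul_assoc]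
    exact Nat.mul_le_mul_right _ ih

lemma card_points_two_ge (ha : 0 < a) (hk : Fintype.card k = p ^ a) (hs : Splitting (p ^ a) A B)
    (hB : B.map (frob k E) = B) (hl : 1 ≤ l) :
    (p ^ a - 1) * (A.natDegree * (p ^ a) ^ l) ≤ (points k 2 (p ^ a) l A 0).card := by
  have hq := two_le_pow p ha
  have h1 := card_points_TP_le_mul (k := k) (l := l) (b := 0) hs hq hB two_pos
  rw [card_points_two_TP ha hk, ← hs.natDegree_mul hq] at h1
  have h2 := card_chains_two_ge (E := E) ha hk hl
  rw [hs.natDegree_mul hq] at h1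
  have h3 : B.natDegree * (A.natDegree * (chains k E 2 (p ^ a) l).card) ≤
      B.natDegree * (points k 2 (p ^ a) l A 0).card := by
    refine le_trans (le_of_eq ?_) h1
    rw [← hs.natDegree_mul hq]; ring
  refine le_trans (le_trans (le_of_eq ?_) (Nat.mul_le_mul_left A.natDegree h2))
    (Nat.le_of_mul_le_mul_left h3 (hs.natDegree_right_pos hq))
  ring

omit [IsAlgClosed E] [Fact (Nat.Prime p)] [CharP E p] in
lemma T_of_rational (hk : Fintype.card k = p ^ a) {z : E} (hz : z ∈ elems k E 1) :
    T (p ^ a) z = 2 * z := by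
  rw [mem_elems one_pos] at hz
  have h1 : z ^ p ^ a = z := by rw [← hk]; exact hz
  rw [T, h1, two_mul]

omit [CharP E p] in
lemma card_chains_rational_le (ha : 0 < a) (hk : Fintype.card k = p ^ a) (hl : 1 ≤ l) :
    (chains k E 1 (p ^ a) l).card ≤ p ^ a := by
  classical
  have hq := two_le_pow p ha
  induction l, hl using Nat.le_induction with
  | base => simpa [hk] using card_chains_le (k := k) (E := E) hq one_pos (le_refl 1)
  | succ l hl ih =>
    rw [card_chains_succ one_pos hl, card_points]
    refine (Finset.sum_le_card_nsmul _ _ 1 fun α hα => ?_).trans ?_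
    · have hc := mem_chains.1 hα
      have h2 : (2 : E) ≠ 0 := by
        intro h
        refine hc.T_ne_zero hq hl le_rfl ?_
        rw [T_of_rational hk (hc.mem l), h, zero_mul]
      refine Finset.card_le_one.2 fun z hz z' hz' => ?_
      obtain ⟨h3, h4⟩ := Finset.mem_filter.1 hz
      obtain ⟨h5, h6⟩ := Finset.mem_filter.1 hz'
      rw [eval_TP, T_of_rational hk h3] at h4
      rw [eval_TP, T_of_rational hk h5] at h6
      exact mul_left_cancel₀ h2 (h4.trans h6.symm)
    · rw [smul_eq_mul, mul_one]; exact ih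

/-- The number of primes of degree two. -/
lemma Curve.exists_primes_two {x : ℕ → LaurentSeries E} {Ω : Finset E} (ha : 0 < a)
    (hk : Fintype.card k = p ^ a) (h : Curve (p ^ a) i x Ω A 0) (hs : Splitting (p ^ a) A B)
    (hA : A.map (frob k E) = A) (hB : B.map (frob k E) = B) :
    ∃ S : Finset (Ideal (rat k x i)), DegAlg.PrimesOfDeg k 2 S ∧
      (p ^ a - 1) * (A.natDegree * (p ^ a) ^ i) ≤ 2 * S.card + p ^ a * A.natDegree := by
  classical
  obtain ⟨S, hS, hcard⟩ := h.exists_primes ha hs hA hB (map_zero _) two_pos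
    (X := points k 2 (p ^ a) i A 0 \ points k 1 (p ^ a) i A 0)
    (fun z hz => (fpoint_iff two_pos).2 (Finset.mem_sdiff.1 hz).1)
    (fun z hz d hd hd' hp => (Finset.mem_sdiff.1 hz).2 (by
      have : d = 1 := by omega
      subst this
      exact (fpoint_iff one_pos).1 hp))
  refine ⟨S, hS, ?_⟩
  have h1 := card_points_two_ge ha hk hs hB h.one_le
  have h2 : (points k 1 (p ^ a) i A 0).card ≤ p ^ a * A.natDegree :=
    (card_points_le_mul hs.pos).trans
      (Nat.mul_le_mul_right _ (card_chains_rational_le ha hk h.one_le))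
  have h3 := Finset.le_card_sdiff (points k 1 (p ^ a) i A 0) (points k 2 (p ^ a) i A 0)
  omega

end Quadratic

section Large

variable {k E : Type*} [Field k] [Fintype k] [Field E] [Algebra k E] [IsAlgClosed E]
  [Algebra.IsAlgebraic k E] {p : ℕ} [Fact p.Prime] [CharP E p] {a i : ℕ} {A B : E[X]}

set_option maxHeartbeats 1000000 in
/-- There are many primes of large degree. -/
lemma Curve.exists_primes_large {x : ℕ → LaurentSeries E} {Ω : Finset E} (ha : 0 < a)
    (hk : Fintype.card k = p ^ a) (h : Curve (p ^ a) i x Ω A 0) (hs : Splitting (p ^ a) A B)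
    (hA : A.map (frob k E) = A) (hB : B.map (frob k E) = B) {j : ℕ} (hj : 0 < j)
    (hbig : (20 * (p ^ a) ^ 3 * (A.natDegree * (p ^ a) ^ i) ^ 2 * j) ^ 2 ≤ (p ^ a) ^ j) :
    ∃ S : Finset (Ideal (rat k x i)), DegAlg.PrimesOfDeg k j S ∧
      (p ^ a) ^ j ≤ 2 * p ^ a * j * S.card := by
  classical
  have hq := two_le_pow p ha
  have hi := h.one_le
  obtain ⟨S, hS, hcard⟩ := h.exists_primes ha hs hA hB (map_zero _) hj
    (X := points k j (p ^ a) i A 0 \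
      (Finset.Icc 1 (j / 2)).biUnion fun d => points k d (p ^ a) i A 0)
    (fun z hz => (fpoint_iff hj).2 (Finset.mem_sdiff.1 hz).1)
    (fun z hz d hd hd' hp => (Finset.mem_sdiff.1 hz).2 (Finset.mem_biUnion.2
      ⟨d, Finset.mem_Icc.2 ⟨hd, by omega⟩, (fpoint_iff hd).1 hp⟩))
  refine ⟨S, hS, ?_⟩
  set G := A.natDegree * (p ^ a) ^ i with hG
  set u := a * j / 2 with hu
  set v := a * j - u with hv
  set w := p ^ v with hw
  have hp1 : 1 < p := (Fact.out : p.Prime).one_lt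
  have hww : (p ^ a) ^ j ≤ w ^ 2 := by
    rw [← pow_mul, hw, ← pow_mul]
    exact Nat.pow_le_pow_right hp1.le (by omega)
  have hww' : w ^ 2 ≤ p ^ a * (p ^ a) ^ j := by
    rw [hw, ← pow_mul p v 2, ← pow_mul p a j, ← pow_add]
    exact Nat.pow_le_pow_right hp1.le (by omega)
  have hhalf : (p ^ a) ^ (j / 2) ≤ w := by
    rw [← pow_mul, hw]
    refine Nat.pow_le_pow_right hp1.le ?_
    have : 2 * (a * (j / 2)) ≤ a * j := by
      rw [mul_left_comm]; exact Nat.mul_le_mul_left _ (Nat.mul_div_le j 2)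
    omega
  have hsum : ((Finset.Icc 1 (j / 2)).biUnion fun d => points k d (p ^ a) i A 0).card ≤
      j * (w * G) := by
    refine Finset.card_biUnion_le.trans ((Finset.sum_le_card_nsmul _ _ (w * G)
      fun d hd => ?_).trans ?_)
    · obtain ⟨h1, h2⟩ := Finset.mem_Icc.1 hd
      refine (card_points_le_crude hq h1 hi hs.pos).trans (Nat.mul_le_mul_right _ ?_)
      rw [hk]
      exact (Nat.pow_le_pow_right (by omega) h2).trans hhalf
    · rw [Nat.card_Icc, smul_eq_mul]
      exact Nat.mul_le_mul_right _ (by omega)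
  have hqi : (p ^ a) ^ i ≤ G := Nat.le_mul_of_pos_left _ hs.pos
  have hqi1 : (p ^ a) ^ (i + 1) ≤ p ^ a * G := by
    rw [pow_succ']; exact Nat.mul_le_mul_left _ hqi
  set q := p ^ a with hqdef
  have hG1 : 1 ≤ G := le_trans (Nat.one_le_pow _ _ (by omega)) hqi
  have hwbig : 20 * q ^ 3 * G ^ 2 * j ≤ w :=
    (Nat.pow_le_pow_iff_left two_ne_zero).1 (hbig.trans hww)
  have hq3 : 1 ≤ q ^ 2 := Nat.one_le_pow _ _ (by omega)
  have hqG : q * G ≤ q ^ 3 * G ^ 2 * j := by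
    calc q * G = 1 * (q * G) * 1 * 1 := by ring
      _ ≤ q ^ 2 * (q * G) * G * j := Nat.mul_le_mul (Nat.mul_le_mul (Nat.mul_le_mul_right _ hq3) hG1) hj
      _ = _ := by ring
  have hqG4 : 4 ≤ q ^ 3 * G ^ 2 * j := by
    calc 4 = 2 ^ 2 * 1 * 1 := by norm_num
      _ ≤ q ^ 3 * G ^ 2 * j := by
        exact Nat.mul_le_mul (Nat.mul_le_mul ((Nat.pow_le_pow_left hq 2).trans
          (Nat.pow_le_pow_right (by omega) (by omega))) (Nat.one_le_pow _ _ hG1)) hj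
  have hchains := card_chains_ge (k := k) (E := E) (p := p) ha hj (i := i) (u := u) (v := v)
    (l := i + 1) (by rw [hk, hqdef, ← pow_mul p a j, ← pow_add]; congr 1; omega) (by omega)
    (by
      rw [← hqdef, ← hw]
      nlinarith) (by omega) le_rfl
  rw [hk, ← hqdef, ← hw, card_chains_succ hj hi] at hchains
  have hTP := card_points_TP_le_mul (k := k) (l := i) (b := 0) hs hq hB hj
  have hBq : B.natDegree ≤ q := by
    rw [← hs.natDegree_mul hq]; exact Nat.le_mul_of_pos_left _ hs.pos
  have hsd := Finset.le_card_sdiff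
    ((Finset.Icc 1 (j / 2)).biUnion fun d => points k d q i A 0) (points k j q i A 0)
  have hpts : (points k j q i A 0).card ≤ j * S.card + j * (w * G) := by omega
  have h1 : q ^ j ≤ q * (j * S.card + j * (w * G)) +
      q ^ (i + 1) * (1 + 2 * (w * (3 * q ^ (i + 1) + 1))) := by
    have := hTP.trans (Nat.mul_le_mul hBq hpts)
    omega
  have hw1 : 1 ≤ w := Nat.one_le_pow _ _ hp1.le
  have h2 : q ^ (i + 1) * (1 + 2 * (w * (3 * q ^ (i + 1) + 1))) ≤ w * (9 * q ^ 2 * G ^ 2) := by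
    have h3 : 1 ≤ q * G := Nat.mul_pos (by omega) hG1
    calc _ ≤ (q * G) * (w * (q * G) + 2 * (w * (3 * (q * G) + q * G))) := by
          refine Nat.mul_le_mul hqi1 (Nat.add_le_add (Nat.mul_pos hw1 h3)
            (Nat.mul_le_mul_left _ (Nat.mul_le_mul_left _ ?_)))
          exact Nat.add_le_add (Nat.mul_le_mul_left _ hqi1) h3
      _ = _ := by ring
  have h4 : q * (j * (w * G)) ≤ w * (q ^ 2 * G ^ 2 * j) := by
    calc q * (j * (w * G)) = w * (q * G * j) * 1 * 1 := by ring
      _ ≤ w * (q * G * j) * q * G := Nat.mul_le_mul (Nat.mul_le_mul_left _ (by omega)) hG1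
      _ = _ := by ring
  have h5 : w * (9 * q ^ 2 * G ^ 2) ≤ w * (9 * q ^ 2 * G ^ 2 * j) := by
    exact Nat.mul_le_mul_left _ (Nat.le_mul_of_pos_right _ hj)
  have h6 : 2 * q * (w * (10 * q ^ 2 * G ^ 2 * j)) ≤ q * q ^ j := by
    refine le_trans ?_ hww'
    calc _ = w * (20 * q ^ 3 * G ^ 2 * j) := by ring
      _ ≤ w * w := Nat.mul_le_mul_left _ hwbig
      _ = w ^ 2 := (sq w).symm
  have h7 : 2 * (w * (10 * q ^ 2 * G ^ 2 * j)) ≤ q ^ j := by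
    refine Nat.le_of_mul_le_mul_left (c := q) ?_ (by omega)
    linarith
  nlinarith

end Large

end Tower

end

section

open Polynomial Function

namespace Tower

section Additive

variable {E : Type*} [Field E] {p : ℕ} [Fact p.Prime] [CharP E p]

/-- The additive polynomials, that is, the linear combinations of the `X ^ p ^ i`. -/
noncomputable def addPoly (E : Type*) [Field E] (p : ℕ) : Submodule E E[X] :=
  Submodule.span E (Set.range fun i : ℕ => (X : E[X]) ^ p ^ i)

omit [Fact p.Prime] [CharP E p] in
lemma X_pow_mem_addPoly (i : ℕ) : (X : E[X]) ^ p ^ i ∈ addPoly E p :=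
  Submodule.subset_span ⟨i, rfl⟩

lemma aeval_add_of_mem_addPoly {L : Type*} [Field L] [Algebra E L] {A : E[X]}
    (hA : A ∈ addPoly E p) (u v : L) : aeval (u + v) A = aeval u A + aeval v A := by
  have : CharP L p := charP_of_injective_algebraMap (algebraMap E L).injective p
  induction hA using Submodule.span_induction with
  | mem f hf =>
    obtain ⟨i, rfl⟩ := hf
    simp only [map_pow, aeval_X]
    exact add_pow_char_pow u v p i
  | zero => simp
  | add f g _ _ hf hg => rw [map_add, map_add, map_add, hf, hg]; ring
  | smul c f _ hf => rw [map_smul, map_smul, map_smul, hf, smul_add]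

lemma eval_zero_of_mem_addPoly {A : E[X]} (hA : A ∈ addPoly E p) : A.eval 0 = 0 := by
  have := aeval_add_of_mem_addPoly hA (0 : E) 0
  simpa using this

/-- Every additive polynomial is, up to a linear term, a left multiple of `X ^ p - c X`. -/
lemma exists_comp_add_of_mem_addPoly (c : E) {A : E[X]} (hA : A ∈ addPoly E p) :
    ∃ A' ∈ addPoly E p, ∃ d : E, A = A'.comp (X ^ p - C c * X) + C d * X := by
  have hp : CharP E[X] p := inferInstance
  induction hA using Submodule.span_induction with
  | mem f hf =>
    obtain ⟨i, rfl⟩ := hf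
    induction i with
    | zero => exact ⟨0, Submodule.zero_mem _, 1, by simp⟩
    | succ i ih =>
      obtain ⟨g, hg, d, h⟩ := ih
      dsimp only at h ⊢
      refine ⟨X ^ p ^ i + c ^ p ^ i • g, add_mem (X_pow_mem_addPoly i)
        (Submodule.smul_mem _ _ hg), c ^ p ^ i * d, ?_⟩
      set V : E[X] := X ^ p - C c * X with hV
      have h1 : (X : E[X]) ^ p = V + C c * X := by rw [hV]; ring
      rw [pow_succ', pow_mul, h1, add_pow_char_pow, mul_pow, add_comp, smul_comp, X_pow_comp,
        smul_eq_C_mul, C_mul, C_pow]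
      linear_combination C c ^ p ^ i * h
  | zero => exact ⟨0, Submodule.zero_mem _, 0, by simp⟩
  | add f g _ _ hf hg =>
    obtain ⟨f', hf', d, h1⟩ := hf
    obtain ⟨g', hg', d', h2⟩ := hg
    refine ⟨f' + g', add_mem hf' hg', d + d', ?_⟩
    rw [add_comp, C_add]
    linear_combination h1 + h2
  | smul r f _ hf =>
    obtain ⟨f', hf', d, h1⟩ := hf
    refine ⟨r • f', Submodule.smul_mem _ _ hf', r * d, ?_⟩
    rw [smul_comp, C_mul, smul_eq_C_mul, smul_eq_C_mul]
    linear_combination C r * h1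

end Additive

section Factor

variable {k E : Type*} [Field k] [Fintype k] [Field E] [Algebra k E] [IsAlgClosed E]
  {p : ℕ} [Fact p.Prime] [CharP E p] {a : ℕ} {A B : E[X]}

omit [Fintype k] [Algebra k E] in
lemma exists_T_eq_zero_of_natDegree_lt (ha : 0 < a) (hpos : 0 < B.natDegree)
    (hB : B.natDegree < p ^ a) : ∃ z : E, T (p ^ a) z = 0 ∧ B.eval z ≠ 0 := by
  classical
  have hq := two_le_pow p ha
  have hdeg := TP_natDegree (K := E) hq
  have h0 : TP E (p ^ a) ≠ 0 := (TP_monic hq).ne_zero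
  have hder : derivative (TP E (p ^ a)) = 1 := by
    have : (p : E) = 0 := CharP.cast_eq_zero E p
    rw [TP, derivative_add, derivative_X, derivative_X_pow,
      Nat.cast_pow, this, zero_pow ha.ne', C_0, zero_mul, zero_add]
  have hsep : (TP E (p ^ a)).Separable := by
    rw [separable_def, hder]; exact isCoprime_one_right
  by_contra! h
  have h1 := card_eval_eq_le (TP E (p ^ a)).roots.toFinset hpos 0
  rw [Finset.filter_true_of_mem, Multiset.toFinset_card_of_nodup (nodup_roots hsep),
    splits_iff_card_roots.1 (IsAlgClosed.splits _), hdeg] at h1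
  · omega
  · intro z hz
    rw [Multiset.mem_toFinset, mem_roots h0, IsRoot, eval_TP] at hz
    exact h z hz

/-- Over a finite field with `p ^ a` elements, `X ^ p ^ a + X` has additive left factors of every
degree `p ^ s` with `s ≤ a`. -/
lemma exists_splitting (ha : 0 < a) (hk : Fintype.card k = p ^ a) {s : ℕ} (hs : 1 ≤ s)
    (hsa : s ≤ a) : ∃ A B : E[X], Splitting (p ^ a) A B ∧ A.map (frob k E) = A ∧
      B.map (frob k E) = B ∧ A.natDegree = p ^ s := by
  have hq := two_le_pow p ha
  have hp : p.Prime := Fact.out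
  suffices ∃ A B : E[X], Splitting (p ^ a) A B ∧ A ∈ addPoly E p ∧
      (∀ u v : E, B.eval (u + v) = B.eval u + B.eval v) ∧ A.map (frob k E) = A ∧
      B.map (frob k E) = B ∧ A.natDegree = p ^ s by
    obtain ⟨A, B, h1, -, -, h2, h3, h4⟩ := this
    exact ⟨A, B, h1, h2, h3, h4⟩
  induction hsa using Nat.decreasingInduction with
  | self =>
    refine ⟨TP E (p ^ a), X, splitting_TP ha, ?_, by simp, TP_map _ _, Polynomial.map_X _,
      TP_natDegree hq⟩
    refine add_mem (X_pow_mem_addPoly a) ?_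
    simpa using X_pow_mem_addPoly (E := E) (p := p) 0
  | of_succ s hsa ih =>
    obtain ⟨A, B, hAB, hA, hBadd, hσA, hσB, hdeg⟩ := ih (by omega)
    have hBq : B.natDegree < p ^ a := by
      have h1 := hAB.natDegree_mul hq
      have h2 : 2 ≤ A.natDegree := by rw [hdeg]; exact two_le_pow p (Nat.succ_pos s)
      have h3 := hAB.natDegree_right_pos hq
      nlinarith
    obtain ⟨z, hz, hz'⟩ := exists_T_eq_zero_of_natDegree_lt (E := E) ha
      (hAB.natDegree_right_pos hq) hBq
    set y := B.eval z with hy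
    have hB0 : B.eval 0 = 0 := by rw [← coeff_zero_eq_eval_zero, hAB.coeff_zero]
    have hAy : A.eval y = 0 := by rw [hy, hAB.eval, hz]
    have hfz : frob k E z = -z := by
      rw [frob_apply, hk]; exact eq_neg_of_add_eq_zero_left hz
    have hfy : frob k E y = -y := by
      have h1 := Polynomial.hom_eval₂ B (RingHom.id E) (frob k E) z
      rw [RingHom.comp_id, ← eval_map (frob k E), hσB, hfz] at h1
      refine h1.trans (eq_neg_of_add_eq_zero_left ?_)
      rw [hy, ← hBadd, neg_add_cancel, hB0]
    set c := y ^ (p - 1) with hc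
    have hfc : frob k E c = c := by
      rw [hc, map_pow, hfy]
      rcases hp.eq_two_or_odd' with h2 | h2
      · have : CharP E 2 := h2 ▸ ‹CharP E p›
        rw [CharTwo.neg_eq]
      · exact (Nat.Odd.sub_odd h2 odd_one).neg_pow y
    set V : E[X] := X ^ p - C c * X with hV
    have hVmem : V ∈ addPoly E p := by
      refine sub_mem ?_ ?_
      · simpa using X_pow_mem_addPoly (E := E) (p := p) 1
      · rw [← smul_eq_C_mul]
        refine Submodule.smul_mem _ _ ?_
        simpa using X_pow_mem_addPoly (E := E) (p := p) 0
    have hVdeg' : (C c * X : E[X]).degree < p := by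
      refine (degree_C_mul_X_le c).trans_lt ?_
      exact_mod_cast hp.one_lt
    have hVmonic : V.Monic := monic_X_pow_sub hVdeg'
    have hVdeg : V.natDegree = p := by
      rw [hV, natDegree_sub_eq_left_of_natDegree_lt, natDegree_X_pow]
      rw [natDegree_X_pow]
      exact (natDegree_C_mul_le c X).trans_lt (natDegree_X.trans_lt hp.one_lt)
    have hVy : V.eval y = 0 := by
      rw [hV, eval_sub, eval_pow, eval_X, eval_mul, eval_C, eval_X, hc, ← pow_succ,
        Nat.sub_add_cancel hp.one_le, sub_self]
    have hσV : V.map (frob k E) = V := by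
      rw [hV, Polynomial.map_sub, Polynomial.map_pow, Polynomial.map_mul, Polynomial.map_X,
        map_C, hfc]
    obtain ⟨A', hA', d, h⟩ := exists_comp_add_of_mem_addPoly c hA
    rw [← hV] at h
    have hd : d = 0 := by
      rw [h, eval_add, eval_comp, hVy, eval_zero_of_mem_addPoly hA', zero_add, eval_mul, eval_C,
        eval_X] at hAy
      exact (mul_eq_zero.1 hAy).resolve_right hz'
    rw [hd, C_0, zero_mul, add_zero] at h
    have hdeg' : A'.natDegree = p ^ s := by
      have h1 := congrArg natDegree h
      rw [natDegree_comp, hVdeg, hdeg, pow_succ] at h1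
      exact (Nat.eq_of_mul_eq_mul_right hp.pos h1).symm
    refine ⟨A', V.comp B, ⟨?_, ?_, ?_, ?_, ?_⟩, hA', fun u v => ?_, ?_, ?_, hdeg'⟩
    · have h1 := congrArg leadingCoeff h
      rw [leadingCoeff_comp (by rw [hVdeg]; exact hp.ne_zero), hVmonic.leadingCoeff, one_pow,
        mul_one, hAB.monic.leadingCoeff] at h1
      exact h1.symm
    · rw [hdeg']; exact pow_pos hp.pos _
    · exact aeval_add_of_mem_addPoly hA'
    · rw [← Polynomial.comp_assoc, ← h, hAB.comp]
    · rw [coeff_zero_eq_eval_zero, eval_comp, hB0, eval_zero_of_mem_addPoly hVmem]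
    · rw [eval_comp, eval_comp, eval_comp, hBadd]
      exact aeval_add_of_mem_addPoly hVmem (L := E) _ _
    · have h1 := congrArg (Polynomial.map (frob k E)) h
      rw [hσA, map_comp, hσV, h] at h1
      have h2 : (A' - A'.map (frob k E)).comp V = 0 := by rw [sub_comp, h1, sub_self]
      rcases comp_eq_zero_iff.1 h2 with h3 | ⟨-, h3⟩
      · exact (sub_eq_zero.1 h3).symm
      · have := congrArg natDegree h3
        rw [hVdeg, natDegree_C] at this
        exact absurd this hp.ne_zero
    · rw [map_comp, hσV, hσB]

end Factor

end Tower

end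

section

open Polynomial Function

namespace DegAlg

/-- The bound of `hasBil_quotient` for a filtered algebra with enough primes of degree two and of
all large degrees. -/
lemma hasBil_of_primes {k R F : Type*} [Field k] [Fintype k] [CommRing R] [Algebra k R] [Field F]
    [Algebra k F] {D : DegAlg k R} {q g G c n r : ℕ} (hk : Fintype.card k = q) (hq : 4 ≤ q)
    (hg : D.HasGaps g) (hgG : g ≤ G) (hG : 0 < G)
    (hlarge : ∀ j, 0 < j → (20 * q ^ 3 * G ^ 2 * j) ^ 2 ≤ q ^ j →
      ∃ S : Finset (Ideal R), PrimesOfDeg k j S ∧ q ^ j ≤ 2 * q * j * S.card)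
    (htwo : ∃ S : Finset (Ideal R), PrimesOfDeg k 2 S ∧ (q - 1) * G ≤ 2 * S.card + c)
    (hsize : 2 * n + 2 * G + 2 * (r * r) + c ≤ (q - 1) * G) (hr : 2 < r) (hrn : r < n)
    (hbig : (20 * q ^ 3 * G ^ 2 * (2 * n + 4 * G + 2 * r)) ^ 2 ≤ q ^ r)
    (hF : Module.finrank k F = n) :
    HasBil k F (3 * (n + G / 2 + r + 2 * (r * r))) := by
  classical
  set M := 2 * n + 4 * G + 2 * r with hM
  have hkey : 8 * (q * M) < q ^ r := by
    have h1 : q * M ≤ q ^ 3 * G ^ 2 * M := by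
      refine Nat.mul_le_mul_right _ ?_
      calc q = q * 1 := (mul_one q).symm
        _ ≤ q ^ 3 * G ^ 2 := Nat.mul_le_mul (Nat.le_self_pow three_ne_zero q)
          (Nat.one_le_pow _ _ hG)
    have h2 : 0 < q * M := Nat.mul_pos (by omega) (by omega)
    nlinarith
  have hprimes : ∀ j, r ≤ j → j ≤ M →
      ∃ S : Finset (Ideal R), PrimesOfDeg k j S ∧ q ^ j ≤ 2 * q * j * S.card := by
    intro j h1 h2
    refine hlarge j (by omega) (le_trans ?_ (hbig.trans (Nat.pow_le_pow_right (by omega) h1)))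
    exact Nat.pow_le_pow_left (Nat.mul_le_mul_left _ h2) 2
  set m := g / r + 1 with hm
  have hm1 : g ≤ m * r := by
    have := Nat.div_add_mod g r
    have := Nat.mod_lt g (show 0 < r by omega)
    rw [hm]; nlinarith
  have hm2 : m * r ≤ G + r := by
    have := Nat.div_mul_le_self g r
    rw [hm, add_mul]; omega
  set N := 2 * n + m * r + m * r + 2 * g with hN
  obtain ⟨Sn, hSn, hSn'⟩ := hprimes n hrn.le (by omega)
  obtain ⟨Sr, hSr, hSr'⟩ := hprimes r le_rfl (by omega)
  obtain ⟨Z, hZ, hZ'⟩ := hprimes N (by omega) (by omega)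
  obtain ⟨B, hB, hB'⟩ := htwo
  obtain ⟨Q, hQ⟩ : Sn.Nonempty := by
    rw [Finset.nonempty_iff_ne_empty]
    rintro rfl
    rw [Finset.card_empty, mul_zero, Nat.le_zero] at hSn'
    exact (pow_pos (by omega : 0 < q) n).ne' hSn'
  have hQ' : PrimesOfDeg k n {Q} :=
    ⟨hSn.1, fun I hI => by rw [Finset.mem_singleton.1 hI]; exact hSn.2 Q hQ⟩
  have hSrcard : 2 * m ≤ Sr.card := by
    by_contra! h
    have h1 : 2 * q * r * Sr.card ≤ 2 * q * r * (2 * m) := Nat.mul_le_mul_left _ h.le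
    have h2 : q * (m * r) ≤ q * M := Nat.mul_le_mul_left _ (by omega)
    have h3 : 2 * q * r * (2 * m) = 4 * (q * (m * r)) := by ring
    omega
  obtain ⟨E₁, hE₁, hE₁c⟩ := Finset.exists_subset_card_eq (show m ≤ Sr.card by omega)
  obtain ⟨E₂, hE₂, hE₂c⟩ := Finset.exists_subset_card_eq (s := Sr \ E₁) (n := m) (by
    rw [Finset.card_sdiff_of_subset hE₁]; omega)
  have hdisj : Disjoint E₁ E₂ := Finset.disjoint_of_subset_right hE₂ Finset.disjoint_sdiff
  have hrN : r ≤ N := by omega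
  have hZcard : Fintype.card k ^ (N - r) + 1 ≤ Z.card := by
    rw [hk]
    by_contra! h
    have h1 : q ^ (N - r) * q ^ r ≤ q ^ (N - r) * (2 * q * N) := by
      rw [← pow_add, Nat.sub_add_cancel hrN, mul_comm]
      exact hZ'.trans (Nat.mul_le_mul_left _ (by omega))
    have h2 := Nat.le_of_mul_le_mul_left h1 (pow_pos (by omega) _)
    have h3 : q * N ≤ q * M := Nat.mul_le_mul_left _ (by omega)
    rw [mul_assoc] at h2
    omega
  have hbil := hasBil_quotient (by omega) hg hQ' hZ (hSr.mono hE₁)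
    (hSr.mono (hE₂.trans Finset.sdiff_subset)) hB hdisj hr hrn (by omega) hrN
    hZcard (by rw [hE₁c]; exact hm1) (by rw [hE₂c]; exact hm1) (by rw [hE₁c, hE₂c])
    (by omega)
  obtain ⟨hQmax, hQdeg⟩ := hSn.2 Q hQ
  have hiso : Nonempty ((R ⧸ Q) ≃ₐ[k] F) := by
    let := Ideal.Quotient.field Q
    obtain ⟨p, hp⟩ := CharP.exists k
    have : Fact p.Prime := ⟨CharP.char_is_prime k p⟩
    have : NeZero n := ⟨by omega⟩
    have : Module.Finite k F := Module.finite_of_finrank_pos (by omega)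
    have : Module.Finite k (R ⧸ Q) := Module.finite_of_finrank_pos (by omega)
    exact ⟨(FiniteField.algEquivExtension k p n (R ⧸ Q) hQdeg).trans
      (FiniteField.algEquivExtension k p n F hF).symm⟩
  refine (hbil.equiv hiso.some).mono ?_
  have := Nat.div_le_div_right (c := 2) hgG
  omega

end DegAlg

namespace Tower

/-- The bound on the bilinear complexity obtained from the tower, at a level of genus at
most `p ^ j`. -/
lemma hasBil_of_le {k F : Type} [Field k] [Fintype k] [Field F] [Algebra k F] {p a j n r : ℕ}
    (hp : p.Prime) (ha : 0 < a) (hk : Fintype.card k = p ^ a) (hq : 4 ≤ p ^ a) (hj : a < j)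
    (hsize : 2 * n + 2 * (r * r) + (p ^ a) ^ 2 ≤ (p ^ a - 3) * p ^ j) (hr : 2 < r) (hrn : r < n)
    (hbig : (20 * (p ^ a) ^ 3 * (p ^ j) ^ 2 * (2 * n + 4 * p ^ j + 2 * r)) ^ 2 ≤ (p ^ a) ^ r)
    (hF : Module.finrank k F = n) :
    HasBil k F (3 * (n + p ^ j / 2 + r + 2 * (r * r))) := by
  classical
  have : Fact p.Prime := ⟨hp⟩
  have hkp : CharP k p := by
    obtain ⟨p', hp'⟩ := CharP.exists k
    have h1 : p'.Prime := CharP.char_is_prime k p'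
    obtain ⟨m, -, hm⟩ := FiniteField.card k p'
    have h2 : p' ∣ p ^ a := by rw [← hk, hm]; exact dvd_pow_self _ m.ne_zero
    rwa [(Nat.prime_dvd_prime_iff_eq h1 hp).1 (h1.dvd_of_dvd_pow h2)] at hp'
  have hEp : CharP (AlgebraicClosure k) p :=
    charP_of_injective_algebraMap (algebraMap k (AlgebraicClosure k)).injective p
  set s := (j - 1) % a + 1 with hs
  set i := (j - 1) / a with hi
  have hsa : s ≤ a := Nat.mod_lt (j - 1) ha
  have hji : s + a * i = j := by
    have := Nat.mod_add_div (j - 1) a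
    rw [← hi] at this
    omega
  have hi1 : 1 ≤ i := (Nat.one_le_div_iff ha).2 (by omega)
  obtain ⟨A, B, hAB, hσA, hσB, hdeg⟩ :=
    exists_splitting (k := k) (E := AlgebraicClosure k) ha hk (show 1 ≤ s by omega) hsa
  obtain ⟨x, h⟩ := exists_curve (p := p) ha hi1 hAB.monic hAB.pos (0 : AlgebraicClosure k)
  have hG : A.natDegree * (p ^ a) ^ i = p ^ j := by
    rw [hdeg, ← pow_mul, ← pow_add, hji]
  obtain ⟨g, hgG, hg⟩ := h.exists_hasGaps_rat (k := k) hAB.add hAB.aeval hσA (map_zero _)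
  rw [hG] at hgG
  refine DegAlg.hasBil_of_primes (c := (p ^ a) ^ 2) hk hq hg hgG (pow_pos hp.pos j)
    (fun d hd hd' => ?_) ?_ ?_ hr hrn hbig hF
  · exact h.exists_primes_large ha hk hAB hσA hσB hd (by rwa [hG])
  · obtain ⟨S, hS, hS'⟩ := h.exists_primes_two ha hk hAB hσA hσB
    refine ⟨S, hS, ?_⟩
    rw [hG] at hS'
    refine hS'.trans (Nat.add_le_add_left ?_ _)
    rw [sq, hdeg]
    exact Nat.mul_le_mul_left _ (Nat.pow_le_pow_right hp.pos hsa)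
  · obtain ⟨c, hc⟩ := Nat.exists_eq_add_of_le hq
    have h1 : p ^ a - 3 = 1 + c := by omega
    have h2 : p ^ a - 1 = 3 + c := by omega
    rw [h1] at hsize
    rw [h2]
    nlinarith

end Tower

end

namespace Tower

open Filter Topology

lemma bilinearComplexity_le {k K : Type} [Field k] [Field K] [Algebra k K] {r : ℕ}
    (h : HasBil k K r) : bilinearComplexity k K ≤ r := Nat.sInf_le h

lemma exists_pow_ge_and_le {p m D : ℕ} (hp : 1 < p) (hm : 0 < m) (hD : m < D) :
    ∃ j, D ≤ m * p ^ j ∧ m * p ^ j ≤ p * D := by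
  classical
  have hex : ∃ j, D ≤ m * p ^ j :=
    ⟨D, (Nat.lt_pow_self hp).le.trans (Nat.le_mul_of_pos_left _ hm)⟩
  refine ⟨Nat.find hex, Nat.find_spec hex, ?_⟩
  obtain ⟨j, hj⟩ : ∃ j, Nat.find hex = j + 1 := by
    refine Nat.exists_eq_succ_of_ne_zero fun h => ?_
    have := Nat.find_spec hex
    rw [h, pow_zero, mul_one] at this
    omega
  have h1 := Nat.find_min hex (m := j) (by omega)
  rw [hj, pow_succ, ← mul_assoc, mul_comm]
  exact Nat.mul_le_mul_left _ (by omega)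

lemma bilinearComplexity_le_of_sqrt {k F : Type} [Field k] [Fintype k] [Field F] [Algebra k F]
    {p a n r : ℕ} (hp : p.Prime) (ha : 0 < a) (hk : Fintype.card k = p ^ a) (hq : 4 ≤ p ^ a)
    (hr : 2 < r) (hrn : r ^ 4 ≤ n) (hnr : n ≤ (r + 1) ^ 4)
    (hbig : (160 * (p ^ a) ^ 15) ^ 2 * (r + 1) ^ 24 ≤ (p ^ a) ^ r)
    (hF : Module.finrank k F = n) :
    ∃ G : ℕ, (p ^ a - 3) * G ≤ p * (2 * n + 2 * (r * r) + (p ^ a) ^ 2) ∧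
      bilinearComplexity k F ≤ 3 * (n + G / 2 + r + 2 * (r * r)) := by
  set q := p ^ a with hqdef
  have hpq : p ≤ q := Nat.le_self_pow ha.ne' p
  have hrr : r * r ≤ n := le_trans (by
    rw [← sq]; exact Nat.pow_le_pow_right (by omega) (by omega)) hrn
  have hn : 0 < n := lt_of_lt_of_le (by nlinarith) hrr
  obtain ⟨j, hj1, hj2⟩ := exists_pow_ge_and_le (p := p) (m := q - 3)
    (D := 2 * n + 2 * (r * r) + q ^ 2) hp.one_lt (by omega) (by
      have : q ≤ q ^ 2 := Nat.le_self_pow two_ne_zero q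
      omega)
  refine ⟨p ^ j, hj2, bilinearComplexity_le ?_⟩
  have hja : a < j := by
    by_contra! h
    have h1 : (q - 3) * p ^ j ≤ q * q :=
      Nat.mul_le_mul (Nat.sub_le _ _) (Nat.pow_le_pow_right hp.pos h)
    rw [← sq] at h1
    omega
  have hG : p ^ j ≤ q ^ 4 * n := by
    have h1 : p ^ j ≤ (q - 3) * p ^ j := Nat.le_mul_of_pos_left _ (by omega)
    have h2 : 2 * n + 2 * (r * r) + q ^ 2 ≤ q ^ 3 * n := by
      have h3 : q ^ 2 ≤ q ^ 2 * n := Nat.le_mul_of_pos_right _ hn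
      have h4 : 4 + q ^ 2 ≤ q ^ 3 := by nlinarith
      have h5 := Nat.mul_le_mul_right n h4
      rw [add_mul] at h5
      omega
    calc p ^ j ≤ p * (2 * n + 2 * (r * r) + q ^ 2) := h1.trans hj2
      _ ≤ q * (q ^ 3 * n) := Nat.mul_le_mul hpq h2
      _ = q ^ 4 * n := by ring
  refine hasBil_of_le hp ha hk hq hja hj1 hr (lt_of_lt_of_le (by nlinarith) hrr) ?_ hF
  refine le_trans ?_ hbig
  have h1 : 2 * n + 4 * p ^ j + 2 * r ≤ 8 * (q ^ 4 * n) := by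
    have h2 : n ≤ q ^ 4 * n := Nat.le_mul_of_pos_left _ (pow_pos (by omega) 4)
    have h3 : r ≤ n := le_trans (Nat.le_mul_self r) hrr
    omega
  calc (20 * q ^ 3 * (p ^ j) ^ 2 * (2 * n + 4 * p ^ j + 2 * r)) ^ 2
      ≤ (20 * q ^ 3 * (q ^ 4 * n) ^ 2 * (8 * (q ^ 4 * n))) ^ 2 :=
        Nat.pow_le_pow_left (Nat.mul_le_mul (Nat.mul_le_mul_left _ (Nat.pow_le_pow_left hG 2)) h1) 2
    _ = (160 * q ^ 15) ^ 2 * n ^ 6 := by ring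
    _ ≤ (160 * q ^ 15) ^ 2 * ((r + 1) ^ 4) ^ 6 :=
        Nat.mul_le_mul_left _ (Nat.pow_le_pow_left hnr 6)
    _ = _ := by rw [← pow_mul (r + 1)]

lemma bilinearComplexity_div_le {k F : Type} [Field k] [Fintype k] [Field F] [Algebra k F]
    {p a n r : ℕ} (hp : p.Prime) (ha : 0 < a) (hk : Fintype.card k = p ^ a) (hq : 4 ≤ p ^ a)
    (hr : 2 < r) (hrn : r ^ 4 ≤ n) (hnr : n ≤ (r + 1) ^ 4)
    (hbig : (160 * (p ^ a) ^ 15) ^ 2 * (r + 1) ^ 24 ≤ (p ^ a) ^ r)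
    (hF : Module.finrank k F = n) :
    (bilinearComplexity k F : ℝ) / n ≤ 3 * (1 + (p : ℝ) / (((p ^ a : ℕ) : ℝ) - 3)) +
      (9 + 3 * (p * (2 + ((p ^ a : ℕ) : ℝ) ^ 2)) / (((p ^ a : ℕ) : ℝ) - 3)) * (r : ℝ)⁻¹ := by
  obtain ⟨G, hG, hle⟩ := bilinearComplexity_le_of_sqrt hp ha hk hq hr hrn hnr hbig hF
  set q := p ^ a with hqdef
  have hq' : (0 : ℝ) < (q : ℝ) - 3 := by
    have : (4 : ℝ) ≤ q := by exact_mod_cast hq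
    linarith
  have hr' : (2 : ℝ) < r := by exact_mod_cast hr
  have hrn' : (r : ℝ) ^ 4 ≤ n := by exact_mod_cast hrn
  have hn : (0 : ℝ) < n := lt_of_lt_of_le (by positivity) hrn'
  have hG' : ((q : ℝ) - 3) * G ≤ p * (2 * n + 2 * (r * r) + q ^ 2) := by
    have : ((q - 3 : ℕ) : ℝ) = (q : ℝ) - 3 := by
      rw [Nat.cast_sub (by omega)]; norm_num
    rw [← this]
    exact_mod_cast hG
  have hle' : (bilinearComplexity k F : ℝ) ≤ 3 * (n + G / 2 + r + 2 * (r * r)) := by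
    have h1 : ((G / 2 : ℕ) : ℝ) ≤ (G : ℝ) / 2 := Nat.cast_div_le
    have h2 : (bilinearComplexity k F : ℝ) ≤
        3 * (n + ((G / 2 : ℕ) : ℝ) + r + 2 * (r * r)) := by exact_mod_cast hle
    linarith
  have hGle : (G : ℝ) ≤ p * (2 * n + 2 * (r * r) + q ^ 2) / ((q : ℝ) - 3) := by
    rw [le_div_iff₀ hq', mul_comm]; exact hG'
  have hrr : (r : ℝ) * r ≤ n * (r : ℝ)⁻¹ := by
    rw [← div_eq_mul_inv, le_div_iff₀ (by linarith)]
    refine le_trans ?_ hrn'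
    have : (1 : ℝ) ≤ r := by linarith
    nlinarith [pow_nonneg (show (0 : ℝ) ≤ r by linarith) 3]
  have hr1 : (r : ℝ) ≤ r * r := by nlinarith
  have hp0 : (0 : ℝ) ≤ p := Nat.cast_nonneg p
  rw [div_le_iff₀ hn]
  have h3 : p * (2 * n + 2 * (r * r) + (q : ℝ) ^ 2) ≤
      p * (2 * n) + 2 * (p * (2 + (q : ℝ) ^ 2)) * (r * r) := by
    have h4 : (0 : ℝ) ≤ (q : ℝ) ^ 2 := by positivity
    have h5 : 1 ≤ (r : ℝ) * r := by nlinarith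
    have h6 : 2 * (r * r) + (q : ℝ) ^ 2 ≤ 2 * (2 + (q : ℝ) ^ 2) * (r * r) := by nlinarith
    have h7 := mul_le_mul_of_nonneg_left h6 hp0
    linarith
  have h8 : (G : ℝ) ≤ 2 * n * (p / ((q : ℝ) - 3)) +
      2 * ((p * (2 + (q : ℝ) ^ 2)) / ((q : ℝ) - 3)) * (r * r) := by
    refine hGle.trans ((div_le_div_of_nonneg_right h3 hq'.le).trans (le_of_eq ?_))
    ring
  set K := (p * (2 + (q : ℝ) ^ 2)) / ((q : ℝ) - 3) with hK
  have hK0 : 0 ≤ K := by positivity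
  have h9 : (9 + 3 * K) * (r * r) ≤ (9 + 3 * K) * (n * (r : ℝ)⁻¹) :=
    mul_le_mul_of_nonneg_left hrr (by positivity)
  have h10 : 3 * (p * (2 + (q : ℝ) ^ 2)) / ((q : ℝ) - 3) = 3 * K := by rw [hK]; ring
  rw [h10]
  have h11 : (9 + 3 * K) * (r : ℝ)⁻¹ * n = (9 + 3 * K) * (n * (r : ℝ)⁻¹) := by ring
  rw [add_mul, h11]
  linarith

lemma eventually_mul_pow_le {q : ℕ} (hq : 2 ≤ q) (c d : ℕ) :
    ∀ᶠ r : ℕ in atTop, c * (r + 1) ^ d ≤ q ^ r := by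
  have h := isLittleO_pow_const_const_pow_of_one_lt (R := ℝ) d (r := q)
    (by exact_mod_cast hq)
  have hc : (0 : ℝ) < 1 / ((c + 1) * q) := by positivity
  filter_upwards [(tendsto_add_atTop_nat 1).eventually (h.def hc)] with r hr
  rw [Real.norm_of_nonneg (by positivity), Real.norm_of_nonneg (by positivity), pow_succ,
    div_mul_eq_mul_div, one_mul, mul_comm ((q : ℝ) ^ r), mul_comm ((c : ℝ) + 1),
    mul_div_mul_left _ _ (by positivity), le_div_iff₀ (by positivity)] at hr
  have h1 : (r + 1) ^ d * (c + 1) ≤ q ^ r := by exact_mod_cast hr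
  exact le_trans (by rw [mul_comm]; exact Nat.mul_le_mul_left _ (Nat.le_succ c)) h1

lemma tendsto_sqrt_sqrt : Tendsto (fun n => Nat.sqrt (Nat.sqrt n)) atTop atTop := by
  have h : Tendsto Nat.sqrt atTop atTop :=
    tendsto_atTop.2 fun b => (eventually_ge_atTop (b * b)).mono fun n hn => Nat.le_sqrt.2 hn
  exact h.comp h

lemma sqrt_sqrt_pow_le (n : ℕ) : Nat.sqrt (Nat.sqrt n) ^ 4 ≤ n := by
  calc Nat.sqrt (Nat.sqrt n) ^ 4 = (Nat.sqrt (Nat.sqrt n) ^ 2) ^ 2 := by ring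
    _ ≤ Nat.sqrt n ^ 2 := Nat.pow_le_pow_left (Nat.sqrt_le' _) 2
    _ ≤ n := Nat.sqrt_le' n

lemma le_sqrt_sqrt_pow (n : ℕ) : n ≤ (Nat.sqrt (Nat.sqrt n) + 1) ^ 4 := by
  calc n ≤ (Nat.sqrt n + 1) ^ 2 := (Nat.lt_succ_sqrt' n).le
    _ ≤ ((Nat.sqrt (Nat.sqrt n) + 1) ^ 2) ^ 2 := Nat.pow_le_pow_left (Nat.lt_succ_sqrt' _) 2
    _ = _ := by ring

end Tower

/-- Let `p` be a prime and `q = p^a ≥ 4` a prime power. Then the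
asymptotic bilinear complexity of multiplication satisfies
`M_q = limsup_{n → ∞} μ_q(n)/n ≤ 3(1 + p/(q-3))`. -/
theorem stmt_14
    (p a : ℕ) (hp : p.Prime) (ha : 0 < a) (q : ℕ) (hq : q = p ^ a) (hq4 : 4 ≤ q)
    (Fq : Type) [Field Fq] [Fintype Fq] (hcard : Fintype.card Fq = q)
    (Fqn : ℕ → Type) [∀ n, Field (Fqn n)] [∀ n, Algebra Fq (Fqn n)]
    (hdeg : ∀ n, Module.finrank Fq (Fqn n) = n) :
    Filter.limsup (fun n : ℕ => (bilinearComplexity Fq (Fqn n) : ℝ) / (n : ℝ))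
        Filter.atTop ≤ 3 * (1 + (p : ℝ) / ((q : ℝ) - 3)) := by
  subst hq
  set c : ℝ := 9 + 3 * (p * (2 + ((p ^ a : ℕ) : ℝ) ^ 2)) / (((p ^ a : ℕ) : ℝ) - 3) with hc
  have hinv : Filter.Tendsto (fun n : ℕ => ((Nat.sqrt (Nat.sqrt n) : ℕ) : ℝ)⁻¹) Filter.atTop
      (nhds 0) := tendsto_inv_atTop_zero.comp
    (tendsto_natCast_atTop_atTop.comp Tower.tendsto_sqrt_sqrt)
  have hlim := (hinv.const_mul c).const_add (3 * (1 + (p : ℝ) / (((p ^ a : ℕ) : ℝ) - 3)))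
  rw [mul_zero, add_zero] at hlim
  rw [← hlim.limsup_eq]
  refine Filter.limsup_le_limsup ?_ ?_ hlim.isBoundedUnder_le
  · filter_upwards [Tower.tendsto_sqrt_sqrt.eventually (Filter.eventually_gt_atTop 2),
      Tower.tendsto_sqrt_sqrt.eventually
        (Tower.eventually_mul_pow_le (q := p ^ a) (by omega) ((160 * (p ^ a) ^ 15) ^ 2) 24)]
      with n h1 h2
    exact Tower.bilinearComplexity_div_le hp ha hcard hq4 h1 (Tower.sqrt_sqrt_pow_le n)
      (Tower.le_sqrt_sqrt_pow n) h2 (hdeg n)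
  · exact Filter.IsCoboundedUnder.of_frequently_ge (a := 0)
      (Filter.Frequently.of_forall fun n => by positivity)
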